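/- Suppose the set of all primes is partitioned into k color classes. Then there exist primes p_1, p_2, p_3, all in the same color class, such that p_1 + p_2 = p_3 + 1. -/

import Mathlib

namespace SchurPrimes
open Finset

/-- The additive character `x ↦ exp (2 π i x)`. -/
noncomputable def ex (x : ℝ) : ℂ := Complex.exp (((2 * Real.pi * x : ℝ) : ℂ) * Complex.I)

/-- The distance to the nearest integer. -/
noncomputable def nn (x : ℝ) : ℝ := |x - round x|

lemma ex_add (x y : ℝ) : ex (x + y) = ex x * ex y := by
  unfold ex; rw [← Complex.exp_add]; congr 1; push_cast; ring

@[simp] lemma ex_zero : ex 0 = 1 := by simp [ex]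

@[simp] lemma norm_ex (x : ℝ) : ‖ex x‖ = 1 := by
  unfold ex; exact Complex.norm_exp_ofReal_mul_I _

lemma ex_int (n : ℤ) : ex n = 1 := by
  unfold ex
  rw [Complex.exp_eq_one_iff]; exact ⟨n, by push_cast; ring⟩

lemma ex_nat_mul (n : ℕ) (x : ℝ) : ex (n * x) = ex x ^ n := by
  unfold ex; rw [← Complex.exp_nat_mul]; congr 1; push_cast; ring

lemma ex_mul_nat (x : ℝ) (n : ℕ) : ex (x * n) = ex x ^ n := by rw [mul_comm, ex_nat_mul]

lemma ex_add_int (x : ℝ) (n : ℤ) : ex (x + n) = ex x := by rw [ex_add, ex_int, mul_one]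

lemma conj_ex (x : ℝ) : (starRingEnd ℂ) (ex x) = ex (-x) := by
  unfold ex; rw [← Complex.exp_conj]; congr 1
  rw [map_mul, Complex.conj_ofReal, Complex.conj_I]; push_cast; ring

lemma ex_sub (x y : ℝ) : ex (x - y) = ex x * (starRingEnd ℂ) (ex y) := by
  rw [conj_ex, ← ex_add, sub_eq_add_neg]

lemma nn_nonneg (x : ℝ) : 0 ≤ nn x := abs_nonneg _

lemma nn_le (x : ℝ) (n : ℤ) : nn x ≤ |x - n| := round_le x n

lemma nn_le_abs (x : ℝ) : nn x ≤ |x| := by simpa using nn_le x 0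

lemma nn_le_half (x : ℝ) : nn x ≤ 1 / 2 := abs_sub_round x

lemma nn_neg (x : ℝ) : nn (-x) = nn x := by
  apply le_antisymm
  · refine (nn_le _ (-round x)).trans (le_of_eq ?_)
    unfold nn; push_cast; rw [← abs_neg]; congr 1; ring
  · refine (nn_le _ (-round (-x))).trans (le_of_eq ?_)
    unfold nn; push_cast; rw [← abs_neg]; congr 1; ring

lemma nn_add_le (x y : ℝ) : nn (x + y) ≤ nn x + nn y := by
  refine (nn_le _ (round x + round y)).trans ?_
  unfold nn; push_cast
  refine le_trans (le_of_eq ?_) (abs_add_le _ _)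
  congr 1; ring

lemma nn_sub_le (x y : ℝ) : nn (x - y) ≤ nn x + nn y := by
  rw [sub_eq_add_neg, ← nn_neg y]; exact nn_add_le _ _

lemma nn_add_int (x : ℝ) (n : ℤ) : nn (x + n) = nn x := by
  unfold nn; rw [round_add_intCast]; push_cast; congr 1; ring

lemma nn_int (n : ℤ) : nn n = 0 := by simp [nn]

lemma nn_nat_mul_le (n : ℕ) (x : ℝ) : nn (n * x) ≤ n * nn x := by
  refine (nn_le _ (n * round x)).trans (le_of_eq ?_)
  unfold nn; push_cast
  rw [← mul_sub, abs_mul, Nat.abs_cast]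

lemma nn_eq_zero_iff {x : ℝ} : nn x = 0 ↔ ∃ n : ℤ, x = n := by
  constructor
  · intro h; exact ⟨round x, by unfold nn at h; linarith [abs_eq_zero.mp h]⟩
  · rintro ⟨n, rfl⟩; exact nn_int n

lemma ex_eq_ex_sub_round (x : ℝ) : ex x = ex (x - round x) := by
  have := ex_add_int (x - round x) (round x)
  rw [← this]; congr 1; ring

lemma norm_ex_sub_one (x : ℝ) : ‖ex x - 1‖ = 2 * |Real.sin (Real.pi * x)| := by
  have := Complex.norm_exp_I_mul_ofReal_sub_one (2 * Real.pi * x)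
  unfold ex
  rw [mul_comm, this, norm_mul, Real.norm_eq_abs, Real.norm_eq_abs]
  norm_num
  congr 1; congr 1; ring

lemma norm_ex_sub_one_le_abs (x : ℝ) : ‖ex x - 1‖ ≤ 2 * Real.pi * |x| := by
  rw [norm_ex_sub_one]
  have := Real.abs_sin_le_abs (x := Real.pi * x)
  rw [abs_mul, abs_of_pos Real.pi_pos] at this
  linarith

lemma norm_ex_sub_one_le (x : ℝ) : ‖ex x - 1‖ ≤ 2 * Real.pi * nn x := by
  rw [ex_eq_ex_sub_round]; exact norm_ex_sub_one_le_abs _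

lemma le_norm_ex_sub_one (x : ℝ) : 4 * nn x ≤ ‖ex x - 1‖ := by
  rw [ex_eq_ex_sub_round, norm_ex_sub_one]
  have h := nn_le_half x
  unfold nn at h ⊢
  have h2 := Real.mul_abs_le_abs_sin (x := Real.pi * (x - round x)) (by
    rw [abs_mul, abs_of_pos Real.pi_pos]; nlinarith [Real.pi_pos])
  rw [abs_mul, abs_of_pos Real.pi_pos, ← mul_assoc, div_mul_cancel₀ _ Real.pi_pos.ne'] at h2
  linarith

lemma norm_ex_sub_ex_le (x y : ℝ) : ‖ex x - ex y‖ ≤ 2 * Real.pi * |x - y| := by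
  have : ex x - ex y = ex y * (ex (x - y) - 1) := by
    rw [mul_sub, ← ex_add]; simp
  rw [this, norm_mul, norm_ex, one_mul]; exact norm_ex_sub_one_le_abs _

lemma norm_geom_mul_nn_le (φ : ℝ) (N : ℕ) :
    ‖∑ n ∈ range N, ex (φ * n)‖ * (2 * nn φ) ≤ 1 := by
  have h1 : (∑ n ∈ range N, ex (φ * n)) * (ex φ - 1) = ex (φ * N) - 1 := by
    simp_rw [ex_mul_nat]; exact geom_sum_mul _ _
  have h2 := congrArg norm h1
  rw [norm_mul] at h2
  have h3 : ‖ex (φ * N) - 1‖ ≤ 2 := by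
    refine (norm_sub_le _ _).trans ?_; simp; norm_num
  nlinarith [le_norm_ex_sub_one φ, norm_nonneg (∑ n ∈ range N, ex (φ * n))]

lemma norm_geom_le {φ : ℝ} {δ : ℝ} (hδ : 0 < δ) (h : δ ≤ nn φ) (N : ℕ) :
    ‖∑ n ∈ range N, ex (φ * n)‖ ≤ 1 / (2 * δ) := by
  rw [le_div_iff₀ (by positivity)]
  refine le_trans ?_ (norm_geom_mul_nn_le φ N)
  gcongr

lemma norm_sum_ex_le (φ : ℝ) (N : ℕ) : ‖∑ n ∈ range N, ex (φ * n)‖ ≤ N := by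
  refine (norm_sum_le _ _).trans ?_; simp

/-- Orthogonality of additive characters modulo `m`. -/
lemma sum_ex_div (m : ℕ) (hm : 1 ≤ m) (a : ℤ) :
    ∑ b ∈ range m, ex (b * a / m) = if (m : ℤ) ∣ a then (m : ℂ) else 0 := by
  have hm0 : (m : ℝ) ≠ 0 := by positivity
  split_ifs with h
  · obtain ⟨t, rfl⟩ := h
    have : ∀ b ∈ range m, ex (b * ((m * t : ℤ) : ℝ) / m) = 1 := by
      intro b _
      have : (b * ((m * t : ℤ) : ℝ) / m) = ((b * t : ℤ) : ℝ) := by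
        push_cast; field_simp
      rw [this, ex_int]
    rw [sum_congr rfl this]; simp
  · have h1 : ∀ b ∈ range m, ex (b * a / m) = ex ((a : ℝ) / m) ^ b := by
      intro b _; rw [← ex_nat_mul]; congr 1; ring
    rw [sum_congr rfl h1]
    have h2 := geom_sum_mul (ex ((a : ℝ) / m)) m
    rw [← ex_nat_mul, mul_div_cancel₀ _ hm0, ex_int, sub_self] at h2
    rcases mul_eq_zero.mp h2 with h3 | h3
    · exact h3
    · exfalso
      have h4 := le_norm_ex_sub_one ((a : ℝ) / m)
      rw [h3, norm_zero] at h4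
      have h5 : nn ((a : ℝ) / m) = 0 := le_antisymm (by linarith) (nn_nonneg _)
      obtain ⟨t, ht⟩ := nn_eq_zero_iff.mp h5
      apply h
      refine ⟨t, ?_⟩
      field_simp at ht
      exact_mod_cast ht

end SchurPrimes

namespace SchurPrimes
open Finset

lemma exists_dvd_mul_add_one {m W : ℕ} (h : m.Coprime W) (hm : 1 ≤ m) :
    ∃ r : ℕ, m ∣ W * r + 1 := by
  rcases Nat.eq_or_lt_of_le hm with h1 | h1
  · exact ⟨0, by rw [← h1]; exact one_dvd _⟩
  obtain ⟨r, hr⟩ := Nat.exists_mul_mod_eq_one_of_coprime h.symm h1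
  refine ⟨(m - 1) * r, ?_⟩
  have h2 : W * r ≡ 1 [MOD m] := by
    unfold Nat.ModEq; rw [hr.2, Nat.mod_eq_of_lt h1]
  have h3 : W * ((m - 1) * r) + 1 ≡ (m - 1) * 1 + 1 [MOD m] := by
    rw [show W * ((m - 1) * r) = (m - 1) * (W * r) by ring]
    exact (h2.mul_left _).add_right _
  have h4 : (m - 1) * 1 + 1 = m := by omega
  rw [h4] at h3
  exact (Nat.modEq_zero_iff_dvd.mp (h3.trans (by simp [Nat.ModEq])))

lemma dvd_mul_add_one_iff {m W r : ℕ} (h : m.Coprime W) (hr : m ∣ W * r + 1) (n : ℕ) :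
    m ∣ W * n + 1 ↔ (m : ℤ) ∣ (n : ℤ) - r := by
  have hc : IsCoprime (m : ℤ) (W : ℤ) := Nat.isCoprime_iff_coprime.mpr h
  have hr' : (m : ℤ) ∣ (W : ℤ) * r + 1 := by exact_mod_cast hr
  rw [← Int.natCast_dvd_natCast]
  push_cast
  constructor
  · intro hn
    have := dvd_sub hn hr'
    rw [show (W : ℤ) * n + 1 - (W * r + 1) = W * (n - r) by ring] at this
    exact hc.dvd_of_dvd_mul_left this
  · intro hn
    have := dvd_add (hn.mul_left (W : ℤ)) hr'
    rwa [show (W : ℤ) * (n - r) + (W * r + 1) = W * n + 1 by ring] at this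

/-- Fourier expansion of an exponential sum over a residue class. -/
lemma sum_filter_dvd_eq {m W r : ℕ} (h : m.Coprime W) (hm : 1 ≤ m) (hr : m ∣ W * r + 1)
    (θ : ℝ) (N : ℕ) :
    ∑ n ∈ range N with m ∣ W * n + 1, ex (θ * n) =
      (1 / m : ℂ) * ∑ b ∈ range m, ex (-(b * r / m)) *
        ∑ n ∈ range N, ex ((θ + b / m) * n) := by
  have hm0 : (m : ℂ) ≠ 0 := by exact_mod_cast (by omega : m ≠ 0)
  have key : ∀ n : ℕ, (if m ∣ W * n + 1 then (1 : ℂ) else 0) =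
      (1 / m : ℂ) * ∑ b ∈ range m, ex (b * ((n : ℤ) - r : ℤ) / m) := by
    intro n
    rw [sum_ex_div m hm]
    simp only [dvd_mul_add_one_iff h hr n]
    split_ifs <;> simp [hm0]
  rw [sum_filter]
  have h1 : ∀ n ∈ range N, (if m ∣ W * n + 1 then ex (θ * n) else 0) =
      (1 / m : ℂ) * ∑ b ∈ range m, ex (-(b * r / m)) * ex ((θ + b / m) * n) := by
    intro n _
    have h2 : (if m ∣ W * n + 1 then ex (θ * n) else 0) =
      (if m ∣ W * n + 1 then (1 : ℂ) else 0) * ex (θ * n) := by split_ifs <;> simp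
    rw [h2, key, mul_assoc, sum_mul]
    congr 1
    refine sum_congr rfl fun b _ => ?_
    rw [← ex_add, ← ex_add]; congr 1; push_cast; ring
  rw [sum_congr rfl h1, ← mul_sum, sum_comm]
  simp_rw [mul_sum]

lemma inv_le_nn_of_not_dvd {a : ℤ} {m : ℕ} (hm : 1 ≤ m) (h : ¬ (m : ℤ) ∣ a) :
    1 / (m : ℝ) ≤ nn ((a : ℝ) / m) := by
  have hm0 : (0 : ℝ) < m := by positivity
  unfold nn
  set t := round ((a : ℝ) / m)
  have h1 : (a : ℝ) / m - t = ((a - m * t : ℤ) : ℝ) / m := by push_cast; field_simp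
  rw [h1, abs_div, abs_of_pos hm0]
  apply div_le_div_of_nonneg_right _ hm0.le
  have h2 : a - m * t ≠ 0 := fun h0 => h ⟨t, by linarith⟩
  exact_mod_cast Int.one_le_abs h2

lemma typeI_of_approx (W N : ℕ) (θ : ℝ) (D : ℕ) (c : ℤ) (q : ℕ) (hq : 1 ≤ q) (hqD : q ≤ D)
    (hcq : IsCoprime c (q : ℤ)) (hθ : |θ - c / q| < 1 / (2 * D ^ 2)) :
    ∃ κ : ℂ, ‖κ‖ ≤ N ∧ ∀ m, 1 ≤ m → m ≤ D → m.Coprime W →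
      ‖∑ n ∈ range N with m ∣ W * n + 1, ex (θ * n) - (if q ∣ m then κ / m else 0)‖
        ≤ (D : ℝ) ^ 2 := by
  have hD : 1 ≤ D := hq.trans hqD
  have hD0 : (0 : ℝ) < D := by positivity
  have hq0 : (0 : ℝ) < q := by positivity
  obtain ⟨rq, hrq⟩ : ∃ r : ℕ, q.Coprime W → q ∣ W * r + 1 := by
    by_cases h : q.Coprime W
    · obtain ⟨r, hr⟩ := exists_dvd_mul_add_one h hq
      exact ⟨r, fun _ => hr⟩
    · exact ⟨0, fun h' => absurd h' h⟩
  set T : ℝ → ℂ := fun φ => ∑ n ∈ range N, ex (φ * n) with hT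
  refine ⟨ex (c * rq / q) * T (θ - c / q), ?_, ?_⟩
  · rw [norm_mul, norm_ex, one_mul]; exact norm_sum_ex_le _ _
  intro m hm hmD hmW
  have hm0 : (0 : ℝ) < m := by positivity
  have hmc : (m : ℂ) ≠ 0 := by exact_mod_cast (by omega : m ≠ 0)
  obtain ⟨r, hr⟩ := exists_dvd_mul_add_one hmW hm
  have hnonres : ∀ b : ℕ, ¬ ((q * m : ℕ) : ℤ) ∣ c * m + b * q →
      ‖T (θ + b / m)‖ ≤ (D : ℝ) ^ 2 := by
    intro b hb
    have h1 := inv_le_nn_of_not_dvd (m := q * m) (by nlinarith) hb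
    have h2 : ((c * m + b * q : ℤ) : ℝ) / (q * m : ℕ) = (θ + b / m) - (θ - c / q) := by
      push_cast; field_simp; ring
    rw [h2] at h1
    have h3 := nn_sub_le (θ + b / m) (θ - c / q)
    have h4 := nn_le_abs (θ - c / q)
    have h5 : 1 / (D : ℝ) ^ 2 ≤ 1 / ((q * m : ℕ) : ℝ) := by
      apply one_div_le_one_div_of_le
      · push_cast; positivity
      · push_cast
        have : (q : ℝ) ≤ D := by exact_mod_cast hqD
        have : (m : ℝ) ≤ D := by exact_mod_cast hmD
        nlinarith
    have h6 : 1 / (2 * (D : ℝ) ^ 2) ≤ nn (θ + b / m) := by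
      have : 1 / (D : ℝ) ^ 2 = 1 / (2 * (D : ℝ) ^ 2) + 1 / (2 * (D : ℝ) ^ 2) := by
        field_simp; norm_num
      linarith
    refine (norm_geom_le (by positivity) h6 N).trans (le_of_eq ?_)
    field_simp
  rw [sum_filter_dvd_eq hmW hm hr θ N]
  have hbound : ∀ s : Finset ℕ, s ⊆ range m →
      (∀ b ∈ s, ‖T (θ + b / m)‖ ≤ (D : ℝ) ^ 2) →
      ‖(1 / m : ℂ) * ∑ b ∈ s, ex (-(b * r / m)) * T (θ + b / m)‖ ≤ (D : ℝ) ^ 2 := by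
    intro s hs hsb
    rw [norm_mul, norm_div, norm_one, Complex.norm_natCast]
    have h1 : ‖∑ b ∈ s, ex (-(b * r / m)) * T (θ + b / m)‖ ≤ m * (D : ℝ) ^ 2 := by
      refine (norm_sum_le _ _).trans ?_
      calc ∑ b ∈ s, ‖ex (-(b * r / m)) * T (θ + b / m)‖
          ≤ ∑ b ∈ s, (D : ℝ) ^ 2 := by
            refine sum_le_sum fun b hb => ?_
            rw [norm_mul, norm_ex, one_mul]; exact hsb b hb
        _ = s.card * (D : ℝ) ^ 2 := by simp
        _ ≤ m * (D : ℝ) ^ 2 := by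
            have := card_le_card hs
            rw [card_range] at this
            gcongr
    rw [one_div, inv_mul_le_iff₀ hm0]; exact h1
  split_ifs with hqm
  · obtain ⟨m', rfl⟩ := hqm
    have hm'0 : 1 ≤ m' := by
      rcases Nat.eq_zero_or_pos m' with h | h
      · simp [h] at hm
      · exact h
    have hm'r : (m' : ℝ) ≠ 0 := by positivity
    set M := q * m' with hM
    have hMz : (0 : ℤ) < (M : ℤ) := by exact_mod_cast hm
    obtain ⟨b₀, hb₀⟩ : ∃ b₀ : ℕ, (b₀ : ℤ) = (-(c * m')) % (M : ℤ) :=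
      ⟨((-(c * m')) % (M : ℤ)).toNat, Int.toNat_of_nonneg (Int.emod_nonneg _ hMz.ne')⟩
    have hb₀M : b₀ ∈ range M := by
      rw [mem_range]
      have := Int.emod_lt_of_pos (-(c * m')) hMz
      rw [← hb₀] at this; exact_mod_cast this
    obtain ⟨t, ht⟩ : ∃ t : ℤ, (b₀ : ℤ) = -(c * m') + M * t := by
      refine ⟨-((-(c * m')) / (M : ℤ)), ?_⟩
      rw [hb₀]
      have := Int.emod_add_mul_ediv (-(c * m')) (M : ℤ)
      linarith
    rw [← add_sum_erase _ _ hb₀M, mul_add]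
    have hdiv : (b₀ : ℝ) / M = -(c / q) + t := by
      have : (b₀ : ℝ) = -(c * m') + M * t := by exact_mod_cast ht
      rw [this, hM]; push_cast; field_simp
    have hT0 : T (θ + b₀ / M) = T (θ - c / q) := by
      rw [hT]; refine sum_congr rfl fun n _ => ?_
      rw [hdiv]
      have := ex_add_int ((θ - c / q) * n) (t * n)
      rw [← this]; congr 1; push_cast; ring
    have hqW : q.Coprime W := Nat.Coprime.coprime_dvd_left (Dvd.intro _ rfl) hmW
    have hrr : (q : ℤ) ∣ (r : ℤ) - rq :=
      (dvd_mul_add_one_iff hqW (hrq hqW) r).mp (dvd_trans (Dvd.intro _ rfl) hr)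
    obtain ⟨u, hu⟩ := hrr
    have hE : ex (-(b₀ * r / M)) = ex (c * rq / q) := by
      have h1 : -((b₀ : ℝ) * r / M) = c * rq / q + ((c * u - t * r : ℤ) : ℝ) := by
        have h2 : (r : ℝ) = rq + q * u := by
          have : (r : ℤ) = rq + q * u := by linarith
          exact_mod_cast this
        rw [mul_div_right_comm, hdiv]
        push_cast
        have : (c : ℝ) / q * r = c * rq / q + c * u := by rw [h2]; field_simp
        linarith
      rw [h1, ex_add_int]
    change ‖(1 / (M : ℂ)) * (ex (-(b₀ * r / M)) * T (θ + b₀ / M)) + _ - _‖ ≤ _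
    rw [hE, hT0]
    have := hbound ((range M).erase b₀) (erase_subset _ _) (by
      intro b hb
      apply hnonres
      rintro ⟨v, hv⟩
      rw [mem_erase, mem_range] at hb
      apply hb.1
      have hv' : (b : ℤ) = -(c * m') + M * v := by
        have hq' : (q : ℤ) ≠ 0 := by exact_mod_cast (by omega : q ≠ 0)
        apply mul_right_cancel₀ hq'
        push_cast at hv
        have : (M : ℤ) = q * m' := by rw [hM]; push_cast; ring
        rw [this] at hv ⊢
        linarith
      have h3 : (b : ℤ) % M = b := Int.emod_eq_of_lt (by positivity) (by exact_mod_cast hb.2)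
      have h4 : (b : ℤ) = b₀ := by
        rw [hb₀, ← h3, hv', Int.add_mul_emod_self_left]
      exact_mod_cast h4)
    refine le_trans (le_of_eq ?_) this
    congr 1
    ring
  · rw [sub_zero]
    refine hbound (range m) subset_rfl fun b _ => hnonres b ?_
    intro hd
    apply hqm
    have h1 : (q : ℤ) ∣ c * m + b * q := dvd_trans ⟨m, by push_cast; ring⟩ hd
    have h2 : (q : ℤ) ∣ c * m := (dvd_add_left (Dvd.intro_left _ rfl)).mp h1
    have h3 : (q : ℤ) ∣ m := hcq.symm.dvd_of_dvd_mul_left h2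
    exact_mod_cast h3

lemma typeI (W N : ℕ) (θ : ℝ) (D : ℕ) (hD : 1 ≤ D) :
    ∃ q : ℕ, 1 ≤ q ∧ ∃ κ : ℂ, ‖κ‖ ≤ N ∧ ∀ m, 1 ≤ m → m ≤ D → m.Coprime W →
      ‖∑ n ∈ range N with m ∣ W * n + 1, ex (θ * n) - (if q ∣ m then κ / m else 0)‖
        ≤ (D : ℝ) ^ 2 := by
  have hD0 : (0 : ℝ) < D := by positivity
  by_cases h : ∃ (c : ℤ) (q : ℕ), 1 ≤ q ∧ q ≤ D ∧ |θ - c / q| < 1 / (2 * D ^ 2)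
  · obtain ⟨c, q, hq, hqD, hθ⟩ := h
    set x : ℚ := (c : ℚ) / q with hx
    have hxr : (c : ℝ) / q = (x.num : ℝ) / x.den := by
      have : (x : ℝ) = (x.num : ℝ) / x.den := Rat.cast_def x
      rw [← this, hx]; push_cast; rfl
    have hden : x.den ∣ q := by
      have := Rat.den_dvd c (q : ℤ)
      rw [← Rat.intCast_div_eq_divInt, Int.cast_natCast, ← hx] at this
      exact Int.natCast_dvd_natCast.mp this
    have hco : IsCoprime x.num (x.den : ℤ) := by
      rw [Int.isCoprime_iff_gcd_eq_one]; exact x.reduced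
    rw [hxr] at hθ
    obtain ⟨κ, h1, h2⟩ := typeI_of_approx W N θ D x.num x.den x.pos
      ((Nat.le_of_dvd hq hden).trans hqD) hco hθ
    exact ⟨_, x.pos, κ, h1, h2⟩
  · push Not at h
    refine ⟨1, le_rfl, 0, by simp, fun m hm hmD hmW => ?_⟩
    obtain ⟨r, hr⟩ := exists_dvd_mul_add_one hmW hm
    have hm0 : (0 : ℝ) < m := by positivity
    rw [sum_filter_dvd_eq hmW hm hr θ N]
    simp only [zero_div, ite_self, sub_zero]
    rw [norm_mul, norm_div, norm_one, Complex.norm_natCast, one_div, inv_mul_le_iff₀ hm0]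
    refine (norm_sum_le _ _).trans ?_
    calc _ ≤ ∑ b ∈ range m, (D : ℝ) ^ 2 := by
          refine sum_le_sum fun b hb => ?_
          rw [norm_mul, norm_ex, one_mul]
          have h6 : 1 / (2 * (D : ℝ) ^ 2) ≤ nn (θ + b / m) := by
            have := h (round (θ + b / m) * m - b) m hm hmD
            unfold nn
            refine this.trans (le_of_eq ?_)
            congr 1; push_cast; field_simp; ring
          refine (norm_geom_le (by positivity) h6 N).trans (le_of_eq ?_)
          field_simp
      _ = m * (D : ℝ) ^ 2 := by simp

end SchurPrimes

namespace SchurPrimes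
open Finset

/-- The multilinear form `∑_{D ⊆ P} c(D) ∏_{p ∈ D} x p`. -/
noncomputable def lin (P : Finset ℕ) (c : Finset ℕ → ℝ) (x : ℕ → ℝ) : ℝ :=
  ∑ D ∈ P.powerset, c D * ∏ p ∈ D, x p

/-- Coefficients of the Bonferroni truncation at level `k`. -/
noncomputable def bonC (k : ℕ) (D : Finset ℕ) : ℝ := if D.card ≤ k then (-1) ^ D.card else 0

/-- Coefficients of the elementary symmetric function of degree `k`. -/
noncomputable def binC (k : ℕ) (D : Finset ℕ) : ℝ := if D.card = k then 1 else 0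

lemma lin_insert {P : Finset ℕ} {p : ℕ} (hp : p ∉ P) (c : Finset ℕ → ℝ) (x : ℕ → ℝ) :
    lin (insert p P) c x = lin P c x + x p * lin P (fun D => c (insert p D)) x := by
  unfold lin
  rw [sum_powerset_insert hp, mul_sum]
  congr 1
  refine sum_congr rfl fun D hD => ?_
  have : p ∉ D := fun h => hp (mem_powerset.mp hD h)
  rw [prod_insert this]; ring

lemma lin_congr {P : Finset ℕ} {c c' : Finset ℕ → ℝ} (x : ℕ → ℝ)
    (h : ∀ D, D ⊆ P → c D = c' D) : lin P c x = lin P c' x :=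
  sum_congr rfl fun D hD => by rw [h D (mem_powerset.mp hD)]

lemma lin_one (P : Finset ℕ) (x : ℕ → ℝ) : lin P (fun _ => 1) x = ∏ p ∈ P, (1 + x p) := by
  unfold lin; rw [prod_one_add]; simp

lemma bonC_insert_zero {D : Finset ℕ} {p : ℕ} (hp : p ∉ D) : bonC 0 (insert p D) = 0 := by
  simp [bonC, card_insert_of_notMem hp]

lemma bonC_insert_succ {D : Finset ℕ} {p : ℕ} (hp : p ∉ D) (k : ℕ) :
    bonC (k + 1) (insert p D) = - bonC k D := by
  simp only [bonC, card_insert_of_notMem hp, add_le_add_iff_right, pow_succ]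
  split_ifs <;> ring

lemma binC_insert_succ {D : Finset ℕ} {p : ℕ} (hp : p ∉ D) (k : ℕ) :
    binC (k + 1) (insert p D) = binC k D := by
  simp [binC, card_insert_of_notMem hp]

lemma lin_bonC_zero (P : Finset ℕ) (x : ℕ → ℝ) : lin P (bonC 0) x = 1 := by
  unfold lin
  rw [sum_eq_single ∅]
  · simp [bonC]
  · intro D _ hD; simp [bonC, hD]
  · simp

lemma lin_binC_nonneg {P : Finset ℕ} {x : ℕ → ℝ} (hx : ∀ p ∈ P, 0 ≤ x p) (k : ℕ) :
    0 ≤ lin P (binC k) x :=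
  sum_nonneg fun D hD => mul_nonneg (by unfold binC; split_ifs <;> norm_num)
    (prod_nonneg fun p hp => hx p (mem_powerset.mp hD hp))

lemma lin_binC_one {P : Finset ℕ} (x : ℕ → ℝ) : lin P (binC 0) x = 1 := by
  unfold lin
  rw [sum_eq_single ∅]
  · simp [binC]
  · intro D _ hD; simp [binC, hD]
  · simp

/-- The Bonferroni inequalities, in weighted form. -/
lemma bonferroni (P : Finset ℕ) (x : ℕ → ℝ) (hx : ∀ p ∈ P, 0 ≤ x p ∧ x p ≤ 1) (k : ℕ) :
    0 ≤ (-1) ^ k * (lin P (bonC k) x - ∏ p ∈ P, (1 - x p)) ∧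
      (-1) ^ k * (lin P (bonC k) x - ∏ p ∈ P, (1 - x p)) ≤ lin P (binC (k + 1)) x := by
  induction P using Finset.induction_on generalizing k with
  | empty => simp [lin, bonC, binC]
  | insert p P hp ih =>
    have hxP : ∀ q ∈ P, 0 ≤ x q ∧ x q ≤ 1 := fun q hq => hx q (mem_insert_of_mem hq)
    have hxp := hx p (mem_insert_self p P)
    rw [prod_insert hp, lin_insert hp, lin_insert hp,
      lin_congr (c := fun D => binC (k + 1) (insert p D)) (c' := binC k) x
        (fun D hD => binC_insert_succ (fun h => hp (hD h)) k)]
    have h1 := ih hxP k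
    cases k with
    | zero =>
      rw [lin_congr (c := fun D => bonC 0 (insert p D)) (c' := fun _ => 0) x
        (fun D hD => bonC_insert_zero (fun h => hp (hD h)))]
      have h2 : lin P (fun _ => 0) x = 0 := by simp [lin]
      rw [h2, lin_binC_one]
      simp only [pow_zero, one_mul] at h1 ⊢
      rw [lin_bonC_zero] at h1 ⊢
      have h3 : 0 ≤ ∏ q ∈ P, (1 - x q) := prod_nonneg fun q hq => by linarith [hxP q hq]
      constructor <;> nlinarith [mul_nonneg hxp.1 h3]
    | succ k =>
      rw [lin_congr (c := fun D => bonC (k + 1) (insert p D)) (c' := fun D => - bonC k D) x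
        (fun D hD => bonC_insert_succ (fun h => hp (hD h)) k)]
      have h2 : lin P (fun D => - bonC k D) x = - lin P (bonC k) x := by simp [lin]
      rw [h2]
      have h4 := ih hxP k
      rw [pow_succ] at h1 ⊢
      constructor
      · nlinarith [mul_nonneg hxp.1 h4.1]
      · nlinarith [mul_le_mul_of_nonneg_left h4.2 hxp.1]

lemma le_lin_bonC {P : Finset ℕ} {x : ℕ → ℝ} (hx : ∀ p ∈ P, 0 ≤ x p ∧ x p ≤ 1) {k : ℕ}
    (hk : Even k) : ∏ p ∈ P, (1 - x p) ≤ lin P (bonC k) x := by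
  have := (bonferroni P x hx k).1
  rw [hk.neg_one_pow] at this; linarith

lemma lin_bonC_le {P : Finset ℕ} {x : ℕ → ℝ} (hx : ∀ p ∈ P, 0 ≤ x p ∧ x p ≤ 1) {k : ℕ}
    (hk : Even k) : lin P (bonC k) x ≤ ∏ p ∈ P, (1 - x p) + lin P (binC (k + 1)) x := by
  have := (bonferroni P x hx k).2
  rw [hk.neg_one_pow] at this; linarith

/-- Rankin's bound for elementary symmetric functions. -/
lemma lin_binC_le {P : Finset ℕ} {x : ℕ → ℝ} (hx : ∀ p ∈ P, 0 ≤ x p) {l : ℝ} (hl : 0 < l)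
    (k : ℕ) : lin P (binC k) x ≤ Real.exp (l * ∑ p ∈ P, x p) / l ^ k := by
  rw [le_div_iff₀ (by positivity)]
  have h1 : lin P (binC k) x * l ^ k ≤ lin P (fun _ => 1) (fun p => l * x p) := by
    unfold lin
    rw [sum_mul]
    refine sum_le_sum fun D hD => ?_
    have h0 : 0 ≤ ∏ p ∈ D, x p := prod_nonneg fun p hp => hx p (mem_powerset.mp hD hp)
    rw [prod_mul_distrib, prod_const]
    unfold binC
    split_ifs with h
    · rw [h]; linarith
    · have : 0 ≤ l ^ D.card * ∏ p ∈ D, x p := by positivity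
      linarith
  refine h1.trans ?_
  rw [lin_one, mul_sum, Real.exp_sum]
  refine prod_le_prod (fun p hp => ?_) fun p hp => ?_
  · have := mul_nonneg hl.le (hx p hp); linarith
  · have := Real.add_one_le_exp (l * x p); linarith

/-- The indicator of divisibility by `p`. -/
noncomputable def dv (m : ℕ) (p : ℕ) : ℝ := if p ∣ m then 1 else 0

lemma dv_mem (m p : ℕ) : 0 ≤ dv m p ∧ dv m p ≤ 1 := by unfold dv; split_ifs <;> norm_num

lemma prod_dv {D : Finset ℕ} (hD : ∀ p ∈ D, p.Prime) (m : ℕ) :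
    ∏ p ∈ D, dv m p = if ∏ p ∈ D, p ∣ m then 1 else 0 := by
  unfold dv
  rw [prod_ite_zero]
  have : (∀ i ∈ D, i ∣ m) ↔ ∏ p ∈ D, p ∣ m := by
    constructor
    · intro h
      exact Finset.prod_primes_dvd m (fun p hp => (hD p hp).prime) h
    · intro h i hi
      exact (dvd_prod_of_mem _ hi).trans h
  simp [this]

/-- The indicator of having no prime factor in `P`. -/
noncomputable def rho (P : Finset ℕ) (m : ℕ) : ℝ := ∏ p ∈ P, (1 - dv m p)

lemma rho_nonneg (P : Finset ℕ) (m : ℕ) : 0 ≤ rho P m :=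
  prod_nonneg fun p _ => by linarith [(dv_mem m p).2]

lemma rho_le_one (P : Finset ℕ) (m : ℕ) : rho P m ≤ 1 :=
  prod_le_one (fun p _ => by linarith [(dv_mem m p).2]) fun p _ => by linarith [(dv_mem m p).1]

end SchurPrimes

namespace SchurPrimes
open Finset

/-- A family of disjoint finite sets of primes not dividing `W`, with levels `K` and
size bounds `T`. -/
structure Blocks (ι : Type) (W : ℕ) where
  P : ι → Finset ℕ
  K : ι → ℕ
  T : ι → ℕ
  prime : ∀ i, ∀ p ∈ P i, p.Prime
  le : ∀ i, ∀ p ∈ P i, p ≤ T i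
  one_le : ∀ i, 1 ≤ T i
  cop : ∀ i, ∀ p ∈ P i, p.Coprime W
  disj : ∀ i j, i ≠ j → Disjoint (P i) (P j)

set_option linter.unusedSectionVars false

namespace Blocks

variable {ι : Type} [Fintype ι] [DecidableEq ι] {W : ℕ} (B : Blocks ι W)

/-- Coefficient families bounded by one and supported on sets of size at most `K`. -/
def Adm (c : ι → Finset ℕ → ℝ) : Prop :=
  ∀ i D, |c i D| ≤ 1 ∧ (B.K i < D.card → c i D = 0)

/-- The level of distribution. -/
def lev : ℕ := ∏ i, B.T i ^ B.K i

/-- The index set of the expansion. -/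
def idx : Finset (ι → Finset ℕ) :=
  Fintype.piFinset fun i => (B.P i).powerset.filter fun D => D.card ≤ B.K i

/-- The modulus attached to an index. -/
def mdl (_ : Blocks ι W) (X : ι → Finset ℕ) : ℕ := ∏ i, ∏ p ∈ X i, p

/-- The product of the block weights. -/
noncomputable def wt (c : ι → Finset ℕ → ℝ) (x : ℕ → ℝ) : ℝ := ∏ i, lin (B.P i) (c i) x

variable {B}

lemma mem_idx {X : ι → Finset ℕ} :
    X ∈ B.idx ↔ ∀ i, X i ⊆ B.P i ∧ (X i).card ≤ B.K i := by
  simp [idx, Fintype.mem_piFinset]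

lemma wt_eq {c : ι → Finset ℕ → ℝ} (hc : B.Adm c) (x : ℕ → ℝ) :
    B.wt c x = ∑ X ∈ B.idx, (∏ i, c i (X i)) * ∏ i, ∏ p ∈ X i, x p := by
  unfold wt idx
  have h1 : ∀ i, lin (B.P i) (c i) x =
      ∑ D ∈ (B.P i).powerset.filter (fun D => D.card ≤ B.K i), c i D * ∏ p ∈ D, x p := by
    intro i
    unfold lin
    rw [sum_filter_of_ne]
    intro D _ hD
    by_contra h
    exact hD (by rw [(hc i D).2 (not_le.mp h), zero_mul])
  simp_rw [h1]
  rw [prod_univ_sum]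
  refine sum_congr rfl fun X _ => ?_
  rw [prod_mul_distrib]

lemma pairwise_disj {X : ι → Finset ℕ} (hX : ∀ i, X i ⊆ B.P i) :
    ∀ i ∈ (univ : Finset ι), ∀ j ∈ (univ : Finset ι), i ≠ j → Disjoint (X i) (X j) :=
  fun i _ j _ hij => Finset.disjoint_of_subset_left (hX i)
    (Finset.disjoint_of_subset_right (hX j) (B.disj i j hij))

lemma mdl_eq {X : ι → Finset ℕ} (hX : ∀ i, X i ⊆ B.P i) :
    B.mdl X = ∏ p ∈ univ.biUnion X, p :=
  (prod_biUnion (fun i hi j hj hij => pairwise_disj hX i hi j hj hij)).symm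

lemma prime_biUnion {X : ι → Finset ℕ} (hX : ∀ i, X i ⊆ B.P i) :
    ∀ p ∈ univ.biUnion X, p.Prime := by
  intro p hp
  obtain ⟨i, _, hi⟩ := mem_biUnion.mp hp
  exact B.prime i p (hX i hi)

lemma primeFactors_mdl {X : ι → Finset ℕ} (hX : ∀ i, X i ⊆ B.P i) :
    (B.mdl X).primeFactors = univ.biUnion X := by
  rw [mdl_eq hX]; exact Nat.primeFactors_prod (prime_biUnion hX)

lemma eq_inter {X : ι → Finset ℕ} (hX : ∀ i, X i ⊆ B.P i) (i : ι) :
    X i = (B.mdl X).primeFactors ∩ B.P i := by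
  rw [primeFactors_mdl hX]
  ext p
  simp only [mem_inter, mem_biUnion, mem_univ, true_and]
  constructor
  · intro h; exact ⟨⟨i, h⟩, hX i h⟩
  · rintro ⟨⟨j, hj⟩, hp⟩
    by_cases hij : i = j
    · rw [hij]; exact hj
    · exact absurd hp (Finset.disjoint_left.mp (B.disj j i (Ne.symm hij)) (hX j hj))

lemma one_le_mdl {X : ι → Finset ℕ} (hX : ∀ i, X i ⊆ B.P i) : 1 ≤ B.mdl X := by
  unfold mdl
  exact Nat.one_le_iff_ne_zero.mpr (prod_ne_zero_iff.mpr fun i _ =>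
    prod_ne_zero_iff.mpr fun p hp => (B.prime i p (hX i hp)).ne_zero)

lemma mdl_le {X : ι → Finset ℕ} (hX : X ∈ B.idx) : B.mdl X ≤ B.lev := by
  unfold mdl lev
  refine Finset.prod_le_prod' fun i _ => ?_
  have h := mem_idx.mp hX i
  calc ∏ p ∈ X i, p ≤ ∏ p ∈ X i, B.T i := prod_le_prod' fun p hp => B.le i p (h.1 hp)
    _ = B.T i ^ (X i).card := by simp
    _ ≤ B.T i ^ B.K i := Nat.pow_le_pow_right (B.one_le i) h.2

lemma coprime_mdl {X : ι → Finset ℕ} (hX : ∀ i, X i ⊆ B.P i) : (B.mdl X).Coprime W := by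
  unfold mdl
  exact Nat.Coprime.prod_left fun i _ => Nat.Coprime.prod_left fun p hp => B.cop i p (hX i hp)

lemma one_le_lev : 1 ≤ B.lev := by
  unfold lev
  exact Nat.one_le_iff_ne_zero.mpr (prod_ne_zero_iff.mpr fun i _ =>
    pow_ne_zero _ (by have := B.one_le i; omega))

lemma card_idx_le : B.idx.card ≤ B.lev := by
  have h : B.idx.card ≤ (Icc 1 B.lev).card := by
    apply card_le_card_of_injOn B.mdl
    · intro X hX
      have hX' : X ∈ B.idx := hX
      have := one_le_mdl (B := B) (fun i => (mem_idx.mp hX' i).1)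
      simp [this, mdl_le hX']
    · intro X hX Y hY hXY
      have hX' : X ∈ B.idx := hX
      have hY' : Y ∈ B.idx := hY
      funext i
      rw [eq_inter (fun i => (mem_idx.mp hX' i).1) i, eq_inter (fun i => (mem_idx.mp hY' i).1) i,
        hXY]
  simpa using h

lemma prod_dv_idx {X : ι → Finset ℕ} (hX : ∀ i, X i ⊆ B.P i) (m : ℕ) :
    ∏ i, ∏ p ∈ X i, dv m p = if B.mdl X ∣ m then 1 else 0 := by
  rw [← prod_biUnion (fun i hi j hj hij => pairwise_disj hX i hi j hj hij),
    prod_dv (prime_biUnion hX), mdl_eq hX]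

lemma prod_inv_idx {X : ι → Finset ℕ} :
    ∏ i, ∏ p ∈ X i, (1 / (p : ℝ)) = 1 / (B.mdl X : ℝ) := by
  unfold mdl; push_cast; simp

lemma abs_coef_le {c : ι → Finset ℕ → ℝ} (hc : B.Adm c) (X : ι → Finset ℕ) :
    |∏ i, c i (X i)| ≤ 1 := by
  rw [abs_prod]; exact prod_le_one (fun i _ => abs_nonneg _) fun i _ => (hc i _).1

lemma squarefree_mdl {X : ι → Finset ℕ} (hX : ∀ i, X i ⊆ B.P i) : Squarefree (B.mdl X) := by
  rw [mdl_eq hX]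
  refine Finset.squarefree_prod_of_pairwise_isCoprime (fun p hp q hq hpq => ?_) fun p hp =>
    (prime_biUnion hX p hp).prime.squarefree
  have := (Nat.coprime_primes (prime_biUnion hX p hp) (prime_biUnion hX q hq)).mpr hpq
  exact Nat.coprime_iff_isRelPrime.mp this

lemma dvd_mdl_iff {X : ι → Finset ℕ} (hX : ∀ i, X i ⊆ B.P i) (q : ℕ) :
    q ∣ B.mdl X ↔ q ∣ B.mdl B.P ∧ ∀ i, (B.P i).filter (· ∣ q) ⊆ X i := by
  have hPP : ∀ i, B.P i ⊆ B.P i := fun i => subset_rfl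
  constructor
  · intro h
    refine ⟨h.trans ?_, fun i p hp => ?_⟩
    · unfold mdl; exact prod_dvd_prod_of_dvd _ _ fun i _ => prod_dvd_prod_of_subset _ _ _ (hX i)
    · rw [mem_filter] at hp
      rw [eq_inter hX i, mem_inter]
      exact ⟨Nat.mem_primeFactors.mpr ⟨B.prime i p hp.1, hp.2.trans h,
        by have := one_le_mdl hX; omega⟩, hp.1⟩
  · rintro ⟨h1, h2⟩
    have hsq := (squarefree_mdl hPP).squarefree_of_dvd h1
    rw [← Nat.prod_primeFactors_of_squarefree hsq, mdl_eq hX]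
    apply prod_dvd_prod_of_subset
    intro p hp
    have hp' := Nat.mem_primeFactors.mp hp
    have : p ∈ (B.mdl B.P).primeFactors := Nat.mem_primeFactors.mpr
      ⟨hp'.1, hp'.2.1.trans h1, by have := one_le_mdl hPP; omega⟩
    rw [primeFactors_mdl hPP] at this
    obtain ⟨i, hi, hpi⟩ := mem_biUnion.mp this
    exact mem_biUnion.mpr ⟨i, hi, h2 i (mem_filter.mpr ⟨hpi, hp'.2.1⟩)⟩

/-- Restriction of coefficients to sets containing a given set. -/
noncomputable def sup (Q : ι → Finset ℕ) (c : ι → Finset ℕ → ℝ) (i : ι) (D : Finset ℕ) : ℝ :=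
  if Q i ⊆ D then c i D else 0

lemma adm_sup {c : ι → Finset ℕ → ℝ} (hc : B.Adm c) (Q : ι → Finset ℕ) : B.Adm (sup Q c) := by
  intro i D
  unfold sup
  split_ifs
  · exact hc i D
  · simp

/-- Fourier transform of a sieve weight. -/
lemma fourier (N : ℕ) (θ : ℝ) : ∃ Q : ι → Finset ℕ, (∀ i, Q i ⊆ B.P i) ∧ ∃ κ : ℂ, ‖κ‖ ≤ N ∧
    ∀ c, B.Adm c → ‖∑ n ∈ range N, (B.wt c (dv (W * n + 1)) : ℂ) * ex (θ * n) -
      κ * (B.wt (sup Q c) (fun p => 1 / (p : ℝ)) : ℂ)‖ ≤ (B.lev : ℝ) ^ 3 := by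
  obtain ⟨q, hq, κ, hκ, h⟩ := typeI W N θ B.lev one_le_lev
  set Q : ι → Finset ℕ := fun i => (B.P i).filter (· ∣ q) with hQ
  refine ⟨Q, fun i => filter_subset _ _, if q ∣ B.mdl B.P then κ else 0, ?_, fun c hc => ?_⟩
  · split_ifs
    · exact hκ
    · simp
  have e1 : ∑ n ∈ range N, (B.wt c (dv (W * n + 1)) : ℂ) * ex (θ * n) =
      ∑ X ∈ B.idx, ((∏ i, c i (X i) : ℝ) : ℂ) *
        ∑ n ∈ range N with B.mdl X ∣ W * n + 1, ex (θ * n) := by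
    simp_rw [wt_eq hc]
    push_cast
    simp_rw [sum_mul]
    rw [sum_comm]
    refine sum_congr rfl fun X hX => ?_
    rw [sum_filter, mul_sum]
    refine sum_congr rfl fun n _ => ?_
    rw [mul_assoc]
    congr 1
    have := prod_dv_idx (fun i => (mem_idx.mp hX i).1) (W * n + 1)
    have h2 : (∏ i, ∏ p ∈ X i, ((dv (W * n + 1) p : ℝ) : ℂ)) =
        ((if B.mdl X ∣ W * n + 1 then 1 else 0 : ℝ) : ℂ) := by
      rw [← this]; push_cast; rfl
    rw [h2]; split_ifs <;> simp
  have e2 : (if q ∣ B.mdl B.P then κ else 0) * (B.wt (sup Q c) (fun p => 1 / (p : ℝ)) : ℂ) =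
      ∑ X ∈ B.idx, ((∏ i, c i (X i) : ℝ) : ℂ) *
        (if q ∣ B.mdl X then κ / B.mdl X else 0) := by
    rw [wt_eq (adm_sup hc Q), Complex.ofReal_sum, mul_sum]
    refine sum_congr rfl fun X hX => ?_
    have hX' := fun i => (mem_idx.mp hX i).1
    rw [prod_inv_idx (B := B)]
    by_cases h1 : q ∣ B.mdl X
    · have h2 := (dvd_mdl_iff hX' q).mp h1
      rw [if_pos h1, if_pos h2.1]
      have h3 : ∏ i, sup Q c i (X i) = ∏ i, c i (X i) :=
        prod_congr rfl fun i _ => if_pos (h2.2 i)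
      rw [h3]; push_cast; ring
    · rw [if_neg h1]
      by_cases h4 : q ∣ B.mdl B.P
      · have h5 : ∃ i, ¬ Q i ⊆ X i := by
          by_contra hcon
          push Not at hcon
          exact h1 ((dvd_mdl_iff hX' q).mpr ⟨h4, hcon⟩)
        obtain ⟨i, hi⟩ := h5
        have h3 : ∏ i, sup Q c i (X i) = 0 :=
          prod_eq_zero (mem_univ i) (if_neg hi)
        rw [h3]; simp
      · rw [if_neg h4]; simp
  rw [e1, e2, ← sum_sub_distrib]
  refine (norm_sum_le _ _).trans ?_
  calc _ ≤ ∑ X ∈ B.idx, (B.lev : ℝ) ^ 2 := by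
        refine sum_le_sum fun X hX => ?_
        have hX' := fun i => (mem_idx.mp hX i).1
        rw [← mul_sub, norm_mul, Complex.norm_real, Real.norm_eq_abs]
        have h1 := abs_coef_le hc X
        have h2 := h (B.mdl X) (one_le_mdl hX') (mdl_le hX) (coprime_mdl hX')
        calc _ ≤ 1 * (B.lev : ℝ) ^ 2 := mul_le_mul h1 h2 (norm_nonneg _) zero_le_one
          _ = _ := one_mul _
    _ = B.idx.card * (B.lev : ℝ) ^ 2 := by simp
    _ ≤ B.lev * (B.lev : ℝ) ^ 2 := by
        gcongr; exact card_idx_le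
    _ = _ := by ring

end Blocks

lemma abs_card_filter_dvd_sub_le {W m : ℕ} (h : m.Coprime W) (hm : 1 ≤ m) (N : ℕ) :
    |(((range N).filter fun n => m ∣ W * n + 1).card : ℝ) - N / m| ≤ 1 := by
  obtain ⟨r, hr⟩ := exists_dvd_mul_add_one h hm
  have h1 : ((range N).filter fun n => m ∣ W * n + 1).card = N.count (· ≡ r [MOD m]) := by
    rw [Nat.count_eq_card_filter_range]
    congr 1
    refine filter_congr fun n _ => ?_
    rw [dvd_mul_add_one_iff h hr, ← Int.natCast_modEq_iff, Int.modEq_comm, Int.modEq_iff_dvd]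
  rw [h1, Nat.count_modEq_card _ hm]
  have hm0 : (0 : ℝ) < m := by positivity
  have h2 : (N : ℝ) / m = (N / m : ℕ) + ((N % m : ℕ) : ℝ) / m := by
    have : (N : ℝ) = m * (N / m : ℕ) + (N % m : ℕ) := by exact_mod_cast (Nat.div_add_mod N m).symm
    field_simp; linarith
  have h3 : ((N % m : ℕ) : ℝ) / m < 1 := by
    rw [div_lt_one hm0]; exact_mod_cast Nat.mod_lt N hm
  have h4 : 0 ≤ ((N % m : ℕ) : ℝ) / m := by positivity
  rw [h2, abs_le]
  push_cast
  split_ifs <;> constructor <;> linarith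

set_option linter.unusedSectionVars false

namespace Blocks

variable {ι : Type} [Fintype ι] [DecidableEq ι] {W : ℕ} {B : Blocks ι W}

/-- Mean value of a sieve weight. -/
lemma mean {c : ι → Finset ℕ → ℝ} (hc : B.Adm c) (N : ℕ) :
    |∑ n ∈ range N, B.wt c (dv (W * n + 1)) - N * B.wt c (fun p => 1 / (p : ℝ))| ≤ B.lev := by
  have e1 : ∑ n ∈ range N, B.wt c (dv (W * n + 1)) - N * B.wt c (fun p => 1 / (p : ℝ)) =
      ∑ X ∈ B.idx, (∏ i, c i (X i)) *
        ((((range N).filter fun n => B.mdl X ∣ W * n + 1).card : ℝ) - N / B.mdl X) := by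
    simp_rw [wt_eq hc]
    rw [sum_comm, mul_sum, ← sum_sub_distrib]
    refine sum_congr rfl fun X hX => ?_
    have hX' := fun i => (mem_idx.mp hX i).1
    rw [prod_inv_idx (B := B), ← mul_sum]
    simp_rw [prod_dv_idx hX']
    rw [sum_boole]; ring
  rw [e1]
  refine (abs_sum_le_sum_abs _ _).trans ?_
  calc _ ≤ ∑ X ∈ B.idx, (1 : ℝ) := by
        refine sum_le_sum fun X hX => ?_
        have hX' := fun i => (mem_idx.mp hX i).1
        rw [abs_mul]
        exact mul_le_one₀ (abs_coef_le hc X) (abs_nonneg _)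
          (abs_card_filter_dvd_sub_le (coprime_mdl hX') (one_le_mdl hX') N)
    _ = B.idx.card := by simp
    _ ≤ B.lev := by exact_mod_cast card_idx_le

end Blocks

end SchurPrimes

namespace SchurPrimes
open Finset

/-- The primes in `(a, b]` not dividing `W`. -/
def prm (W a b : ℕ) : Finset ℕ := (Ioc a b).filter fun p => p.Prime ∧ ¬ p ∣ W

lemma mem_prm {W a b p : ℕ} : p ∈ prm W a b ↔ (a < p ∧ p ≤ b) ∧ p.Prime ∧ ¬ p ∣ W := by
  simp [prm]

lemma prm_union {W a b c : ℕ} (hab : a ≤ b) (hbc : b ≤ c) :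
    prm W a c = prm W a b ∪ prm W b c := by
  ext p; simp only [mem_prm, mem_union]; grind

lemma prm_disjoint {W a b c d : ℕ} (h : b ≤ c) : Disjoint (prm W a b) (prm W c d) := by
  rw [Finset.disjoint_left]; intro p; simp only [mem_prm]; grind

lemma sum_inv_prm_dyadic (W k : ℕ) (hk : 1 ≤ k) :
    ∑ p ∈ prm W (2 ^ k) (2 ^ (k + 1)), 1 / (p : ℝ) ≤ 4 / k := by
  have hk0 : (0 : ℝ) < k := by positivity
  have hlog2 : 0 < Real.log 2 := Real.log_pos (by norm_num)
  have h1 : ∑ p ∈ prm W (2 ^ k) (2 ^ (k + 1)), Real.log p ≤ Real.log 4 * 2 ^ (k + 1) := by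
    have h2 := Chebyshev.theta_le_log4_mul_x (x := (2 : ℝ) ^ (k + 1)) (by positivity)
    refine le_trans ?_ h2
    unfold Chebyshev.theta
    have h3 : ⌊(2 : ℝ) ^ (k + 1)⌋₊ = 2 ^ (k + 1) := by
      have : (2 : ℝ) ^ (k + 1) = ((2 ^ (k + 1) : ℕ) : ℝ) := by push_cast; rfl
      rw [this, Nat.floor_natCast]
    rw [h3]
    apply sum_le_sum_of_subset_of_nonneg
    · intro p hp
      rw [mem_prm] at hp
      rw [mem_filter, mem_Ioc]
      exact ⟨⟨hp.2.1.pos, hp.1.2⟩, hp.2.1⟩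
    · intro p _ _; exact Real.log_natCast_nonneg p
  have h4 : ∀ p ∈ prm W (2 ^ k) (2 ^ (k + 1)),
      1 / (p : ℝ) ≤ Real.log p / (k * Real.log 2 * 2 ^ k) := by
    intro p hp
    rw [mem_prm] at hp
    have hp2 : (2 : ℝ) ^ k ≤ p := by exact_mod_cast hp.1.1.le
    have hlog : k * Real.log 2 ≤ Real.log p := by
      rw [← Real.log_pow]; exact Real.log_le_log (by positivity) hp2
    have hp0 : (0 : ℝ) < p := lt_of_lt_of_le (by positivity) hp2
    rw [div_le_div_iff₀ hp0 (by positivity), one_mul]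
    have : 0 ≤ k * Real.log 2 := by positivity
    exact mul_le_mul hlog hp2 (by positivity) (by linarith)
  refine (sum_le_sum h4).trans ?_
  rw [← sum_div, div_le_div_iff₀ (by positivity) hk0]
  have h5 : Real.log 4 = 2 * Real.log 2 := by
    rw [show (4 : ℝ) = 2 ^ 2 by norm_num, Real.log_pow]; norm_num
  have h6 : (2 : ℝ) ^ (k + 1) = 2 ^ k * 2 := pow_succ _ _
  rw [h5, h6] at h1
  nlinarith

lemma sum_inv_prm_le (W a : ℕ) (ha : 1 ≤ a) (j : ℕ) :
    ∑ p ∈ prm W (2 ^ a) (2 ^ (a + j)), 1 / (p : ℝ) ≤ ∑ i ∈ range j, 4 / ((a + i : ℕ) : ℝ) := by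
  induction j with
  | zero =>
    rw [sum_eq_zero]
    · simp
    · intro p hp; rw [mem_prm] at hp; simp at hp; omega
  | succ j ih =>
    rw [prm_union (b := 2 ^ (a + j)) (Nat.pow_le_pow_right (by norm_num) (by omega))
      (Nat.pow_le_pow_right (by norm_num) (by omega)), sum_union (prm_disjoint le_rfl),
      sum_range_succ]
    exact add_le_add ih (sum_inv_prm_dyadic W (a + j) (by omega))

lemma sum_inv_prm_block (W t : ℕ) (ht : 1 ≤ t) :
    ∑ p ∈ prm W (2 ^ t) (2 ^ (2 * t)), 1 / (p : ℝ) ≤ 4 := by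
  have h := sum_inv_prm_le W t ht t
  rw [← two_mul] at h
  refine h.trans ?_
  have ht0 : (0 : ℝ) < t := by positivity
  calc _ ≤ ∑ i ∈ range t, 4 / (t : ℝ) := by
        refine sum_le_sum fun i _ => ?_
        gcongr; omega
    _ = 4 := by simp; field_simp

lemma sum_inv_prm_start (W s : ℕ) (hs : 1 ≤ s) :
    ∑ p ∈ prm W 0 (2 ^ s), 1 / (p : ℝ) ≤ 5 + 4 * Real.log s := by
  have h1 : ∑ p ∈ prm W 0 (2 ^ 1), 1 / (p : ℝ) ≤ 1 := by
    calc _ ≤ ∑ p ∈ ({2} : Finset ℕ), 1 / (p : ℝ) := by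
          apply sum_le_sum_of_subset_of_nonneg
          · intro p hp; rw [mem_prm] at hp
            have := hp.2.1.two_le
            rw [mem_singleton]; omega
          · intros; positivity
      _ ≤ 1 := by norm_num
  have h2 := sum_inv_prm_le W 1 le_rfl (s - 1)
  rw [show 1 + (s - 1) = s by omega] at h2
  rw [prm_union (a := 0) (b := 2 ^ 1) (c := 2 ^ s) (by positivity)
    (Nat.pow_le_pow_right (by norm_num) hs), sum_union (prm_disjoint le_rfl)]
  have h3 : ∑ i ∈ range (s - 1), 4 / ((1 + i : ℕ) : ℝ) ≤ 4 * (1 + Real.log s) := by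
    have h4 := harmonic_le_one_add_log s
    have h5 : ∑ i ∈ range (s - 1), 4 / ((1 + i : ℕ) : ℝ) ≤ 4 * (harmonic s : ℝ) := by
      unfold harmonic
      push_cast
      rw [mul_sum]
      calc _ = ∑ i ∈ range (s - 1), 4 * ((i : ℝ) + 1)⁻¹ :=
            sum_congr rfl fun i _ => by rw [div_eq_mul_inv, add_comm]
        _ ≤ _ := by
            apply sum_le_sum_of_subset_of_nonneg
            · exact range_subset_range.mpr (by omega)
            · intros; positivity
    linarith
  linarith

lemma exp_neg_le_prod_prm {P : Finset ℕ} (hP : ∀ p ∈ P, p.Prime) :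
    Real.exp (-(2 * ∑ p ∈ P, 1 / (p : ℝ))) ≤ ∏ p ∈ P, (1 - 1 / (p : ℝ)) := by
  rw [mul_sum, ← sum_neg_distrib, Real.exp_sum]
  refine prod_le_prod (fun p _ => (Real.exp_pos _).le) fun p hp => ?_
  have hp2 : (2 : ℝ) ≤ p := by exact_mod_cast (hP p hp).two_le
  set x := 1 / (p : ℝ) with hx
  have hx0 : 0 < x := by positivity
  have hx2 : x ≤ 1 / 2 := one_div_le_one_div_of_le (by norm_num) hp2
  rw [Real.exp_neg]
  apply inv_le_of_inv_le₀ (by linarith)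
  have h1 := Real.add_one_le_exp (2 * x)
  refine le_trans ?_ h1
  rw [inv_le_iff_one_le_mul₀ (by linarith)]
  nlinarith

/-- The sieve density `∏ (1 - 1/p)` over primes `p ≤ z` not dividing `W`. -/
noncomputable def dens (W z : ℕ) : ℝ := ∏ p ∈ prm W 0 z, (1 - 1 / (p : ℝ))

lemma one_sub_inv_prime_mem {p : ℕ} (hp : p.Prime) :
    0 < 1 - 1 / (p : ℝ) ∧ 1 - 1 / (p : ℝ) ≤ 1 := by
  have hp2 : (2 : ℝ) ≤ p := by exact_mod_cast hp.two_le
  have : 1 / (p : ℝ) ≤ 1 / 2 := one_div_le_one_div_of_le (by norm_num) hp2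
  have : 0 < 1 / (p : ℝ) := by positivity
  constructor <;> linarith

lemma dens_pos (W z : ℕ) : 0 < dens W z :=
  prod_pos fun _ hp => (one_sub_inv_prime_mem (mem_prm.mp hp).2.1).1

/-- Mertens-type lower bound with a crude exponent. -/
lemma inv_dens_le (W s : ℕ) (hs : 1 ≤ s) :
    1 / dens W (2 ^ s) ≤ Real.exp 10 * (s : ℝ) ^ 8 := by
  have h1 := exp_neg_le_prod_prm (P := prm W 0 (2 ^ s)) fun p hp => (mem_prm.mp hp).2.1
  have h2 := sum_inv_prm_start W s hs
  have hs0 : (0 : ℝ) < s := by positivity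
  rw [div_le_iff₀ (dens_pos _ _)]
  have h3 : Real.exp (-(10 + 8 * Real.log s)) ≤ dens W (2 ^ s) := by
    refine le_trans (Real.exp_le_exp.mpr ?_) h1
    linarith
  have h4 : Real.exp 10 * (s : ℝ) ^ 8 = Real.exp (10 + 8 * Real.log s) := by
    rw [Real.exp_add]; congr 1
    rw [show (8 : ℝ) = ((8 : ℕ) : ℝ) by norm_num, Real.exp_nat_mul, Real.exp_log hs0]
  rw [h4]
  calc (1 : ℝ) = Real.exp (10 + 8 * Real.log s) * Real.exp (-(10 + 8 * Real.log s)) := by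
        rw [← Real.exp_add]; simp
    _ ≤ _ := by gcongr

lemma log_le_prod_inv (z : ℕ) :
    Real.log z ≤ ∏ p ∈ prm 1 0 z, (1 - 1 / (p : ℝ))⁻¹ := by
  rcases Nat.eq_zero_or_pos z with rfl | hz
  · simp only [CharP.cast_eq_zero, Real.log_zero]
    exact prod_nonneg fun p hp =>
      inv_nonneg.mpr (one_sub_inv_prime_mem (mem_prm.mp hp).2.1).1.le
  let f : ℕ →* ℝ :=
    { toFun := fun n => (n : ℝ)⁻¹
      map_one' := by simp
      map_mul' := fun a b => by push_cast; rw [mul_inv] }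
  have hf : ∀ {p : ℕ}, p.Prime → ‖f p‖ < 1 := by
    intro p hp
    change ‖(p : ℝ)⁻¹‖ < 1
    rw [norm_inv, Real.norm_natCast]
    exact inv_lt_one_of_one_lt₀ (by exact_mod_cast hp.one_lt)
  obtain ⟨h1, h2⟩ := EulerProduct.summable_and_hasSum_smoothNumbers_prod_primesBelow_geometric
    hf (z + 1)
  have h3 : ∏ p ∈ (z + 1).primesBelow, (1 - f p)⁻¹ = ∏ p ∈ prm 1 0 z, (1 - 1 / (p : ℝ))⁻¹ := by
    have : (z + 1).primesBelow = prm 1 0 z := by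
      ext p
      rw [Nat.mem_primesBelow, mem_prm]
      constructor
      · rintro ⟨a, b⟩
        exact ⟨⟨b.pos, by omega⟩, b, fun h => b.one_lt.ne' (Nat.dvd_one.mp h)⟩
      · rintro ⟨a, b, c⟩; exact ⟨by omega, b⟩
    rw [this]
    refine prod_congr rfl fun p _ => ?_
    change (1 - (p : ℝ)⁻¹)⁻¹ = _
    rw [one_div]
  rw [h3] at h2
  have h4 : ∀ m ∈ Icc 1 z, m ∈ (z + 1).smoothNumbers := by
    intro m hm
    rw [mem_Icc] at hm
    exact Nat.mem_smoothNumbers_of_lt hm.1 (by omega)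
  let S : Finset (z + 1).smoothNumbers := (Icc 1 z).attach.image fun m => ⟨m.1, h4 m.1 m.2⟩
  have h5 : ∑ m ∈ S, f m ≤ ∏ p ∈ prm 1 0 z, (1 - 1 / (p : ℝ))⁻¹ := by
    apply sum_le_hasSum S _ h2
    intro m _
    change 0 ≤ ((m : ℕ) : ℝ)⁻¹
    positivity
  have h6 : ∑ m ∈ S, f m = ∑ m ∈ Icc 1 z, (m : ℝ)⁻¹ := by
    rw [sum_image]
    · exact sum_attach (Icc 1 z) (fun m => (m : ℝ)⁻¹)
    · intro a _ b _ h
      have := congrArg Subtype.val h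
      exact Subtype.ext this
  rw [h6] at h5
  refine le_trans ?_ h5
  have h7 := log_add_one_le_harmonic z
  have h8 : ((harmonic z : ℚ) : ℝ) = ∑ m ∈ Icc 1 z, (m : ℝ)⁻¹ := by
    rw [harmonic_eq_sum_Icc]; push_cast; rfl
  rw [h8] at h7
  refine le_trans (Real.log_le_log (by positivity) ?_) h7
  push_cast; linarith

lemma dens_mul_log_le (W z : ℕ) (hW : 1 ≤ W) :
    dens W z * (W.totient / W : ℝ) * Real.log z ≤ 1 := by
  have hW0 : (W : ℝ) ≠ 0 := by positivity
  have h1 : (W.totient / W : ℝ) = ∏ p ∈ W.primeFactors, (1 - 1 / (p : ℝ)) := by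
    have h := Nat.totient_eq_mul_prod_factors W
    have h' : (W.totient : ℝ) = W * ∏ p ∈ W.primeFactors, (1 - (p : ℝ)⁻¹) := by
      have h0 := congrArg (Rat.cast : ℚ → ℝ) h
      push_cast at h0
      exact h0
    rw [h', mul_div_cancel_left₀ _ hW0]
    simp
  have h2 : dens W z * (W.totient / W : ℝ) ≤ ∏ p ∈ prm 1 0 z, (1 - 1 / (p : ℝ)) := by
    have h3 : prm 1 0 z ⊆ prm W 0 z ∪ W.primeFactors := by
      intro p hp
      rw [mem_prm] at hp
      rw [mem_union, mem_prm, Nat.mem_primeFactors]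
      by_cases h : p ∣ W
      · exact Or.inr ⟨hp.2.1, h, by omega⟩
      · exact Or.inl ⟨hp.1, hp.2.1, h⟩
    have h4 : Disjoint (prm W 0 z) W.primeFactors := by
      rw [Finset.disjoint_left]; intro p hp hp'
      exact (mem_prm.mp hp).2.2 (Nat.dvd_of_mem_primeFactors hp')
    rw [h1, dens, ← prod_union h4, ← prod_sdiff h3]
    have hpos : ∀ p ∈ prm W 0 z ∪ W.primeFactors, p.Prime := by
      intro p hp
      rcases mem_union.mp hp with h | h
      · exact (mem_prm.mp h).2.1
      · exact Nat.prime_of_mem_primeFactors h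
    have h5 : ∏ p ∈ (prm W 0 z ∪ W.primeFactors) \ prm 1 0 z, (1 - 1 / (p : ℝ)) ≤ 1 :=
      prod_le_one (fun p hp => (one_sub_inv_prime_mem (hpos p (mem_sdiff.mp hp).1)).1.le)
        fun p hp => (one_sub_inv_prime_mem (hpos p (mem_sdiff.mp hp).1)).2
    exact mul_le_of_le_one_left (prod_nonneg fun p hp =>
      (one_sub_inv_prime_mem (mem_prm.mp hp).2.1).1.le) h5
  have h6 := log_le_prod_inv z
  rw [prod_inv_distrib] at h6
  have hpos : 0 < ∏ p ∈ prm 1 0 z, (1 - 1 / (p : ℝ)) :=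
    prod_pos fun p hp => (one_sub_inv_prime_mem (mem_prm.mp hp).2.1).1
  rw [← one_div, le_div_iff₀ hpos] at h6
  rcases Nat.eq_zero_or_pos z with rfl | hz
  · simp
  have h7 : 0 ≤ Real.log z := Real.log_natCast_nonneg z
  calc _ ≤ (∏ p ∈ prm 1 0 z, (1 - 1 / (p : ℝ))) * Real.log z := by gcongr
    _ ≤ 1 := by linarith

end SchurPrimes

namespace SchurPrimes
open Finset

lemma lin_sup_le {P Q : Finset ℕ} (hQ : Q ⊆ P) {c : Finset ℕ → ℝ} (hc : ∀ D, |c D| ≤ 1)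
    {x : ℕ → ℝ} (hx : ∀ p ∈ P, 0 ≤ x p) :
    |lin P (fun D => if Q ⊆ D then c D else 0) x| ≤
      (∏ p ∈ Q, x p) * Real.exp (∑ p ∈ P, x p) := by
  have h0 : ∀ D, D ⊆ P → 0 ≤ ∏ p ∈ D, x p := fun D hD => prod_nonneg fun p hp => hx p (hD hp)
  unfold lin
  refine (abs_sum_le_sum_abs _ _).trans ?_
  calc _ ≤ ∑ D ∈ P.powerset.filter (Q ⊆ ·), (∏ p ∈ Q, x p) * ∏ p ∈ D \ Q, x p := by
        rw [sum_filter]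
        refine sum_le_sum fun D hD => ?_
        have hD' := mem_powerset.mp hD
        rw [abs_mul, abs_of_nonneg (h0 D hD')]
        show |if Q ⊆ D then c D else 0| * _ ≤ _
        split_ifs with h
        · rw [mul_comm (∏ p ∈ Q, x p), prod_sdiff h]
          exact mul_le_of_le_one_left (h0 D hD') (hc D)
        · simp
    _ ≤ (∏ p ∈ Q, x p) * ∑ D ∈ P.powerset, ∏ p ∈ D, x p := by
        rw [← mul_sum]
        refine mul_le_mul_of_nonneg_left ?_ (h0 Q hQ)
        rw [← sum_image (s := P.powerset.filter (Q ⊆ ·)) (g := fun D => D \ Q)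
          (f := fun D => ∏ p ∈ D, x p)]
        · apply sum_le_sum_of_subset_of_nonneg
          · intro D hD
            obtain ⟨D', hD', rfl⟩ := mem_image.mp hD
            rw [mem_filter, mem_powerset] at hD'
            exact mem_powerset.mpr (sdiff_subset.trans hD'.1)
          · intro D hD _; exact h0 D (mem_powerset.mp hD)
        · intro D hD D' hD' h
          have h1 := (mem_filter.mp hD).2
          have h2 := (mem_filter.mp hD').2
          have h3 : D \ Q = D' \ Q := h
          rw [← sdiff_union_of_subset h1, ← sdiff_union_of_subset h2, h3]
    _ ≤ _ := by
        refine mul_le_mul_of_nonneg_left ?_ (h0 Q hQ)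
        have := lin_one P x
        unfold lin at this
        simp only [one_mul] at this
        rw [this, Real.exp_sum]
        refine prod_le_prod (fun p hp => by linarith [hx p hp]) fun p hp => ?_
        have := Real.add_one_le_exp (x p); linarith

lemma prod_sub_prod_le {ι : Type} [DecidableEq ι] (s : Finset ι) (A R Bd : ι → ℝ)
    (h : ∀ i ∈ s, 0 ≤ R i ∧ R i ≤ A i ∧ A i ≤ R i + Bd i) :
    ∏ i ∈ s, A i - ∏ i ∈ s, R i ≤ ∑ i ∈ s, Bd i * ∏ j ∈ s.erase i, A j := by
  induction s using Finset.induction_on with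
  | empty => simp
  | insert i s hi ih =>
    have hs : ∀ j ∈ s, 0 ≤ R j ∧ R j ≤ A j ∧ A j ≤ R j + Bd j :=
      fun j hj => h j (mem_insert_of_mem hj)
    have hi' := h i (mem_insert_self _ _)
    have ih' := ih hs
    rw [prod_insert hi, prod_insert hi, sum_insert hi, erase_insert hi]
    have h1 : ∑ j ∈ s, Bd j * ∏ l ∈ (insert i s).erase j, A l =
        A i * ∑ j ∈ s, Bd j * ∏ l ∈ s.erase j, A l := by
      rw [mul_sum]
      refine sum_congr rfl fun j hj => ?_
      have hij : i ≠ j := fun h => hi (h ▸ hj)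
      rw [erase_insert_of_ne hij, prod_insert (fun h => hi (mem_of_mem_erase h))]
      ring
    rw [h1]
    have hA : 0 ≤ ∏ j ∈ s, A j := prod_nonneg fun j hj => (hs j hj).1.trans (hs j hj).2.1
    have hAR : 0 ≤ ∏ j ∈ s, A j - ∏ j ∈ s, R j :=
      sub_nonneg.mpr (prod_le_prod (fun j hj => (hs j hj).1) fun j hj => (hs j hj).2.1)
    have hX : 0 ≤ ∑ j ∈ s, Bd j * ∏ l ∈ s.erase j, A l := hAR.trans ih'
    calc A i * ∏ j ∈ s, A j - R i * ∏ j ∈ s, R j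
        = (A i - R i) * ∏ j ∈ s, A j + R i * (∏ j ∈ s, A j - ∏ j ∈ s, R j) := by ring
      _ ≤ Bd i * ∏ j ∈ s, A j + A i * ∑ j ∈ s, Bd j * ∏ l ∈ s.erase j, A l := by
          apply add_le_add
          · exact mul_le_mul_of_nonneg_right (by linarith [hi'.2.2]) hA
          · exact mul_le_mul hi'.2.1 ih' hAR (hi'.1.trans hi'.2.1)

/-- The truncation level of the `j`-th block. -/
def klev (b J j : ℕ) : ℕ := 2 * (b + (J - 1 - j))

/-- The concrete family of blocks used for the sieve. -/
def blk (W b s J : ℕ) : Blocks (Option (Fin J)) W where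
  P i := i.elim (prm W 0 (2 ^ s)) fun j => prm W (2 ^ (s * 2 ^ (j : ℕ))) (2 ^ (s * 2 ^ (j + 1 : ℕ)))
  K i := i.elim (2 * s + 1) fun j => klev b J j + 1
  T i := i.elim (2 ^ s) fun j => 2 ^ (s * 2 ^ (j + 1 : ℕ))
  prime := by rintro (_ | j) p hp <;> exact (mem_prm.mp hp).2.1
  le := by rintro (_ | j) p hp <;> exact (mem_prm.mp hp).1.2
  one_le := by rintro (_ | j) <;> exact Nat.one_le_two_pow
  cop := by
    rintro (_ | j) p hp <;>
      exact (Nat.Prime.coprime_iff_not_dvd (mem_prm.mp hp).2.1).mpr (mem_prm.mp hp).2.2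
  disj := by
    have h0 : ∀ j : ℕ, 2 ^ s ≤ 2 ^ (s * 2 ^ j) := fun j =>
      Nat.pow_le_pow_right (by norm_num) (Nat.le_mul_of_pos_right _ (by positivity))
    have h1 : ∀ i j : ℕ, i < j → 2 ^ (s * 2 ^ (i + 1)) ≤ 2 ^ (s * 2 ^ j) := fun i j hij =>
      Nat.pow_le_pow_right (by norm_num)
        (Nat.mul_le_mul_left _ (Nat.pow_le_pow_right (by norm_num) hij))
    rintro (_ | i) (_ | j) hij
    · exact absurd rfl hij
    · exact prm_disjoint (h0 j)
    · exact (prm_disjoint (h0 i)).symm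
    · have hne : (i : ℕ) ≠ j := fun h => hij (by rw [Fin.ext h])
      rcases lt_or_gt_of_ne hne with h | h
      · exact prm_disjoint (h1 i j h)
      · exact (prm_disjoint (h1 j i h)).symm

/-- Truncation levels. -/
def kk (b s J : ℕ) (i : Option (Fin J)) : ℕ := i.elim (2 * s) fun j => klev b J j

lemma even_kk (b s J : ℕ) (i : Option (Fin J)) : Even (kk b s J i) := by
  rcases i with _ | j
  · exact even_two_mul s
  · exact even_two_mul _

lemma K_eq (W b s J : ℕ) (i : Option (Fin J)) : (blk W b s J).K i = kk b s J i + 1 := by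
  rcases i with _ | j <;> rfl

lemma abs_bonC_le (k : ℕ) (D : Finset ℕ) : |bonC k D| ≤ 1 := by
  unfold bonC; split_ifs <;> simp

lemma abs_binC_le (k : ℕ) (D : Finset ℕ) : |binC k D| ≤ 1 := by
  unfold binC; split_ifs <;> simp

/-- The density of the `i`-th block. -/
noncomputable def vden (W b s J : ℕ) (i : Option (Fin J)) : ℝ :=
  ∏ p ∈ (blk W b s J).P i, (1 - 1 / (p : ℝ))

lemma vden_pos (W b s J : ℕ) (i : Option (Fin J)) : 0 < vden W b s J i :=
  prod_pos fun p hp => (one_sub_inv_prime_mem ((blk W b s J).prime i p hp)).1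

lemma prm_biUnion (W b s J : ℕ) :
    univ.biUnion (blk W b s J).P = prm W 0 (2 ^ (s * 2 ^ J)) := by
  have key : ∀ J' ≤ J, (univ : Finset (Option (Fin J'))).biUnion (blk W b s J').P =
      prm W 0 (2 ^ (s * 2 ^ J')) := by
    intro J' _
    induction J' with
    | zero =>
      ext p
      simp only [mem_biUnion, mem_univ, true_and, blk, Option.exists, Option.elim, pow_zero,
        mul_one]
      exact ⟨fun h => h.elim id fun ⟨j, _⟩ => j.elim0, Or.inl⟩
    | succ n ih =>
      rw [prm_union (b := 2 ^ (s * 2 ^ n)) (Nat.zero_le _) (Nat.pow_le_pow_right (by norm_num)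
        (Nat.mul_le_mul_left _ (Nat.pow_le_pow_right (by norm_num) (by omega)))),
        ← ih (by omega)]
      ext p
      simp only [mem_biUnion, mem_univ, true_and, mem_union, blk, Option.exists, Option.elim]
      constructor
      · rintro (h | ⟨j, hj⟩)
        · exact Or.inl (Or.inl h)
        · rcases Nat.lt_succ_iff_lt_or_eq.mp j.2 with h | h
          · exact Or.inl (Or.inr ⟨⟨j, h⟩, hj⟩)
          · right; rw [h] at hj; exact hj
      · rintro ((h | ⟨j, hj⟩) | h)
        · exact Or.inl h
        · exact Or.inr ⟨⟨j, by omega⟩, hj⟩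
        · exact Or.inr ⟨⟨n, by omega⟩, h⟩
  exact key J le_rfl

lemma prod_blk (W b s J : ℕ) (g : ℕ → ℝ) :
    ∏ i, ∏ p ∈ (blk W b s J).P i, g p = ∏ p ∈ prm W 0 (2 ^ (s * 2 ^ J)), g p := by
  rw [← prm_biUnion W b s J, prod_biUnion]
  exact fun i hi j hj hij => (blk W b s J).disj i j hij

lemma prod_vden (W b s J : ℕ) : ∏ i, vden W b s J i = dens W (2 ^ (s * 2 ^ J)) :=
  prod_blk W b s J _

lemma lev_le (W b s J : ℕ) (hJ : 3 * s ≤ 2 ^ J) :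
    (blk W b s J).lev ≤ (2 ^ (s * 2 ^ J)) ^ (4 * b + 8) := by
  have key : ∀ n : ℕ, ∑ j : Fin n, (2 ^ ((j : ℕ) + 1)) * (2 * (b + (n - 1 - j)) + 1) ≤
      2 ^ n * (4 * b + 6) := by
    have aux : ∀ n : ℕ, ∑ j : Fin n, (2 ^ ((j : ℕ) + 1)) * (2 * (b + (n - 1 - j)) + 1) + 4 * n + 4 * b + 6
        ≤ 2 ^ n * (4 * b + 6) := by
      intro n
      induction n with
      | zero => simp
      | succ n ih =>
        rw [Fin.sum_univ_succ]
        have : ∀ i : Fin n, 2 ^ (((i.succ : Fin (n + 1)) : ℕ) + 1) *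
            (2 * (b + (n + 1 - 1 - ((i.succ : Fin (n + 1)) : ℕ))) + 1) =
            2 * (2 ^ ((i : ℕ) + 1) * (2 * (b + (n - 1 - i)) + 1)) := by
          intro i
          have h1 : n + 1 - 1 - ((i.succ : Fin (n + 1)) : ℕ) = n - 1 - i := by
            rw [Fin.val_succ]; omega
          rw [h1, Fin.val_succ, pow_succ]; ring
        simp_rw [this]
        rw [← mul_sum]
        have h3 : 2 ^ (n + 1) * (4 * b + 6) = 2 * (2 ^ n * (4 * b + 6)) := by ring
        rw [h3]
        generalize 2 ^ n * (4 * b + 6) = Y at ih ⊢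
        generalize ∑ i : Fin n, 2 ^ ((i : ℕ) + 1) * (2 * (b + (n - 1 - i)) + 1) = X at ih ⊢
        simp only [Fin.val_zero, zero_add, add_tsub_cancel_right, tsub_zero]
        omega
    intro n
    have := aux n; omega
  unfold Blocks.lev
  rw [Fintype.prod_option]
  change (2 ^ s) ^ (2 * s + 1) *
    ∏ j : Fin J, (2 ^ (s * 2 ^ ((j : ℕ) + 1))) ^ (klev b J j + 1) ≤ _
  simp_rw [← pow_mul]
  rw [prod_pow_eq_pow_sum, ← pow_add]
  apply Nat.pow_le_pow_right (by norm_num)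
  have h2 : ∑ j : Fin J, s * 2 ^ ((j : ℕ) + 1) * (klev b J j + 1) ≤ s * (2 ^ J * (4 * b + 6)) := by
    simp_rw [mul_assoc]
    rw [← mul_sum]
    exact Nat.mul_le_mul_left _ (key J)
  rcases Nat.eq_zero_or_pos s with rfl | hs
  · simp
  · nlinarith

end SchurPrimes

namespace SchurPrimes
open Finset

/-- The reciprocal function. -/
noncomputable def rcp (p : ℕ) : ℝ := 1 / (p : ℝ)

lemma rcp_nonneg (p : ℕ) : 0 ≤ rcp p := by unfold rcp; positivity

lemma rcp_le_one (p : ℕ) : rcp p ≤ 1 := by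
  unfold rcp
  rcases Nat.eq_zero_or_pos p with rfl | h
  · simp
  · rw [div_le_one (by exact_mod_cast h)]; exact_mod_cast h

/-- Relative truncation errors of the blocks. -/
noncomputable def eps (b s J : ℕ) (i : Option (Fin J)) : ℝ :=
  i.elim (Real.exp 20 * s ^ 16 / 2 ^ s) fun j => Real.exp 24 / 16 ^ (b + (J - 1 - j))

lemma eps_nonneg (b s J : ℕ) (i : Option (Fin J)) : 0 ≤ eps b s J i := by
  rcases i with _ | j <;> simp only [eps, Option.elim] <;> positivity

/-- A bound for the product of the relative errors. -/
noncomputable def epsC : ℝ := Real.exp (1 + 2 * Real.exp 24)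

lemma one_le_epsC : 1 ≤ epsC := by
  unfold epsC; rw [Real.one_le_exp_iff]; positivity

lemma sum_eps_le (b s J : ℕ) :
    ∑ i, eps b s J i ≤ Real.exp 20 * s ^ 16 / 2 ^ s + 2 * Real.exp 24 / 16 ^ b := by
  rw [Fintype.sum_option]
  simp only [eps, Option.elim]
  refine add_le_add le_rfl ?_
  have h : ∑ j : Fin J, Real.exp 24 / 16 ^ (b + (J - 1 - (j : ℕ))) =
      Real.exp 24 / 16 ^ b * ∑ j ∈ range J, (1 / 16 : ℝ) ^ j := by
    rw [Fin.sum_univ_eq_sum_range (fun j => Real.exp 24 / 16 ^ (b + (J - 1 - j))) J,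
      ← sum_range_reflect (fun j => (1 / 16 : ℝ) ^ j), mul_sum]
    refine sum_congr rfl fun j _ => ?_
    rw [pow_add, one_div, inv_pow]; field_simp
  rw [h]
  have h2 : ∑ j ∈ range J, (1 / 16 : ℝ) ^ j ≤ 2 := by
    have := geom_sum_eq (x := (1 / 16 : ℝ)) (by norm_num) J
    rw [this]
    have : (0 : ℝ) < (1 / 16) ^ J := by positivity
    rw [div_le_iff_of_neg (by norm_num)]; linarith
  calc _ ≤ Real.exp 24 / 16 ^ b * 2 := by gcongr
    _ = _ := by ring

lemma prod_one_add_eps_le {b s J : ℕ} (hs : Real.exp 20 * (s : ℝ) ^ 16 / 2 ^ s ≤ 1)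
    (A : Finset (Option (Fin J))) : ∏ i ∈ A, (1 + eps b s J i) ≤ epsC := by
  calc _ ≤ ∏ i ∈ A, Real.exp (eps b s J i) := prod_le_prod
        (fun i _ => by linarith [eps_nonneg b s J i])
        fun i _ => by linarith [Real.add_one_le_exp (eps b s J i)]
    _ = Real.exp (∑ i ∈ A, eps b s J i) := (Real.exp_sum _ _).symm
    _ ≤ epsC := by
      unfold epsC
      rw [Real.exp_le_exp]
      refine (sum_le_sum_of_subset_of_nonneg (subset_univ A) fun i _ _ =>
        eps_nonneg b s J i).trans ((sum_eps_le b s J).trans ?_)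
      have : 2 * Real.exp 24 / 16 ^ b ≤ 2 * Real.exp 24 :=
        div_le_self (by positivity) (one_le_pow₀ (by norm_num))
      linarith

section
variable {W b s J : ℕ}

lemma sum_rcp_some (hs : 1 ≤ s) (j : Fin J) : ∑ p ∈ (blk W b s J).P (some j), rcp p ≤ 4 := by
  have := sum_inv_prm_block W (s * 2 ^ (j : ℕ)) (Nat.mul_pos hs (by positivity))
  simpa [blk, rcp, pow_succ, mul_comm, mul_left_comm] using this

lemma sum_rcp_none (hs : 1 ≤ s) :
    ∑ p ∈ (blk W b s J).P none, rcp p ≤ 5 + 4 * Real.log s := by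
  simpa [blk, rcp] using sum_inv_prm_start W s hs

lemma inv_vden_none (hs : 1 ≤ s) : 1 / vden W b s J none ≤ Real.exp 10 * (s : ℝ) ^ 8 :=
  inv_dens_le W s hs

lemma inv_vden_some (hs : 1 ≤ s) (j : Fin J) : 1 / vden W b s J (some j) ≤ Real.exp 8 := by
  have h1 := exp_neg_le_prod_prm ((blk W b s J).prime (some j))
  have h2 := sum_rcp_some (W := W) (b := b) hs j
  rw [div_le_iff₀ (vden_pos _ _ _ _ _), ← div_le_iff₀' (Real.exp_pos _), one_div, ← Real.exp_neg]
  refine le_trans (Real.exp_le_exp.mpr ?_) h1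
  simp only [rcp] at h2
  linarith

lemma vden_le_one (i : Option (Fin J)) : vden W b s J i ≤ 1 :=
  prod_le_one (fun p hp => (one_sub_inv_prime_mem ((blk W b s J).prime i p hp)).1.le)
    fun p hp => (one_sub_inv_prime_mem ((blk W b s J).prime i p hp)).2

lemma exp_mul_log (hs : 1 ≤ s) (k : ℕ) : Real.exp (k * Real.log s) = (s : ℝ) ^ k := by
  rw [Real.exp_nat_mul, Real.exp_log (by positivity)]

lemma lin_bin_le_eps (hs : 1 ≤ s) (i : Option (Fin J)) :
    lin ((blk W b s J).P i) (binC (kk b s J i + 1)) rcp ≤ eps b s J i * vden W b s J i := by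
  rw [← div_le_iff₀ (vden_pos _ _ _ _ _), div_eq_mul_one_div]
  have hn := lin_binC_nonneg (P := (blk W b s J).P i) (x := rcp) (fun p _ => rcp_nonneg p)
    (kk b s J i + 1)
  rcases i with _ | j
  · have h1 := lin_binC_le (P := (blk W b s J).P none) (x := rcp) (fun p _ => rcp_nonneg p)
      (l := 2) (by norm_num) (kk b s J none + 1)
    have h2 := sum_rcp_none (W := W) (b := b) (J := J) hs
    have h3 := inv_vden_none (W := W) (b := b) (J := J) hs
    have h4 : Real.exp (2 * ∑ p ∈ (blk W b s J).P none, rcp p) ≤ Real.exp 10 * (s : ℝ) ^ 8 := by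
      rw [← exp_mul_log hs, ← Real.exp_add, Real.exp_le_exp]; push_cast; linarith
    have h5 : lin ((blk W b s J).P none) (binC (kk b s J none + 1)) rcp ≤
        Real.exp 10 * (s : ℝ) ^ 8 / 2 ^ s := by
      refine h1.trans ?_
      gcongr
      · norm_num
      · show s ≤ 2 * s + 1; omega
    have e20 : Real.exp 20 = Real.exp 10 * Real.exp 10 := by rw [← Real.exp_add]; norm_num
    calc _ ≤ Real.exp 10 * (s : ℝ) ^ 8 / 2 ^ s * (Real.exp 10 * (s : ℝ) ^ 8) :=
          mul_le_mul h5 h3 (one_div_pos.mpr (vden_pos _ _ _ _ _)).le (by positivity)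
      _ = _ := by simp only [eps, Option.elim]; rw [e20]; ring
  · have h1 := lin_binC_le (P := (blk W b s J).P (some j)) (x := rcp) (fun p _ => rcp_nonneg p)
      (l := 4) (by norm_num) (kk b s J (some j) + 1)
    have h2 := sum_rcp_some (W := W) (b := b) hs j
    have h3 := inv_vden_some (W := W) (b := b) hs j
    have h4 : Real.exp (4 * ∑ p ∈ (blk W b s J).P (some j), rcp p) ≤ Real.exp 16 := by
      rw [Real.exp_le_exp]; linarith
    have h5 : lin ((blk W b s J).P (some j)) (binC (kk b s J (some j) + 1)) rcp ≤
        Real.exp 16 / 16 ^ (b + (J - 1 - j)) := by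
      refine h1.trans ?_
      have : (16 : ℝ) ^ (b + (J - 1 - (j : ℕ))) ≤ 4 ^ (kk b s J (some j) + 1) := by
        have e : (16 : ℝ) = 4 ^ 2 := by norm_num
        rw [e, ← pow_mul]
        exact pow_le_pow_right₀ (by norm_num) (Nat.le_succ _)
      gcongr
    have e24 : Real.exp 24 = Real.exp 16 * Real.exp 8 := by rw [← Real.exp_add]; norm_num
    calc _ ≤ Real.exp 16 / 16 ^ (b + (J - 1 - j)) * Real.exp 8 :=
          mul_le_mul h5 h3 (one_div_pos.mpr (vden_pos _ _ _ _ _)).le (by positivity)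
      _ = _ := by simp only [eps, Option.elim]; rw [e24]; ring

/-- Main term of a block. -/
noncomputable def smain (W b s J : ℕ) (i : Option (Fin J)) : ℝ :=
  lin ((blk W b s J).P i) (bonC (kk b s J i)) rcp

lemma vden_le_smain (i : Option (Fin J)) : vden W b s J i ≤ smain W b s J i :=
  le_lin_bonC (fun p _ => ⟨rcp_nonneg p, rcp_le_one p⟩) (even_kk b s J i)

lemma smain_le (hs : 1 ≤ s) (i : Option (Fin J)) :
    smain W b s J i ≤ (1 + eps b s J i) * vden W b s J i := by
  have h1 := lin_bonC_le (P := (blk W b s J).P i) (x := rcp)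
    (fun p _ => ⟨rcp_nonneg p, rcp_le_one p⟩) (even_kk b s J i)
  have h2 := lin_bin_le_eps (W := W) (b := b) hs i
  have h3 : ∏ p ∈ (blk W b s J).P i, (1 - rcp p) = vden W b s J i := rfl
  unfold smain; linarith

lemma smain_pos (i : Option (Fin J)) : 0 < smain W b s J i :=
  (vden_pos _ _ _ _ _).trans_le (vden_le_smain i)

/-- The untruncated coefficients. -/
noncomputable def cF (b s J : ℕ) (i : Option (Fin J)) : Finset ℕ → ℝ := bonC (kk b s J i)

/-- Trivial coefficients off the first block. -/
noncomputable def cT (J : ℕ) (c : Finset ℕ → ℝ) (i : Option (Fin J)) : Finset ℕ → ℝ :=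
  i.elim c fun _ => bonC 0

lemma adm_bonC (i : Option (Fin J)) {k : ℕ} (hk : k ≤ kk b s J i + 1) (D : Finset ℕ) :
    |bonC k D| ≤ 1 ∧ ((blk W b s J).K i < D.card → bonC k D = 0) := by
  refine ⟨abs_bonC_le _ _, fun h => ?_⟩
  rw [K_eq] at h
  unfold bonC; rw [if_neg (by omega)]

lemma adm_binC (i : Option (Fin J)) {k : ℕ} (hk : k ≤ kk b s J i + 1) (D : Finset ℕ) :
    |binC k D| ≤ 1 ∧ ((blk W b s J).K i < D.card → binC k D = 0) := by
  refine ⟨abs_binC_le _ _, fun h => ?_⟩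
  rw [K_eq] at h
  unfold binC; rw [if_neg (by omega)]

lemma adm_cF : (blk W b s J).Adm (cF b s J) := fun i D => adm_bonC i (Nat.le_succ _) D

lemma adm_cB (i : Option (Fin J)) :
    (blk W b s J).Adm (Function.update (cF b s J) i (binC (kk b s J i + 1))) := by
  intro j D
  rcases eq_or_ne j i with rfl | h
  · rw [Function.update_self]; exact adm_binC j le_rfl D
  · rw [Function.update_of_ne h]; exact adm_cF j D

lemma adm_cA : (blk W b s J).Adm (cT J (bonC (2 * s))) := by
  rintro (_ | j) D
  · exact adm_bonC none (Nat.le_succ _) D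
  · exact adm_bonC (some j) (Nat.zero_le _) D

lemma adm_cA' : (blk W b s J).Adm (cT J (binC (2 * s + 1))) := by
  rintro (_ | j) D
  · exact adm_binC none le_rfl D
  · exact adm_bonC (some j) (Nat.zero_le _) D

lemma wt_cT (c : Finset ℕ → ℝ) (x : ℕ → ℝ) :
    (blk W b s J).wt (cT J c) x = lin (prm W 0 (2 ^ s)) c x := by
  unfold Blocks.wt
  rw [Fintype.prod_option]
  simp only [cT, Option.elim, lin_bonC_zero, prod_const_one, mul_one]
  rfl

lemma rho_le_wt_cF (m : ℕ) :
    rho (prm W 0 (2 ^ (s * 2 ^ J))) m ≤ (blk W b s J).wt (cF b s J) (dv m) := by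
  unfold rho Blocks.wt
  rw [← prod_blk W b s J fun p => 1 - dv m p]
  exact prod_le_prod (fun i _ => prod_nonneg fun p _ => by linarith [(dv_mem m p).2])
    fun i _ => le_lin_bonC (fun p _ => dv_mem m p) (even_kk b s J i)

lemma wt_cF_sub_rho_le (m : ℕ) :
    (blk W b s J).wt (cF b s J) (dv m) - rho (prm W 0 (2 ^ (s * 2 ^ J))) m ≤
      ∑ i, (blk W b s J).wt (Function.update (cF b s J) i (binC (kk b s J i + 1))) (dv m) := by
  unfold rho
  rw [← prod_blk W b s J fun p => 1 - dv m p]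
  refine (prod_sub_prod_le univ _ _ (fun i => lin ((blk W b s J).P i)
    (binC (kk b s J i + 1)) (dv m)) fun i _ => ⟨prod_nonneg fun p _ => by
      linarith [(dv_mem m p).2], le_lin_bonC (fun p _ => dv_mem m p) (even_kk b s J i),
      lin_bonC_le (fun p _ => dv_mem m p) (even_kk b s J i)⟩).trans ?_
  refine sum_le_sum fun i _ => le_of_eq ?_
  unfold Blocks.wt
  rw [← mul_prod_erase univ _ (mem_univ i), Function.update_self]
  congr 1
  refine prod_congr rfl fun j hj => ?_
  rw [Function.update_of_ne (ne_of_mem_erase hj)]; rfl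

lemma prod_smain_le (hs : 1 ≤ s) (A : Finset (Option (Fin J)))
    (hs2 : Real.exp 20 * (s : ℝ) ^ 16 / 2 ^ s ≤ 1) :
    ∏ i ∈ A, smain W b s J i ≤ epsC * ∏ i ∈ A, vden W b s J i := by
  calc _ ≤ ∏ i ∈ A, ((1 + eps b s J i) * vden W b s J i) :=
        prod_le_prod (fun i _ => (smain_pos i).le) fun i _ => smain_le hs i
    _ ≤ _ := by
        rw [prod_mul_distrib]
        exact mul_le_mul_of_nonneg_right (prod_one_add_eps_le hs2 A)
          (prod_nonneg fun i _ => (vden_pos _ _ _ _ _).le)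

lemma wt_cB_rcp_le (hs : 1 ≤ s) (hs2 : Real.exp 20 * (s : ℝ) ^ 16 / 2 ^ s ≤ 1)
    (i : Option (Fin J)) :
    (blk W b s J).wt (Function.update (cF b s J) i (binC (kk b s J i + 1))) rcp ≤
      eps b s J i * epsC * ∏ j, vden W b s J j := by
  unfold Blocks.wt
  rw [← mul_prod_erase univ _ (mem_univ i), Function.update_self,
    ← mul_prod_erase univ (vden W b s J) (mem_univ i)]
  have h : ∏ j ∈ univ.erase i, lin ((blk W b s J).P j)
      (Function.update (cF b s J) i (binC (kk b s J i + 1)) j) rcp =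
      ∏ j ∈ univ.erase i, smain W b s J j := by
    refine prod_congr rfl fun j hj => ?_
    rw [Function.update_of_ne (ne_of_mem_erase hj)]; rfl
  rw [h]
  calc _ ≤ (eps b s J i * vden W b s J i) * (epsC * ∏ j ∈ univ.erase i, vden W b s J j) :=
        mul_le_mul (lin_bin_le_eps hs i) (prod_smain_le hs _ hs2)
          (prod_nonneg fun i _ => (smain_pos i).le)
          (mul_nonneg (eps_nonneg _ _ _ _) (vden_pos _ _ _ _ _).le)
    _ = _ := by ring

/-- The frequency coefficients of the fine blocks are small. -/
lemma wt_sup_le (hs : 1 ≤ s) (hs2 : Real.exp 20 * (s : ℝ) ^ 16 / 2 ^ s ≤ 1)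
    {Q : Option (Fin J) → Finset ℕ} (hQ : ∀ i, Q i ⊆ (blk W b s J).P i) {j₀ : Fin J}
    (hj : (Q (some j₀)).Nonempty) :
    |(blk W b s J).wt (Blocks.sup Q (cF b s J)) rcp| ≤
      Real.exp 27 * epsC * s ^ 12 / 2 ^ s * ∏ i, vden W b s J i := by
  have hfac : ∀ i, |lin ((blk W b s J).P i) (Blocks.sup Q (cF b s J) i) rcp| ≤
      (∏ p ∈ Q i, rcp p) * Real.exp (∑ p ∈ (blk W b s J).P i, rcp p) := fun i =>
    lin_sup_le (hQ i) (fun D => abs_bonC_le _ D) fun p _ => rcp_nonneg p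
  have hprod : ∀ A : Finset ℕ, ∏ p ∈ A, rcp p ≤ 1 := fun A =>
    prod_le_one (fun p _ => rcp_nonneg p) fun p _ => rcp_le_one p
  have hnone : |lin ((blk W b s J).P none) (Blocks.sup Q (cF b s J) none) rcp| ≤
      Real.exp 15 * s ^ 12 * vden W b s J none := by
    rw [← div_le_iff₀ (vden_pos _ _ _ _ _), div_eq_mul_one_div]
    have h1 : |lin ((blk W b s J).P none) (Blocks.sup Q (cF b s J) none) rcp| ≤
        Real.exp 5 * s ^ 4 := by
      refine (hfac none).trans ((mul_le_of_le_one_left (Real.exp_pos _).le (hprod _)).trans ?_)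
      rw [← exp_mul_log hs, ← Real.exp_add, Real.exp_le_exp]
      have := sum_rcp_none (W := W) (b := b) (J := J) hs
      push_cast; linarith
    have e : Real.exp 15 = Real.exp 5 * Real.exp 10 := by rw [← Real.exp_add]; norm_num
    calc _ ≤ (Real.exp 5 * (s : ℝ) ^ 4) * (Real.exp 10 * s ^ 8) :=
          mul_le_mul h1 (inv_vden_none hs) (one_div_pos.mpr (vden_pos _ _ _ _ _)).le
            (by positivity)
      _ = _ := by rw [e]; ring
  have hne : ∀ j : Fin J, (Q (some j)).Nonempty →
      |lin ((blk W b s J).P (some j)) (Blocks.sup Q (cF b s J) (some j)) rcp| ≤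
      Real.exp 12 / 2 ^ s * vden W b s J (some j) := by
    rintro j ⟨p, hp⟩
    rw [← div_le_iff₀ (vden_pos _ _ _ _ _), div_eq_mul_one_div]
    have h1 : |lin ((blk W b s J).P (some j)) (Blocks.sup Q (cF b s J) (some j)) rcp| ≤
        1 / 2 ^ s * Real.exp 4 := by
      refine (hfac _).trans (mul_le_mul ?_ (Real.exp_le_exp.mpr (sum_rcp_some hs j))
        (Real.exp_pos _).le (by positivity))
      rw [← mul_prod_erase _ _ hp]
      refine (mul_le_of_le_one_right (rcp_nonneg p) (hprod _)).trans ?_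
      have hp2 : p ∈ prm W (2 ^ (s * 2 ^ (j : ℕ))) (2 ^ (s * 2 ^ (j + 1 : ℕ))) := hQ _ hp
      have hp3 : (2 : ℝ) ^ s ≤ p := by
        have : 2 ^ s ≤ p := (Nat.pow_le_pow_right (by norm_num)
          (Nat.le_mul_of_pos_right _ (by positivity))).trans (mem_prm.mp hp2).1.1.le
        exact_mod_cast this
      unfold rcp
      gcongr
    have e : Real.exp 12 = Real.exp 4 * Real.exp 8 := by rw [← Real.exp_add]; norm_num
    calc _ ≤ (1 / 2 ^ s * Real.exp 4) * Real.exp 8 :=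
          mul_le_mul h1 (inv_vden_some hs j) (one_div_pos.mpr (vden_pos _ _ _ _ _)).le
            (by positivity)
      _ = _ := by rw [e]; ring
  have hs3 : Real.exp 12 / 2 ^ s ≤ 1 := by
    refine le_trans ?_ hs2
    have h1 : (1 : ℝ) ≤ (s : ℝ) ^ 16 := one_le_pow₀ (by exact_mod_cast hs)
    have h2 : Real.exp 12 ≤ Real.exp 20 := Real.exp_le_exp.mpr (by norm_num)
    have h3 := Real.exp_pos 20
    gcongr
    nlinarith
  have hall : ∀ j : Fin J,
      |lin ((blk W b s J).P (some j)) (Blocks.sup Q (cF b s J) (some j)) rcp| ≤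
      (1 + eps b s J (some j)) * vden W b s J (some j) := by
    intro j
    have he := eps_nonneg b s J (some j)
    have hv := vden_pos W b s J (some j)
    rcases (Q (some j)).eq_empty_or_nonempty with h | h
    · have h1 : Blocks.sup Q (cF b s J) (some j) = cF b s J (some j) := by
        funext D; simp [Blocks.sup, h]
      rw [h1]
      have : lin ((blk W b s J).P (some j)) (cF b s J (some j)) rcp = smain W b s J (some j) := rfl
      rw [this, abs_of_pos (smain_pos _)]
      exact smain_le hs _
    · refine (hne j h).trans (mul_le_mul_of_nonneg_right ?_ hv.le)
      linarith
  unfold Blocks.wt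
  rw [abs_prod, Fintype.prod_option, Fintype.prod_option, ← mul_prod_erase univ _ (mem_univ j₀),
    ← mul_prod_erase univ (fun j => vden W b s J (some j)) (mem_univ j₀)]
  have hrest : ∏ j ∈ univ.erase j₀,
      |lin ((blk W b s J).P (some j)) (Blocks.sup Q (cF b s J) (some j)) rcp| ≤
      epsC * ∏ j ∈ univ.erase j₀, vden W b s J (some j) := by
    calc _ ≤ ∏ j ∈ univ.erase j₀, ((1 + eps b s J (some j)) * vden W b s J (some j)) :=
          prod_le_prod (fun _ _ => abs_nonneg _) fun j _ => hall j
      _ ≤ _ := by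
          rw [prod_mul_distrib]
          refine mul_le_mul_of_nonneg_right ?_ (prod_nonneg fun i _ => (vden_pos _ _ _ _ _).le)
          have := prod_one_add_eps_le (b := b) hs2
            ((univ.erase j₀).map ⟨some, Option.some_injective _⟩)
          rwa [prod_map] at this
  have e : Real.exp 27 = Real.exp 15 * Real.exp 12 := by rw [← Real.exp_add]; norm_num
  have hv0 := vden_pos W b s J none
  have hv1 := vden_pos W b s J (some j₀)
  calc _ ≤ (Real.exp 15 * s ^ 12 * vden W b s J none) *
        ((Real.exp 12 / 2 ^ s * vden W b s J (some j₀)) *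
          (epsC * ∏ j ∈ univ.erase j₀, vden W b s J (some j))) := by
        refine mul_le_mul hnone (mul_le_mul (hne _ hj) hrest (prod_nonneg fun _ _ => abs_nonneg _)
          (by positivity)) (by positivity) (by positivity)
    _ = _ := by rw [e]; ring

end
end SchurPrimes

namespace SchurPrimes
open Finset

/-- A constant in the remainder estimates. -/
noncomputable def levC : ℝ := Real.exp 10 * 40320

lemma levC_pos : 0 < levC := by unfold levC; positivity

section
variable {W b s J : ℕ}

lemma lev_div_dens_le (hs : 1 ≤ s) (hJ : 3 * s ≤ 2 ^ J) {N : ℕ}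
    (hN : (2 ^ (s * 2 ^ J)) ^ (12 * b + 28) ≤ N) :
    (J + 1) * (((blk W b s J).lev : ℝ) ^ 3 / dens W (2 ^ (s * 2 ^ J))) ≤ levC / 2 ^ s * N := by
  set y := s * 2 ^ J with hy
  set z : ℝ := 2 ^ y with hz
  have hy1 : 1 ≤ y := Nat.mul_pos hs (by positivity)
  have hz1 : 1 ≤ z := one_le_pow₀ (by norm_num)
  have h1 : ((blk W b s J).lev : ℝ) ^ 3 ≤ z ^ (12 * b + 24) := by
    have : ((blk W b s J).lev : ℝ) ≤ z ^ (4 * b + 8) := by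
      rw [hz]; exact_mod_cast lev_le W b s J hJ
    calc _ ≤ (z ^ (4 * b + 8)) ^ 3 := by gcongr
      _ = _ := by rw [← pow_mul]; congr 1; ring
  have h2 : 1 / dens W (2 ^ y) ≤ levC * z ^ 2 := by
    refine (inv_dens_le W y hy1).trans ?_
    unfold levC
    rw [mul_assoc]
    refine mul_le_mul_of_nonneg_left ?_ (Real.exp_pos _).le
    have h3 := Real.pow_div_factorial_le_exp (y : ℝ) (by positivity) 8
    have h4 : Real.exp y ≤ z ^ 2 := by
      have e1 : Real.exp y = Real.exp 1 ^ y := by rw [← Real.exp_nat_mul, mul_one]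
      have e2 : z ^ 2 = (2 ^ 2) ^ y := by rw [hz, ← pow_mul, ← pow_mul, mul_comm]
      rw [e1, e2]
      refine pow_le_pow_left₀ (Real.exp_pos _).le ?_ _
      have := Real.exp_one_lt_d9; norm_num; linarith
    have h5 : ((Nat.factorial 8 : ℕ) : ℝ) = 40320 := by norm_num [Nat.factorial]
    rw [h5, div_le_iff₀ (by norm_num)] at h3
    linarith
  have h3 : (J : ℝ) + 1 ≤ z := by
    have a1 : J + 1 ≤ 2 ^ J := Nat.lt_two_pow_self
    have a2 : 2 ^ J ≤ 2 ^ y :=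
      Nat.pow_le_pow_right (by norm_num) (Nat.lt_two_pow_self.le.trans (Nat.le_mul_of_pos_left _ hs))
    rw [hz]; exact_mod_cast a1.trans a2
  have h4 : (2 : ℝ) ^ s ≤ z :=
    pow_le_pow_right₀ (by norm_num) (Nat.le_mul_of_pos_right _ (by positivity))
  have h5 : z ^ (12 * b + 28) ≤ N := by rw [hz]; exact_mod_cast hN
  have hd := dens_pos W (2 ^ y)
  rw [div_mul_eq_mul_div, le_div_iff₀ (by positivity)]
  calc (J + 1) * (((blk W b s J).lev : ℝ) ^ 3 / dens W (2 ^ y)) * 2 ^ s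
      = (J + 1) * (((blk W b s J).lev : ℝ) ^ 3 * (1 / dens W (2 ^ y))) * 2 ^ s := by ring
    _ ≤ z * (z ^ (12 * b + 24) * (levC * z ^ 2)) * z := by
        have := levC_pos
        gcongr
    _ = levC * z ^ (12 * b + 28) := by ring
    _ ≤ levC * N := mul_le_mul_of_nonneg_left h5 levC_pos.le

/-- Local densities of the fine blocks. -/
noncomputable def fineC (W b s J : ℕ) : ℝ :=
  ∏ j : Fin J, smain W b s J (some j) / vden W b s J (some j)

lemma fineC_pos : 0 < fineC W b s J :=
  prod_pos fun _ _ => div_pos (smain_pos _) (vden_pos _ _ _ _ _)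

lemma fineC_le (hs : 1 ≤ s) (hs2 : Real.exp 20 * (s : ℝ) ^ 16 / 2 ^ s ≤ 1) :
    fineC W b s J ≤ epsC := by
  have := prod_one_add_eps_le (b := b) hs2
    ((univ : Finset (Fin J)).map ⟨some, Option.some_injective _⟩)
  rw [prod_map] at this
  refine le_trans (prod_le_prod (fun j _ => (div_pos (smain_pos _) (vden_pos _ _ _ _ _)).le)
    fun j _ => ?_) this
  exact (div_le_iff₀ (vden_pos _ _ _ _ _)).mpr (smain_le hs _)

lemma fineC_div : fineC W b s J / vden W b s J none =
    (∏ j : Fin J, smain W b s J (some j)) / dens W (2 ^ (s * 2 ^ J)) := by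
  rw [← prod_vden W b s J, Fintype.prod_option]
  unfold fineC
  rw [prod_div_distrib, div_div, mul_comm]

lemma dens_le_vden_none : dens W (2 ^ (s * 2 ^ J)) ≤ vden W b s J none := by
  rw [← prod_vden W b s J, Fintype.prod_option]
  exact mul_le_of_le_one_right (vden_pos _ _ _ _ _).le
    (prod_le_one (fun i _ => (vden_pos _ _ _ _ _).le) fun i _ => vden_le_one _)

/-- The periodic model of the sieve weight. -/
noncomputable def perM (W b s J n : ℕ) : ℝ :=
  fineC W b s J / vden W b s J none * rho (prm W 0 (2 ^ s)) (W * n + 1)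

lemma perM_mem (hs : 1 ≤ s) (hs2 : Real.exp 20 * (s : ℝ) ^ 16 / 2 ^ s ≤ 1) (n : ℕ) :
    0 ≤ perM W b s J n ∧ perM W b s J n ≤ epsC * (Real.exp 10 * s ^ 8) := by
  have h1 := fineC_pos (W := W) (b := b) (s := s) (J := J)
  have h2 := vden_pos W b s J none
  refine ⟨mul_nonneg (by positivity) (rho_nonneg _ _), ?_⟩
  unfold perM
  refine (mul_le_of_le_one_right (by positivity) (rho_le_one _ _)).trans ?_
  rw [div_eq_mul_one_div]
  exact mul_le_mul (fineC_le hs hs2) (inv_vden_none hs) (by positivity)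
    (by linarith [one_le_epsC])

lemma perM_add {M : ℕ} (hM : ∀ p, p.Prime → p ≤ 2 ^ s → p ∣ M) (n : ℕ) :
    perM W b s J (n + M) = perM W b s J n := by
  unfold perM rho
  congr 1
  refine prod_congr rfl fun p hp => ?_
  have hp' := mem_prm.mp hp
  have : p ∣ W * (n + M) + 1 ↔ p ∣ W * n + 1 := by
    have e : W * (n + M) + 1 = (W * n + 1) + W * M := by ring
    rw [e]
    exact (Nat.dvd_add_left ((hM p hp'.2.1 hp'.1.2).mul_left W))
  simp [dv, this]

/-- The normalized sieve weight. -/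
noncomputable def sieveW (W b s J n : ℕ) : ℝ :=
  (blk W b s J).wt (cF b s J) (dv (W * n + 1)) / dens W (2 ^ (s * 2 ^ J))

lemma rho_div_le_sieveW (n : ℕ) :
    rho (prm W 0 (2 ^ (s * 2 ^ J))) (W * n + 1) / dens W (2 ^ (s * 2 ^ J)) ≤ sieveW W b s J n :=
  div_le_div_of_nonneg_right (rho_le_wt_cF _) (dens_pos _ _).le

lemma lev_le_cube : ((blk W b s J).lev : ℝ) ≤ ((blk W b s J).lev : ℝ) ^ 3 :=
  le_self_pow₀ (by exact_mod_cast Blocks.one_le_lev) (by norm_num)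

lemma sum_sieveW_le (hs : 1 ≤ s) (hs2 : Real.exp 20 * (s : ℝ) ^ 16 / 2 ^ s ≤ 1)
    (hJ : 3 * s ≤ 2 ^ J) {N : ℕ} (hN : (2 ^ (s * 2 ^ J)) ^ (12 * b + 28) ≤ N) :
    ∑ n ∈ range N, sieveW W b s J n ≤ (epsC + levC) * N := by
  have hd := dens_pos W (2 ^ (s * 2 ^ J))
  have h1 := (abs_le.mp (Blocks.mean (B := blk W b s J) adm_cF N)).2
  have h2 := prod_smain_le (W := W) (b := b) (J := J) hs univ hs2
  rw [prod_vden] at h2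
  have h3 : (blk W b s J).wt (cF b s J) (fun p => 1 / (p : ℝ)) = ∏ i, smain W b s J i := rfl
  rw [h3] at h1
  have h4 := lev_div_dens_le (W := W) hs hJ hN
  have h5 : levC / 2 ^ s * N ≤ levC * N := by
    gcongr
    exact div_le_self levC_pos.le (one_le_pow₀ (by norm_num))
  have h6 : ((blk W b s J).lev : ℝ) / dens W (2 ^ (s * 2 ^ J)) ≤ levC * N := by
    refine le_trans ?_ (h4.trans h5)
    refine le_trans (div_le_div_of_nonneg_right lev_le_cube hd.le) ?_
    refine le_mul_of_one_le_left (by positivity) ?_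
    have : (0 : ℝ) ≤ J := by positivity
    linarith
  unfold sieveW
  rw [← sum_div]
  calc _ ≤ (N * (epsC * dens W (2 ^ (s * 2 ^ J))) + (blk W b s J).lev) /
        dens W (2 ^ (s * 2 ^ J)) := by
        gcongr
        have : (N : ℝ) * ∏ i, smain W b s J i ≤ N * (epsC * dens W (2 ^ (s * 2 ^ J))) := by gcongr
        linarith
    _ = epsC * N + (blk W b s J).lev / dens W (2 ^ (s * 2 ^ J)) := by field_simp
    _ ≤ _ := by linarith

lemma sum_sieveW_sub_le (hs : 1 ≤ s) (hs2 : Real.exp 20 * (s : ℝ) ^ 16 / 2 ^ s ≤ 1)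
    (hJ : 3 * s ≤ 2 ^ J) {N : ℕ} (hN : (2 ^ (s * 2 ^ J)) ^ (12 * b + 28) ≤ N) :
    ∑ n ∈ range N, (sieveW W b s J n -
      rho (prm W 0 (2 ^ (s * 2 ^ J))) (W * n + 1) / dens W (2 ^ (s * 2 ^ J))) ≤
      (epsC * (Real.exp 20 * s ^ 16 / 2 ^ s + 2 * Real.exp 24 / 16 ^ b) + levC / 2 ^ s) * N := by
  have hd := dens_pos W (2 ^ (s * 2 ^ J))
  have h4 := lev_div_dens_le (W := W) hs hJ hN
  have key : ∑ n ∈ range N, ((blk W b s J).wt (cF b s J) (dv (W * n + 1)) -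
      rho (prm W 0 (2 ^ (s * 2 ^ J))) (W * n + 1)) ≤
      ∑ i, (N * (eps b s J i * epsC * dens W (2 ^ (s * 2 ^ J))) + (blk W b s J).lev) := by
    refine (sum_le_sum fun n _ => wt_cF_sub_rho_le _).trans ?_
    rw [sum_comm]
    refine sum_le_sum fun i _ => ?_
    have h1 := (abs_le.mp (Blocks.mean (B := blk W b s J) (adm_cB i) N)).2
    have h2 := wt_cB_rcp_le (W := W) (b := b) hs hs2 i
    rw [prod_vden] at h2
    have h3 : (N : ℝ) * (blk W b s J).wt (Function.update (cF b s J) i (binC (kk b s J i + 1)))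
        rcp ≤ N * (eps b s J i * epsC * dens W (2 ^ (s * 2 ^ J))) := by gcongr
    change _ - (N : ℝ) * (blk W b s J).wt (Function.update (cF b s J) i (binC (kk b s J i + 1)))
        rcp ≤ _ at h1
    linarith
  unfold sieveW
  simp_rw [← sub_div]
  rw [← sum_div]
  refine (div_le_div_of_nonneg_right key hd.le).trans ?_
  rw [sum_add_distrib, sum_const, card_univ, Fintype.card_option, Fintype.card_fin, nsmul_eq_mul,
    ← mul_sum, ← sum_mul, ← sum_mul]
  have h5 := sum_eps_le b s J
  have h6 : ((J + 1 : ℕ) : ℝ) * (blk W b s J).lev / dens W (2 ^ (s * 2 ^ J)) ≤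
      levC / 2 ^ s * N := by
    refine le_trans ?_ h4
    push_cast
    rw [mul_div_assoc]
    gcongr
    exact lev_le_cube
  have h7 := one_le_epsC
  calc _ = N * ((∑ i, eps b s J i) * epsC) +
        ((J + 1 : ℕ) : ℝ) * (blk W b s J).lev / dens W (2 ^ (s * 2 ^ J)) := by field_simp
    _ ≤ N * ((Real.exp 20 * s ^ 16 / 2 ^ s + 2 * Real.exp 24 / 16 ^ b) * epsC) +
        levC / 2 ^ s * N := by gcongr
    _ = _ := by ring

lemma norm_main_le (hs : 1 ≤ s) (hs2 : Real.exp 20 * (s : ℝ) ^ 16 / 2 ^ s ≤ 1)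
    {Q : Option (Fin J) → Finset ℕ} (hQ : ∀ i, Q i ⊆ (blk W b s J).P i) :
    |(blk W b s J).wt (Blocks.sup Q (cF b s J)) rcp / dens W (2 ^ (s * 2 ^ J)) -
      fineC W b s J / vden W b s J none *
        (blk W b s J).wt (Blocks.sup Q (cT J (bonC (2 * s)))) rcp| ≤
      Real.exp 27 * epsC * s ^ 12 / 2 ^ s := by
  have hd := dens_pos W (2 ^ (s * 2 ^ J))
  have hC := one_le_epsC
  by_cases h : ∀ j, Q (some j) = ∅
  · have h1 : (blk W b s J).wt (Blocks.sup Q (cF b s J)) rcp =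
        lin ((blk W b s J).P none) (Blocks.sup Q (cF b s J) none) rcp *
          ∏ j : Fin J, smain W b s J (some j) := by
      unfold Blocks.wt
      rw [Fintype.prod_option]
      congr 1
      refine prod_congr rfl fun j _ => ?_
      have : Blocks.sup Q (cF b s J) (some j) = cF b s J (some j) := by
        funext D; simp [Blocks.sup, h j]
      rw [this]; rfl
    have h2 : (blk W b s J).wt (Blocks.sup Q (cT J (bonC (2 * s)))) rcp =
        lin ((blk W b s J).P none) (Blocks.sup Q (cF b s J) none) rcp := by
      unfold Blocks.wt
      rw [Fintype.prod_option]
      have : ∀ j : Fin J, lin ((blk W b s J).P (some j))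
          (Blocks.sup Q (cT J (bonC (2 * s))) (some j)) rcp = 1 := by
        intro j
        have : Blocks.sup Q (cT J (bonC (2 * s))) (some j) = bonC 0 := by
          funext D; simp [Blocks.sup, h j, cT]
        rw [this, lin_bonC_zero]
      simp only [this, prod_const_one, mul_one]
      rfl
    rw [h1, h2, fineC_div, mul_div_assoc, mul_comm, sub_self, abs_zero]
    positivity
  · push Not at h
    obtain ⟨j₀, hj⟩ := h
    have h2 : (blk W b s J).wt (Blocks.sup Q (cT J (bonC (2 * s)))) rcp = 0 := by
      unfold Blocks.wt
      refine prod_eq_zero (mem_univ (some j₀)) ?_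
      unfold lin
      refine sum_eq_zero fun D _ => ?_
      have : Blocks.sup Q (cT J (bonC (2 * s))) (some j₀) D = 0 := by
        simp only [Blocks.sup, cT, Option.elim]
        split_ifs with hD
        · obtain ⟨p, hp⟩ := hj
          have : 0 < D.card := card_pos.mpr ⟨p, hD hp⟩
          unfold bonC; rw [if_neg (by omega)]
        · rfl
      rw [this, zero_mul]
    rw [h2, mul_zero, sub_zero, abs_div, abs_of_pos hd, div_le_iff₀ hd, ← prod_vden W b s J]
    exact wt_sup_le hs hs2 hQ hj

lemma sum_sub_rho_le (hs : 1 ≤ s) (N : ℕ) :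
    ∑ n ∈ range N, ((blk W b s J).wt (cT J (bonC (2 * s))) (dv (W * n + 1)) -
      rho (prm W 0 (2 ^ s)) (W * n + 1)) ≤
      N * (Real.exp 20 * s ^ 16 / 2 ^ s * vden W b s J none) + (blk W b s J).lev := by
  have h1 := (abs_le.mp (Blocks.mean (B := blk W b s J) (adm_cA' (J := J) (b := b)) N)).2
  have h2 := lin_bin_le_eps (W := W) (b := b) (J := J) hs none
  change _ - (N : ℝ) * (blk W b s J).wt (cT J (binC (2 * s + 1))) rcp ≤ _ at h1
  rw [wt_cT] at h1
  change lin (prm W 0 (2 ^ s)) (binC (2 * s + 1)) rcp ≤ _ at h2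
  have h3 : (N : ℝ) * lin (prm W 0 (2 ^ s)) (binC (2 * s + 1)) rcp ≤
      N * (Real.exp 20 * s ^ 16 / 2 ^ s * vden W b s J none) := by
    refine mul_le_mul_of_nonneg_left h2 (by positivity)
  refine le_trans (sum_le_sum fun n _ => ?_) (by linarith : ∑ n ∈ range N,
    (blk W b s J).wt (cT J (binC (2 * s + 1))) (dv (W * n + 1)) ≤ _)
  rw [wt_cT, wt_cT]
  have := lin_bonC_le (P := prm W 0 (2 ^ s)) (fun p _ => dv_mem (W * n + 1) p)
    (even_two_mul s)
  unfold rho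
  linarith

lemma fourier_sieveW_le (hs : 1 ≤ s) (hs2 : Real.exp 20 * (s : ℝ) ^ 16 / 2 ^ s ≤ 1)
    (hJ : 3 * s ≤ 2 ^ J) {N : ℕ} (hN : (2 ^ (s * 2 ^ J)) ^ (12 * b + 28) ≤ N) (θ : ℝ) :
    ‖∑ n ∈ range N, ((sieveW W b s J n - perM W b s J n : ℝ) : ℂ) * ex (θ * n)‖ ≤
      (Real.exp 27 * epsC * s ^ 12 / 2 ^ s + epsC * (Real.exp 20 * s ^ 16 / 2 ^ s) +
        3 * epsC * levC / 2 ^ s) * N := by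
  obtain ⟨Q, hQ, κ, hκ, hF⟩ := Blocks.fourier (B := blk W b s J) N θ
  set V := dens W (2 ^ (s * 2 ^ J)) with hV
  set V0 := vden W b s J none with hV0
  set E := fineC W b s J with hE
  set L : ℝ := ((blk W b s J).lev : ℝ) ^ 3 with hL
  have hd : 0 < V := dens_pos W _
  have hd0 : 0 < V0 := vden_pos _ _ _ _ _
  have hdd : V ≤ V0 := dens_le_vden_none
  have hE0 : 0 < E := fineC_pos
  have hE1 : E ≤ epsC := fineC_le hs hs2
  have hL0 : 0 ≤ L := by positivity
  have hC := one_le_epsC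
  have hF1 := hF _ adm_cF
  have hF2 := hF _ (adm_cA (J := J) (b := b))
  set SF : ℂ := ∑ n ∈ range N, ((blk W b s J).wt (cF b s J) (dv (W * n + 1)) : ℂ) * ex (θ * n)
  set SA : ℂ := ∑ n ∈ range N,
    ((blk W b s J).wt (cT J (bonC (2 * s))) (dv (W * n + 1)) : ℂ) * ex (θ * n)
  set SD : ℂ := ∑ n ∈ range N, (((blk W b s J).wt (cT J (bonC (2 * s))) (dv (W * n + 1)) -
      rho (prm W 0 (2 ^ s)) (W * n + 1) : ℝ) : ℂ) * ex (θ * n) with hSD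
  change ‖SF - κ * ((blk W b s J).wt (Blocks.sup Q (cF b s J)) rcp : ℂ)‖ ≤ L at hF1
  change ‖SA - κ * ((blk W b s J).wt (Blocks.sup Q (cT J (bonC (2 * s)))) rcp : ℂ)‖ ≤ L at hF2
  set w1 := (blk W b s J).wt (Blocks.sup Q (cF b s J)) rcp
  set w2 := (blk W b s J).wt (Blocks.sup Q (cT J (bonC (2 * s)))) rcp
  have hmain : |w1 / V - E / V0 * w2| ≤ Real.exp 27 * epsC * s ^ 12 / 2 ^ s :=
    norm_main_le hs hs2 hQ
  have hSDle : ‖SD‖ ≤ N * (Real.exp 20 * s ^ 16 / 2 ^ s * V0) + L := by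
    refine (norm_sum_le _ _).trans ?_
    refine le_trans (sum_le_sum fun n _ => ?_)
      ((sum_sub_rho_le (W := W) (b := b) (J := J) hs N).trans ?_)
    · rw [norm_mul, norm_ex, mul_one, Complex.norm_real, Real.norm_of_nonneg]
      rw [wt_cT, sub_nonneg]
      exact le_lin_bonC (fun p _ => dv_mem _ p) (even_two_mul s)
    · have := lev_le_cube (W := W) (b := b) (s := s) (J := J)
      linarith
  have hdecomp : ∑ n ∈ range N, ((sieveW W b s J n - perM W b s J n : ℝ) : ℂ) * ex (θ * n) =
      (1 / V : ℝ) * (SF - κ * w1) - (E / V0 : ℝ) * (SA - κ * w2) + (E / V0 : ℝ) * SD +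
        κ * (w1 / V - E / V0 * w2 : ℝ) := by
    have e1 : ∑ n ∈ range N, ((sieveW W b s J n - perM W b s J n : ℝ) : ℂ) * ex (θ * n) =
        (1 / V : ℝ) * SF - (E / V0 : ℝ) * SA + (E / V0 : ℝ) * SD := by
      simp only [SF, SA, SD]
      rw [mul_sum, mul_sum, mul_sum, ← sum_sub_distrib, ← sum_add_distrib]
      refine sum_congr rfl fun n _ => ?_
      simp only [sieveW, perM, ← hV, ← hV0, ← hE]
      push_cast
      ring
    rw [e1]; push_cast; ring
  have hLV : L / V ≤ levC / 2 ^ s * N := by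
    refine le_trans ?_ (lev_div_dens_le (W := W) hs hJ hN)
    refine le_mul_of_one_le_left (by positivity) ?_
    have : (0 : ℝ) ≤ J := by positivity
    linarith
  have hEV : E / V0 ≤ epsC / V := by gcongr
  have hEL : E / V0 * L ≤ epsC * (L / V) := by
    calc _ ≤ epsC / V * L := by gcongr
      _ = _ := by ring
  have n1 : ‖((1 / V : ℝ) : ℂ) * (SF - κ * w1)‖ ≤ L / V := by
    rw [norm_mul, Complex.norm_real, Real.norm_of_nonneg (by positivity)]
    calc _ ≤ 1 / V * L := by gcongr
      _ = _ := by ring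
  have n2 : ‖((E / V0 : ℝ) : ℂ) * (SA - κ * w2)‖ ≤ E / V0 * L := by
    rw [norm_mul, Complex.norm_real, Real.norm_of_nonneg (by positivity)]
    gcongr
  have n3 : ‖((E / V0 : ℝ) : ℂ) * SD‖ ≤ epsC * (Real.exp 20 * s ^ 16 / 2 ^ s) * N + E / V0 * L := by
    rw [norm_mul, Complex.norm_real, Real.norm_of_nonneg (by positivity)]
    calc _ ≤ E / V0 * (N * (Real.exp 20 * s ^ 16 / 2 ^ s * V0) + L) := by gcongr
      _ = E * (Real.exp 20 * s ^ 16 / 2 ^ s) * N + E / V0 * L := by field_simp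
      _ ≤ _ := by gcongr
  have n4 : ‖κ * ((w1 / V - E / V0 * w2 : ℝ) : ℂ)‖ ≤
      N * (Real.exp 27 * epsC * s ^ 12 / 2 ^ s) := by
    rw [norm_mul, Complex.norm_real, Real.norm_eq_abs]
    gcongr
  rw [hdecomp]
  have hfin : L / V + 2 * (E / V0 * L) ≤ 3 * epsC * levC / 2 ^ s * N := by
    have : epsC * (L / V) ≤ epsC * (levC / 2 ^ s * N) := by gcongr
    have h3 : 0 ≤ levC / 2 ^ s * N := by have := levC_pos; positivity
    calc _ ≤ levC / 2 ^ s * N + 2 * (epsC * (levC / 2 ^ s * N)) := by linarith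
      _ ≤ epsC * (levC / 2 ^ s * N) + 2 * (epsC * (levC / 2 ^ s * N)) := by nlinarith
      _ = _ := by ring
  refine (norm_add_le _ _).trans ?_
  have t1 := norm_add_le (((1 / V : ℝ) : ℂ) * (SF - κ * w1) - ((E / V0 : ℝ) : ℂ) * (SA - κ * w2))
    (((E / V0 : ℝ) : ℂ) * SD)
  have t2 := norm_sub_le (((1 / V : ℝ) : ℂ) * (SF - κ * w1)) (((E / V0 : ℝ) : ℂ) * (SA - κ * w2))
  have : (Real.exp 27 * epsC * s ^ 12 / 2 ^ s + epsC * (Real.exp 20 * s ^ 16 / 2 ^ s) +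
        3 * epsC * levC / 2 ^ s) * N = N * (Real.exp 27 * epsC * s ^ 12 / 2 ^ s) +
        epsC * (Real.exp 20 * s ^ 16 / 2 ^ s) * N + 3 * epsC * levC / 2 ^ s * N := by ring
  rw [this]
  linarith

end

/-- Existence of a sieve majorant with a periodic model. -/
theorem sieve_exists : ∃ C : ℝ, 1 ≤ C ∧ ∃ s₀ : ℕ, 1 ≤ s₀ ∧ ∀ W b s J : ℕ, s₀ ≤ s → 3 * s ≤ 2 ^ J →
    ∃ ν a : ℕ → ℝ, (∀ n, 0 ≤ a n ∧ a n ≤ C * s ^ 8) ∧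
      (∀ M, (∀ p, p.Prime → p ≤ 2 ^ s → p ∣ M) → ∀ n, a (n + M) = a n) ∧
      (∀ n, rho (prm W 0 (2 ^ (s * 2 ^ J))) (W * n + 1) / dens W (2 ^ (s * 2 ^ J)) ≤ ν n) ∧
      ∀ N : ℕ, (2 ^ (s * 2 ^ J)) ^ (12 * b + 28) ≤ N →
        (∀ θ, ‖∑ n ∈ range N, ((ν n - a n : ℝ) : ℂ) * ex (θ * n)‖ ≤ C * (s ^ 16 / 2 ^ s) * N) ∧
        ∑ n ∈ range N, ν n ≤ C * N ∧
        ∑ n ∈ range N, (ν n - rho (prm W 0 (2 ^ (s * 2 ^ J))) (W * n + 1) /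
          dens W (2 ^ (s * 2 ^ J))) ≤ C * (1 / 16 ^ b + s ^ 16 / 2 ^ s) * N := by
  have h1 := one_le_epsC
  have h2 := levC_pos
  set C : ℝ := epsC * (Real.exp 27 + Real.exp 20 + 2 * Real.exp 24 + Real.exp 10 + 4 * levC + 1)
    with hC
  have hC1 : 1 ≤ C := by
    rw [hC]
    have := mul_pos (by linarith : 0 < epsC) (Real.exp_pos 27)
    have := mul_pos (by linarith : 0 < epsC) (Real.exp_pos 24)
    have := mul_pos (by linarith : 0 < epsC) (Real.exp_pos 20)
    have := mul_pos (by linarith : 0 < epsC) (Real.exp_pos 10)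
    have := mul_pos (by linarith : 0 < epsC) h2
    linarith
  have hlim := tendsto_pow_const_div_const_pow_of_one_lt 16 (r := (2 : ℝ)) (by norm_num)
  obtain ⟨s₁, hs₁⟩ := Filter.eventually_atTop.mp
    (hlim.eventually_le_const (u := (Real.exp 20)⁻¹) (by positivity))
  refine ⟨C, hC1, s₁ + 1, by omega, fun W b s J hs hJ => ?_⟩
  have hs1 : 1 ≤ s := by omega
  have hs2 : Real.exp 20 * (s : ℝ) ^ 16 / 2 ^ s ≤ 1 := by
    have := hs₁ s (by omega)
    rw [mul_div_assoc]
    calc _ ≤ Real.exp 20 * (Real.exp 20)⁻¹ := by gcongr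
      _ = 1 := mul_inv_cancel₀ (Real.exp_pos _).ne'
  refine ⟨sieveW W b s J, perM W b s J, fun n => ⟨(perM_mem hs1 hs2 n).1,
    (perM_mem hs1 hs2 n).2.trans ?_⟩, fun M hM n => perM_add hM n, fun n => rho_div_le_sieveW n,
    fun N hN => ⟨fun θ => (fourier_sieveW_le hs1 hs2 hJ hN θ).trans ?_,
      (sum_sieveW_le hs1 hs2 hJ hN).trans ?_, (sum_sieveW_sub_le hs1 hs2 hJ hN).trans ?_⟩⟩
  · rw [← mul_assoc]
    gcongr
    rw [hC]
    gcongr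
    linarith [Real.exp_pos 27, Real.exp_pos 20, Real.exp_pos 24]
  · gcongr
    set X : ℝ := (s : ℝ) ^ 16 / 2 ^ s with hX
    have hs' : (1 : ℝ) ≤ s := by exact_mod_cast hs1
    have a1 : (s : ℝ) ^ 12 / 2 ^ s ≤ X := by
      rw [hX]; gcongr; norm_num
    have a2 : 1 / (2 : ℝ) ^ s ≤ X := by rw [hX]; gcongr; exact one_le_pow₀ hs'
    have hX0 : 0 ≤ X := by positivity
    calc _ = Real.exp 27 * epsC * ((s : ℝ) ^ 12 / 2 ^ s) + epsC * (Real.exp 20 * X) +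
          3 * epsC * levC * (1 / 2 ^ s) := by rw [hX]; ring
      _ ≤ Real.exp 27 * epsC * X + epsC * (Real.exp 20 * X) + 3 * epsC * levC * X := by gcongr
      _ = epsC * (Real.exp 27 + Real.exp 20 + 3 * levC) * X := by ring
      _ ≤ C * X := by
        rw [hC]
        exact mul_le_mul_of_nonneg_right (mul_le_mul_of_nonneg_left
          (by linarith [Real.exp_pos 24, Real.exp_pos 10]) (by linarith)) hX0
  · gcongr
    rw [hC]
    calc epsC + levC ≤ epsC + epsC * levC := by gcongr; exact le_mul_of_one_le_left h2.le h1
      _ = epsC * (1 + levC) := by ring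
      _ ≤ _ := by
        exact mul_le_mul_of_nonneg_left (by
          linarith [Real.exp_pos 27, Real.exp_pos 20, Real.exp_pos 24, Real.exp_pos 10])
          (by linarith)
  · gcongr
    set X : ℝ := (s : ℝ) ^ 16 / 2 ^ s with hX
    have hs' : (1 : ℝ) ≤ s := by exact_mod_cast hs1
    have a2 : 1 / (2 : ℝ) ^ s ≤ X := by rw [hX]; gcongr; exact one_le_pow₀ hs'
    have hX0 : 0 ≤ X := by positivity
    have hB : (0 : ℝ) ≤ 1 / 16 ^ b := by positivity
    have e1 : levC / 2 ^ s ≤ epsC * levC * X := by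
      calc _ = levC * (1 / 2 ^ s) := by ring
        _ ≤ levC * X := by gcongr
        _ ≤ epsC * levC * X := by
          have : levC ≤ epsC * levC := le_mul_of_one_le_left h2.le h1
          gcongr
    calc _ ≤ epsC * (Real.exp 20 * s ^ 16 / 2 ^ s + 2 * Real.exp 24 / 16 ^ b) +
          epsC * levC * X := by linarith
      _ = epsC * (2 * Real.exp 24) * (1 / 16 ^ b) + epsC * (Real.exp 20 + levC) * X := by
        rw [hX]; ring
      _ ≤ C * (1 / 16 ^ b) + C * X := by
        rw [hC]
        refine add_le_add (mul_le_mul_of_nonneg_right (mul_le_mul_of_nonneg_left ?_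
          (by linarith)) hB) (mul_le_mul_of_nonneg_right (mul_le_mul_of_nonneg_left ?_
          (by linarith)) hX0)
        · linarith [Real.exp_pos 27, Real.exp_pos 20, Real.exp_pos 24, Real.exp_pos 10]
        · linarith [Real.exp_pos 27, Real.exp_pos 20, Real.exp_pos 24, Real.exp_pos 10]
      _ = _ := by ring

end SchurPrimes

namespace SchurPrimes
open Finset

lemma nn_eq_abs {x : ℝ} (h : |x| < 1 / 2) : nn x = |x| := by
  unfold nn
  have : round x = 0 := by
    rw [round_eq_zero_iff]
    rw [abs_lt] at h
    exact ⟨by linarith, by linarith⟩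
  rw [this]; simp

/-- Points of a short progression hitting a short arc are sparse, if the slope is not close to
a rational with small denominator. -/
lemma card_arc_window_lt {ψ φ r κ : ℝ} {L x : ℕ} (hκ : 0 < κ) (hκ1 : κ ≤ 1) (hr : 0 ≤ r)
    (hL : 8 ≤ κ ^ 2 * L) (hrL : 8 * r * L ≤ 1)
    (hψ : ∀ h : ℕ, 1 ≤ h → (h : ℝ) ≤ 4 / κ → 16 * r / (κ ^ 2 * L) < nn (h * ψ)) :
    (((Ico x (x + L)).filter fun n : ℕ => nn (ψ * n - φ) ≤ r).card : ℝ) < κ * L := by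
  by_contra hcon
  push Not at hcon
  set A := (Ico x (x + L)).filter fun n : ℕ => nn (ψ * n - φ) ≤ r with hA
  have hpair : ∀ m n : ℕ, m ∈ A → n ∈ A → m ≤ n → nn (ψ * ((n - m : ℕ) : ℝ)) ≤ 2 * r := by
    intro m n hm hn hmn
    have h1 := (mem_filter.mp hm).2
    have h2 := (mem_filter.mp hn).2
    have e : ψ * ((n - m : ℕ) : ℝ) = (ψ * n - φ) - (ψ * m - φ) := by
      rw [Nat.cast_sub hmn]; ring
    rw [e]
    exact (nn_sub_le _ _).trans (by linarith)
  have hL0 : (0 : ℝ) < L := by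
    by_contra h
    have : (L : ℝ) = 0 := le_antisymm (not_lt.mp h) (by positivity)
    rw [this] at hL; norm_num at hL
  have hκL : 8 ≤ κ * L := by nlinarith
  set g : ℕ := ⌊4 / κ⌋₊ with hg
  have hg4 : (g : ℝ) ≤ 4 / κ := Nat.floor_le (by positivity)
  have hg3 : 3 / κ ≤ g := by
    have h1 := Nat.lt_floor_add_one (4 / κ)
    have h2 : 1 ≤ 1 / κ := by rw [le_div_iff₀ hκ]; linarith
    have h3 : 4 / κ = 3 / κ + 1 / κ := by ring
    rw [← hg] at h1
    linarith
  have hg0 : 0 < g := by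
    have : (0 : ℝ) < g := lt_of_lt_of_le (by positivity) hg3
    exact_mod_cast this
  have hgR : (0 : ℝ) < g := by exact_mod_cast hg0
  obtain ⟨m, hm, n, hn, hmn, hcell⟩ : ∃ m ∈ A, ∃ n ∈ A, m ≠ n ∧ (m - x) / g = (n - x) / g := by
    apply exists_ne_map_eq_of_card_lt_of_maps_to (t := range (L / g + 1))
    · rw [card_range]
      have h1 : ((L / g + 1 : ℕ) : ℝ) ≤ L / g + 1 := by
        push_cast; linarith [@Nat.cast_div_le ℝ _ _ _ L g]
      have h2 : (L : ℝ) / g ≤ κ * L / 3 := by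
        rw [div_le_iff₀ hgR]
        rw [div_le_iff₀ hκ] at hg3
        nlinarith
      have : ((L / g + 1 : ℕ) : ℝ) < A.card := by linarith
      exact_mod_cast this
    · intro n hn
      have := mem_Ico.mp (mem_filter.mp hn).1
      rw [mem_coe, mem_range]
      exact Nat.lt_succ_of_le (Nat.div_le_div_right (by omega))
  wlog hlt : m < n generalizing m n
  · exact this n hn m hm hmn.symm hcell.symm (by omega)
  set h := n - m with hh
  have hmx := mem_Ico.mp (mem_filter.mp hm).1
  have hh1 : 1 ≤ h := by omega
  have hhg : h ≤ g := by
    have e1 := Nat.div_add_mod (m - x) g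
    have e2 := Nat.div_add_mod (n - x) g
    have e3 := Nat.mod_lt (m - x) hg0
    have e4 := Nat.mod_lt (n - x) hg0
    rw [hcell] at e1
    omega
  have hh4 : (h : ℝ) ≤ 4 / κ := le_trans (by exact_mod_cast hhg) hg4
  have hψh := hψ h hh1 hh4
  have hhR : (0 : ℝ) < h := by exact_mod_cast hh1
  obtain ⟨c, -, hc⟩ : ∃ c ∈ range h, (A.card : ℝ) / h ≤ ((A.filter fun n => n % h = c).card : ℝ) := by
    by_contra hno
    push Not at hno
    have e := card_eq_sum_card_fiberwise (s := A) (t := range h) (f := fun n => n % h)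
      (fun n _ => by rw [mem_coe, mem_range]; exact Nat.mod_lt _ hh1)
    have : (A.card : ℝ) < A.card := by
      calc (A.card : ℝ) = ∑ c ∈ range h, ((A.filter fun n => n % h = c).card : ℝ) := by
            exact_mod_cast e
        _ < ∑ c ∈ range h, (A.card : ℝ) / h := by
            apply sum_lt_sum_of_nonempty
            · exact ⟨0, mem_range.mpr hh1⟩
            · exact hno
        _ = A.card := by rw [sum_const, card_range, nsmul_eq_mul]; field_simp
    exact lt_irrefl _ this
  set B := A.filter fun n => n % h = c with hB
  have hBc : κ ^ 2 * L / 4 ≤ B.card := by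
    refine le_trans ?_ hc
    rw [le_div_iff₀ hhR]
    rw [le_div_iff₀ hκ] at hh4
    nlinarith
  have hB2 : (2 : ℝ) ≤ B.card := by linarith
  have hBne : B.Nonempty := card_pos.mp (by
    have : (0 : ℝ) < B.card := by linarith
    exact_mod_cast this)
  set p := B.min' hBne
  set q := B.max' hBne
  have hp := B.min'_mem hBne
  have hq := B.max'_mem hBne
  have hpq : p ≤ q := B.min'_le _ hq
  have hdvd : h ∣ q - p := by
    have e1 := (mem_filter.mp hp).2
    have e2 := (mem_filter.mp hq).2
    exact (Nat.modEq_iff_dvd' hpq).mp (e1.trans e2.symm)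
  obtain ⟨j, hj⟩ := hdvd
  have hBj : B.card ≤ j + 1 := by
    have : B ⊆ (range (j + 1)).image fun i => p + h * i := by
      intro y hy
      have hpy := B.min'_le _ hy
      have hyq := B.le_max' _ hy
      obtain ⟨i, hi⟩ : h ∣ y - p :=
        (Nat.modEq_iff_dvd' hpy).mp ((mem_filter.mp hp).2.trans (mem_filter.mp hy).2.symm)
      refine mem_image.mpr ⟨i, mem_range.mpr ?_, by omega⟩
      have : h * i ≤ h * j := by omega
      have := Nat.le_of_mul_le_mul_left this hh1
      omega
    calc _ ≤ _ := card_le_card this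
      _ ≤ (range (j + 1)).card := card_image_le
      _ = _ := card_range _
  have hjc : κ ^ 2 * L / 8 ≤ j := by
    have : (B.card : ℝ) ≤ j + 1 := by exact_mod_cast hBj
    linarith
  have hqL : q - p ≤ L := by
    have e1 := mem_Ico.mp (mem_filter.mp (mem_filter.mp hp).1).1
    have e2 := mem_Ico.mp (mem_filter.mp (mem_filter.mp hq).1).1
    omega
  have hjL : (j : ℝ) ≤ L := by
    have : j ≤ h * j := Nat.le_mul_of_pos_left _ hh1
    exact_mod_cast (by omega : j ≤ L)
  set γ := (h : ℝ) * ψ - round ((h : ℝ) * ψ) with hγ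
  have hγn : nn (h * ψ) = |γ| := rfl
  have hγ2 : |γ| ≤ 2 * r := by
    rw [← hγn, mul_comm]
    exact hpair m n hm hn hlt.le
  have hjγ : (j : ℝ) * |γ| ≤ 2 * r := by
    have h1 : |(j : ℝ) * γ| ≤ 1 / 4 := by
      rw [abs_mul, Nat.abs_cast]
      calc (j : ℝ) * |γ| ≤ L * (2 * r) := by gcongr
        _ ≤ _ := by linarith
    have h2 := nn_eq_abs (lt_of_le_of_lt h1 (by norm_num))
    have h3 := hpair p q (mem_filter.mp hp).1 (mem_filter.mp hq).1 hpq
    rw [hj] at h3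
    have h4 : ψ * ((h * j : ℕ) : ℝ) = j * γ + ((j * round ((h : ℝ) * ψ) : ℤ) : ℝ) := by
      rw [hγ]; push_cast; ring
    rw [h4, nn_add_int, h2, abs_mul, Nat.abs_cast] at h3
    exact h3
  rw [hγn, div_lt_iff₀ (by positivity)] at hψh
  have : |γ| * (κ ^ 2 * L) ≤ |γ| * (8 * j) :=
    mul_le_mul_of_nonneg_left (by linarith) (abs_nonneg _)
  linarith

lemma card_arc_le {ψ φ r κ : ℝ} {L : ℕ} (hκ : 0 < κ) (hκ1 : κ ≤ 1) (hr : 0 ≤ r)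
    (hL : 8 ≤ κ ^ 2 * L) (hrL : 8 * r * L ≤ 1)
    (hψ : ∀ h : ℕ, 1 ≤ h → (h : ℝ) ≤ 4 / κ → 16 * r / (κ ^ 2 * L) < nn (h * ψ)) (Y : ℕ) :
    (((range Y).filter fun n : ℕ => nn (ψ * n - φ) ≤ r).card : ℝ) ≤ κ * (Y + L) := by
  have hL0 : 0 < L := by
    rcases Nat.eq_zero_or_pos L with rfl | h
    · norm_num at hL
    · exact h
  have key : ∀ k : ℕ, (((range (k * L)).filter fun n : ℕ => nn (ψ * n - φ) ≤ r).card : ℝ) ≤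
      κ * (k * L) := by
    intro k
    induction k with
    | zero => simp
    | succ k ih =>
      have h1 := (card_arc_window_lt (x := k * L) (φ := φ) hκ hκ1 hr hL hrL hψ).le
      have h2 : range ((k + 1) * L) = range (k * L) ∪ Ico (k * L) (k * L + L) := by
        ext n; simp only [mem_range, mem_union, mem_Ico]
        have : (k + 1) * L = k * L + L := by ring
        omega
      rw [h2, filter_union]
      have h3 := card_union_le ((range (k * L)).filter fun n : ℕ => nn (ψ * n - φ) ≤ r)
        ((Ico (k * L) (k * L + L)).filter fun n : ℕ => nn (ψ * n - φ) ≤ r)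
      have h4 : ((((range (k * L)).filter fun n : ℕ => nn (ψ * n - φ) ≤ r) ∪
        ((Ico (k * L) (k * L + L)).filter fun n : ℕ => nn (ψ * n - φ) ≤ r)).card : ℝ) ≤
        ((range (k * L)).filter fun n : ℕ => nn (ψ * n - φ) ≤ r).card +
        ((Ico (k * L) (k * L + L)).filter fun n : ℕ => nn (ψ * n - φ) ≤ r).card := by
        exact_mod_cast h3
      push_cast
      linarith
  have h1 := key (Y / L + 1)
  have h2 : Y ≤ (Y / L + 1) * L := by
    have := Nat.lt_div_mul_add (a := Y) hL0
    have e : (Y / L + 1) * L = Y / L * L + L := by ring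
    omega
  have h3 : (((range Y).filter fun n : ℕ => nn (ψ * n - φ) ≤ r).card : ℝ) ≤
      ((range ((Y / L + 1) * L)).filter fun n : ℕ => nn (ψ * n - φ) ≤ r).card := by
    exact_mod_cast card_le_card (filter_subset_filter _ (range_mono h2))
  refine h3.trans (h1.trans (mul_le_mul_of_nonneg_left ?_ hκ.le))
  have : ((Y / L * L : ℕ) : ℝ) ≤ Y := by exact_mod_cast Nat.div_mul_le_self Y L
  push_cast at this ⊢
  linarith

/-- The normalized Fejér kernel. -/
noncomputable def fej (H : ℕ) (t : ℝ) : ℝ := ‖∑ h ∈ range H, ex (t * h)‖ ^ 2 / H ^ 2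

lemma fej_nonneg (H : ℕ) (t : ℝ) : 0 ≤ fej H t := by unfold fej; positivity

lemma fej_le_one (H : ℕ) (t : ℝ) : fej H t ≤ 1 := by
  unfold fej
  exact div_le_one_of_le₀ (by gcongr; exact norm_sum_ex_le t H) (by positivity)

lemma fej_le {H : ℕ} (hH : 1 ≤ H) {t r : ℝ} (hr : 0 < r) (h : r ≤ nn t) :
    fej H t ≤ 1 / (2 * H * r) ^ 2 := by
  have hH0 : (0 : ℝ) < H := by exact_mod_cast hH
  unfold fej
  have := norm_geom_le hr h H
  calc _ ≤ (1 / (2 * r)) ^ 2 / H ^ 2 := by gcongr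
    _ = _ := by field_simp

lemma le_fej {H : ℕ} (hH : 1 ≤ H) {t : ℝ} (h : nn t ≤ 1 / (13 * H)) : 1 / 4 ≤ fej H t := by
  have hH0 : (0 : ℝ) < H := by exact_mod_cast hH
  have h1 : ‖∑ j ∈ range H, ex (t * j) - H‖ ≤ H / 2 := by
    have e : ∑ j ∈ range H, ex (t * j) - H = ∑ j ∈ range H, (ex (t * j) - 1) := by
      rw [sum_sub_distrib]; simp
    rw [e]
    refine (norm_sum_le _ _).trans ?_
    calc _ ≤ ∑ j ∈ range H, (1 / 2 : ℝ) := by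
          refine sum_le_sum fun j hj => (norm_ex_sub_one_le _).trans ?_
          have h2 : nn (t * j) ≤ 1 / 13 := by
            rw [mul_comm]
            refine (nn_nat_mul_le j t).trans ?_
            have : (j : ℝ) ≤ H := by exact_mod_cast (mem_range.mp hj).le
            calc (j : ℝ) * nn t ≤ H * (1 / (13 * H)) :=
                  mul_le_mul this h (nn_nonneg _) hH0.le
              _ = _ := by field_simp
          have := Real.pi_lt_d2
          have := Real.pi_pos
          have := nn_nonneg (t * j)
          nlinarith
      _ = H / 2 := by rw [sum_const, card_range, nsmul_eq_mul]; ring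
  have h2 : (H : ℝ) / 2 ≤ ‖∑ j ∈ range H, ex (t * j)‖ := by
    have := norm_sub_norm_le (H : ℂ) (∑ j ∈ range H, ex (t * j))
    rw [norm_sub_rev, Complex.norm_natCast] at this
    linarith
  unfold fej
  rw [le_div_iff₀ (by positivity)]
  calc _ = ((H : ℝ) / 2) ^ 2 := by ring
    _ ≤ _ := by gcongr

lemma fej_eq (H : ℕ) (t : ℝ) : ((fej H t : ℝ) : ℂ) =
    (∑ h ∈ range H, ∑ h' ∈ range H, ex (t * ((h : ℝ) - h'))) / H ^ 2 := by
  unfold fej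
  push_cast
  congr 1
  rw [← Complex.mul_conj', map_sum, sum_mul_sum]
  refine sum_congr rfl fun h _ => sum_congr rfl fun h' _ => ?_
  rw [← ex_sub]; congr 1; ring

/-- Weights with small discrepancy in frequency are small on short arcs. -/
lemma sum_arc_le {ν a : ℕ → ℝ} {I : Finset ℕ} {E A B ψ φ r : ℝ} {H : ℕ} (hH : 1 ≤ H)
    (hν : ∀ n ∈ I, 0 ≤ ν n) (ha : ∀ n, 0 ≤ a n ∧ a n ≤ A)
    (hE : ∀ θ, ‖∑ n ∈ I, ((ν n - a n : ℝ) : ℂ) * ex (θ * n)‖ ≤ E) (hr : 0 < r)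
    (hB : ((I.filter fun n : ℕ => nn (ψ * n - φ) ≤ r).card : ℝ) ≤ B) :
    ∑ n ∈ I.filter (fun n : ℕ => nn (ψ * n - φ) ≤ 1 / (13 * H)), ν n ≤
      4 * (E + A * (B + I.card / (2 * H * r) ^ 2)) := by
  have hA : 0 ≤ A := (ha 0).1.trans (ha 0).2
  have hH0 : (0 : ℝ) < H := by exact_mod_cast hH
  have h1 : ∑ n ∈ I.filter (fun n : ℕ => nn (ψ * n - φ) ≤ 1 / (13 * H)), ν n ≤
      4 * ∑ n ∈ I, ν n * fej H (ψ * n - φ) := by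
    rw [mul_sum]
    calc _ ≤ ∑ n ∈ I.filter (fun n : ℕ => nn (ψ * n - φ) ≤ 1 / (13 * H)),
          4 * (ν n * fej H (ψ * n - φ)) := by
          refine sum_le_sum fun n hn => ?_
          have := le_fej hH (mem_filter.mp hn).2
          have := hν n (mem_filter.mp hn).1
          nlinarith
      _ ≤ _ := sum_le_sum_of_subset_of_nonneg (filter_subset _ _) fun n hn _ => by
          have := hν n hn
          have := fej_nonneg H (ψ * n - φ)
          positivity
  have h2 : |∑ n ∈ I, (ν n - a n) * fej H (ψ * n - φ)| ≤ E := by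
    have e : ((∑ n ∈ I, (ν n - a n) * fej H (ψ * n - φ) : ℝ) : ℂ) =
        (∑ h ∈ range H, ∑ h' ∈ range H, ex (-φ * ((h : ℝ) - h')) *
          ∑ n ∈ I, ((ν n - a n : ℝ) : ℂ) * ex (ψ * ((h : ℝ) - h') * n)) / H ^ 2 := by
      rw [Complex.ofReal_sum]
      simp_rw [Complex.ofReal_mul, fej_eq, mul_div_assoc', ← sum_div, mul_sum]
      congr 1
      rw [sum_comm]
      refine sum_congr rfl fun h _ => ?_
      rw [sum_comm]
      refine sum_congr rfl fun h' _ => sum_congr rfl fun n _ => ?_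
      have : (ψ * n - φ) * ((h : ℝ) - h') = -φ * ((h : ℝ) - h') + ψ * ((h : ℝ) - h') * n := by ring
      rw [this, ex_add]; ring
    rw [← Real.norm_eq_abs, ← Complex.norm_real, e, norm_div]
    have hn : ‖((H : ℂ)) ^ 2‖ = (H : ℝ) ^ 2 := by simp
    rw [hn, div_le_iff₀ (by positivity)]
    refine (norm_sum_le _ _).trans ?_
    calc _ ≤ ∑ h ∈ range H, ∑ h' ∈ range H, E := by
          refine sum_le_sum fun h _ => (norm_sum_le _ _).trans (sum_le_sum fun h' _ => ?_)
          rw [norm_mul, norm_ex, one_mul]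
          exact hE _
      _ = _ := by simp; ring
  have h3 : ∑ n ∈ I, a n * fej H (ψ * n - φ) ≤ A * (B + I.card / (2 * H * r) ^ 2) := by
    calc _ ≤ ∑ n ∈ I, A * ((if nn (ψ * n - φ) ≤ r then 1 else 0) + 1 / (2 * H * r) ^ 2) := by
          refine sum_le_sum fun n _ => ?_
          refine mul_le_mul (ha n).2 ?_ (fej_nonneg _ _) hA
          split_ifs with hc
          · have := fej_le_one H (ψ * n - φ)
            have : (0 : ℝ) ≤ 1 / (2 * H * r) ^ 2 := by positivity
            linarith
          · have := fej_le hH hr (not_le.mp hc).le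
            linarith
      _ = A * (((I.filter fun n : ℕ => nn (ψ * n - φ) ≤ r).card : ℝ) +
            I.card / (2 * H * r) ^ 2) := by
          rw [← mul_sum, sum_add_distrib, sum_const, sum_boole, nsmul_eq_mul]; ring
      _ ≤ _ := by gcongr
  have h4 : ∑ n ∈ I, ν n * fej H (ψ * n - φ) = ∑ n ∈ I, (ν n - a n) * fej H (ψ * n - φ) +
      ∑ n ∈ I, a n * fej H (ψ * n - φ) := by
    rw [← sum_add_distrib]; exact sum_congr rfl fun n _ => by ring
  rw [h4] at h1
  linarith [(abs_le.mp h2).2]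

end SchurPrimes

namespace SchurPrimes
open Finset

lemma sum_Ioc_zero_eq {β : Type*} [AddCommMonoid β] (F : ℕ → β) (D : ℕ) :
    ∑ d ∈ Ioc 0 D, F d = ∑ d ∈ range D, F (d + 1) := by
  rw [range_eq_Ico, sum_Ico_add' F 0 D 1]
  refine sum_congr ?_ fun _ _ => rfl
  ext d; simp only [mem_Ioc, mem_Ico]; omega

lemma norm_sum_range_periodic_le {a : ℕ → ℝ} {A φ t : ℝ} {P : ℕ} (hP : 1 ≤ P)
    (ha : ∀ n, 0 ≤ a n ∧ a n ≤ A) (hper : ∀ n, a (n + P) = a n) (ht : 0 < t)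
    (h : t ≤ nn (P * φ)) (D : ℕ) : ‖∑ d ∈ range D, (a d : ℂ) * ex (φ * d)‖ ≤ A * P / t := by
  have hA : 0 ≤ A := (ha 0).1.trans (ha 0).2
  have htriv : ∀ (x R : ℕ), ‖∑ d ∈ range R, (a (x + d) : ℂ) * ex (φ * (d : ℕ))‖ ≤ A * R := by
    intro x R
    refine (norm_sum_le _ _).trans ?_
    calc _ ≤ ∑ _d ∈ range R, A := by
          refine sum_le_sum fun d _ => ?_
          rw [norm_mul, norm_ex, mul_one, Complex.norm_real, Real.norm_eq_abs,
            abs_of_nonneg (ha _).1]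
          exact (ha _).2
      _ = _ := by simp [mul_comm]
  have hperk : ∀ q n, a (P * q + n) = a n := by
    intro q n
    induction q with
    | zero => simp
    | succ q ih => rw [← ih, ← hper (P * q + n)]; congr 1; ring
  have hfull : ∀ q : ℕ, ∑ d ∈ range (P * q), (a d : ℂ) * ex (φ * d) =
      (∑ j ∈ range q, ex ((P * φ) * j)) * ∑ d ∈ range P, (a d : ℂ) * ex (φ * d) := by
    intro q
    induction q with
    | zero => simp
    | succ q ih =>
      rw [mul_add, mul_one, sum_range_add, ih, sum_range_succ, add_mul, mul_sum (range P) _ (ex _)]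
      congr 1
      refine sum_congr rfl fun d _ => ?_
      rw [hperk]
      have : φ * ((P * q + d : ℕ) : ℝ) = P * φ * q + φ * d := by push_cast; ring
      rw [this, ex_add]; ring
  have ht2 : t ≤ 1 / 2 := h.trans (nn_le_half _)
  rw [← Nat.div_add_mod D P, sum_range_add, hfull]
  refine (norm_add_le _ _).trans ?_
  rw [norm_mul]
  have h1 := norm_geom_le ht h (D / P)
  have h2 := htriv 0 P
  simp only [zero_add] at h2
  have h3 : ‖∑ x ∈ range (D % P), (a (P * (D / P) + x) : ℂ) *
      ex (φ * ((P * (D / P) + x : ℕ) : ℝ))‖ ≤ A * P := by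
    have : ∑ x ∈ range (D % P), (a (P * (D / P) + x) : ℂ) *
        ex (φ * ((P * (D / P) + x : ℕ) : ℝ)) = ex (φ * (P * (D / P) : ℕ)) *
          ∑ x ∈ range (D % P), (a (P * (D / P) + x) : ℂ) * ex (φ * (x : ℕ)) := by
      rw [mul_sum]
      refine sum_congr rfl fun x _ => ?_
      rw [Nat.cast_add, mul_add, ex_add]; ring
    rw [this, norm_mul, norm_ex, one_mul]
    refine (htriv _ _).trans (mul_le_mul_of_nonneg_left ?_ hA)
    exact_mod_cast (Nat.mod_lt _ hP).le
  calc _ ≤ 1 / (2 * t) * (A * P) + A * P := by gcongr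
    _ ≤ 1 / (2 * t) * (A * P) + 1 / (2 * t) * (A * P) := by
        have : 1 ≤ 1 / (2 * t) := by rw [le_div_iff₀ (by positivity)]; linarith
        have : 0 ≤ A * P := by positivity
        nlinarith
    _ = _ := by field_simp; ring

lemma norm_sum_Ioc_periodic_le {a : ℕ → ℝ} {A φ t : ℝ} {P : ℕ} (hP : 1 ≤ P)
    (ha : ∀ n, 0 ≤ a n ∧ a n ≤ A) (hper : ∀ n, a (n + P) = a n) (ht : 0 < t)
    (h : t ≤ nn (P * φ)) (D : ℕ) : ‖∑ d ∈ Ioc 0 D, (a d : ℂ) * ex (φ * d)‖ ≤ A * P / t := by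
  have h1 := norm_sum_range_periodic_le (a := fun n => a (n + 1)) hP (fun n => ha _)
    (fun n => by rw [← hper (n + 1)]; congr 1; ring) ht h D
  rw [sum_Ioc_zero_eq]
  have : ∑ d ∈ range D, (a (d + 1) : ℂ) * ex (φ * ((d + 1 : ℕ) : ℝ)) =
      ex φ * ∑ d ∈ range D, (a (d + 1) : ℂ) * ex (φ * d) := by
    rw [mul_sum]
    refine sum_congr rfl fun x _ => ?_
    rw [Nat.cast_add, mul_add, ex_add, Nat.cast_one, mul_one]; ring
  rw [this, norm_mul, norm_ex, one_mul]
  exact h1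

/-- Exponential sums of a weight which is close to a bounded periodic function. -/
lemma norm_sum_weight_le {ν a : ℕ → ℝ} {A φ r δ : ℝ} {P D : ℕ} (hP : 1 ≤ P)
    (ha : ∀ n, 0 ≤ a n ∧ a n ≤ A) (hper : ∀ n, a (n + P) = a n) (hr : 0 < r)
    (hF : ‖∑ n ∈ Ioc 0 D, ((ν n - a n : ℝ) : ℂ) * ex (φ * n)‖ ≤ δ * D) :
    ‖∑ n ∈ Ioc 0 D, (ν n : ℂ) * ex (φ * n)‖ ≤
      δ * D + A * P / r + (if nn (P * φ) ≤ r then A * D else 0) := by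
  have hA : 0 ≤ A := (ha 0).1.trans (ha 0).2
  have h1 : ∑ n ∈ Ioc 0 D, (ν n : ℂ) * ex (φ * n) =
      ∑ n ∈ Ioc 0 D, ((ν n - a n : ℝ) : ℂ) * ex (φ * n) + ∑ n ∈ Ioc 0 D, (a n : ℂ) * ex (φ * n) := by
    rw [← sum_add_distrib]; refine sum_congr rfl fun n _ => by push_cast; ring
  have h2 : ‖∑ n ∈ Ioc 0 D, (a n : ℂ) * ex (φ * n)‖ ≤
      A * P / r + (if nn (P * φ) ≤ r then A * D else 0) := by
    split_ifs with hc
    · have : ‖∑ n ∈ Ioc 0 D, (a n : ℂ) * ex (φ * n)‖ ≤ A * D := by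
        refine (norm_sum_le _ _).trans ?_
        calc _ ≤ ∑ _d ∈ Ioc 0 D, A := by
              refine sum_le_sum fun d _ => ?_
              rw [norm_mul, norm_ex, mul_one, Complex.norm_real, Real.norm_eq_abs,
                abs_of_nonneg (ha _).1]
              exact (ha _).2
          _ = _ := by simp [mul_comm]
      have : 0 ≤ A * P / r := by positivity
      linarith
    · rw [add_zero]
      exact norm_sum_Ioc_periodic_le hP ha hper hr (not_le.mp hc).le D
  rw [h1]
  refine (norm_add_le _ _).trans ?_
  linarith

/-- Cauchy-Schwarz for a bilinear form supported below a hyperbola. -/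
lemma bilinear_cauchy {α γ ν : ℕ → ℝ} {V θ : ℝ} {I J : Finset ℕ} {N : ℕ}
    (hV : 0 ≤ V)
    (hα : ∀ n, 0 ≤ α n) (hγ : ∀ n, 0 ≤ γ n ∧ γ n ≤ V * ν n) :
    ‖∑ n ∈ J, ∑ d ∈ I.filter (fun d => d * n ≤ N), ((α n * γ d : ℝ) : ℂ) * ex (θ * (d * n : ℕ))‖ ^ 2
      ≤ (∑ d ∈ I, V * ν d) * (V * ∑ n ∈ J, ∑ n' ∈ J, α n * α n' *
        ‖∑ d ∈ I.filter (fun d => d * n ≤ N ∧ d * n' ≤ N), (ν d : ℂ) * ex (θ * ((n : ℝ) - n') * d)‖)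
    := by
  set T : ℕ → ℂ := fun d => ∑ n ∈ J, if d * n ≤ N then (α n : ℂ) * ex (θ * (d * n : ℕ)) else 0
    with hT
  have e1 : ∑ n ∈ J, ∑ d ∈ I.filter (fun d => d * n ≤ N), ((α n * γ d : ℝ) : ℂ) *
      ex (θ * (d * n : ℕ)) = ∑ d ∈ I, (γ d : ℂ) * T d := by
    simp_rw [sum_filter]
    rw [sum_comm]
    refine sum_congr rfl fun d _ => ?_
    rw [hT, mul_sum]
    refine sum_congr rfl fun n _ => ?_
    split_ifs
    · push_cast; ring
    · simp
  rw [e1]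
  have h1 : ‖∑ d ∈ I, (γ d : ℂ) * T d‖ ^ 2 ≤ (∑ d ∈ I, γ d) * ∑ d ∈ I, γ d * ‖T d‖ ^ 2 := by
    have : ‖∑ d ∈ I, (γ d : ℂ) * T d‖ ≤ ∑ d ∈ I, γ d * ‖T d‖ := by
      refine (norm_sum_le _ _).trans_eq (sum_congr rfl fun d _ => ?_)
      rw [norm_mul, Complex.norm_real, Real.norm_eq_abs, abs_of_nonneg (hγ d).1]
    refine (pow_le_pow_left₀ (norm_nonneg _) this 2).trans ?_
    exact sum_sq_le_sum_mul_sum_of_sq_le_mul I (fun d _ => (hγ d).1)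
      (fun d _ => mul_nonneg (hγ d).1 (sq_nonneg _)) fun d _ => le_of_eq (by ring)
  have hVν : ∀ d, 0 ≤ V * ν d := fun d => (hγ d).1.trans (hγ d).2
  have h2 : ∑ d ∈ I, γ d * ‖T d‖ ^ 2 ≤ V * ∑ d ∈ I, ν d * ‖T d‖ ^ 2 := by
    rw [mul_sum]
    refine sum_le_sum fun d _ => ?_
    rw [← mul_assoc]
    exact mul_le_mul_of_nonneg_right (hγ d).2 (sq_nonneg _)
  have h2' : 0 ≤ ∑ d ∈ I, γ d * ‖T d‖ ^ 2 :=
    sum_nonneg fun d _ => mul_nonneg (hγ d).1 (sq_nonneg _)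
  have h3 : ((∑ d ∈ I, ν d * ‖T d‖ ^ 2 : ℝ) : ℂ) = ∑ n ∈ J, ∑ n' ∈ J, ((α n * α n' : ℝ) : ℂ) *
      ∑ d ∈ I.filter (fun d => d * n ≤ N ∧ d * n' ≤ N), (ν d : ℂ) * ex (θ * ((n : ℝ) - n') * d) := by
    simp_rw [mul_sum, sum_filter]
    push_cast
    have : ∀ d, (‖T d‖ : ℂ) ^ 2 = ∑ n ∈ J, ∑ n' ∈ J, if d * n ≤ N ∧ d * n' ≤ N then
        ((α n * α n' : ℝ) : ℂ) * ex (θ * ((n : ℝ) - n') * d) else 0 := by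
      intro d
      rw [← Complex.mul_conj', hT, map_sum, sum_mul_sum]
      refine sum_congr rfl fun n _ => sum_congr rfl fun n' _ => ?_
      by_cases h : d * n ≤ N <;> by_cases h' : d * n' ≤ N <;> simp only [h, h', if_true, if_false,
        and_true, and_false, and_self, map_zero, mul_zero, zero_mul]
      have e : θ * ((n : ℝ) - n') * d = θ * (d * n : ℕ) - θ * (d * n' : ℕ) := by push_cast; ring
      rw [e, ex_sub, map_mul, Complex.conj_ofReal]; push_cast; ring
    simp_rw [this, mul_sum]
    rw [sum_comm]
    refine sum_congr rfl fun n _ => ?_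
    rw [sum_comm]
    refine sum_congr rfl fun n' _ => sum_congr rfl fun d _ => ?_
    split_ifs
    · push_cast; ring
    · simp
  have h4 : ∑ d ∈ I, ν d * ‖T d‖ ^ 2 ≤ ∑ n ∈ J, ∑ n' ∈ J, α n * α n' *
      ‖∑ d ∈ I.filter (fun d => d * n ≤ N ∧ d * n' ≤ N), (ν d : ℂ) * ex (θ * ((n : ℝ) - n') * d)‖ := by
    refine (le_abs_self _).trans ?_
    rw [← Real.norm_eq_abs, ← Complex.norm_real, h3]
    refine (norm_sum_le _ _).trans (sum_le_sum fun n _ => (norm_sum_le _ _).trans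
      (sum_le_sum fun n' _ => ?_))
    rw [norm_mul, Complex.norm_real, Real.norm_eq_abs, abs_of_nonneg (mul_nonneg (hα _) (hα _))]
  refine h1.trans ?_
  exact mul_le_mul (sum_le_sum fun d _ => (hγ d).2)
    (h2.trans (mul_le_mul_of_nonneg_left h4 hV)) h2' (sum_nonneg fun d _ => hVν d)

/-- Count of short arcs hit by multiples of a minor arc frequency. -/
lemma sum_arc_Ioc_le {ν a : ℕ → ℝ} {A P σ δ φ ψ M : ℝ} {X N H : ℕ} (hA : 1 ≤ A) (hP : 1 ≤ P)
    (hσ : 0 < σ) (hσ1 : σ ≤ 1) (hν : ∀ n, 0 ≤ ν n) (ha : ∀ n, 0 ≤ a n ∧ a n ≤ A)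
    (hE : ∀ θ, ‖∑ n ∈ Ioc 0 (2 * X), ((ν n - a n : ℝ) : ℂ) * ex (θ * n)‖ ≤ δ * (2 * X : ℕ))
    (hX : (208 * 72 * 2) * A * P / σ ^ 4 ≤ X) (hMX : X ≤ M) (hMX' : N ≤ 2 * (M * X)) (hN : 0 < N)
    (hH : 1 ≤ H) (hHM : σ * M ≤ 26 * A * P * H)
    (hψ : ∀ h : ℕ, 1 ≤ h → (h : ℝ) ≤ 12 / σ →
      (144 * 26 * 416 * 2) * A ^ 2 * P ^ 2 / (σ ^ 6 * N) < nn (h * ψ)) :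
    ∑ n ∈ (Ioc 0 (2 * X)).filter (fun n : ℕ => nn (ψ * n - φ) ≤ 1 / (13 * H)), ν n ≤
      8 * δ * X + 6 * A ^ 2 * σ * X := by
  have hH0 : (0 : ℝ) < H := by exact_mod_cast hH
  have hN0 : (0 : ℝ) < N := by exact_mod_cast hN
  have hA0 : 0 < A := by linarith
  have hP0 : 0 < P := by linarith
  have hX0 : (0 : ℝ) < X := lt_of_lt_of_le (by positivity) hX
  have hM0 : 0 < M := by linarith
  set r : ℝ := 1 / (σ * H) with hr
  have hr0 : 0 < r := by positivity
  have hrM : r ≤ 26 * A * P / (σ ^ 2 * M) := by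
    rw [hr, div_le_div_iff₀ (by positivity) (by positivity)]
    nlinarith
  set c : ℝ := σ ^ 2 / (208 * A * P) with hc
  have hc0 : 0 < c := by positivity
  have hcX : 72 * 2 / σ ^ 2 ≤ c * X := by
    calc _ = c * ((208 * 72 * 2) * A * P / σ ^ 4) := by rw [hc]; field_simp
      _ ≤ _ := by gcongr
  have h144 : 144 ≤ c * X := by
    refine le_trans ?_ hcX
    rw [le_div_iff₀ (by positivity)]
    nlinarith
  set L : ℕ := ⌊c * X⌋₊ with hL
  have hLle : (L : ℝ) ≤ c * X := Nat.floor_le (by positivity)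
  have hLge : c * X / 2 ≤ L := by
    have := Nat.lt_floor_add_one (c * X)
    rw [← hL] at this
    linarith
  have hc1 : c ≤ 1 := by
    rw [hc, div_le_one (by positivity)]
    have : 1 ≤ A * P := one_le_mul_of_one_le_of_one_le hA hP
    nlinarith
  have hκ : ∀ Y : ℕ, (((range Y).filter fun n : ℕ => nn (ψ * n - (φ - ψ)) ≤ r).card : ℝ) ≤
      σ / 3 * (Y + L) := by
    refine card_arc_le (by positivity) (by linarith) hr0.le ?_ ?_ ?_
    · calc (8 : ℝ) = (σ / 3) ^ 2 * (72 * 2 / σ ^ 2 / 2) := by field_simp; norm_num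
        _ ≤ (σ / 3) ^ 2 * L := by gcongr; linarith
    · calc 8 * r * L ≤ 8 * (26 * A * P / (σ ^ 2 * M)) * (c * M) := by
            gcongr
            exact hLle.trans (by gcongr)
        _ = 1 := by rw [hc]; field_simp; norm_num
    · intro h h1 h2
      refine lt_of_le_of_lt ?_ (hψ h h1 (h2.trans_eq (by field_simp; norm_num)))
      calc 16 * r / ((σ / 3) ^ 2 * L) ≤
            16 * (26 * A * P / (σ ^ 2 * M)) / ((σ / 3) ^ 2 * (c * X / 2)) := by gcongr
        _ = (144 * 26 * 416) * A ^ 2 * P ^ 2 / (σ ^ 6 * (M * X)) := by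
            rw [hc]; field_simp; norm_num
        _ ≤ (144 * 26 * 416) * A ^ 2 * P ^ 2 / (σ ^ 6 * (N / 2)) := by gcongr; linarith
        _ = _ := by field_simp
  have hB : (((Ioc 0 (2 * X)).filter fun n : ℕ => nn (ψ * n - φ) ≤ r).card : ℝ) ≤ σ * X := by
    have h1 : (((Ioc 0 (2 * X)).filter fun n : ℕ => nn (ψ * n - φ) ≤ r).card : ℝ) =
        ((range (2 * X)).filter fun n : ℕ => nn (ψ * n - (φ - ψ)) ≤ r).card := by
      rw [← sum_boole, ← sum_boole, sum_Ioc_zero_eq]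
      refine sum_congr rfl fun n _ => ?_
      have : ψ * ((n + 1 : ℕ) : ℝ) - φ = ψ * n - (φ - ψ) := by push_cast; ring
      rw [this]
    rw [h1]
    refine (hκ _).trans ?_
    push_cast
    have : (L : ℝ) ≤ X := hLle.trans (by nlinarith)
    nlinarith
  refine (sum_arc_le hH (fun n _ => hν n) ha hE hr0 hB).trans ?_
  have h5 : ((Ioc 0 (2 * X)).card : ℝ) / (2 * H * r) ^ 2 = σ ^ 2 * X / 2 := by
    rw [hr, Nat.card_Ioc, Nat.sub_zero]; push_cast; field_simp
  rw [h5]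
  push_cast
  have h6 : σ ^ 2 * X ≤ σ * X := by nlinarith
  have h7 : A * (σ * X + σ ^ 2 * X / 2) ≤ A * (σ * X * (3 / 2)) := by gcongr; linarith
  have h8 : A * (σ * X) ≤ A ^ 2 * (σ * X) := by
    have : 0 ≤ σ * X := by positivity
    nlinarith [mul_nonneg (mul_nonneg hA0.le (by linarith : 0 ≤ A - 1)) this]
  linarith

/-- Bilinear sums over a dyadic range at a minor arc frequency. -/
lemma bilinear_le {ν a α γ : ℕ → ℝ} {A C V σ δ θ : ℝ} {P X N Y₀ : ℕ} (hA : 1 ≤ A) (hC : 1 ≤ C)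
    (hP : 1 ≤ P) (hV : 0 ≤ V) (hδ : 0 ≤ δ)
    (hσ : 0 < σ) (hσ1 : σ ≤ 1) (hν : ∀ n, 0 ≤ ν n) (ha : ∀ n, 0 ≤ a n ∧ a n ≤ A)
    (hper : ∀ n, a (n + P) = a n)
    (hE : ∀ Y, Y₀ ≤ Y → ∀ θ, ‖∑ n ∈ Ioc 0 Y, ((ν n - a n : ℝ) : ℂ) * ex (θ * n)‖ ≤ δ * Y)
    (hS : ∀ Y, Y₀ ≤ Y → ∑ n ∈ Ioc 0 Y, ν n ≤ C * Y)
    (hα : ∀ n, 0 ≤ α n ∧ α n ≤ V * ν n) (hγ : ∀ n, 0 ≤ γ n ∧ γ n ≤ V * ν n)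
    (hX : (208 * 72 * 2) * A * P / σ ^ 4 ≤ X) (hXY : 2 * Y₀ ≤ X) (hXN : X ^ 2 ≤ N)
    (hθ : ∀ h : ℕ, 1 ≤ h → (h : ℝ) ≤ 12 * P / σ →
      (144 * 26 * 416 * 2) * A ^ 2 * P ^ 2 / (σ ^ 6 * N) < nn (h * θ)) :
    ‖∑ n ∈ Ioc X (2 * X), ∑ d ∈ (Ioc 0 (N / X)).filter (fun d => d * n ≤ N),
      ((α n * γ d : ℝ) : ℂ) * ex (θ * (d * n : ℕ))‖ ^ 2 ≤
      V ^ 4 * N ^ 2 * C ^ 3 * (20 * A * δ + 16 * A ^ 3 * σ) := by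
  have hA0 : 0 < A := by linarith
  have hP1 : (1 : ℝ) ≤ P := by exact_mod_cast hP
  have hP0 : (0 : ℝ) < P := by linarith
  have hX0 : (0 : ℝ) < X := lt_of_lt_of_le (by positivity) hX
  have hX0' : 0 < X := by exact_mod_cast hX0
  have hN : 0 < N := lt_of_lt_of_le (by positivity) hXN
  set M : ℕ := N / X with hM
  have hMX : X ≤ M := by
    rw [hM, Nat.le_div_iff_mul_le hX0', ← sq]; exact hXN
  have hMX0 : (X : ℝ) ≤ M := by exact_mod_cast hMX
  have hM0 : (0 : ℝ) < M := by linarith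
  have hMXN : M * X ≤ N := Nat.div_mul_le_self N X
  have hMXN0 : (M : ℝ) * X ≤ N := by exact_mod_cast hMXN
  have hMX2 : (N : ℝ) ≤ 2 * (M * X) := by
    have h1 : N < X * (M + 1) := Nat.lt_mul_div_succ N hX0'
    have h2 : X ≤ M * X := Nat.le_mul_of_pos_left _ (by omega)
    have : N ≤ 2 * (M * X) := by nlinarith
    exact_mod_cast this
  set H : ℕ := ⌊σ * M / (13 * A * P)⌋₊ with hH
  have hσM : 13 * A * P ≤ σ * M := by
    calc 13 * A * P ≤ σ * ((208 * 72 * 2) * A * P / σ ^ 4) := by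
          rw [mul_div_assoc', le_div_iff₀ (by positivity)]
          have : σ ^ 4 ≤ σ := pow_le_of_le_one hσ.le hσ1 (by norm_num)
          have : A * P * σ ^ 4 ≤ A * P * σ := by gcongr
          nlinarith [mul_pos (mul_pos hA0 hP0) hσ]
      _ ≤ σ * M := by gcongr; linarith
  have hH1 : 1 ≤ H := by
    rw [hH, Nat.one_le_floor_iff, le_div_iff₀ (by positivity)]
    linarith
  have hH0 : (0 : ℝ) < H := by exact_mod_cast hH1
  have hHle : 13 * A * P * H ≤ σ * M := by
    have : (H : ℝ) ≤ σ * M / (13 * A * P) := Nat.floor_le (by positivity)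
    rw [le_div_iff₀ (by positivity)] at this
    linarith
  have hHge : σ * M ≤ 26 * A * P * H := by
    have h1 : σ * M / (13 * A * P) < H + 1 := Nat.lt_floor_add_one _
    rw [div_lt_iff₀ (by positivity)] at h1
    have : (1 : ℝ) ≤ H := by exact_mod_cast hH1
    nlinarith [mul_pos hA0 hP0]
  have hYX : Y₀ ≤ 2 * X := by omega
  have hYM : Y₀ ≤ M := by omega
  have harc : ∀ φ, ∑ n ∈ (Ioc 0 (2 * X)).filter
      (fun n : ℕ => nn (P * θ * n - φ) ≤ 1 / (13 * H)), ν n ≤ 8 * δ * X + 6 * A ^ 2 * σ * X := by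
    intro φ
    refine sum_arc_Ioc_le hA hP1 hσ hσ1 hν ha (hE _ hYX) hX hMX0 hMX2 hN hH1 hHge ?_
    intro h h1 h2
    have := hθ (h * P) (by nlinarith) (by
      push_cast
      calc (h : ℝ) * P ≤ 12 / σ * P := by gcongr
        _ = _ := by ring)
    push_cast at this
    rwa [mul_assoc (h : ℝ)] at this
  refine (bilinear_cauchy hV (fun n => (hα n).1) hγ).trans ?_
  have hin : ∀ n ∈ Ioc X (2 * X), ∀ n' ∈ Ioc X (2 * X),
      ‖∑ d ∈ (Ioc 0 M).filter (fun d => d * n ≤ N ∧ d * n' ≤ N),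
        (ν d : ℂ) * ex (θ * ((n : ℝ) - n') * d)‖ ≤ δ * M + σ * M +
        if nn (P * θ * n - P * θ * n') ≤ 1 / (13 * H) then A * M else 0 := by
    have key : ∀ n n' : ℕ, X < n → n ≤ 2 * X → n' ≤ n →
        ‖∑ d ∈ (Ioc 0 M).filter (fun d => d * n ≤ N ∧ d * n' ≤ N),
          (ν d : ℂ) * ex (θ * ((n : ℝ) - n') * d)‖ ≤ δ * M + σ * M +
          if nn (P * θ * n - P * θ * n') ≤ 1 / (13 * H) then A * M else 0 := by
      intro n n' h1 h2 h3
      have hn0 : 0 < n := by omega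
      have hD : N / n ≤ M := Nat.div_le_div_left h1.le hX0'
      have hD0 : ((N / n : ℕ) : ℝ) ≤ M := by exact_mod_cast hD
      have hDY : Y₀ ≤ N / n := by
        rw [Nat.le_div_iff_mul_le hn0]
        calc Y₀ * n ≤ Y₀ * (2 * X) := by gcongr
          _ = 2 * Y₀ * X := by ring
          _ ≤ X * X := by gcongr
          _ ≤ N := by rw [← sq]; exact hXN
      have e1 : (Ioc 0 M).filter (fun d => d * n ≤ N ∧ d * n' ≤ N) = Ioc 0 (N / n) := by
        ext d
        simp only [mem_filter, mem_Ioc, Nat.le_div_iff_mul_le hn0]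
        constructor
        · rintro ⟨⟨h, _⟩, h', _⟩; exact ⟨h, h'⟩
        · rintro ⟨h, h'⟩
          refine ⟨⟨h, ((Nat.le_div_iff_mul_le hn0).mpr h').trans hD⟩, h', ?_⟩
          exact (Nat.mul_le_mul_left d h3).trans h'
      rw [e1]
      have hr : (0 : ℝ) < 1 / (13 * H) := by positivity
      refine (norm_sum_weight_le (ν := ν) hP ha hper hr (hE _ hDY _)).trans ?_
      have e2 : P * (θ * ((n : ℝ) - n')) = P * θ * n - P * θ * n' := by ring
      rw [e2]
      have e3 : A * P / (1 / (13 * H)) ≤ σ * M := by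
        rw [div_div_eq_mul_div, div_one]; linarith
      refine add_le_add (add_le_add (by gcongr) e3) ?_
      split_ifs
      · gcongr
      · exact le_rfl
    intro n hn n' hn'
    rw [mem_Ioc] at hn hn'
    rcases le_total n' n with h | h
    · exact key n n' hn.1 hn.2 h
    · have := key n' n hn'.1 hn'.2 h
      rw [← nn_neg, neg_sub] at this
      convert this using 1
      rw [← Complex.norm_conj, map_sum]
      congr 1
      refine sum_congr ?_ fun d _ => ?_
      · ext d; simp only [mem_filter]; tauto
      · rw [map_mul, Complex.conj_ofReal, conj_ex]; congr 2; ring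
  have hνJ : ∑ n ∈ Ioc X (2 * X), ν n ≤ 2 * C * X := by
    calc _ ≤ ∑ n ∈ Ioc 0 (2 * X), ν n :=
          sum_le_sum_of_subset_of_nonneg (Ioc_subset_Ioc_left (Nat.zero_le _)) fun n _ _ => hν n
      _ ≤ C * (2 * X : ℕ) := hS _ hYX
      _ = _ := by push_cast; ring
  have hνJ0 : 0 ≤ ∑ n ∈ Ioc X (2 * X), ν n := sum_nonneg fun n _ => hν n
  have hT : ∑ n ∈ Ioc X (2 * X), ∑ n' ∈ Ioc X (2 * X), α n * α n' *
      ‖∑ d ∈ (Ioc 0 M).filter (fun d => d * n ≤ N ∧ d * n' ≤ N),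
        (ν d : ℂ) * ex (θ * ((n : ℝ) - n') * d)‖ ≤
      V ^ 2 * M * (4 * C ^ 2 * (δ + σ) + 2 * C * A * (8 * δ + 6 * A ^ 2 * σ)) * X ^ 2 := by
    calc _ ≤ ∑ n ∈ Ioc X (2 * X), ∑ n' ∈ Ioc X (2 * X), (V * ν n) * (V * ν n') *
          (δ * M + σ * M +
            if nn (P * θ * n - P * θ * n') ≤ 1 / (13 * H) then A * M else 0) := by
          refine sum_le_sum fun n hn => sum_le_sum fun n' hn' => ?_
          refine mul_le_mul (mul_le_mul (hα n).2 (hα n').2 (hα n').1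
            ((hα n).1.trans (hα n).2)) (hin n hn n' hn') (norm_nonneg _) ?_
          exact mul_nonneg ((hα n).1.trans (hα n).2) ((hα n').1.trans (hα n').2)
      _ = V ^ 2 * M * ((δ + σ) * (∑ n ∈ Ioc X (2 * X), ν n) ^ 2 + A * ∑ n' ∈ Ioc X (2 * X),
            ν n' * ∑ n ∈ (Ioc X (2 * X)).filter
              (fun n : ℕ => nn (P * θ * n - P * θ * n') ≤ 1 / (13 * H)), ν n) := by
          rw [sq (∑ n ∈ Ioc X (2 * X), ν n), sum_mul_sum, mul_add, mul_sum, mul_sum,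
            mul_sum (Ioc X (2 * X)) _ A, mul_sum (Ioc X (2 * X)) _ (V ^ 2 * M)]
          simp_rw [mul_sum, sum_filter]
          conv_rhs =>
            arg 2
            rw [sum_comm]
          rw [← sum_add_distrib]
          refine sum_congr rfl fun n _ => ?_
          rw [← sum_add_distrib]
          refine sum_congr rfl fun n' _ => ?_
          split_ifs <;> ring
      _ ≤ V ^ 2 * M * ((δ + σ) * (2 * C * X) ^ 2 + A * ∑ n' ∈ Ioc X (2 * X),
            ν n' * (8 * δ * X + 6 * A ^ 2 * σ * X)) := by
          gcongr with n' hn'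
          · exact hν n'
          · refine le_trans ?_ (harc (P * θ * n'))
            exact sum_le_sum_of_subset_of_nonneg (filter_subset_filter _
              (Ioc_subset_Ioc_left (Nat.zero_le _))) fun n _ _ => hν n
      _ ≤ V ^ 2 * M * ((δ + σ) * (2 * C * X) ^ 2 + A * (2 * C * X *
            (8 * δ * X + 6 * A ^ 2 * σ * X))) := by
          rw [← sum_mul]; gcongr
      _ = _ := by ring
  have hI : ∑ d ∈ Ioc 0 M, V * ν d ≤ V * (C * M) := by
    rw [← mul_sum]; exact mul_le_mul_of_nonneg_left (hS _ hYM) hV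
  calc _ ≤ V * (C * M) * (V * (V ^ 2 * M * (4 * C ^ 2 * (δ + σ) +
        2 * C * A * (8 * δ + 6 * A ^ 2 * σ)) * X ^ 2)) := by
        refine mul_le_mul hI (mul_le_mul_of_nonneg_left hT hV) ?_ (by positivity)
        exact mul_nonneg hV (sum_nonneg fun n _ => sum_nonneg fun n' _ =>
          mul_nonneg (mul_nonneg (hα n).1 (hα n').1) (norm_nonneg _))
    _ = V ^ 4 * (M * X) ^ 2 * (C * (4 * C ^ 2 * (δ + σ) +
        2 * C * A * (8 * δ + 6 * A ^ 2 * σ))) := by ring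
    _ ≤ V ^ 4 * N ^ 2 * (C ^ 3 * (20 * A * δ + 16 * A ^ 3 * σ)) := by
        refine mul_le_mul_of_nonneg_left (?_ : _ ≤ _) (by positivity) |>.trans' <|
          mul_le_mul_of_nonneg_right (mul_le_mul_of_nonneg_left (pow_le_pow_left₀ (by positivity)
            hMXN0 2) (by positivity)) (by positivity)
        have hA3 : 1 ≤ A ^ 3 := one_le_pow₀ hA
        have hC2 : C ^ 2 ≤ C ^ 3 := pow_le_pow_right₀ hC (by norm_num)
        have : C ^ 3 * (4 * (δ + σ)) ≤ C ^ 3 * (4 * A * δ + 4 * A ^ 3 * σ) := by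
          gcongr; nlinarith
        have : C ^ 2 * (16 * A * δ + 12 * A ^ 3 * σ) ≤ C ^ 3 * (16 * A * δ + 12 * A ^ 3 * σ) := by
          gcongr
        nlinarith
    _ = _ := by ring

end SchurPrimes

namespace SchurPrimes
open Finset

/-- The density of integers free of prime factors up to `z`. -/
lemma sieve_Ioc : ∃ C : ℝ, 1 ≤ C ∧ ∃ s₀ : ℕ, 1 ≤ s₀ ∧ ∀ b s J : ℕ, s₀ ≤ s → 3 * s ≤ 2 ^ J →
    ∃ ν a : ℕ → ℝ, (∀ n, 0 ≤ ν n) ∧ (∀ n, 0 ≤ a n ∧ a n ≤ C * s ^ 8) ∧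
      (∀ n, a (n + (2 ^ s).factorial) = a n) ∧
      (∀ n, 1 ≤ n → rho (prm 1 0 (2 ^ (s * 2 ^ J))) n ≤ dens 1 (2 ^ (s * 2 ^ J)) * ν n) ∧
      ∀ N : ℕ, (2 ^ (s * 2 ^ J)) ^ (12 * b + 28) ≤ N →
        (∀ θ, ‖∑ n ∈ Ioc 0 N, ((ν n - a n : ℝ) : ℂ) * ex (θ * n)‖ ≤ C * (s ^ 16 / 2 ^ s) * N) ∧
        ∑ n ∈ Ioc 0 N, ν n ≤ C * N ∧
        ∑ n ∈ Ioc 0 N, (dens 1 (2 ^ (s * 2 ^ J)) * ν n - rho (prm 1 0 (2 ^ (s * 2 ^ J))) n) ≤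
          dens 1 (2 ^ (s * 2 ^ J)) * (C * (1 / 16 ^ b + s ^ 16 / 2 ^ s) * N) := by
  obtain ⟨C, hC, s₀, hs₀, H⟩ := sieve_exists
  refine ⟨C, hC, s₀, hs₀, fun b s J hs hJ => ?_⟩
  obtain ⟨ν, a, ha, hper, hν, hN⟩ := H 1 b s J hs hJ
  set z := 2 ^ (s * 2 ^ J) with hz
  set P := (2 ^ s).factorial with hPdef
  have hP : 1 ≤ P := Nat.factorial_pos _
  have hper' : ∀ n, a (n + P) = a n :=
    hper P fun p hp h => (Nat.Prime.dvd_factorial hp).mpr h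
  have hd := dens_pos 1 z
  have hν0 : ∀ n, 0 ≤ ν n := fun n => (div_nonneg (rho_nonneg _ _) hd.le).trans (hν n)
  have haa : ∀ n, a (n + 1 + P - 1) = a n := fun n => by
    rw [← hper' n]; congr 1; omega
  refine ⟨fun n => ν (n - 1), fun n => a (n + P - 1), fun n => hν0 _, fun n => ha _, ?_, ?_, ?_⟩
  · intro n
    simp only
    rw [← hper' (n + P - 1)]; congr 1; omega
  · intro n hn
    have := hν (n - 1)
    rw [one_mul, Nat.sub_add_cancel hn, div_le_iff₀ hd] at this
    simp only
    linarith
  · intro N hNz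
    obtain ⟨h1, h2, h3⟩ := hN N hNz
    refine ⟨fun θ => ?_, ?_, ?_⟩
    · rw [sum_Ioc_zero_eq]
      have : ∑ n ∈ range N, ((ν (n + 1 - 1) - a (n + 1 + P - 1) : ℝ) : ℂ) *
          ex (θ * ((n + 1 : ℕ) : ℝ)) = ex θ * ∑ n ∈ range N, ((ν n - a n : ℝ) : ℂ) * ex (θ * n) := by
        rw [mul_sum]
        refine sum_congr rfl fun n _ => ?_
        rw [haa, Nat.add_sub_cancel, Nat.cast_add, mul_add, ex_add, Nat.cast_one, mul_one]; ring
      rw [this, norm_mul, norm_ex, one_mul]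
      exact h1 θ
    · rw [sum_Ioc_zero_eq]; simpa using h2
    · rw [sum_Ioc_zero_eq]
      refine le_trans (le_of_eq ?_) (mul_le_mul_of_nonneg_left h3 hd.le)
      rw [mul_sum]
      refine sum_congr rfl fun n _ => ?_
      simp only [one_mul, Nat.add_sub_cancel]
      rw [mul_sub, mul_div_cancel₀ _ hd.ne']

/-- Dyadic decomposition of a bilinear sum. -/
lemma norm_bilinear_le_of_dyadic {α γ : ℕ → ℝ} {θ B : ℝ} {z U N : ℕ} (hz : 1 ≤ z)
    (hU : U ^ 2 ≤ N) (hB : 0 ≤ B) (hα : ∀ n, U < n → α n = 0)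
    (h : ∀ X, z ≤ X → X ^ 2 ≤ N → ‖∑ n ∈ Ioc X (2 * X),
      ∑ d ∈ (Ioc 0 (N / X)).filter (fun d => d * n ≤ N),
        ((α n * γ d : ℝ) : ℂ) * ex (θ * (d * n : ℕ))‖ ≤ B) :
    ‖∑ n ∈ Ioc z U, ∑ d ∈ (Ioc 0 N).filter (fun d => d * n ≤ N),
        ((α n * γ d : ℝ) : ℂ) * ex (θ * (d * n : ℕ))‖ ≤ (Nat.log 2 N + 1 : ℕ) * B := by
  set f : ℕ → ℂ := fun n => ∑ d ∈ (Ioc 0 N).filter (fun d => d * n ≤ N),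
        ((α n * γ d : ℝ) : ℂ) * ex (θ * (d * n : ℕ)) with hf
  have hf0 : ∀ n, U < n → f n = 0 := fun n hn => by
    simp [hf, hα n hn]
  have hUN : U ≤ N := le_trans (Nat.le_self_pow (by norm_num) U) hU
  have hblock : ∀ X, z ≤ X → ‖∑ n ∈ Ioc X (2 * X), f n‖ ≤ B := by
    intro X hX
    by_cases hXU : X ≤ U
    · refine le_trans (le_of_eq ?_) (h X hX ((Nat.pow_le_pow_left hXU 2).trans hU))
      congr 1
      refine sum_congr rfl fun n hn => sum_congr ?_ fun _ _ => rfl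
      have hn := mem_Ioc.mp hn
      have hX0 : 0 < X := by omega
      ext d
      simp only [mem_filter, mem_Ioc]
      constructor
      · rintro ⟨⟨h1, h2⟩, h3⟩
        refine ⟨⟨h1, ?_⟩, h3⟩
        rw [Nat.le_div_iff_mul_le hX0]
        exact (Nat.mul_le_mul_left d hn.1.le).trans h3
      · rintro ⟨⟨h1, h2⟩, h3⟩
        exact ⟨⟨h1, h2.trans (Nat.div_le_self _ _)⟩, h3⟩
    · rw [sum_eq_zero fun n hn => hf0 n (by have := mem_Ioc.mp hn; omega), norm_zero]
      exact hB
  have hsum : ∀ T : ℕ, ‖∑ n ∈ Ioc z (z * 2 ^ T), f n‖ ≤ T * B := by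
    intro T
    induction T with
    | zero => simp
    | succ T ih =>
      have h1 : z ≤ z * 2 ^ T := Nat.le_mul_of_pos_right _ (by positivity)
      have h2 : z * 2 ^ (T + 1) = 2 * (z * 2 ^ T) := by ring
      rw [h2, ← sum_Ioc_consecutive f h1 (by omega)]
      refine (norm_add_le _ _).trans ?_
      have := hblock _ h1
      push_cast
      linarith
  refine le_trans (le_of_eq ?_) (hsum (Nat.log 2 N + 1))
  congr 1
  have hN : N < 2 ^ (Nat.log 2 N + 1) := Nat.lt_pow_succ_log_self (by norm_num) N
  have : U ≤ z * 2 ^ (Nat.log 2 N + 1) := by nlinarith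
  refine sum_subset (Ioc_subset_Ioc_right this) fun n h1 h2 => hf0 n ?_
  simp only [mem_Ioc] at h1 h2
  omega

lemma prod_dv_mul_eq {z d e : ℕ} (hd : 0 < d) (he : 0 < e) :
    rho (prm 1 0 z) (d * e) = rho (prm 1 0 z) d * rho (prm 1 0 z) e := by
  unfold rho
  rw [← prod_mul_distrib]
  refine prod_congr rfl fun p hp => ?_
  have hpp := (mem_prm.mp hp).2.1
  unfold dv
  by_cases h1 : p ∣ d <;> by_cases h2 : p ∣ e <;> simp [hpp.dvd_mul, h1, h2]

lemma rho_eq_zero {z n p : ℕ} (hp : p.Prime) (hpz : p ≤ z) (h : p ∣ n) :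
    rho (prm 1 0 z) n = 0 := by
  unfold rho
  refine prod_eq_zero (i := p) ?_ (by simp [dv, h])
  rw [mem_prm]
  exact ⟨⟨hp.pos, hpz⟩, hp, hp.one_lt.ne' ∘ Nat.dvd_one.mp⟩

lemma rho_eq_zero_of_le {z n : ℕ} (h1 : 2 ≤ n) (h2 : n ≤ z) : rho (prm 1 0 z) n = 0 :=
  rho_eq_zero (Nat.minFac_prime (by omega)) ((Nat.minFac_le (by omega)).trans h2) (Nat.minFac_dvd n)

lemma rho_one (z : ℕ) : rho (prm 1 0 z) 1 = 1 := by
  unfold rho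
  refine prod_eq_one fun p hp => ?_
  simp [dv, (mem_prm.mp hp).2.1.one_lt.ne']

lemma rho_prime {z p : ℕ} (hp : p.Prime) (h : z < p) : rho (prm 1 0 z) p = 1 := by
  unfold rho
  refine prod_eq_one fun q hq => ?_
  obtain ⟨⟨_, h2⟩, h1, _⟩ := mem_prm.mp hq
  have : ¬ q ∣ p := fun hd => by
    have := (Nat.prime_dvd_prime_iff_eq h1 hp).mp hd; omega
  simp [dv, this]

lemma rho_anti {z z' : ℕ} (h : z' ≤ z) (n : ℕ) : rho (prm 1 0 z) n ≤ rho (prm 1 0 z') n := by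
  unfold rho
  have hsub : prm 1 0 z' ⊆ prm 1 0 z := fun p hp => by
    rw [mem_prm] at hp ⊢
    exact ⟨⟨hp.1.1, hp.1.2.trans h⟩, hp.2⟩
  rw [← prod_sdiff hsub]
  exact mul_le_of_le_one_left (rho_nonneg _ n) (rho_le_one _ n)

/-- The decomposition of rough numbers weighted by the logarithm. -/
lemma sum_rho_log_eq (z N : ℕ) (θ : ℝ) :
    ∑ m ∈ Ioc 0 N, ((rho (prm 1 0 z) m * Real.log m : ℝ) : ℂ) * ex (θ * m) =
      ∑ e ∈ Ioc 0 N, ∑ d ∈ (Ioc 0 N).filter (fun d => d * e ≤ N),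
        ((rho (prm 1 0 z) e * (rho (prm 1 0 z) d * ArithmeticFunction.vonMangoldt d) : ℝ) : ℂ) *
          ex (θ * (d * e : ℕ)) := by
  have h1 : ∀ m ∈ Ioc 0 N, ((rho (prm 1 0 z) m * Real.log m : ℝ) : ℂ) * ex (θ * m) =
      ∑ e ∈ Ioc 0 N, ∑ d ∈ Ioc 0 N, if d * e = m then
        ((rho (prm 1 0 z) e * (rho (prm 1 0 z) d * ArithmeticFunction.vonMangoldt d) : ℝ) : ℂ) *
          ex (θ * (d * e : ℕ)) else 0 := by
    intro m hm
    have hm := mem_Ioc.mp hm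
    rw [← ArithmeticFunction.vonMangoldt_sum, mul_sum, Complex.ofReal_sum, sum_mul, sum_comm]
    have hsub : m.divisors ⊆ Ioc 0 N := fun d hd => by
      rw [mem_Ioc]
      exact ⟨Nat.pos_of_mem_divisors hd, (Nat.divisor_le hd).trans hm.2⟩
    refine sum_subset_zero_on_sdiff hsub ?_ ?_
    · intro d hd
      refine sum_eq_zero fun e _ => if_neg fun h => ?_
      exact (mem_sdiff.mp hd).2 (Nat.mem_divisors.mpr ⟨⟨e, h.symm⟩, by omega⟩)
    · intro d hd
      have hd0 := Nat.pos_of_mem_divisors hd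
      obtain ⟨e, rfl⟩ := Nat.dvd_of_mem_divisors hd
      have he0 : 0 < e := Nat.pos_of_mul_pos_left hm.1
      rw [sum_eq_single e]
      · rw [if_pos rfl, prod_dv_mul_eq hd0 he0]; push_cast; ring
      · intro e' _ h
        rw [if_neg]
        exact fun h' => h (Nat.eq_of_mul_eq_mul_left hd0 h')
      · intro h
        exact absurd (mem_Ioc.mpr ⟨he0, le_trans (Nat.le_mul_of_pos_left _ hd0) hm.2⟩) h
  rw [sum_congr rfl h1, sum_comm]
  refine sum_congr rfl fun e he => ?_
  rw [sum_comm, sum_filter]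
  refine sum_congr rfl fun d hd => ?_
  have hd := mem_Ioc.mp hd
  have he := mem_Ioc.mp he
  rw [sum_ite_eq]
  have : d * e ∈ Ioc 0 N ↔ d * e ≤ N := by
    rw [mem_Ioc]; exact ⟨fun h => h.2, fun h => ⟨Nat.mul_pos hd.1 he.1, h⟩⟩
  simp only [this]

lemma sum_inv_sqrt_le (N : ℕ) : ∑ m ∈ Ioc 0 N, 1 / √(m : ℝ) ≤ 2 * √N := by
  rw [sum_Ioc_zero_eq]
  induction N with
  | zero => simp
  | succ N ih =>
    rw [sum_range_succ]
    have h1 : 0 < √((N + 1 : ℕ) : ℝ) := Real.sqrt_pos.mpr (by positivity)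
    have h2 := Real.sq_sqrt (by positivity : (0 : ℝ) ≤ ((N + 1 : ℕ) : ℝ))
    have h3 := Real.sq_sqrt (by positivity : (0 : ℝ) ≤ (N : ℝ))
    have h4 := Real.sqrt_nonneg (N : ℝ)
    push_cast at *
    have : 1 / √((N : ℝ) + 1) ≤ 2 * √(N + 1) - 2 * √N := by
      rw [div_le_iff₀ h1]
      nlinarith [sq_nonneg (√((N : ℝ) + 1) - √N)]
    linarith

lemma sum_log_sq_le (N : ℕ) : ∑ m ∈ Ioc 0 N, Real.log (N / m) ^ 2 ≤ 32 * N := by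
  have h : ∀ m ∈ Ioc 0 N, Real.log (N / m) ^ 2 ≤ 16 * √N * (1 / √(m : ℝ)) := by
    intro m hm
    have hm := mem_Ioc.mp hm
    have hm0 : (0 : ℝ) < m := by exact_mod_cast hm.1
    have h1 : (1 : ℝ) ≤ N / m := by
      rw [le_div_iff₀ hm0, one_mul]; exact_mod_cast hm.2
    set x : ℝ := N / m
    have h2 : Real.log x ≤ 4 * √(√x) := by
      have h3 := Real.log_le_sub_one_of_pos (x := √(√x)) (by positivity)
      rw [Real.log_sqrt (by positivity), Real.log_sqrt (by positivity)] at h3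
      linarith
    calc _ ≤ (4 * √(√x)) ^ 2 := pow_le_pow_left₀ (Real.log_nonneg h1) h2 2
      _ = 16 * √x := by rw [mul_pow, Real.sq_sqrt (by positivity)]; norm_num
      _ = _ := by rw [Real.sqrt_div (by positivity)]; ring
  refine (sum_le_sum h).trans ?_
  rw [← mul_sum]
  have := sum_inv_sqrt_le N
  have h0 := Real.sqrt_nonneg (N : ℝ)
  have h3 := Real.mul_self_sqrt (by positivity : (0 : ℝ) ≤ (N : ℝ))
  nlinarith

/-- The von Mangoldt function is concentrated on large primes. -/
lemma norm_sum_vonMangoldt_sub_le {z N : ℕ} (hN : 1 ≤ N) (θ : ℝ) :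
    ‖∑ n ∈ Ioc 0 N, (ArithmeticFunction.vonMangoldt n : ℂ) * ex (θ * n)‖ ≤
      ‖∑ n ∈ Ioc 0 N, ((rho (prm 1 0 z) n * ArithmeticFunction.vonMangoldt n : ℝ) : ℂ) *
        ex (θ * n)‖ + (2 * √N * Real.log N + 2 * z) := by
  have h1 : ∑ n ∈ Ioc 0 N, (ArithmeticFunction.vonMangoldt n : ℂ) * ex (θ * n) =
      ∑ n ∈ Ioc 0 N, ((rho (prm 1 0 z) n * ArithmeticFunction.vonMangoldt n : ℝ) : ℂ) *
        ex (θ * n) + ∑ n ∈ Ioc 0 N, (((1 - rho (prm 1 0 z) n) *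
          ArithmeticFunction.vonMangoldt n : ℝ) : ℂ) * ex (θ * n) := by
    rw [← sum_add_distrib]; refine sum_congr rfl fun n _ => by push_cast; ring
  rw [h1]
  refine (norm_add_le _ _).trans (add_le_add le_rfl ?_)
  have h2 : ∀ n ∈ Ioc 0 N, ‖(((1 - rho (prm 1 0 z) n) *
      ArithmeticFunction.vonMangoldt n : ℝ) : ℂ) * ex (θ * n)‖ ≤
      (ArithmeticFunction.vonMangoldt n - if n.Prime then Real.log n else 0) +
        if n ∈ Ioc 0 z ∧ n.Prime then Real.log n else 0 := by
    intro n hn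
    have hn := mem_Ioc.mp hn
    have hΛ := ArithmeticFunction.vonMangoldt_nonneg (n := n)
    have hr0 := rho_nonneg (prm 1 0 z) n
    have hr1 := rho_le_one (prm 1 0 z) n
    rw [norm_mul, norm_ex, mul_one, Complex.norm_real, Real.norm_eq_abs,
      abs_of_nonneg (mul_nonneg (by linarith) hΛ)]
    by_cases hp : n.Prime
    · have hl : 0 ≤ Real.log n := Real.log_natCast_nonneg n
      rw [if_pos hp, ArithmeticFunction.vonMangoldt_apply_prime hp]
      by_cases hz : n ≤ z
      · rw [if_pos ⟨mem_Ioc.mpr ⟨hn.1, hz⟩, hp⟩]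
        nlinarith
      · rw [rho_prime hp (not_le.mp hz)]
        split_ifs <;> linarith
    · rw [if_neg hp, if_neg fun h => hp h.2]
      nlinarith
  refine (norm_sum_le _ _).trans ((sum_le_sum h2).trans ?_)
  rw [sum_add_distrib, sum_sub_distrib, ← sum_filter]
  have hψ : Chebyshev.psi N = ∑ n ∈ Ioc 0 N, ArithmeticFunction.vonMangoldt n := by
    simp [Chebyshev.psi]
  have hθ : Chebyshev.theta N = ∑ n ∈ (Ioc 0 N).filter Nat.Prime, Real.log n := by
    simp [Chebyshev.theta]
  have hθz : Chebyshev.theta z = ∑ n ∈ (Ioc 0 z).filter Nat.Prime, Real.log n := by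
    simp [Chebyshev.theta]
  have h3 := Chebyshev.abs_psi_sub_theta_le_sqrt_mul_log (x := N) (by exact_mod_cast hN)
  have h4 := Chebyshev.theta_le_log4_mul_x (x := z) (by positivity)
  have h5 : ∑ n ∈ Ioc 0 N, (if n ∈ Ioc 0 z ∧ n.Prime then Real.log n else 0) ≤
      Chebyshev.theta z := by
    rw [hθz, ← sum_filter]
    refine sum_le_sum_of_subset_of_nonneg (fun n hn => ?_) fun n _ _ => Real.log_natCast_nonneg n
    rw [mem_filter] at hn ⊢
    exact hn.2
  have h6 : Real.log 4 ≤ 2 := by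
    have : Real.log 4 = 2 * Real.log 2 := by
      rw [show (4 : ℝ) = 2 ^ 2 by norm_num, Real.log_pow]; norm_num
    have := Real.log_two_lt_d9
    linarith
  rw [← hψ, ← hθ]
  have := (abs_le.mp h3).2
  have : Real.log 4 * z ≤ 2 * z := by gcongr
  linarith

end SchurPrimes

namespace SchurPrimes
open Finset

/-- Splitting the rough hyperbola into the prime part and two bilinear sums. -/
lemma norm_sum_rho_vonMangoldt_le {z U N : ℕ} (hz : 1 ≤ z) (hzU : z ≤ U) (hU : U ^ 2 ≤ N)
    (hU' : N < (U + 1) ^ 2) (θ : ℝ) {R L : ℕ → ℝ} (hR1 : R 1 = 1)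
    (hR : ∀ n, 2 ≤ n → n ≤ z → R n = 0) (hL : ∀ n, n ≤ z → L n = 0) :
    ‖∑ n ∈ Ioc 0 N, (L n : ℂ) * ex (θ * n)‖ ≤
      ‖∑ e ∈ Ioc 0 N, ∑ d ∈ (Ioc 0 N).filter (fun d => d * e ≤ N),
        ((R e * L d : ℝ) : ℂ) * ex (θ * (d * e : ℕ))‖ +
      ‖∑ e ∈ Ioc z U, ∑ d ∈ (Ioc 0 N).filter (fun d => d * e ≤ N),
        ((R e * L d : ℝ) : ℂ) * ex (θ * (d * e : ℕ))‖ +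
      ‖∑ d ∈ Ioc z U, ∑ e ∈ (Ioc 0 N).filter (fun e => e * d ≤ N),
        ((L d * (if U < e then R e else 0) : ℝ) : ℂ) * ex (θ * (e * d : ℕ))‖ := by
  have hUN : U ≤ N := le_trans (Nat.le_self_pow (by norm_num) U) hU
  set F : ℕ → ℂ := fun e => ∑ d ∈ (Ioc 0 N).filter (fun d => d * e ≤ N),
        ((R e * L d : ℝ) : ℂ) * ex (θ * (d * e : ℕ)) with hF
  have h1 : F 1 = ∑ n ∈ Ioc 0 N, (L n : ℂ) * ex (θ * n) := by
    rw [hF]; simp only [mul_one, hR1, one_mul]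
    refine sum_congr ?_ fun _ _ => rfl
    ext d; simp
  have h2 : ∑ e ∈ Ioc 0 N, F e = F 1 + ∑ e ∈ Ioc z U, F e + ∑ e ∈ Ioc U N, F e := by
    rw [← sum_Ioc_consecutive F (Nat.zero_le U) hUN, ← sum_Ioc_consecutive F (Nat.zero_le z) hzU]
    congr 2
    refine sum_eq_single 1 (fun n hn hn1 => ?_) fun h => absurd (mem_Ioc.mpr ⟨one_pos, hz⟩) h
    have hn := mem_Ioc.mp hn
    rw [hF]; simp [hR n (by omega) hn.2]
  have h3 : ∑ e ∈ Ioc U N, F e = ∑ d ∈ Ioc z U, ∑ e ∈ (Ioc 0 N).filter (fun e => e * d ≤ N),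
        ((L d * (if U < e then R e else 0) : ℝ) : ℂ) * ex (θ * (e * d : ℕ)) := by
    have e1 : ∀ e ∈ Ioc U N, F e = ∑ d ∈ Ioc z U, if d * e ≤ N then
        ((R e * L d : ℝ) : ℂ) * ex (θ * (d * e : ℕ)) else 0 := by
      intro e he
      have he := mem_Ioc.mp he
      rw [hF]
      simp only
      rw [sum_filter]
      symm
      refine sum_subset (fun d hd => ?_) fun d hd hd' => ?_
      · rw [mem_Ioc] at hd ⊢; omega
      · split_ifs with hde
        · have hdU : d ≤ U := by
            by_contra h
            have : (U + 1) * (U + 1) ≤ d * e := Nat.mul_le_mul (by omega) (by omega)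
            nlinarith
          have : d ≤ z := by
            rw [mem_Ioc] at hd'; omega
          simp [hL d this]
        · rfl
    rw [sum_congr rfl e1, sum_comm]
    refine sum_congr rfl fun d hd => ?_
    rw [sum_filter]
    have : ∀ e, (if e * d ≤ N then ((L d * (if U < e then R e else 0) : ℝ) : ℂ) *
        ex (θ * (e * d : ℕ)) else 0) = if U < e then (if d * e ≤ N then
          ((R e * L d : ℝ) : ℂ) * ex (θ * (d * e : ℕ)) else 0) else 0 := by
      intro e
      rw [mul_comm e d, mul_comm (L d)]
      split_ifs <;> simp
    have hs : Ioc U N = (Ioc 0 N).filter (fun e => U < e) := by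
      ext e; simp only [mem_filter, mem_Ioc]; omega
    rw [hs, sum_filter]
    exact sum_congr rfl fun e _ => (this e).symm
  have h4 : F 1 = ∑ e ∈ Ioc 0 N, F e - ∑ e ∈ Ioc z U, F e - ∑ e ∈ Ioc U N, F e := by
    rw [h2]; ring
  rw [← h1, h4, ← h3]
  refine (norm_sub_le _ _).trans (add_le_add (norm_sub_le _ _) le_rfl)

/-- The smooth part of the decomposition: logarithmically weighted rough numbers. -/
lemma norm_sum_rho_log_le {ν a : ℕ → ℝ} {R : ℕ → ℝ} {A C V r δ ε θ : ℝ} {P N : ℕ} (hP : 1 ≤ P)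
    (hN : 1 ≤ N) (hV : 0 ≤ V)
    (ha : ∀ n, 0 ≤ a n ∧ a n ≤ A) (hper : ∀ n, a (n + P) = a n) (hr : 0 < r)
    (hRν : ∀ n, 1 ≤ n → 0 ≤ R n ∧ R n ≤ V * ν n) (hR1 : ∀ n, R n ≤ 1)
    (hF : ‖∑ n ∈ Ioc 0 N, ((ν n - a n : ℝ) : ℂ) * ex (θ * n)‖ ≤ δ * N)
    (hS : ∑ n ∈ Ioc 0 N, ν n ≤ C * N)
    (hD : ∑ n ∈ Ioc 0 N, (V * ν n - R n) ≤ V * (ε * N)) (hθ : r < nn (P * θ)) :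
    ‖∑ m ∈ Ioc 0 N, ((R m * Real.log m : ℝ) : ℂ) * ex (θ * m)‖ ≤
      V * Real.log N * ((δ + ε) * N + A * P / r) + √(32 * V * C) * N := by
  have hN0 : (0 : ℝ) < N := by exact_mod_cast hN
  have hlog : 0 ≤ Real.log N := Real.log_natCast_nonneg N
  have e1 : ∑ m ∈ Ioc 0 N, ((R m * Real.log m : ℝ) : ℂ) * ex (θ * m) =
      Real.log N * ∑ m ∈ Ioc 0 N, (R m : ℂ) * ex (θ * m) -
        ∑ m ∈ Ioc 0 N, ((R m * Real.log (N / m) : ℝ) : ℂ) * ex (θ * m) := by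
    rw [mul_sum, ← sum_sub_distrib]
    refine sum_congr rfl fun m hm => ?_
    have hm : (0 : ℝ) < m := by exact_mod_cast (mem_Ioc.mp hm).1
    rw [Real.log_div hN0.ne' hm.ne']; push_cast; ring
  have h1 : ‖∑ m ∈ Ioc 0 N, (R m : ℂ) * ex (θ * m)‖ ≤ V * ((δ + ε) * N + A * P / r) := by
    have e2 : ∑ m ∈ Ioc 0 N, (R m : ℂ) * ex (θ * m) =
        V * ∑ m ∈ Ioc 0 N, (ν m : ℂ) * ex (θ * m) -
          ∑ m ∈ Ioc 0 N, ((V * ν m - R m : ℝ) : ℂ) * ex (θ * m) := by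
      rw [mul_sum, ← sum_sub_distrib]
      refine sum_congr rfl fun m hm => by push_cast; ring
    rw [e2]
    refine (norm_sub_le _ _).trans ?_
    have h2 := norm_sum_weight_le (φ := θ) hP ha hper hr hF
    rw [if_neg (not_le.mpr hθ), add_zero] at h2
    have h3 : ‖∑ m ∈ Ioc 0 N, ((V * ν m - R m : ℝ) : ℂ) * ex (θ * m)‖ ≤ V * (ε * N) := by
      refine (norm_sum_le _ _).trans (le_trans (le_of_eq ?_) hD)
      refine sum_congr rfl fun m hm => ?_
      rw [norm_mul, norm_ex, mul_one, Complex.norm_real, Real.norm_eq_abs, abs_of_nonneg]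
      linarith [(hRν m (mem_Ioc.mp hm).1).2]
    rw [norm_mul, Complex.norm_real, Real.norm_eq_abs, abs_of_nonneg hV]
    calc _ ≤ V * (δ * N + A * P / r) + V * (ε * N) := by gcongr
      _ = _ := by ring
  have h4 : ‖∑ m ∈ Ioc 0 N, ((R m * Real.log (N / m) : ℝ) : ℂ) * ex (θ * m)‖ ≤
      √(32 * V * C) * N := by
    have hl : ∀ m ∈ Ioc 0 N, 0 ≤ Real.log (N / m) := fun m hm => by
      have hm := mem_Ioc.mp hm
      have hm0 : (0 : ℝ) < m := by exact_mod_cast hm.1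
      refine Real.log_nonneg ?_
      rw [le_div_iff₀ hm0, one_mul]; exact_mod_cast hm.2
    have h5 : ‖∑ m ∈ Ioc 0 N, ((R m * Real.log (N / m) : ℝ) : ℂ) * ex (θ * m)‖ ≤
        ∑ m ∈ Ioc 0 N, R m * Real.log (N / m) := by
      refine (norm_sum_le _ _).trans (le_of_eq (sum_congr rfl fun m hm => ?_))
      rw [norm_mul, norm_ex, mul_one, Complex.norm_real, Real.norm_eq_abs,
        abs_of_nonneg (mul_nonneg (hRν m (mem_Ioc.mp hm).1).1 (hl m hm))]
    refine h5.trans ?_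
    have h6 : (∑ m ∈ Ioc 0 N, R m * Real.log (N / m)) ^ 2 ≤
        (∑ m ∈ Ioc 0 N, V * ν m) * ∑ m ∈ Ioc 0 N, Real.log (N / m) ^ 2 := by
      refine sum_sq_le_sum_mul_sum_of_sq_le_mul _ (fun m hm => ?_) (fun m _ => sq_nonneg _)
        fun m hm => ?_
      · exact (hRν m (mem_Ioc.mp hm).1).1.trans (hRν m (mem_Ioc.mp hm).1).2
      · rw [mul_pow]
        refine mul_le_mul_of_nonneg_right ?_ (sq_nonneg _)
        obtain ⟨h7, h8⟩ := hRν m (mem_Ioc.mp hm).1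
        have := hR1 m
        nlinarith
    have h7 : ∑ m ∈ Ioc 0 N, V * ν m ≤ V * (C * N) := by
      rw [← mul_sum]; exact mul_le_mul_of_nonneg_left hS hV
    have h8 := sum_log_sq_le N
    have h9 : 0 ≤ ∑ m ∈ Ioc 0 N, V * ν m :=
      sum_nonneg fun m hm => (hRν m (mem_Ioc.mp hm).1).1.trans (hRν m (mem_Ioc.mp hm).1).2
    have h10 : (∑ m ∈ Ioc 0 N, R m * Real.log (N / m)) ^ 2 ≤ (32 * V * C) * N ^ 2 := by
      refine h6.trans ((mul_le_mul h7 h8 (sum_nonneg fun _ _ => sq_nonneg _) (h9.trans h7)).trans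
        (le_of_eq (by ring)))
    calc _ ≤ √((32 * V * C) * N ^ 2) := Real.le_sqrt_of_sq_le h10
      _ = _ := by
        rw [mul_comm, Real.sqrt_mul (by positivity), Real.sqrt_sq hN0.le, mul_comm]
  rw [e1]
  refine (norm_sub_le _ _).trans (add_le_add ?_ h4)
  rw [norm_mul, Complex.norm_real, Real.norm_eq_abs, abs_of_nonneg hlog]
  calc _ ≤ Real.log N * (V * ((δ + ε) * N + A * P / r)) := by gcongr
    _ = _ := by ring

/-- Dyadic choice of the sieving level. -/
lemma exists_sieve_level {t J₀ N : ℕ} (ht : 2 ≤ t) (hN : t ^ 2 ^ J₀ ≤ N) :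
    ∃ J, J₀ ≤ J ∧ t ^ 2 ^ J ≤ N ∧ N < (t ^ 2 ^ J) ^ 2 := by
  have hex : ∃ J, N < t ^ 2 ^ J := by
    refine ⟨N, ?_⟩
    calc N < 2 ^ N := Nat.lt_two_pow_self
      _ ≤ t ^ N := Nat.pow_le_pow_left ht N
      _ ≤ t ^ 2 ^ N := Nat.pow_le_pow_right (by omega) Nat.lt_two_pow_self.le
  have h1 := Nat.find_spec hex
  have hlt : J₀ < Nat.find hex := by
    by_contra h
    have : t ^ 2 ^ Nat.find hex ≤ t ^ 2 ^ J₀ :=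
      Nat.pow_le_pow_right (by omega) (Nat.pow_le_pow_right (by norm_num) (not_lt.mp h))
    omega
  refine ⟨Nat.find hex - 1, by omega, ?_, ?_⟩
  · exact not_lt.mp (Nat.find_min hex (by omega))
  · rw [← pow_mul, ← pow_succ, Nat.sub_add_cancel (by omega)]
    exact h1
end SchurPrimes

namespace SchurPrimes
open Finset

lemma eventually_sqrt_mul_log_le (K C δ : ℝ) (hδ : 0 < δ) : ∀ᶠ N : ℕ in Filter.atTop,
    2 * √(N : ℝ) * Real.log N + 2 * √(N : ℝ) ≤ δ * N ∧
      √(32 * (2 * K / Real.log N) * C) ≤ δ := by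
  have t1 : Filter.Tendsto (fun x : ℝ => Real.log x / x ^ (1 / 2 : ℝ)) Filter.atTop (nhds 0) :=
    (isLittleO_log_rpow_atTop (by norm_num)).tendsto_div_nhds_zero
  have t2 : Filter.Tendsto (fun x : ℝ => 2 * (Real.log x / x ^ (1 / 2 : ℝ)) +
      2 * x ^ (-(1 / 2) : ℝ)) Filter.atTop (nhds (2 * 0 + 2 * 0)) :=
    (t1.const_mul 2).add ((tendsto_rpow_neg_atTop (by norm_num)).const_mul 2)
  have t3 := t2.comp (tendsto_natCast_atTop_atTop (R := ℝ))
  have t4 : Filter.Tendsto (fun x : ℝ => √(32 * (2 * K / Real.log x) * C)) Filter.atTop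
      (nhds √(32 * 0 * C)) :=
    (((Real.tendsto_log_atTop.const_div_atTop (2 * K)).const_mul 32).mul_const C).sqrt
  have t5 := t4.comp (tendsto_natCast_atTop_atTop (R := ℝ))
  simp only [mul_zero, zero_mul, add_zero, Real.sqrt_zero] at t3 t5
  filter_upwards [t3.eventually (gt_mem_nhds hδ), t5.eventually (gt_mem_nhds hδ),
    Filter.eventually_ge_atTop 1] with N h1 h2 hN
  have hN0 : (0 : ℝ) < N := by exact_mod_cast hN
  refine ⟨?_, h2.le⟩
  simp only [Function.comp] at h1
  rw [Real.rpow_neg hN0.le, ← Real.sqrt_eq_rpow] at h1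
  have hsq := Real.mul_self_sqrt hN0.le
  have hsp := Real.sqrt_pos.mpr hN0
  calc 2 * √(N : ℝ) * Real.log N + 2 * √(N : ℝ) =
      (2 * (Real.log N / √N) + 2 * (√N)⁻¹) * (√N * √N) := by field_simp
    _ ≤ δ * N := by rw [hsq]; gcongr

lemma nat_log_two_add_one_le {N : ℕ} (hN : 3 ≤ N) :
    ((Nat.log 2 N + 1 : ℕ) : ℝ) ≤ 3 * Real.log N := by
  have hlog1 : 1 ≤ Real.log N := by
    rw [Real.le_log_iff_exp_le (by positivity)]
    have : (3 : ℝ) ≤ N := by exact_mod_cast hN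
    linarith [Real.exp_one_lt_d9]
  have h7 : (2 : ℝ) ^ Nat.log 2 N ≤ N := by exact_mod_cast Nat.pow_log_le_self 2 (by omega)
  have h8 := Real.log_le_log (by positivity) h7
  rw [Real.log_pow] at h8
  have h9 : (Nat.log 2 N : ℝ) * (2 / 3) ≤ Nat.log 2 N * Real.log 2 := by
    gcongr; linarith [Real.log_two_gt_d9]
  push_cast
  linarith

set_option maxHeartbeats 2000000 in
/-- The Fourier bound for the von Mangoldt function in terms of the sieve parameters. -/
lemma exists_norm_sum_vonMangoldt_le : ∃ C : ℝ, 1 ≤ C ∧ ∃ s₀ : ℕ, 1 ≤ s₀ ∧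
    ∀ (b s : ℕ) (σ : ℝ), s₀ ≤ s → 0 < σ → σ ≤ 1 → ∃ Q : ℕ, 1 ≤ Q ∧ ∃ N₀ : ℕ, ∀ N, N₀ ≤ N →
      ∀ θ : ℝ, (∀ h : ℕ, 1 ≤ h → h ≤ Q → (Q : ℝ) / N < nn (h * θ)) →
      ‖∑ n ∈ Ioc 0 N, (ArithmeticFunction.vonMangoldt n : ℂ) * ex (θ * n)‖ ≤
        (2 * (12 * b + 30) * (3 * (C * (s ^ 16 / 2 ^ s)) + C / 16 ^ b) +
          2 * (C * (s ^ 16 / 2 ^ s)) + 6 * (128 * (12 * b + 30)) ^ 2 *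
          √(C ^ 3 * (20 * (C * s ^ 8) * (C * (s ^ 16 / 2 ^ s)) + 16 * (C * s ^ 8) ^ 3 * σ))) * N := by
  obtain ⟨C, hC, s₀, hs₀, H⟩ := sieve_Ioc
  refine ⟨C, hC, s₀, hs₀, fun b s σ hs hσ hσ1 => ?_⟩
  set K : ℕ := 12 * b + 30 with hK
  have hKr : (12 * b + 30 : ℝ) = K := by rw [hK]; push_cast; ring
  set δ : ℝ := C * (s ^ 16 / 2 ^ s) with hδdef
  set A : ℝ := C * s ^ 8 with hAdef
  set P : ℕ := (2 ^ s).factorial with hPdef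
  set E : ℝ := √(C ^ 3 * (20 * A * δ + 16 * A ^ 3 * σ)) with hE
  have hs1 : 1 ≤ s := hs₀.trans hs
  have hs1r : (1 : ℝ) ≤ s := by exact_mod_cast hs1
  have hδ : 0 < δ := by positivity
  have hA : 1 ≤ A := by
    have : (1 : ℝ) ≤ (s : ℝ) ^ 8 := one_le_pow₀ hs1r
    nlinarith
  have hP : 1 ≤ P := Nat.factorial_pos _
  obtain ⟨Q, hQ⟩ := exists_nat_ge ((P : ℝ) + 12 * P / σ +
    (144 * 26 * 416 * 2) * A ^ 2 * P ^ 2 / σ ^ 6 + A * P / δ)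
  have hP0 : (0 : ℝ) < P := by exact_mod_cast hP
  have q1 : (0 : ℝ) ≤ 12 * P / σ := by positivity
  have q2 : (0 : ℝ) ≤ (144 * 26 * 416 * 2) * A ^ 2 * P ^ 2 / σ ^ 6 := by positivity
  have q3 : (0 : ℝ) ≤ A * P / δ := by positivity
  have hPQ : P ≤ Q := by
    have : (P : ℝ) ≤ Q := by linarith
    exact_mod_cast this
  obtain ⟨J₁, hJ₁⟩ := exists_nat_ge ((208 * 72 * 2) * A * P / σ ^ 4)
  set J₀ : ℕ := 3 * s + J₁ + 6 with hJ₀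
  have hsm := eventually_sqrt_mul_log_le K C δ hδ
  obtain ⟨N₁, hN₁⟩ := Filter.eventually_atTop.mp hsm
  refine ⟨Q, hP.trans hPQ, max (max N₁ 3) ((2 ^ (s * K)) ^ 2 ^ J₀), fun N hN θ hθ => ?_⟩
  have hN3 : 3 ≤ N := (le_max_right _ _).trans ((le_max_left _ _).trans hN)
  obtain ⟨hb1, hb2⟩ := hN₁ N ((le_max_left _ _).trans ((le_max_left _ _).trans hN))
  have hN0 : (0 : ℝ) < N := by positivity
  obtain ⟨J, hJ, hJN, hNJ⟩ := exists_sieve_level (t := 2 ^ (s * K)) (N := N) (J₀ := J₀)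
    (by calc 2 = 2 ^ 1 := rfl
          _ ≤ _ := Nat.pow_le_pow_right (by norm_num) (Nat.mul_pos hs1 (by omega)))
    ((le_max_right _ _).trans hN)
  set z : ℕ := 2 ^ (s * 2 ^ J) with hz
  have hzt : (2 ^ (s * K)) ^ 2 ^ J = z ^ K := by rw [hz, ← pow_mul, ← pow_mul]; ring_nf
  rw [hzt] at hJN hNJ
  obtain ⟨J₂, rfl⟩ : ∃ J₂, J = J₂ + 6 := ⟨J - 6, by omega⟩
  set z₂ : ℕ := 2 ^ (s * 2 ^ J₂) with hz₂
  have hzz : z = z₂ ^ 64 := by rw [hz, hz₂, ← pow_mul]; ring_nf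
  have hz₂2 : 2 ≤ z₂ := by
    calc 2 = 2 ^ 1 := rfl
      _ ≤ _ := Nat.pow_le_pow_right (by norm_num) (Nat.mul_pos hs1 (by positivity))
  have hz₂z : z₂ ≤ z := by rw [hzz]; exact Nat.le_self_pow (by norm_num) _
  have hz1 : 1 ≤ z := by omega
  have hJ2s : 3 * s ≤ 2 ^ J₂ := by
    have : J₂ < 2 ^ J₂ := Nat.lt_two_pow_self
    omega
  have hJs : 3 * s ≤ 2 ^ (J₂ + 6) := hJ2s.trans (Nat.pow_le_pow_right (by norm_num) (by omega))
  have hzJ : J₁ ≤ z := by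
    have h1 : J₂ < 2 ^ J₂ := Nat.lt_two_pow_self
    have h2 : 2 ^ J₂ < 2 ^ 2 ^ J₂ := Nat.lt_two_pow_self
    have h3 : 2 ^ 2 ^ J₂ ≤ z₂ := Nat.pow_le_pow_right (by norm_num) (Nat.le_mul_of_pos_left _ hs1)
    omega
  have hz2N : z ^ 2 ≤ N := (Nat.pow_le_pow_right hz1 (by omega)).trans hJN
  have H1 := H b s (J₂ + 6) hs hJs
  have H2 := H 1 s J₂ hs hJ2s
  have hδ2 : C * (1 / 16 ^ b + (s : ℝ) ^ 16 / 2 ^ s) = C / 16 ^ b + δ := by rw [hδdef]; ring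
  have hE2 : E ^ 2 = C ^ 3 * (20 * A * δ + 16 * A ^ 3 * σ) := Real.sq_sqrt (by positivity)
  have hE0 : 0 ≤ E := Real.sqrt_nonneg _
  simp only [← hδdef, ← hAdef, ← hPdef, ← hz, ← hz₂, hδ2] at H1 H2
  clear_value δ A P E K z z₂
  obtain ⟨ν, a, hν0, ha, hper, hRν, hLev⟩ := H1
  obtain ⟨ν', a', hν0', ha', hper', hRν', hLev'⟩ := H2
  set V := dens 1 z with hV
  set V' := dens 1 z₂ with hV'
  have hV0 : 0 < V := dens_pos _ _
  have hV0' : 0 < V' := dens_pos _ _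
  have hlog1 : 1 ≤ Real.log N := by
    rw [Real.le_log_iff_exp_le hN0]
    have : (3 : ℝ) ≤ N := by exact_mod_cast hN3
    linarith [Real.exp_one_lt_d9]
  have hlogN : Real.log N ≤ 2 * K * Real.log z := by
    have h1 : (N : ℝ) ≤ (z : ℝ) ^ (K * 2) := by
      rw [pow_mul]; exact_mod_cast hNJ.le
    calc Real.log N ≤ Real.log ((z : ℝ) ^ (K * 2)) := Real.log_le_log hN0 h1
      _ = _ := by rw [Real.log_pow]; push_cast; ring
  have hVlog : V * Real.log N ≤ 2 * K := by
    have := dens_mul_log_le 1 z le_rfl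
    simp only [Nat.totient_one, Nat.cast_one, div_one, mul_one] at this
    calc V * Real.log N ≤ V * (2 * K * Real.log z) := by gcongr
      _ = 2 * K * (V * Real.log z) := by ring
      _ ≤ 2 * K * 1 := by gcongr
      _ = _ := by ring
  have hVlog' : V' * Real.log N ≤ 128 * K := by
    have := dens_mul_log_le 1 z₂ le_rfl
    simp only [Nat.totient_one, Nat.cast_one, div_one, mul_one] at this
    have hl : Real.log z = 64 * Real.log z₂ := by rw [hzz]; push_cast; rw [Real.log_pow]; norm_num
    calc V' * Real.log N ≤ V' * (2 * K * Real.log z) := by gcongr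
      _ = 128 * K * (V' * Real.log z₂) := by rw [hl]; ring
      _ ≤ 128 * K * 1 := by gcongr
      _ = _ := by ring
  set R : ℕ → ℝ := rho (prm 1 0 z) with hR
  have hR0 : ∀ n, 0 ≤ R n := fun n => rho_nonneg _ _
  have hR1 : ∀ n, R n ≤ 1 := fun n => rho_le_one _ _
  have hR2 : ∀ n, 1 ≤ n → R n ≤ V' * ν' n := fun n hn => (rho_anti hz₂z n).trans (hRν' n hn)
  -- reduce to rough numbers and decompose
  have h1 := norm_sum_vonMangoldt_sub_le (z := z) (N := N) (by omega) θ
  set U := Nat.sqrt N with hU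
  have hUN : U ^ 2 ≤ N := by rw [sq]; exact Nat.sqrt_le N
  have hNU : N < (U + 1) ^ 2 := by rw [sq]; exact Nat.lt_succ_sqrt N
  have hzU : z ≤ U := by rw [hU, Nat.le_sqrt, ← sq]; exact hz2N
  have hUleN : U ≤ N := Nat.sqrt_le_self N
  have h2 := norm_sum_rho_vonMangoldt_le hz1 hzU hUN hNU θ (R := R)
    (L := fun n => R n * ArithmeticFunction.vonMangoldt n) (rho_one z)
    (fun n h h' => rho_eq_zero_of_le h h') fun n hn => by
      rcases Nat.lt_or_ge n 2 with h | h
      · interval_cases n <;> simp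
      · simp [hR, rho_eq_zero_of_le h hn]
  have h3 := sum_rho_log_eq z N θ
  rw [← hR] at h3
  -- the smooth part
  have hQ0 : (0 : ℝ) < Q := by exact_mod_cast hP.trans hPQ
  obtain ⟨l1, l2, l3⟩ := hLev N ((Nat.pow_le_pow_right hz1 (by omega)).trans hJN)
  have h4 := norm_sum_rho_log_le (R := R) (r := (Q : ℝ) / N) (θ := θ) hP (by omega) hV0.le ha hper
    (by positivity) (fun n hn => ⟨hR0 n, hRν n hn⟩) hR1 (l1 θ) l2 l3 (hθ P hP hPQ)
  have h5 : V * Real.log N * ((δ + (C / 16 ^ b + δ)) * N + A * P / (Q / N)) +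
      √(32 * V * C) * N ≤ (2 * K * (3 * δ + C / 16 ^ b) + δ) * N := by
    have e1 : A * P / ((Q : ℝ) / N) ≤ δ * N := by
      have : A * P / δ ≤ Q := by linarith
      rw [div_le_iff₀ hδ] at this
      rw [div_div_eq_mul_div, div_le_iff₀ hQ0]
      nlinarith
    have e2 : √(32 * V * C) ≤ δ := by
      refine le_trans (Real.sqrt_le_sqrt ?_) hb2
      have : V ≤ 2 * K / Real.log N := by rwa [le_div_iff₀ (by linarith)]
      gcongr
    calc _ ≤ 2 * K * ((δ + (C / 16 ^ b + δ)) * N + δ * N) + δ * N := by gcongr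
      _ = _ := by ring
  -- the bilinear parts
  have hbil : ∀ α γ : ℕ → ℝ, (∀ n, U < n → α n = 0) → (∀ n, 0 ≤ α n ∧ α n ≤ V' * ν' n) →
      (∀ n, 0 ≤ γ n ∧ γ n ≤ V' * ν' n) →
      Real.log N * ‖∑ n ∈ Ioc z U, ∑ d ∈ (Ioc 0 N).filter (fun d => d * n ≤ N),
        ((α n * γ d : ℝ) : ℂ) * ex (θ * (d * n : ℕ))‖ ≤ 3 * (128 * K) ^ 2 * E * N := by
    intro α γ hαU hα hγ
    have hB := norm_bilinear_le_of_dyadic (γ := γ) (θ := θ) (B := V' ^ 2 * N * E) hz1 hUN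
      (by positivity) hαU fun X hzX hXN => by
        have hzXr : (z : ℝ) ≤ X := by exact_mod_cast hzX
        have hzJr : (J₁ : ℝ) ≤ z := by exact_mod_cast hzJ
        have hb := bilinear_le (θ := θ) (Y₀ := z₂ ^ 40) hA hC hP hV0'.le hδ.le hσ hσ1 hν0' ha' hper'
          (fun Y hY => (hLev' Y (by simpa using hY)).1)
          (fun Y hY => (hLev' Y (by simpa using hY)).2.1) hα hγ
          (by linarith) (by
            have : z₂ ^ 40 * 2 ≤ z := by
              rw [hzz]
              calc z₂ ^ 40 * 2 ≤ z₂ ^ 40 * z₂ := by gcongr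
                _ = z₂ ^ 41 := by ring
                _ ≤ z₂ ^ 64 := Nat.pow_le_pow_right (by omega) (by norm_num)
            omega) hXN fun h hh1 hh2 => by
              refine lt_of_le_of_lt ?_ (hθ h hh1 ?_)
              · rw [← div_div]; gcongr; linarith
              · have : (h : ℝ) ≤ Q := by linarith
                exact_mod_cast this
        refine le_of_sq_le_sq (hb.trans (le_of_eq ?_)) (by positivity)
        linear_combination (-(V' ^ 4 * (N : ℝ) ^ 2)) * hE2
    have hl2 := nat_log_two_add_one_le hN3
    calc _ ≤ Real.log N * ((3 * Real.log N) * (V' ^ 2 * N * E)) := by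
          refine mul_le_mul_of_nonneg_left (hB.trans ?_) (by linarith)
          exact mul_le_mul_of_nonneg_right hl2 (by positivity)
      _ = 3 * (V' * Real.log N) ^ 2 * E * N := by ring
      _ ≤ _ := by gcongr
  set α₁ : ℕ → ℝ := fun n => if 1 ≤ n ∧ n ≤ N then R n else 0 with hα₁
  set α₂ : ℕ → ℝ := fun n => if 1 ≤ n ∧ n ≤ N then
    R n * ArithmeticFunction.vonMangoldt n / Real.log N else 0 with hα₂
  have hα₁b : ∀ n, 0 ≤ α₁ n ∧ α₁ n ≤ V' * ν' n := fun n => by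
    simp only [hα₁]
    split_ifs with h
    · exact ⟨hR0 n, hR2 n h.1⟩
    · exact ⟨le_rfl, mul_nonneg hV0'.le (hν0' n)⟩
  have hα₂b : ∀ n, 0 ≤ α₂ n ∧ α₂ n ≤ V' * ν' n := fun n => by
    simp only [hα₂]
    split_ifs with h
    · refine ⟨div_nonneg (mul_nonneg (hR0 n) ArithmeticFunction.vonMangoldt_nonneg) (by linarith),
        le_trans ?_ (hR2 n h.1)⟩
      rw [div_le_iff₀ (by linarith)]
      refine mul_le_mul_of_nonneg_left (ArithmeticFunction.vonMangoldt_le_log.trans ?_) (hR0 n)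
      exact Real.log_le_log (by exact_mod_cast h.1) (by exact_mod_cast h.2)
    · exact ⟨le_rfl, mul_nonneg hV0'.le (hν0' n)⟩
  have cut : ∀ β : ℕ → ℝ, (∀ n, 0 ≤ β n ∧ β n ≤ V' * ν' n) → ∀ p : ℕ → Prop, ∀ [DecidablePred p],
      ∀ n, 0 ≤ (if p n then β n else 0) ∧ (if p n then β n else 0) ≤ V' * ν' n := by
    intro β hβ p _ n
    split_ifs
    · exact hβ n
    · exact ⟨le_rfl, mul_nonneg hV0'.le (hν0' n)⟩
  have h6 := hbil (fun n => if n ≤ U then α₁ n else 0) α₂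
    (fun n hn => if_neg (not_le.mpr hn)) (cut _ hα₁b _) hα₂b
  have h7 := hbil (fun n => if n ≤ U then α₂ n else 0) (fun n => if U < n then α₁ n else 0)
    (fun n hn => if_neg (not_le.mpr hn)) (cut _ hα₂b _) (cut _ hα₁b _)
  have hlog0 : Real.log N ≠ 0 := by linarith
  have fac : ∀ S : ℂ, Real.log N * ‖S‖ = ‖(Real.log N : ℂ) * S‖ := fun S => by
    rw [norm_mul, Complex.norm_real, Real.norm_eq_abs, abs_of_nonneg (by linarith)]
  rw [fac, mul_sum] at h6 h7
  have e6 : ∑ e ∈ Ioc z U, ∑ d ∈ (Ioc 0 N).filter (fun d => d * e ≤ N),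
        ((R e * (R d * ArithmeticFunction.vonMangoldt d) : ℝ) : ℂ) * ex (θ * (d * e : ℕ)) =
      ∑ n ∈ Ioc z U, (Real.log N : ℂ) * ∑ d ∈ (Ioc 0 N).filter (fun d => d * n ≤ N),
        (((if n ≤ U then α₁ n else 0) * α₂ d : ℝ) : ℂ) * ex (θ * (d * n : ℕ)) := by
    refine sum_congr rfl fun e he => ?_
    rw [mul_sum]
    refine sum_congr rfl fun d hd => ?_
    have he := mem_Ioc.mp he
    have hd := mem_Ioc.mp (mem_filter.mp hd).1
    rw [if_pos he.2]
    simp only [hα₁, hα₂]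
    rw [if_pos ⟨by omega, by omega⟩, if_pos ⟨by omega, by omega⟩, ← mul_assoc (Real.log N : ℂ),
      ← Complex.ofReal_mul]
    congr 2
    field_simp
  have e7 : ∑ d ∈ Ioc z U, ∑ e ∈ (Ioc 0 N).filter (fun e => e * d ≤ N),
        (((R d * ArithmeticFunction.vonMangoldt d) * (if U < e then R e else 0) : ℝ) : ℂ) *
          ex (θ * (e * d : ℕ)) =
      ∑ n ∈ Ioc z U, (Real.log N : ℂ) * ∑ d ∈ (Ioc 0 N).filter (fun d => d * n ≤ N),
        (((if n ≤ U then α₂ n else 0) * (if U < d then α₁ d else 0) : ℝ) : ℂ) *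
          ex (θ * (d * n : ℕ)) := by
    refine sum_congr rfl fun e he => ?_
    rw [mul_sum]
    refine sum_congr rfl fun d hd => ?_
    have he := mem_Ioc.mp he
    have hd := mem_Ioc.mp (mem_filter.mp hd).1
    rw [if_pos he.2]
    simp only [hα₁, hα₂]
    rw [if_pos (⟨by omega, by omega⟩ : 1 ≤ e ∧ e ≤ N),
      if_pos (⟨by omega, by omega⟩ : 1 ≤ d ∧ d ≤ N), ← mul_assoc (Real.log N : ℂ),
      ← Complex.ofReal_mul]
    congr 2
    field_simp
  rw [← e6] at h6
  rw [← e7] at h7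
  rw [← h3] at h2
  have hzs : (z : ℝ) ≤ √N := Real.le_sqrt_of_sq_le (by exact_mod_cast hz2N)
  rw [hKr]
  have h8 := h1.trans (add_le_add_left (h2.trans (add_le_add (add_le_add (h4.trans h5) h6) h7)) _)
  refine h8.trans ?_
  have : 2 * √(N : ℝ) * Real.log N + 2 * z ≤ δ * N := by linarith
  linarith
end SchurPrimes

namespace SchurPrimes
open Finset

lemma eventually_pow_div_two_pow_le (k : ℕ) (c : ℝ) {τ : ℝ} (hτ : 0 < τ) :
    ∀ᶠ s : ℕ in Filter.atTop, c * ((s : ℝ) ^ k / 2 ^ s) ≤ τ := by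
  have h := (tendsto_pow_const_div_const_pow_of_one_lt k (one_lt_two : (1 : ℝ) < 2)).const_mul c
  rw [mul_zero] at h
  exact (h.eventually (gt_mem_nhds hτ)).mono fun _ h => h.le

/-- Minor arc estimate for the von Mangoldt function. -/
theorem minor_arc {η : ℝ} (hη : 0 < η) : ∃ Q : ℕ, 1 ≤ Q ∧ ∃ N₀ : ℕ, ∀ N, N₀ ≤ N →
    ∀ θ : ℝ, (∀ h : ℕ, 1 ≤ h → h ≤ Q → (Q : ℝ) / N < nn (h * θ)) →
    ‖∑ n ∈ Ioc 0 N, (ArithmeticFunction.vonMangoldt n : ℂ) * ex (θ * n)‖ ≤ η * N := by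
  obtain ⟨C, hC, s₀, hs₀, H⟩ := exists_norm_sum_vonMangoldt_le
  obtain ⟨b, hb⟩ : ∃ b : ℕ, 2 * (12 * b + 30) * (C / 16 ^ b) ≤ η / 4 := by
    have h1 := (tendsto_pow_const_div_const_pow_of_one_lt 1
      (by norm_num : (1 : ℝ) < 16)).const_mul (24 * C)
    have h2 := (tendsto_pow_const_div_const_pow_of_one_lt 0
      (by norm_num : (1 : ℝ) < 16)).const_mul (60 * C)
    have h3 := h1.add h2
    simp only [mul_zero, add_zero] at h3
    obtain ⟨b, hb⟩ := (h3.eventually (gt_mem_nhds (by positivity : 0 < η / 4))).exists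
    refine ⟨b, le_trans (le_of_eq ?_) hb.le⟩
    ring
  set K : ℝ := 12 * b + 30 with hK
  have hK0 : 0 < K := by positivity
  set τ : ℝ := (η / (24 * (128 * K) ^ 2)) ^ 2 / 2 with hτ
  have hτ0 : 0 < τ := by positivity
  obtain ⟨s, h1, h2, hs⟩ := ((eventually_pow_div_two_pow_le 16 ((6 * K + 2) * C)
    (by positivity : 0 < η / 4)).and ((eventually_pow_div_two_pow_le 24 (20 * C ^ 5) hτ0).and
      (Filter.eventually_ge_atTop s₀))).exists
  have hs1 : (1 : ℝ) ≤ s := by exact_mod_cast hs₀.trans hs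
  set D : ℝ := C ^ 3 * (16 * (C * s ^ 8) ^ 3) with hD
  have hD0 : 0 < D := by positivity
  obtain ⟨Q, hQ, N₀, h3⟩ := H b s (min 1 (τ / D)) hs (by positivity) (min_le_left _ _)
  refine ⟨Q, hQ, N₀, fun N hN θ hθ => (h3 N hN θ hθ).trans ?_⟩
  refine mul_le_mul_of_nonneg_right ?_ (Nat.cast_nonneg N)
  have h4 : √(C ^ 3 * (20 * (C * s ^ 8) * (C * (s ^ 16 / 2 ^ s)) +
      16 * (C * s ^ 8) ^ 3 * min 1 (τ / D))) ≤ η / (24 * (128 * K) ^ 2) := by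
    refine Real.sqrt_le_iff.mpr ⟨by positivity, ?_⟩
    have h5 : D * min 1 (τ / D) ≤ τ := by
      calc _ ≤ D * (τ / D) := by gcongr; exact min_le_right _ _
        _ = τ := by field_simp
    calc _ = 20 * C ^ 5 * ((s : ℝ) ^ 24 / 2 ^ s) + D * min 1 (τ / D) := by rw [hD]; ring
      _ ≤ τ + τ := add_le_add h2 h5
      _ = _ := by rw [hτ]; ring
  have h5 : 6 * (128 * K) ^ 2 * √(C ^ 3 * (20 * (C * s ^ 8) * (C * (s ^ 16 / 2 ^ s)) +
      16 * (C * s ^ 8) ^ 3 * min 1 (τ / D))) ≤ η / 4 := by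
    calc _ ≤ 6 * (128 * K) ^ 2 * (η / (24 * (128 * K) ^ 2)) := by gcongr
      _ = η / 4 := by field_simp; norm_num
  have h6 : 2 * K * (3 * (C * ((s : ℝ) ^ 16 / 2 ^ s)) + C / 16 ^ b) + 2 * (C * (s ^ 16 / 2 ^ s)) =
    (6 * K + 2) * C * ((s : ℝ) ^ 16 / 2 ^ s) + 2 * K * (C / 16 ^ b) := by ring
  rw [h6]
  linarith
end SchurPrimes

namespace SchurPrimes
open Finset MeasureTheory

/-- The Fejér kernel on the real line. -/
noncomputable def fk (l v : ℝ) : ℝ := 2 * ∫ t in (0 : ℝ)..l, (1 - t / l) * Real.cos (t * v)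

lemma fk_eq {l v : ℝ} (hl : 0 < l) (hv : v ≠ 0) :
    fk l v = 2 * (1 - Real.cos (l * v)) / (l * v ^ 2) := by
  have h : ∀ t ∈ Set.uIcc 0 l, HasDerivAt (fun t : ℝ => (1 - t / l) * (Real.sin (t * v) / v) -
      Real.cos (t * v) / (l * v ^ 2)) ((1 - t / l) * Real.cos (t * v)) t := by
    intro t _
    have h0 : HasDerivAt (fun t : ℝ => t * v) v t := by simpa using (hasDerivAt_id t).mul_const v
    have h1 := (((hasDerivAt_id t).div_const l).const_sub 1).mul (h0.sin.div_const v)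
    have h2 := h1.sub (h0.cos.div_const (l * v ^ 2))
    refine h2.congr_deriv ?_
    simp only [id]
    field_simp
    ring
  rw [fk, intervalIntegral.integral_eq_sub_of_hasDerivAt h
    (Continuous.intervalIntegrable (by fun_prop) _ _)]
  simp
  field_simp
  ring

lemma continuous_fk (l : ℝ) : Continuous (fk l) := by
  unfold fk
  refine continuous_const.mul ?_
  exact intervalIntegral.continuous_parametric_intervalIntegral_of_continuous'
    (by fun_prop) 0 l

lemma fk_zero {l : ℝ} (hl : 0 < l) : fk l 0 = l := by
  have : ∫ t in (0 : ℝ)..l, (1 - t / l) * Real.cos (t * 0) = l / 2 := by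
    simp
    field_simp
    ring
  rw [fk, this]; ring

lemma fk_nonneg {l : ℝ} (hl : 0 < l) (v : ℝ) : 0 ≤ fk l v := by
  rcases eq_or_ne v 0 with rfl | hv
  · rw [fk_zero hl]; exact hl.le
  · rw [fk_eq hl hv]
    have := Real.cos_le_one (l * v)
    positivity [sub_nonneg.mpr this]

lemma fk_le {l : ℝ} (hl : 0 < l) (v : ℝ) : fk l v ≤ l := by
  rcases eq_or_ne v 0 with rfl | hv
  · rw [fk_zero hl]
  · rw [fk_eq hl hv, div_le_iff₀ (by positivity)]
    nlinarith [Real.one_sub_sq_div_two_le_cos (x := l * v)]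

lemma fk_le_inv {l v : ℝ} (hl : 0 < l) (hv : v ≠ 0) : fk l v ≤ 4 / (l * v ^ 2) := by
  rw [fk_eq hl hv]
  gcongr
  linarith [Real.neg_one_le_cos (l * v)]

lemma le_fk {l v : ℝ} (hl : 0 < l) (hv : |v| ≤ 1 / l) : l / 5 * 2 ≤ fk l v := by
  rcases eq_or_ne v 0 with rfl | h0
  · rw [fk_zero hl]; linarith
  · rw [fk_eq hl h0, le_div_iff₀ (by positivity)]
    have h1 : |l * v| ≤ 1 := by
      rw [abs_mul, abs_of_pos hl]
      calc l * |v| ≤ l * (1 / l) := by gcongr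
        _ = 1 := by field_simp
    have h2 := Real.cos_le_one_sub_mul_cos_sq (x := l * v) (h1.trans (by linarith [Real.pi_gt_three]))
    have h3 : (1 : ℝ) / 5 ≤ 2 / Real.pi ^ 2 := by
      rw [div_le_div_iff₀ (by norm_num) (by positivity)]
      nlinarith [Real.pi_lt_d2, Real.pi_gt_three]
    nlinarith [mul_le_mul_of_nonneg_right h3 (sq_nonneg (l * v))]

lemma fk_le_cauchy {l : ℝ} (hl : 0 < l) (v : ℝ) : fk l v ≤ (l + 4 / l) * (1 + v ^ 2)⁻¹ := by
  rw [← div_eq_mul_inv, le_div_iff₀ (by positivity), mul_add, mul_one]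
  refine add_le_add (fk_le hl v) ?_
  rcases eq_or_ne v 0 with rfl | h0
  · simp; positivity
  · calc fk l v * v ^ 2 ≤ 4 / (l * v ^ 2) * v ^ 2 := by gcongr; exact fk_le_inv hl h0
      _ = 4 / l := by field_simp

lemma integrable_fk {l : ℝ} (hl : 0 < l) : Integrable (fk l) := by
  refine (integrable_inv_one_add_sq.const_mul (l + 4 / l)).mono'
    (continuous_fk l).aestronglyMeasurable (Filter.Eventually.of_forall fun v => ?_)
  rw [Real.norm_eq_abs, abs_of_nonneg (fk_nonneg hl v)]
  exact fk_le_cauchy hl v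

lemma le_integral_fk {l : ℝ} (hl : 0 < l) : 4 / 5 ≤ ∫ v, fk l v := by
  have h1 : ∫ v in Set.Icc (-(1 / l)) (1 / l), l / 5 * 2 ≤
      ∫ v in Set.Icc (-(1 / l)) (1 / l), fk l v :=
    setIntegral_mono_on (continuous_const.integrableOn_Icc) (integrable_fk hl).integrableOn measurableSet_Icc
      fun v hv => le_fk hl (abs_le.mpr hv)
  have h2 := setIntegral_le_integral (s := Set.Icc (-(1 / l)) (1 / l)) (integrable_fk hl)
    (Filter.Eventually.of_forall (fk_nonneg hl))
  refine le_trans (le_of_eq ?_) (h1.trans h2)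
  rw [setIntegral_const, Real.volume_real_Icc_of_le (by
    have : 0 < 1 / l := by positivity
    linarith)]
  simp
  field_simp
  norm_num

lemma integral_fk_Ioi_le {l d : ℝ} (hl : 0 < l) (hd : 0 < d) :
    ∫ v in Set.Ioi d, fk l v ≤ 4 / (l * d) := by
  have h0 := integrableOn_Ioi_rpow_of_lt (by norm_num : (-2 : ℝ) < -1) hd
  have h1 : ∫ v in Set.Ioi d, fk l v ≤ ∫ v in Set.Ioi d, 4 / l * v ^ (-2 : ℝ) := by
    refine setIntegral_mono_on (integrable_fk hl).integrableOn (h0.const_mul _) measurableSet_Ioi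
      fun v hv => ?_
    have hv0 : 0 < v := hd.trans hv
    refine (fk_le_inv hl hv0.ne').trans (le_of_eq ?_)
    rw [Real.rpow_neg hv0.le]
    norm_cast
    field_simp
  refine h1.trans (le_of_eq ?_)
  rw [integral_const_mul, integral_Ioi_rpow_of_lt (by norm_num) hd]
  norm_num [Real.rpow_neg_one]
  field_simp

lemma fk_neg (l v : ℝ) : fk l (-v) = fk l v := by simp [fk]

lemma integral_fk_Iio_le {l d : ℝ} (hl : 0 < l) (hd : 0 < d) :
    ∫ v in Set.Iio (-d), fk l v ≤ 4 / (l * d) := by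
  rw [← integral_Iic_eq_integral_Iio, ← integral_comp_neg_Ioi]
  simpa only [fk_neg] using integral_fk_Ioi_le hl hd

/-- The Fejér kernel as a Fourier transform of a compactly supported function. -/
lemma integral_tent_mul_exp {l : ℝ} (hl : 0 < l) (v : ℝ) :
    ∫ t in (-l)..l, ((1 - |t| / l : ℝ) : ℂ) * Complex.exp (t * v * Complex.I) = fk l v := by
  have hc : Continuous fun t : ℝ => ((1 - |t| / l : ℝ) : ℂ) * Complex.exp (t * v * Complex.I) := by
    fun_prop
  rw [← intervalIntegral.integral_add_adjacent_intervals (b := 0)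
    (hc.intervalIntegrable _ _) (hc.intervalIntegrable _ _)]
  have h1 : ∫ t in (-l)..0, ((1 - |t| / l : ℝ) : ℂ) * Complex.exp (t * v * Complex.I) =
      ∫ t in 0..l, ((1 - |t| / l : ℝ) : ℂ) * Complex.exp (-(t * v * Complex.I)) := by
    have := intervalIntegral.integral_comp_neg (a := 0) (b := l)
      fun t : ℝ => ((1 - |t| / l : ℝ) : ℂ) * Complex.exp (t * v * Complex.I)
    rw [neg_zero] at this
    rw [← this]
    refine intervalIntegral.integral_congr fun t _ => ?_
    simp
  rw [h1, ← intervalIntegral.integral_add (Continuous.intervalIntegrable (by fun_prop) _ _)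
    (hc.intervalIntegrable _ _), fk]
  push_cast
  rw [← intervalIntegral.integral_ofReal, ← intervalIntegral.integral_const_mul]
  refine intervalIntegral.integral_congr fun t ht => ?_
  rw [Set.uIcc_of_le hl.le] at ht
  rw [abs_of_nonneg ht.1]
  push_cast
  rw [Complex.cos]
  have : -(t * v * Complex.I : ℂ) = -(t * v) * Complex.I := by ring
  rw [this]
  ring
end SchurPrimes

namespace SchurPrimes
open Finset MeasureTheory Filter Topology

lemma integral_mul_exp_mul_fk {a : ℝ → ℝ} {M : ℝ} {H : ℂ → ℂ} (ha : Measurable a)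
    (hM : ∀ u, |a u| ≤ M)
    (hH : ∀ s : ℂ, 0 < s.re → ∫ u in Set.Ioi (0 : ℝ), (a u : ℂ) * Complex.exp (-s * u) = H s)
    {l : ℝ} (hl : 0 < l) {e : ℝ} (he : 0 < e) (L : ℝ) :
    ∫ u in Set.Ioi (0 : ℝ), ((a u * fk l (u - L) * Real.exp (-e * u) : ℝ) : ℂ) =
      ∫ t in Set.Ioc (-l) l, ((1 - |t| / l : ℝ) : ℂ) * Complex.exp (-(t * L * Complex.I)) *
        H (e - t * Complex.I) := by
  have h1 : ∀ u : ℝ, ((a u * fk l (u - L) * Real.exp (-e * u) : ℝ) : ℂ) =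
      ∫ t in Set.Ioc (-l) l, ((a u * Real.exp (-e * u) : ℝ) : ℂ) * ((1 - |t| / l : ℝ) : ℂ) *
        Complex.exp (t * (u - L) * Complex.I) := by
    intro u
    have := integral_tent_mul_exp hl (u - L)
    rw [intervalIntegral.integral_of_le (by linarith)] at this
    simp_rw [mul_assoc]
    rw [integral_const_mul]
    simp_rw [← mul_assoc]
    push_cast at this ⊢
    rw [this]; ring
  simp_rw [h1]
  rw [integral_integral_swap]
  · refine integral_congr_ae (Eventually.of_forall fun t => ?_)
    simp only
    rw [← hH (e - t * Complex.I) (by simpa using he), ← integral_const_mul]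
    refine integral_congr_ae (Eventually.of_forall fun u => ?_)
    simp only
    have : Complex.exp (t * (u - L) * Complex.I) * Complex.exp (-e * u) =
        Complex.exp (-(t * L * Complex.I)) * Complex.exp (-(e - t * Complex.I) * u) := by
      rw [← Complex.exp_add, ← Complex.exp_add]; congr 1; ring
    push_cast
    linear_combination ((a u : ℂ) * (1 - ((|t| : ℝ) : ℂ) / l)) * this
  · have i1 : Integrable (fun u : ℝ => ((a u * Real.exp (-e * u) : ℝ) : ℂ))
        (volume.restrict (Set.Ioi 0)) := by
      refine Integrable.ofReal ?_
      have := (exp_neg_integrableOn_Ioi 0 he)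
      refine Integrable.bdd_mul this ha.aestronglyMeasurable (c := M) (Eventually.of_forall fun u => ?_)
      rw [Real.norm_eq_abs]; exact hM u
    have i2 : Integrable (fun t : ℝ => ((1 - |t| / l : ℝ) : ℂ)) (volume.restrict (Set.Ioc (-l) l)) :=
      (Continuous.integrableOn_Icc (by fun_prop)).mono_set Set.Ioc_subset_Icc_self
    have i3 := i1.mul_prod i2
    refine Integrable.mul_bdd (c := 1) i3 (Continuous.aestronglyMeasurable (by fun_prop))
      (Eventually.of_forall fun p => ?_)
    have : (p.2 : ℂ) * (p.1 - L) * Complex.I = ((p.2 * (p.1 - L) : ℝ) : ℂ) * Complex.I := by push_cast; ring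
    rw [this, Complex.norm_exp_ofReal_mul_I]

lemma integral_mul_fk {a : ℝ → ℝ} {M : ℝ} {H : ℂ → ℂ} (ha : Measurable a)
    (hM : ∀ u, |a u| ≤ M) (hHc : ContinuousOn H {s | 0 ≤ s.re})
    (hH : ∀ s : ℂ, 0 < s.re → ∫ u in Set.Ioi (0 : ℝ), (a u : ℂ) * Complex.exp (-s * u) = H s)
    {l : ℝ} (hl : 0 < l) (L : ℝ) :
    ∫ u in Set.Ioi (0 : ℝ), ((a u * fk l (u - L) : ℝ) : ℂ) =
      ∫ t in Set.Ioc (-l) l, ((1 - |t| / l : ℝ) : ℂ) * Complex.exp (-(t * L * Complex.I)) *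
        H (-(t * Complex.I)) := by
  have h1 : Tendsto (fun e : ℝ => ∫ u in Set.Ioi (0 : ℝ),
      ((a u * fk l (u - L) * Real.exp (-e * u) : ℝ) : ℂ)) (𝓝[>] 0)
      (𝓝 (∫ u in Set.Ioi (0 : ℝ), ((a u * fk l (u - L) : ℝ) : ℂ))) := by
    refine tendsto_integral_filter_of_dominated_convergence
      (fun u => M * fk l (u - L)) ?_ ?_ ?_ ?_
    · refine Eventually.of_forall fun e => Measurable.aestronglyMeasurable ?_
      have := (continuous_fk l).measurable
      fun_prop
    · filter_upwards [self_mem_nhdsWithin] with e he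
      refine (ae_restrict_iff' measurableSet_Ioi).mpr (Eventually.of_forall fun u hu => ?_)
      have he : 0 < e := he
      have hu : 0 < u := hu
      rw [Complex.norm_real, Real.norm_eq_abs, abs_mul, abs_mul, abs_of_nonneg (fk_nonneg hl _),
        Real.abs_exp]
      have h3 : Real.exp (-e * u) ≤ 1 := Real.exp_le_one_iff.mpr (by nlinarith)
      have := fk_nonneg hl (u - L)
      have := hM u
      have h0 := abs_nonneg (a u)
      have hM0 : 0 ≤ M := h0.trans this
      calc |a u| * fk l (u - L) * Real.exp (-e * u) ≤ M * fk l (u - L) * 1 := by gcongr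
        _ = _ := by ring
    · exact (((integrable_fk hl).comp_sub_right L).const_mul M).integrableOn
    · refine Eventually.of_forall fun u => ?_
      have : Continuous fun e : ℝ => ((a u * fk l (u - L) * Real.exp (-e * u) : ℝ) : ℂ) := by fun_prop
      have := (this.tendsto 0).mono_left (nhdsWithin_le_nhds (s := Set.Ioi 0))
      simpa using this
  have h2 : Tendsto (fun e : ℝ => ∫ t in Set.Ioc (-l) l, ((1 - |t| / l : ℝ) : ℂ) *
      Complex.exp (-(t * L * Complex.I)) * H (e - t * Complex.I)) (𝓝[>] 0)
      (𝓝 (∫ t in Set.Ioc (-l) l, ((1 - |t| / l : ℝ) : ℂ) * Complex.exp (-(t * L * Complex.I)) *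
        H (-(t * Complex.I)))) := by
    have hmap : ContinuousOn (fun p : ℝ × ℝ => H (p.1 - p.2 * Complex.I))
        (Set.Icc 0 1 ×ˢ Set.Icc (-l) l) := by
      refine hHc.comp (Continuous.continuousOn (by fun_prop)) fun p hp => ?_
      simpa using hp.1.1
    obtain ⟨B, hB⟩ := (isCompact_Icc.prod isCompact_Icc).exists_bound_of_continuousOn hmap
    have hmem : ∀ᶠ e : ℝ in 𝓝[>] 0, e ∈ Set.Ioc (0 : ℝ) 1 := Ioc_mem_nhdsGT one_pos
    refine tendsto_integral_filter_of_dominated_convergence (fun _ => B) ?_ ?_ ?_ ?_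
    · filter_upwards [hmem] with e he
      refine ContinuousOn.aestronglyMeasurable ?_ measurableSet_Ioc
      refine ContinuousOn.mul (Continuous.continuousOn (by fun_prop)) ?_
      exact hmap.comp (f := fun t : ℝ => (e, t)) (Continuous.continuousOn (by fun_prop))
        fun t ht => ⟨⟨he.1.le, he.2⟩, ht.1.le, ht.2⟩
    · filter_upwards [hmem] with e he
      refine (ae_restrict_iff' measurableSet_Ioc).mpr (Eventually.of_forall fun t ht => ?_)
      have h3 := hB (e, t) ⟨⟨he.1.le, he.2⟩, ht.1.le, ht.2⟩
      have h4 : |t| ≤ l := abs_le.mpr ⟨ht.1.le, ht.2⟩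
      have h5 : |t| / l ≤ 1 := (div_le_one hl).mpr h4
      have h6 : 0 ≤ |t| / l := by positivity
      have h7 : -(t * L * Complex.I : ℂ) = ((-(t * L) : ℝ) : ℂ) * Complex.I := by push_cast; ring
      rw [norm_mul, norm_mul, h7, Complex.norm_exp_ofReal_mul_I, Complex.norm_real,
        Real.norm_eq_abs, abs_of_nonneg (by linarith), mul_one]
      have h8 := norm_nonneg (H (e - t * Complex.I))
      calc _ ≤ 1 * ‖H (e - t * Complex.I)‖ := by gcongr; linarith
        _ ≤ B := by rw [one_mul]; exact h3
    · exact integrable_const B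
    · refine (ae_restrict_iff' measurableSet_Ioc).mpr (Eventually.of_forall fun t ht => ?_)
      refine Tendsto.const_mul _ ?_
      have h3 : ContinuousWithinAt (fun e : ℝ => H (e - t * Complex.I)) (Set.Ioi 0) 0 := by
        refine ContinuousWithinAt.comp (t := {s | 0 ≤ s.re}) (hHc _ (by simp))
          (Continuous.continuousWithinAt (by fun_prop)) fun e he => ?_
        have he : 0 < e := he
        simpa using he.le
      simpa [ContinuousWithinAt] using h3
  refine tendsto_nhds_unique h1 (h2.congr' ?_)
  filter_upwards [self_mem_nhdsWithin] with e he
  exact (integral_mul_exp_mul_fk ha hM hH hl he L).symm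

lemma tendsto_integral_mul_fk {a : ℝ → ℝ} {M : ℝ} {H : ℂ → ℂ} (ha : Measurable a)
    (hM : ∀ u, |a u| ≤ M) (hHc : ContinuousOn H {s | 0 ≤ s.re})
    (hH : ∀ s : ℂ, 0 < s.re → ∫ u in Set.Ioi (0 : ℝ), (a u : ℂ) * Complex.exp (-s * u) = H s)
    {l : ℝ} (hl : 0 < l) :
    Tendsto (fun L => ∫ u in Set.Ioi (0 : ℝ), a u * fk l (u - L)) atTop (𝓝 0) := by
  have h1 := Real.tendsto_integral_exp_smul_cocompact (fun t : ℝ => (Set.Ioc (-l) l).indicator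
    (fun t : ℝ => ((1 - |t| / l : ℝ) : ℂ) * H (-(t * Complex.I))) t)
  have h2 : Tendsto (fun L : ℝ => L / (2 * Real.pi)) atTop (cocompact ℝ) :=
    (tendsto_id.atTop_div_const (by positivity)).mono_right atTop_le_cocompact
  have h3 := h1.comp h2
  have h4 : ∀ L : ℝ, ((∫ u in Set.Ioi (0 : ℝ), a u * fk l (u - L) : ℝ) : ℂ) =
      ∫ v, (Real.fourierChar (-(v * (L / (2 * Real.pi)))) : Circle) • (Set.Ioc (-l) l).indicator
    (fun t : ℝ => ((1 - |t| / l : ℝ) : ℂ) * H (-(t * Complex.I))) v := by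
    intro L
    rw [← integral_complex_ofReal, integral_mul_fk ha hM hHc hH hl, ← integral_indicator measurableSet_Ioc]
    refine integral_congr_ae (Eventually.of_forall fun t => ?_)
    simp only [Set.indicator_apply]
    split_ifs
    · rw [Circle.smul_def, Real.fourierChar_apply, smul_eq_mul]
      have : ((2 * Real.pi * -(t * (L / (2 * Real.pi))) : ℝ) : ℂ) * Complex.I =
          -(t * L * Complex.I) := by
        have : (2 * Real.pi * -(t * (L / (2 * Real.pi))) : ℝ) = -(t * L) := by
          field_simp
        rw [this]; push_cast; ring
      rw [this]; ring
    · simp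
  have h5 : Tendsto (fun L => ((∫ u in Set.Ioi (0 : ℝ), a u * fk l (u - L) : ℝ) : ℂ)) atTop
      (𝓝 ((0 : ℝ) : ℂ)) := by
    simp_rw [h4]
    exact h3
  have h6 := (Complex.continuous_re.tendsto _).comp h5
  simpa [Function.comp_def] using h6
end SchurPrimes

namespace SchurPrimes
open Finset MeasureTheory Filter Topology

lemma le_integral_fk_interval {l d : ℝ} (hl : 0 < l) (hd : 0 < d) :
    (∫ v, fk l v) - 2 * (4 / (l * d)) ≤ ∫ v in (-d)..d, fk l v := by
  have hi := integrable_fk hl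
  have h1 := intervalIntegral.integral_Iic_add_Ioi (b := d) hi.integrableOn hi.integrableOn
  have h2 := intervalIntegral.integral_Iic_sub_Iic (a := -d) (b := d) hi.integrableOn hi.integrableOn
  have h3 := integral_fk_Iio_le hl hd
  have h4 := integral_fk_Ioi_le hl hd
  rw [← integral_Iic_eq_integral_Iio] at h3
  linarith

/-- A Wiener–Ikehara Tauberian theorem for Laplace transforms. -/
theorem tendsto_of_laplace {A : ℝ → ℝ} {M : ℝ} {H : ℂ → ℂ} (hA : Measurable A)
    (h0 : ∀ u, 0 ≤ A u) (hM : ∀ u, A u ≤ M)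
    (hmono : ∀ u v, 0 ≤ u → u ≤ v → A u * Real.exp u ≤ A v * Real.exp v)
    (hHc : ContinuousOn H {s | 0 ≤ s.re})
    (hH : ∀ s : ℂ, 0 < s.re →
      ∫ u in Set.Ioi (0 : ℝ), ((A u - 1 : ℝ) : ℂ) * Complex.exp (-s * u) = H s) :
    Tendsto A atTop (𝓝 1) := by
  have hM0 : 0 ≤ M := (h0 0).trans (hM 0)
  suffices h : ∀ τ : ℝ, 0 < τ → τ ≤ 1 → ∀ᶠ L in atTop, |A L - 1| ≤ τ by
    rw [Metric.tendsto_nhds]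
    intro e he
    filter_upwards [h (min (e / 2) 1) (by positivity) (min_le_right _ _)] with L hL
    rw [Real.dist_eq]
    exact lt_of_le_of_lt (hL.trans (min_le_left _ _)) (by linarith)
  intro τ hτ hτ1
  set d : ℝ := τ / 8 with hd
  have hd0 : 0 < d := by positivity
  have hexp : Real.exp (2 * d) ≤ 1 + τ / 2 := by
    have h1 := Real.exp_bound_div_one_sub_of_interval' (x := 2 * d) (by positivity)
      (by rw [hd]; linarith)
    refine h1.le.trans ?_
    rw [div_le_iff₀ (by rw [hd]; linarith), hd]
    nlinarith
  set κ : ℝ := τ / (20 * (1 + M)) with hκ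
  have hκ0 : 0 < κ := by positivity
  have hκ1 : κ * (1 + M) = τ / 20 := by rw [hκ]; field_simp
  set l : ℝ := 4 / (κ * d) with hl
  have hl0 : 0 < l := by positivity
  have hld : 4 / (l * d) = κ := by rw [hl]; field_simp
  have hmid := le_integral_fk_interval hl0 hd0
  rw [hld] at hmid
  have hI := le_integral_fk hl0
  have hi := integrable_fk hl0
  set I : ℝ := ∫ v, fk l v with hIdef
  have hT := tendsto_integral_mul_fk (a := fun u => A u - 1) (M := M + 1) (hA.sub_const 1)
    (fun u => abs_le.mpr ⟨by linarith [h0 u], by linarith [hM u]⟩) hHc hH hl0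
  have hT' := Metric.tendsto_nhds.mp hT κ hκ0
  simp only [dist_zero_right, Real.norm_eq_abs] at hT'
  have hshift : ∀ c : ℝ, Integrable fun u => fk l (u - c) := fun c => hi.comp_sub_right c
  have hAint : ∀ c : ℝ, Integrable fun u => A u * fk l (u - c) := fun c =>
    (hshift c).bdd_mul hA.aestronglyMeasurable (c := M) (Eventually.of_forall fun u => by
      rw [Real.norm_eq_abs, abs_of_nonneg (h0 u)]; exact hM u)
  have hnn : ∀ c u, 0 ≤ fk l (u - c) := fun c u => fk_nonneg hl0 _
  have hmid' : ∀ c : ℝ, I - 2 * κ ≤ ∫ u in Set.Ioc (c - d) (c + d), fk l (u - c) := fun c => by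
    rw [← intervalIntegral.integral_of_le (by linarith), intervalIntegral.integral_comp_sub_right]
    simpa using hmid
  have hfull : ∀ c : ℝ, ∫ u in Set.Ioi (0 : ℝ), fk l (u - c) ≤ I := fun c => by
    rw [hIdef, ← integral_sub_right_eq_self (fun u => fk l u) c]
    exact setIntegral_le_integral (hshift c) (Eventually.of_forall (hnn c))
  have hTsplit : ∀ c : ℝ, ∫ u in Set.Ioi (0 : ℝ), (A u - 1) * fk l (u - c) =
      (∫ u in Set.Ioi (0 : ℝ), A u * fk l (u - c)) - ∫ u in Set.Ioi (0 : ℝ), fk l (u - c) := by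
    intro c
    rw [← integral_sub (hAint c).integrableOn (hshift c).integrableOn]
    simp_rw [sub_mul, one_mul]
  have hu := (tendsto_atTop_add_const_right atTop d tendsto_id).eventually hT'
  have hd' := (tendsto_atTop_add_const_right atTop (-d) tendsto_id).eventually hT'
  filter_upwards [hu, hd', eventually_ge_atTop (2 * d + 1)] with L h1 h2 hL
  simp only [id] at h1 h2
  rw [abs_lt] at h1 h2
  have hexp1 : 1 ≤ Real.exp (2 * d) := Real.one_le_exp (by positivity)
  have hAL := h0 L
  -- upper bound
  have up : A L * (I - 2 * κ) ≤ Real.exp (2 * d) * (I + κ) := by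
    rw [hTsplit] at h1
    have g1 := hfull (L + d)
    have g2 : ∫ u in Set.Ioc (L + d - d) (L + d + d), A L * Real.exp (-(2 * d)) * fk l (u - (L + d))
        ≤ ∫ u in Set.Ioi (0 : ℝ), A u * fk l (u - (L + d)) := by
      refine le_trans (setIntegral_mono_on ((hshift _).const_mul _).integrableOn
        (hAint (L + d)).integrableOn measurableSet_Ioc fun u hu => ?_)
        (setIntegral_mono_set (hAint _).integrableOn
          (Eventually.of_forall fun u => mul_nonneg (h0 u) (hnn _ _))
          (LE.le.eventuallyLE fun u hu => ?_))
      · refine mul_le_mul_of_nonneg_right ?_ (hnn _ _)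
        have h3 := hmono L u (by linarith) (by linarith [hu.1])
        have h4 : A u * Real.exp u ≤ A u * Real.exp (L + 2 * d) := by
          gcongr
          · exact h0 u
          · linarith [hu.2]
        have h5 := h3.trans h4
        rw [Real.exp_add] at h5
        rw [Real.exp_neg, ← div_eq_mul_inv, div_le_iff₀ (Real.exp_pos _)]
        have := Real.exp_pos L
        nlinarith
      · have := hu.1
        simp only [Set.mem_Ioi]; linarith
    rw [integral_const_mul] at g2
    have g3 := hmid' (L + d)
    have g4 : A L * Real.exp (-(2 * d)) * (I - 2 * κ) ≤ I + κ := by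
      refine le_trans (mul_le_mul_of_nonneg_left g3 (by positivity)) ?_
      linarith [h1.2]
    rw [Real.exp_neg] at g4
    calc A L * (I - 2 * κ) = Real.exp (2 * d) * (A L * (Real.exp (2 * d))⁻¹ * (I - 2 * κ)) := by
          field_simp
      _ ≤ _ := by gcongr
  -- lower bound
  have low : I - 3 * κ ≤ A L * Real.exp (2 * d) * I + M * (2 * κ) := by
    rw [hTsplit] at h2
    set c := L + -d with hc
    have hsub : Set.Ioc (c - d) (c + d) ⊆ Set.Ioi 0 := fun u hu => by
      have := hu.1
      simp only [Set.mem_Ioi]; linarith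
    have g1 : I - 2 * κ ≤ ∫ u in Set.Ioi (0 : ℝ), fk l (u - c) :=
      (hmid' c).trans (setIntegral_mono_set (hshift _).integrableOn
          (Eventually.of_forall fun u => hnn _ _) (LE.le.eventuallyLE hsub))
    have g2 : ∫ u in Set.Ioi (0 : ℝ), A u * fk l (u - c) ≤
        ∫ u in Set.Ioi (0 : ℝ), ((A L * Real.exp (2 * d) + M) * fk l (u - c) -
          (Set.Ioc (c - d) (c + d)).indicator (fun u => M * fk l (u - c)) u) := by
      refine setIntegral_mono_on (hAint c).integrableOn
        (((hshift c).const_mul _).sub (((hshift c).const_mul _).indicator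
          measurableSet_Ioc)).integrableOn measurableSet_Ioi fun u hu => ?_
      rw [Set.indicator_apply]
      have hf := hnn c u
      split_ifs with hmem
      · have h3 := hmono u L (le_of_lt hu) (by linarith [hmem.2])
        have h4 : A L * Real.exp L ≤ A L * Real.exp (u + 2 * d) := by
          gcongr; linarith [hmem.1]
        have h5 := h3.trans h4
        rw [Real.exp_add] at h5
        have h6 : A u ≤ A L * Real.exp (2 * d) := by
          have := Real.exp_pos u
          refine le_of_mul_le_mul_right ?_ this
          linarith
        nlinarith
      · have := mul_le_mul_of_nonneg_right (hM u) hf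
        have : 0 ≤ A L * Real.exp (2 * d) * fk l (u - c) := by positivity
        linarith
    rw [integral_sub ((hshift c).const_mul _).integrableOn (((hshift c).const_mul _).indicator
          measurableSet_Ioc).integrableOn, integral_const_mul,
      setIntegral_indicator measurableSet_Ioc, Set.inter_eq_right.mpr hsub, integral_const_mul] at g2
    have g3 := mul_le_mul_of_nonneg_left (hmid' c) hM0
    have g4 := mul_le_mul_of_nonneg_left (hfull c)
      (by positivity : 0 ≤ A L * Real.exp (2 * d) + M)
    linarith [h2.1]
  have hκs : κ ≤ τ / 20 := by nlinarith
  rw [abs_le]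
  constructor
  · by_contra hcon
    push Not at hcon
    have h3 : A L * Real.exp (2 * d) ≤ (1 - τ) * (1 + τ / 2) := by
      refine mul_le_mul (by linarith) hexp (by positivity) (by linarith)
    have h4 : A L * Real.exp (2 * d) * I ≤ (1 - τ / 2) * I := by
      refine mul_le_mul_of_nonneg_right (h3.trans ?_) (by linarith)
      nlinarith
    nlinarith
  · have h3 : Real.exp (2 * d) * (I + κ) ≤ (1 + τ / 2) * (I + κ) :=
      mul_le_mul_of_nonneg_right hexp (by linarith)
    have h4 : (1 + τ / 2) * (I + κ) ≤ (1 + τ) * (I - 2 * κ) := by nlinarith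
    have h5 : A L ≤ 1 + τ := le_of_mul_le_mul_right (up.trans (h3.trans h4)) (by linarith)
    linarith
end SchurPrimes

namespace SchurPrimes
open Finset MeasureTheory Filter Topology
open ArithmeticFunction.vonMangoldt (residueClass residueClass_nonneg residueClass_le
  LFunctionResidueClassAux continuousOn_LFunctionResidueClassAux eqOn_LFunctionResidueClassAux)

theorem sum_residueClass_le {q : ℕ} (a : ZMod q) (n : ℕ) :
    ∑ k ∈ Icc 1 n, residueClass a k ≤ (Real.log 4 + 4) * n := by
  calc ∑ k ∈ Icc 1 n, residueClass a k ≤ ∑ k ∈ Icc 1 n, ArithmeticFunction.vonMangoldt k :=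
        sum_le_sum fun k _ => residueClass_le a k
    _ = Chebyshev.psi n := by
        rw [Chebyshev.psi, Nat.floor_natCast]; rfl
    _ ≤ _ := Chebyshev.psi_le_const_mul_self (Nat.cast_nonneg n)

theorem LSeries_eq_mul_integral_exp (f : ℕ → ℝ) (hf : ∀ n, 0 ≤ f n)
    (hO : (fun n : ℕ ↦ ∑ k ∈ Icc 1 n, f k) =O[atTop] fun n : ℕ ↦ (n : ℝ) ^ (1 : ℝ))
    {s : ℂ} (hs : 0 < s.re) :
    LSeries (fun n => (f n : ℂ)) (1 + s) = (1 + s) * ∫ u in Set.Ioi (0 : ℝ),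
      (((∑ k ∈ Icc 1 ⌊Real.exp u⌋₊, f k) * Real.exp (-u) : ℝ) : ℂ) * Complex.exp (-s * u) := by
  rw [LSeries_eq_mul_integral_of_nonneg f zero_le_one (by simpa using hs) hO hf]
  congr 1
  have him : Real.exp '' Set.Ioi 0 = Set.Ioi 1 := by
    ext x
    simp only [Set.mem_image, Set.mem_Ioi]
    constructor
    · rintro ⟨u, hu, rfl⟩
      exact Real.one_lt_exp_iff.mpr hu
    · intro hx
      exact ⟨Real.log x, Real.log_pos hx, Real.exp_log (by linarith)⟩
  rw [← him, integral_image_eq_integral_abs_deriv_smul measurableSet_Ioi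
    (fun x _ => (Real.hasDerivAt_exp x).hasDerivWithinAt) Real.exp_injective.injOn]
  refine setIntegral_congr_fun measurableSet_Ioi fun u hu => ?_
  simp only [Real.abs_exp, Complex.real_smul]
  rw [Complex.ofReal_mul, Complex.ofReal_sum, Complex.ofReal_exp, Complex.ofReal_exp,
    Complex.cpow_def_of_ne_zero (Complex.exp_ne_zero _), ← Complex.ofReal_exp,
    ← Complex.ofReal_log (Real.exp_pos u).le, Real.log_exp, mul_left_comm, mul_assoc,
    Complex.ofReal_exp, ← Complex.exp_add, ← Complex.exp_add]
  congr 2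
  push_cast
  ring

theorem tendsto_sum_residueClass_div {q : ℕ} [NeZero q] {a : ZMod q} (ha : IsUnit a) :
    Tendsto (fun N : ℕ => (∑ k ∈ Icc 1 N, residueClass a k) / N) atTop (𝓝 (1 / (q.totient : ℝ))) := by
  set φ : ℝ := (q.totient : ℝ) with hφ
  have hφ0 : 0 < φ := by
    simpa [hφ] using Nat.totient_pos.mpr (NeZero.pos q)
  set S : ℕ → ℝ := fun n => ∑ k ∈ Icc 1 n, residueClass a k with hS
  have hSn : ∀ n, 0 ≤ S n := fun n => sum_nonneg fun k _ => residueClass_nonneg a k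
  have hSm : Monotone S := fun m n hmn =>
    sum_le_sum_of_subset_of_nonneg (Icc_subset_Icc le_rfl hmn) fun k _ _ => residueClass_nonneg a k
  set A : ℝ → ℝ := fun u => φ * (S ⌊Real.exp u⌋₊ * Real.exp (-u)) with hA
  set H : ℂ → ℂ := fun s => ((q.totient : ℂ) * LFunctionResidueClassAux a (1 + s) - 1) / (1 + s) with hH
  have hO : (fun n : ℕ ↦ ∑ k ∈ Icc 1 n, residueClass a k) =O[atTop] fun n : ℕ ↦ (n : ℝ) ^ (1 : ℝ) := by
    refine Asymptotics.IsBigO.of_bound (Real.log 4 + 4) (Eventually.of_forall fun n => ?_)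
    rw [Real.rpow_one, Real.norm_of_nonneg (hSn n), Real.norm_of_nonneg (Nat.cast_nonneg n)]
    exact sum_residueClass_le a n
  have hmeas : Measurable A := by
    refine measurable_const.mul (Measurable.mul ?_ (by fun_prop))
    exact (measurable_from_nat (f := S)).comp (Nat.measurable_floor.comp Real.measurable_exp)
  have hle : ∀ u, S ⌊Real.exp u⌋₊ * Real.exp (-u) ≤ Real.log 4 + 4 := by
    intro u
    have h1 := sum_residueClass_le a ⌊Real.exp u⌋₊
    have h2 := Nat.floor_le (Real.exp_pos u).le
    have h3 : 0 < Real.log 4 := Real.log_pos (by norm_num)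
    rw [Real.exp_neg, ← div_eq_mul_inv, div_le_iff₀ (Real.exp_pos u)]
    exact h1.trans (by gcongr)
  have key := tendsto_of_laplace (A := A) (M := φ * (Real.log 4 + 4)) (H := H) hmeas
    (fun u => by have := hSn ⌊Real.exp u⌋₊; positivity)
    (fun u => mul_le_mul_of_nonneg_left (hle u) hφ0.le)
    (fun u v _ huv => by
      have h : ∀ w, A w * Real.exp w = φ * S ⌊Real.exp w⌋₊ := fun w => by
        simp only [hA]
        rw [mul_assoc, mul_assoc, ← Real.exp_add]; simp
      rw [h, h]
      exact mul_le_mul_of_nonneg_left (hSm (Nat.floor_mono (Real.exp_le_exp.mpr huv))) hφ0.le)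
    (by
      have hc : ContinuousOn (fun s : ℂ => LFunctionResidueClassAux a (1 + s)) {s | 0 ≤ s.re} :=
        (continuousOn_LFunctionResidueClassAux a).comp (by fun_prop)
          (fun s hs => by simpa using hs)
      refine ContinuousOn.div (by fun_prop) (by fun_prop) ?_
      intro s hs h0
      have := congrArg Complex.re h0
      simp at this hs
      linarith)
    (by
      intro s hs
      have h1 := LSeries_eq_mul_integral_exp (residueClass a) (residueClass_nonneg a) hO hs
      have hmem : 1 + s ∈ {s : ℂ | 1 < s.re} := by simpa using hs
      have h2 := eqOn_LFunctionResidueClassAux ha hmem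
      have hne : (1 + s) ≠ 0 := by
        intro h0
        have := congrArg Complex.re h0
        simp at this
        linarith
      have hs0 : s ≠ 0 := by
        intro h0; simp [h0] at hs
      have hi0 : IntegrableOn (fun u : ℝ => Complex.exp (-s * u)) (Set.Ioi 0) :=
        integrableOn_exp_mul_complex_Ioi (by simpa using hs) 0
      have hi1 : IntegrableOn (fun u : ℝ => ((A u : ℝ) : ℂ) * Complex.exp (-s * u)) (Set.Ioi 0) := by
        refine Integrable.bdd_mul (c := φ * (Real.log 4 + 4)) hi0
          (Complex.measurable_ofReal.comp hmeas).aestronglyMeasurable ?_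
        refine Eventually.of_forall fun u => ?_
        rw [Complex.norm_real, Real.norm_of_nonneg (by have := hSn ⌊Real.exp u⌋₊; positivity)]
        exact mul_le_mul_of_nonneg_left (hle u) hφ0.le
      have h3 : ∫ u in Set.Ioi (0 : ℝ), ((A u - 1 : ℝ) : ℂ) * Complex.exp (-s * u) =
          (∫ u in Set.Ioi (0 : ℝ), ((A u : ℝ) : ℂ) * Complex.exp (-s * u)) -
            ∫ u in Set.Ioi (0 : ℝ), Complex.exp (-s * u) := by
        rw [← integral_sub hi1 hi0]
        refine integral_congr_ae (Eventually.of_forall fun u => ?_)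
        push_cast; ring
      have h4 : ∫ u in Set.Ioi (0 : ℝ), Complex.exp (-s * u) = 1 / s := by
        rw [integral_exp_mul_complex_Ioi (by simpa using hs)]
        simp [neg_div]
      have h5 : ∫ u in Set.Ioi (0 : ℝ), ((A u : ℝ) : ℂ) * Complex.exp (-s * u) =
          (q.totient : ℂ) * ∫ u in Set.Ioi (0 : ℝ), (((∑ k ∈ Icc 1 ⌊Real.exp u⌋₊, residueClass a k)
            * Real.exp (-u) : ℝ) : ℂ) * Complex.exp (-s * u) := by
        rw [← integral_const_mul]
        refine integral_congr_ae (Eventually.of_forall fun u => ?_)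
        simp only [hA, hS, hφ]
        push_cast; ring
      rw [h3, h4, h5]
      simp only [hH]
      rw [h2]
      beta_reduce
      have hφc : (q.totient : ℂ) ≠ 0 := by
        have : q.totient ≠ 0 := (Nat.totient_pos.mpr (NeZero.pos q)).ne'
        exact_mod_cast this
      generalize (∫ u in Set.Ioi (0 : ℝ), (((∑ k ∈ Icc 1 ⌊Real.exp u⌋₊, residueClass a k)
            * Real.exp (-u) : ℝ) : ℂ) * Complex.exp (-s * u)) = I at *
      rw [h1]
      have : (1 + s - 1) = s := by ring
      rw [this]
      field_simp
      ring)
  have h7 : Tendsto (fun N : ℕ => A (Real.log N)) atTop (𝓝 1) :=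
    key.comp (Real.tendsto_log_atTop.comp tendsto_natCast_atTop_atTop)
  have h8 := h7.const_mul (1 / φ)
  rw [mul_one] at h8
  refine h8.congr' ?_
  filter_upwards [eventually_ge_atTop 1] with N hN
  have hN' : (0 : ℝ) < N := by exact_mod_cast hN
  simp only [hA, hS]
  rw [Real.exp_log hN', Nat.floor_natCast, Real.exp_neg, Real.exp_log hN']
  field_simp

theorem tendsto_sum_log_prime_div {q : ℕ} (hq : 1 ≤ q) (b : ℕ) :
    Tendsto (fun N : ℕ => (∑ p ∈ (Icc 1 N).filter fun p => p.Prime ∧ p ≡ b [MOD q], Real.log p) / N)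
      atTop (𝓝 (if b.Coprime q then 1 / (q.totient : ℝ) else 0)) := by
  have : NeZero q := ⟨by omega⟩
  split_ifs with hb
  · have ha : IsUnit (b : ZMod q) := (ZMod.isUnit_iff_coprime b q).mpr hb
    have h1 := tendsto_sum_residueClass_div ha
    have h2 : Tendsto (fun N : ℕ => 2 * (Real.log N / (N : ℝ) ^ (1 / 2 : ℝ))) atTop (𝓝 0) := by
      have := ((isLittleO_log_rpow_atTop (r := 1 / 2) (by norm_num)).tendsto_div_nhds_zero.comp
        tendsto_natCast_atTop_atTop).const_mul 2
      simpa using this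
    have h3 := h1.sub h2
    rw [sub_zero] at h3
    refine tendsto_of_tendsto_of_tendsto_of_le_of_le' h3 h1 ?_ ?_
    all_goals
      filter_upwards [eventually_ge_atTop 1] with N hN
      have hN' : (0 : ℝ) < N := by exact_mod_cast hN
      have heq : ∑ p ∈ (Icc 1 N).filter (fun p => p.Prime ∧ p ≡ b [MOD q]), Real.log p =
          ∑ p ∈ Icc 1 N, if p.Prime then residueClass (b : ZMod q) p else 0 := by
        rw [sum_filter]
        refine sum_congr rfl fun p hp => ?_
        simp only [residueClass, Set.indicator_apply, Set.mem_ofPred_eq, ZMod.natCast_eq_natCast_iff]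
        by_cases hpp : p.Prime <;> by_cases hpb : p ≡ b [MOD q] <;>
          simp [hpp, hpb, ArithmeticFunction.vonMangoldt_apply_prime]
    · have h4 := Chebyshev.psi_sub_theta_le (x := N) (by exact_mod_cast hN)
      rw [Chebyshev.psi_sub_theta_eq_sum_not_prime, Nat.floor_natCast] at h4
      have h5 : ∑ k ∈ Icc 1 N, residueClass (b : ZMod q) k -
          ∑ p ∈ (Icc 1 N).filter (fun p => p.Prime ∧ p ≡ b [MOD q]), Real.log p ≤
          2 * √N * Real.log N := by
        refine le_trans ?_ h4
        rw [heq, ← sum_sub_distrib, sum_filter]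
        refine sum_le_sum fun p _ => ?_
        have := residueClass_le (b : ZMod q) p
        by_cases hpp : p.Prime
        · simp [hpp]
        · rw [if_neg hpp, if_pos hpp, sub_zero]
          exact this
      have h6 : 2 * (Real.log N / (N : ℝ) ^ (1 / 2 : ℝ)) = 2 * √N * Real.log N / N := by
        rw [← Real.sqrt_eq_rpow]
        have := Real.sqrt_pos.mpr hN'
        rw [← mul_div_assoc, div_eq_div_iff this.ne' hN'.ne']
        linear_combination (-2 * Real.log N) * Real.mul_self_sqrt hN'.le
      rw [h6, ← sub_div]
      gcongr
      linarith
    · rw [heq]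
      gcongr with p hp
      split_ifs
      · exact le_rfl
      · exact residueClass_nonneg _ p
  · have h1 : Tendsto (fun N : ℕ => (∑ p ∈ Icc 1 q, Real.log p) / (N : ℝ)) atTop (𝓝 0) :=
      tendsto_const_div_atTop_nhds_zero_nat _
    refine tendsto_of_tendsto_of_tendsto_of_le_of_le tendsto_const_nhds h1 (fun N => ?_) fun N => ?_
    · refine div_nonneg (sum_nonneg fun p _ => Real.log_natCast_nonneg p) (Nat.cast_nonneg N)
    · refine div_le_div_of_nonneg_right ?_ (Nat.cast_nonneg N)
      refine sum_le_sum_of_subset_of_nonneg ?_ fun p _ _ => Real.log_natCast_nonneg p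
      intro p hp
      simp only [mem_filter, mem_Icc] at hp ⊢
      refine ⟨hp.1.1, ?_⟩
      by_contra hpq
      push Not at hpq
      refine hb ?_
      have h2 : p.Coprime q := (hp.2.1.coprime_iff_not_dvd).mpr fun h =>
        absurd (Nat.le_of_dvd hq h) (by omega)
      have h3 := hp.2.2.gcd_eq
      rw [Nat.Coprime, ← h3]
      exact h2
end SchurPrimes

namespace SchurPrimes
open Finset

theorem sum_range_add_of_periodic {G : ℕ → ℂ} {h : ℕ} (hp : ∀ c, G (c + h) = G c) (d : ℕ) :
    ∑ c ∈ range h, G (c + d) = ∑ c ∈ range h, G c := by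
  induction d with
  | zero => simp
  | succ d ih =>
    rw [← ih]
    have h1 := sum_range_succ (fun c => G (c + d)) h
    have h2 := sum_range_succ' (fun c => G (c + d)) h
    have h3 : G (h + d) = G (0 + d) := by rw [add_comm h d, hp, zero_add]
    rw [h1, h3] at h2
    have h4 := add_right_cancel h2
    rw [h4]
    refine sum_congr rfl fun c _ => ?_
    congr 1; ring

theorem sum_dvd_mul_add_one_ex_eq_zero (W : ℕ) {h d : ℕ} {a : ℤ} (ha : IsCoprime a (h : ℤ))
    (hdh : d ∣ h) (hlt : d < h) (hd : 1 ≤ d) :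
    ∑ c ∈ range h with d ∣ W * c + 1, ex (a / h * c) = 0 := by
  have hh : (h : ℝ) ≠ 0 := by
    have : h ≠ 0 := by omega
    exact_mod_cast this
  set G : ℕ → ℂ := fun c => if d ∣ W * c + 1 then ex (a / h * c) else 0 with hG
  have hshift : ∀ c m, d ∣ m → G (c + m) = ex (a / h * m) * G c := by
    intro c m hm
    have h1 : d ∣ W * (c + m) + 1 ↔ d ∣ W * c + 1 := by
      have : W * (c + m) + 1 = (W * c + 1) + W * m := by ring
      rw [this]
      exact (Nat.dvd_add_iff_left (hm.mul_left W)).symm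
    simp only [hG, h1]
    split_ifs
    · rw [← ex_add]; congr 1; push_cast; ring
    · simp
  have hper : ∀ c, G (c + h) = G c := by
    intro c
    rw [hshift c h hdh, div_mul_cancel₀ _ hh, ex_int, one_mul]
  have h1 := sum_range_add_of_periodic hper d
  simp only [hshift _ d dvd_rfl, ← mul_sum] at h1
  rw [sum_filter]
  change ∑ c ∈ range h, G c = 0
  have hne : ex (a / h * d) ≠ 1 := by
    intro hone
    have h2 := le_norm_ex_sub_one (a / h * d : ℝ)
    rw [hone, sub_self, norm_zero] at h2
    have hnd : ¬ (h : ℤ) ∣ a * d := by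
      intro hdvd
      have h3 : (h : ℤ) ∣ (d : ℤ) := ha.symm.dvd_of_dvd_mul_left hdvd
      have := Nat.le_of_dvd hd (Int.natCast_dvd_natCast.mp h3)
      omega
    have h3 := inv_le_nn_of_not_dvd (m := h) (by omega) hnd
    have h4 : ((a * d : ℤ) : ℝ) / h = a / h * d := by push_cast; ring
    rw [h4] at h3
    have : (0 : ℝ) < h := by
      have : 0 < h := by omega
      exact_mod_cast this
    have : (0 : ℝ) < 1 / h := by positivity
    linarith
  have h2 : (ex (a / h * d) - 1) * ∑ c ∈ range h, G c = 0 := by rw [sub_mul, h1]; ring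
  exact (mul_eq_zero.mp h2).resolve_left (sub_ne_zero.mpr hne)

theorem card_dvd_mul_add_one_le (W : ℕ) {h : ℕ} :
    #{c ∈ range h | h ∣ W * c + 1} ≤ if h.Coprime W then 1 else 0 := by
  split_ifs with hc
  · rw [card_le_one]
    intro x hx y hy
    simp only [mem_filter, mem_range] at hx hy
    have hr := (dvd_mul_add_one_iff hc hy.2 x).mp hx.2
    have h2 : (x : ℤ) % h = y % h :=
      Int.emod_eq_emod_iff_emod_sub_eq_zero.mpr (Int.emod_eq_zero_of_dvd hr)
    rw [Int.emod_eq_of_lt (by positivity) (by exact_mod_cast hx.1),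
      Int.emod_eq_of_lt (by positivity) (by exact_mod_cast hy.1)] at h2
    exact_mod_cast h2
  · rw [Nat.le_zero, card_eq_zero, filter_eq_empty_iff]
    intro x _ hx
    refine hc ?_
    have h1 : Nat.gcd h W ∣ 1 := by
      have h2 : Nat.gcd h W ∣ W * x + 1 := (Nat.gcd_dvd_left h W).trans hx
      exact (Nat.dvd_add_right ((Nat.gcd_dvd_right h W).mul_right x)).mp h2
    exact Nat.dvd_one.mp h1

theorem norm_sum_coprime_ex_le (W : ℕ) {h : ℕ} (hh : 1 ≤ h) {a : ℤ} (ha : IsCoprime a (h : ℤ)) :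
    ‖∑ c ∈ range h with (W * c + 1).Coprime h, ex (a / h * c)‖ ≤
      if h.Coprime W then 1 else 0 := by
  have key : ∀ n : ℕ, (if n.Coprime h then (1 : ℂ) else 0) =
      ∑ d ∈ h.divisors, if d ∣ n then (ArithmeticFunction.moebius d : ℂ) else 0 := by
    intro n
    have h1 : ∑ d ∈ (n.gcd h).divisors, ArithmeticFunction.moebius d = if n.gcd h = 1 then 1 else 0 := by
      rw [← ArithmeticFunction.coe_mul_zeta_apply, ArithmeticFunction.moebius_mul_coe_zeta,
        ArithmeticFunction.one_apply]
    have h2 : (n.gcd h).divisors = h.divisors.filter (· ∣ n) := by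
      ext d
      simp only [Nat.mem_divisors, mem_filter, Nat.dvd_gcd_iff]
      have : n.gcd h ≠ 0 := (Nat.gcd_pos_of_pos_right n hh).ne'
      have : h ≠ 0 := by omega
      tauto
    rw [h2, sum_filter] at h1
    have h3 := congrArg (Int.cast : ℤ → ℂ) h1
    push_cast at h3
    exact h3.symm
  have h1 : ∑ c ∈ range h with (W * c + 1).Coprime h, ex (a / h * c) =
      ∑ d ∈ h.divisors, (ArithmeticFunction.moebius d : ℂ) *
        ∑ c ∈ range h with d ∣ W * c + 1, ex (a / h * c) := by
    have : ∀ c, (if (W * c + 1).Coprime h then ex (a / h * c) else 0) =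
        (if (W * c + 1).Coprime h then (1 : ℂ) else 0) * ex (a / h * c) := by
      intro c; split_ifs <;> simp
    rw [sum_filter]
    simp_rw [this, key, sum_mul, mul_sum]
    rw [sum_comm]
    refine sum_congr rfl fun d _ => ?_
    rw [sum_filter]
    refine sum_congr rfl fun c _ => ?_
    split_ifs <;> simp
  have h2 : ∑ d ∈ h.divisors, (ArithmeticFunction.moebius d : ℂ) *
        ∑ c ∈ range h with d ∣ W * c + 1, ex (a / h * c) =
      (ArithmeticFunction.moebius h : ℂ) * ∑ c ∈ range h with h ∣ W * c + 1, ex (a / h * c) := by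
    refine sum_eq_single_of_mem h (Nat.mem_divisors_self h (by omega)) fun d hd hdh => ?_
    have hdvd := Nat.dvd_of_mem_divisors hd
    rw [sum_dvd_mul_add_one_ex_eq_zero W ha hdvd
      (lt_of_le_of_ne (Nat.le_of_dvd hh hdvd) hdh) (Nat.pos_of_mem_divisors hd), mul_zero]
  rw [h1, h2, norm_mul]
  have h3 : ‖(ArithmeticFunction.moebius h : ℂ)‖ ≤ 1 := by
    rw [Complex.norm_intCast]
    exact_mod_cast ArithmeticFunction.abs_moebius_le_one
  have h4 : ‖∑ c ∈ range h with h ∣ W * c + 1, ex (a / h * c)‖ ≤ if h.Coprime W then 1 else 0 := by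
    refine (norm_sum_le _ _).trans ?_
    simp only [norm_ex, sum_const, nsmul_eq_mul, mul_one]
    exact_mod_cast card_dvd_mul_add_one_le W
  calc _ ≤ 1 * (if h.Coprime W then 1 else 0 : ℝ) := by gcongr
    _ = _ := one_mul _

end SchurPrimes

namespace SchurPrimes
open Finset Filter Topology

/-- The von Mangoldt weight on primes `≡ 1` modulo `W`, normalised to have mean `1`. -/
noncomputable def lamW (W n : ℕ) : ℝ :=
  (W.totient / W : ℝ) * if (W * n + 1).Prime then Real.log ((W * n + 1 : ℕ) : ℝ) else 0

theorem lamW_nonneg (W n : ℕ) : 0 ≤ lamW W n := by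
  unfold lamW
  split_ifs
  · have := Real.log_natCast_nonneg (W * n + 1)
    positivity
  · simp

theorem sum_lamW_residue {W h : ℕ} (hW : 1 ≤ W) (c N : ℕ) :
    ∑ n ∈ range N with n ≡ c [MOD h], lamW W n = (W.totient / W : ℝ) *
      ∑ p ∈ (Icc 1 (W * N)).filter fun p => p.Prime ∧ p ≡ W * c + 1 [MOD W * h], Real.log p := by
  unfold lamW
  rw [← mul_sum, ← sum_filter]
  congr 1
  refine sum_nbij (fun n => W * n + 1) ?_ ?_ ?_ ?_
  · intro n hn
    simp only [mem_filter, mem_range, mem_Icc] at hn ⊢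
    refine ⟨⟨by omega, ?_⟩, hn.2, ?_⟩
    · calc W * n + 1 ≤ W * n + W := by omega
        _ = W * (n + 1) := by ring
        _ ≤ W * N := Nat.mul_le_mul_left _ hn.1.1
    · exact (hn.1.2.mul_left' W).add_right 1
  · intro x _ y _ hxy
    simp only [add_left_inj] at hxy
    exact Nat.eq_of_mul_eq_mul_left hW hxy
  · intro p hp
    simp only [coe_filter, mem_Icc, Set.mem_ofPred_eq, Set.mem_image, mem_filter, mem_range] at hp ⊢
    have h1 : 1 ≡ p [MOD W] := by
      have h2 := (hp.2.2.of_dvd (dvd_mul_right W h))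
      have h3 : W * c + 1 ≡ 1 [MOD W] := by simp [Nat.ModEq]
      exact (h2.trans h3).symm
    obtain ⟨n, hn⟩ := (Nat.modEq_iff_dvd' hp.1.1).mp h1
    have hpn : p = W * n + 1 := by omega
    subst hpn
    refine ⟨n, ⟨⟨?_, ?_⟩, hp.2.1⟩, rfl⟩
    · have : W * n < W * N := by omega
      exact Nat.lt_of_mul_lt_mul_left this
    · exact Nat.ModEq.mul_left_cancel' (by omega) (Nat.ModEq.add_right_cancel' 1 hp.2.2)
  · intro n _
    rfl

theorem tendsto_sum_lamW_residue {W h : ℕ} (hW : 1 ≤ W) (hh : 1 ≤ h) (c : ℕ) :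
    Tendsto (fun N : ℕ => (∑ n ∈ range N with n ≡ c [MOD h], lamW W n) / N) atTop
      (𝓝 (if (W * c + 1).Coprime h then (W.totient : ℝ) / (W * h).totient else 0)) := by
  have h1 := (tendsto_sum_log_prime_div (q := W * h) (by nlinarith) (W * c + 1)).comp
    (tendsto_id.const_mul_atTop' (show 0 < W by omega))
  have h2 := h1.const_mul (W.totient : ℝ)
  have hW0 : (W : ℝ) ≠ 0 := by
    have : W ≠ 0 := by omega
    exact_mod_cast this
  have hco : (W * c + 1).Coprime (W * h) ↔ (W * c + 1).Coprime h := by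
    rw [Nat.coprime_mul_iff_right]
    have : (W * c + 1).Coprime W := by simp
    tauto
  have h3 : (W.totient : ℝ) * (if (W * c + 1).Coprime (W * h) then 1 / ((W * h).totient : ℝ) else 0) =
      if (W * c + 1).Coprime h then (W.totient : ℝ) / (W * h).totient else 0 := by
    simp only [hco]; split_ifs
    · ring
    · ring
  rw [h3] at h2
  refine h2.congr fun N => ?_
  rw [sum_lamW_residue hW]
  simp only [Function.comp, id]
  push_cast
  by_cases hN : (N : ℝ) = 0
  · simp [hN]
  field_simp

theorem tendsto_sum_lamW_ex {W h : ℕ} (hW : 1 ≤ W) (hh : 1 ≤ h) (a : ℤ) :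
    Tendsto (fun N : ℕ => (∑ n ∈ range N, (lamW W n : ℂ) * ex (a / h * n)) / N) atTop
      (𝓝 (((W.totient : ℝ) / (W * h).totient : ℝ) *
        ∑ c ∈ range h with (W * c + 1).Coprime h, ex (a / h * c))) := by
  have hh0 : (h : ℝ) ≠ 0 := by
    have : h ≠ 0 := by omega
    exact_mod_cast this
  have h1 : ∀ N : ℕ, (∑ n ∈ range N, (lamW W n : ℂ) * ex (a / h * n)) / N =
      ∑ c ∈ range h, ex (a / h * c) *
        (((∑ n ∈ range N with n ≡ c [MOD h], lamW W n) / N : ℝ) : ℂ) := by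
    intro N
    have : ∀ n ∈ range N, n % h ∈ range h := fun n _ => mem_range.mpr (Nat.mod_lt n hh)
    rw [← sum_fiberwise_of_maps_to this, sum_div]
    refine sum_congr rfl fun c hc => ?_
    rw [Complex.ofReal_div, Complex.ofReal_sum, Complex.ofReal_natCast, ← mul_div_assoc, mul_sum]
    congr 1
    have hfe : (range N).filter (fun n => n % h = c) = (range N).filter (fun n => n ≡ c [MOD h]) := by
      refine filter_congr fun n _ => ?_
      rw [Nat.ModEq, Nat.mod_eq_of_lt (mem_range.mp hc)]
    rw [hfe]
    refine sum_congr rfl fun n hn => ?_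
    rw [← hfe, mem_filter] at hn
    have h2 : (n : ℝ) = h * (n / h : ℕ) + c := by
      have := Nat.div_add_mod n h
      rw [hn.2] at this
      exact_mod_cast this.symm
    rw [mul_comm]
    congr 1
    rw [h2, mul_add, ex_add, ← mul_assoc, div_mul_cancel₀ _ hh0]
    have : ex ((a : ℝ) * (n / h : ℕ)) = 1 := by
      have := ex_int (a * ((n / h : ℕ) : ℤ))
      rwa [Int.cast_mul, Int.cast_natCast] at this
    rw [this, one_mul]
  simp_rw [h1]
  rw [sum_filter, mul_sum]
  refine tendsto_finsetSum _ fun c _ => ?_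
  have h2 := (Complex.continuous_ofReal.tendsto _).comp (tendsto_sum_lamW_residue hW hh c)
  have h3 := h2.const_mul (ex (a / h * c))
  refine (h3.congr fun N => rfl).trans (le_of_eq ?_)
  congr 1
  split_ifs
  · rw [mul_comm]
  · simp

theorem exists_tendsto_sum_lamW_sub_one {W h w : ℕ} (hw : 1 ≤ w)
    (hWw : ∀ p, p.Prime → p ≤ w → p ∣ W) (hW : 1 ≤ W) (hh : 1 ≤ h) {a : ℤ}
    (ha : IsCoprime a (h : ℤ)) :
    ∃ κ : ℂ, ‖κ‖ ≤ 1 / w ∧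
      Tendsto (fun N : ℕ => (∑ n ∈ range N, ((lamW W n - 1 : ℝ) : ℂ) * ex (a / h * n)) / N) atTop
        (𝓝 κ) := by
  have h1 := tendsto_sum_lamW_ex hW hh a
  have hW0 : (0 : ℝ) < W.totient := by exact_mod_cast Nat.totient_pos.mpr hW
  have hsub : ∀ N : ℕ, (∑ n ∈ range N, ((lamW W n - 1 : ℝ) : ℂ) * ex (a / h * n)) / N =
      (∑ n ∈ range N, (lamW W n : ℂ) * ex (a / h * n)) / N - (∑ n ∈ range N, ex (a / h * n)) / N := by
    intro N
    rw [← sub_div, ← sum_sub_distrib]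
    congr 1
    refine sum_congr rfl fun n _ => ?_
    push_cast; ring
  simp_rw [hsub]
  rcases eq_or_lt_of_le hh with rfl | hh1
  · refine ⟨0, by simp, ?_⟩
    have h2 : Tendsto (fun N : ℕ => (∑ n ∈ range N, ex ((a : ℝ) / ((1 : ℕ) : ℝ) * n)) / (N : ℂ))
        atTop (𝓝 1) := by
      refine tendsto_const_nhds.congr' ?_
      filter_upwards [eventually_ge_atTop 1] with N hN
      have : ∀ n : ℕ, ex ((a : ℝ) * n) = 1 := by
        intro n
        have := ex_int (a * n)
        rwa [Int.cast_mul, Int.cast_natCast] at this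
      have hN0 : (N : ℂ) ≠ 0 := by
        have : N ≠ 0 := by omega
        exact_mod_cast this
      simp [this, hN0]
    have h3 := h1.sub h2
    have h4 : (((W.totient : ℝ) / (W * 1).totient : ℝ) : ℂ) *
        ∑ c ∈ range 1 with (W * c + 1).Coprime 1, ex ((a : ℝ) / ((1 : ℕ) : ℝ) * c) - 1 = 0 := by
      have hc : (W.totient : ℂ) ≠ 0 := by exact_mod_cast hW0.ne'
      simp [ex_zero, hc]
    rwa [h4] at h3
  · refine ⟨_, ?_, by
      have h2 : Tendsto (fun N : ℕ => (∑ n ∈ range N, ex (a / h * n)) / (N : ℂ)) atTop (𝓝 0) := by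
        rw [tendsto_zero_iff_norm_tendsto_zero]
        have h3 : Tendsto (fun N : ℕ => (h / 2 : ℝ) / (N : ℝ)) atTop (𝓝 0) :=
          tendsto_const_div_atTop_nhds_zero_nat _
        refine squeeze_zero (fun N => norm_nonneg _) (fun N => ?_) h3
        rw [norm_div, Complex.norm_natCast]
        refine div_le_div_of_nonneg_right ?_ (Nat.cast_nonneg N)
        have hh0 : (0 : ℝ) < h := by exact_mod_cast hh
        have h4 := inv_le_nn_of_not_dvd (m := h) (a := a) (by omega) (fun hdvd => by
          have := ha.symm.isUnit_of_dvd' dvd_rfl hdvd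
          rw [Int.isUnit_iff] at this
          omega)
        refine (norm_geom_le (by positivity) h4 N).trans ?_
        rw [mul_one_div, one_div_div]
      have h3 := h1.sub h2
      rw [sub_zero] at h3
      exact h3⟩
    rw [norm_mul, Complex.norm_real, Real.norm_of_nonneg (by positivity)]
    have h2 := norm_sum_coprime_ex_le W hh ha
    have h3 : 0 ≤ (W.totient : ℝ) / (W * h).totient := by positivity
    refine (mul_le_mul_of_nonneg_left h2 h3).trans ?_
    split_ifs with hc
    · rw [Nat.totient_mul hc.symm, mul_one]
      have hp : h.minFac.Prime := Nat.minFac_prime (by omega)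
      have h4 : w < h.minFac := by
        by_contra hle
        push Not at hle
        have h5 := hWw _ hp hle
        have h6 := Nat.dvd_gcd (Nat.minFac_dvd h) h5
        rw [Nat.Coprime] at hc
        rw [hc] at h6
        exact hp.one_lt.ne' (Nat.dvd_one.mp h6)
      have h5 : w ≤ h.totient := by
        have h6 := Nat.totient_dvd_of_dvd (Nat.minFac_dvd h)
        rw [Nat.totient_prime hp] at h6
        have := Nat.le_of_dvd (Nat.totient_pos.mpr hh) h6
        omega
      have h6 : (w : ℝ) ≤ h.totient := by exact_mod_cast h5
      have h7 : (0 : ℝ) < w := by exact_mod_cast hw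
      push_cast
      rw [div_mul_eq_div_div, div_self hW0.ne']
      gcongr
    · simp
end SchurPrimes

namespace SchurPrimes
open Finset Filter Topology

theorem sum_mul_ex_eq (F : ℕ → ℂ) (β : ℝ) (N : ℕ) :
    ∑ n ∈ range N, F n * ex (β * n) = (∑ n ∈ range N, F n) * ex (β * N) -
      ∑ n ∈ range N, (∑ j ∈ range (n + 1), F j) * (ex (β * (n + 1 : ℕ)) - ex (β * n)) := by
  induction N with
  | zero => simp
  | succ N ih =>
    rw [sum_range_succ, ih, sum_range_succ _ N, sum_range_succ (fun n => (∑ j ∈ range (n + 1), F j) * _),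
      sum_range_succ F N]
    ring

theorem norm_sum_mul_ex_le {F : ℕ → ℂ} {B : ℝ} {N : ℕ} (hB : ∀ x ≤ N, ‖∑ n ∈ range x, F n‖ ≤ B)
    (β : ℝ) : ‖∑ n ∈ range N, F n * ex (β * n)‖ ≤ B * (1 + 2 * Real.pi * |β| * N) := by
  rw [sum_mul_ex_eq]
  have hB0 : 0 ≤ B := (norm_nonneg _).trans (hB 0 (Nat.zero_le _))
  have h1 : ‖∑ n ∈ range N, (∑ j ∈ range (n + 1), F j) * (ex (β * (n + 1 : ℕ)) - ex (β * n))‖ ≤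
      N * (B * (2 * Real.pi * |β|)) := by
    refine (norm_sum_le _ _).trans ?_
    calc _ ≤ ∑ _n ∈ range N, B * (2 * Real.pi * |β|) := by
          refine sum_le_sum fun n hn => ?_
          rw [norm_mul]
          refine mul_le_mul (hB _ (mem_range.mp hn)) ?_ (norm_nonneg _) hB0
          refine (norm_ex_sub_ex_le _ _).trans (le_of_eq ?_)
          push_cast
          congr 2; ring
      _ = _ := by simp
  refine (norm_sub_le _ _).trans ?_
  rw [norm_mul, norm_ex, mul_one]
  linarith [hB N le_rfl]

theorem eventually_norm_sub_le {S : ℕ → ℂ} {κ : ℂ} (h : Tendsto (fun N : ℕ => S N / N) atTop (𝓝 κ))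
    {τ : ℝ} (hτ : 0 < τ) : ∀ᶠ N : ℕ in atTop, ∀ x ≤ N, ‖S x - κ * x‖ ≤ τ * N := by
  have h1 := (Metric.tendsto_atTop.mp h) τ hτ
  obtain ⟨x₀, hx₀⟩ := h1
  set C := ∑ x ∈ range (x₀ + 1), ‖S x - κ * x‖
  have h2 : ∀ᶠ N : ℕ in atTop, C ≤ τ * N :=
    (tendsto_natCast_atTop_atTop.const_mul_atTop hτ).eventually_ge_atTop C
  filter_upwards [h2] with N hN x hx
  by_cases hx0 : x ≤ x₀
  · refine le_trans ?_ hN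
    exact single_le_sum (f := fun x => ‖S x - κ * x‖) (fun _ _ => norm_nonneg _)
      (mem_range.mpr (by omega))
  · have h3 := hx₀ x (by omega)
    rw [dist_eq_norm] at h3
    have hxp : (0 : ℝ) < x := by
      have : 0 < x := by omega
      exact_mod_cast this
    have h4 : S x - κ * x = (S x / x - κ) * x := by
      have : (x : ℂ) ≠ 0 := by exact_mod_cast hxp.ne'
      field_simp
    rw [h4, norm_mul, Complex.norm_natCast]
    have : (x : ℝ) ≤ N := by exact_mod_cast hx
    exact mul_le_mul h3.le this hxp.le hτ.le

theorem major_arc {W w : ℕ} (hw : 1 ≤ w) (hWw : ∀ p, p.Prime → p ≤ w → p ∣ W) (hW : 1 ≤ W) (Q : ℕ)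
    {τ : ℝ} (hτ : 0 < τ) : ∀ᶠ N : ℕ in atTop, ∀ θ : ℝ,
      (∃ h : ℕ, 1 ≤ h ∧ h ≤ Q ∧ ∃ a : ℤ, |θ - a / h| ≤ Q / N) →
      ‖∑ n ∈ range N, ((lamW W n - 1 : ℝ) : ℂ) * ex (θ * n)‖ ≤ (1 / w + τ) * N := by
  set τ' : ℝ := τ / (1 + 2 * Real.pi * Q) with hτ'
  have hπ := Real.pi_pos
  have hτ'0 : 0 < τ' := by positivity
  have hfin : ∀ᶠ N : ℕ in atTop, ∀ h ∈ Icc 1 Q, ∀ r ∈ range h, IsCoprime (r : ℤ) (h : ℤ) →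
      ∃ κ : ℂ, ‖κ‖ ≤ 1 / w ∧ ∀ x ≤ N,
        ‖∑ n ∈ range x, (((lamW W n - 1 : ℝ) : ℂ) * ex ((r : ℤ) / h * n) - κ)‖ ≤ τ' * N := by
    rw [eventually_all_finset]
    intro h hh
    rw [eventually_all_finset]
    intro r hr
    by_cases hc : IsCoprime (r : ℤ) (h : ℤ)
    · obtain ⟨κ, hκ, ht⟩ := exists_tendsto_sum_lamW_sub_one hw hWw hW (mem_Icc.mp hh).1 hc
      filter_upwards [eventually_norm_sub_le ht hτ'0] with N hN _
      refine ⟨κ, hκ, fun x hx => ?_⟩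
      have := hN x hx
      rwa [sum_sub_distrib, sum_const, card_range, nsmul_eq_mul, mul_comm (x : ℂ)]
    · exact Eventually.of_forall fun N h' => absurd h' hc
  filter_upwards [hfin, eventually_ge_atTop 1] with N hN hN1 θ hθ
  obtain ⟨h₀, hh₀, hhQ₀, a₀, hβ₀⟩ := hθ
  obtain ⟨h, a, hh, hhQ, hc, hβ⟩ : ∃ (h : ℕ) (a : ℤ), 1 ≤ h ∧ h ≤ Q ∧ IsCoprime a (h : ℤ) ∧
      |θ - a / h| ≤ Q / N := by
    set x : ℚ := (a₀ : ℚ) / h₀ with hx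
    refine ⟨x.den, x.num, x.pos, ?_, ?_, ?_⟩
    · refine le_trans (Nat.le_of_dvd hh₀ ?_) hhQ₀
      have h1 := Rat.den_dvd a₀ h₀
      rw [Rat.divInt_eq_div, Int.cast_natCast, ← hx] at h1
      exact_mod_cast h1
    · rw [Int.isCoprime_iff_gcd_eq_one]
      exact x.reduced
    · have h1 : ((x.num : ℝ) / x.den) = (a₀ : ℝ) / h₀ := by
        have := Rat.cast_def (K := ℝ) x
        rw [← this, hx]; push_cast; rfl
      rwa [h1]
  have hh0 : (0 : ℝ) < h := by exact_mod_cast hh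
  set r : ℕ := (a % h).toNat with hr
  have hrz : (r : ℤ) = a % h := Int.toNat_of_nonneg (Int.emod_nonneg _ (by omega))
  have hrlt : r < h := by
    have := Int.emod_lt_of_pos a (show (0 : ℤ) < h by omega)
    omega
  have hrc : IsCoprime (r : ℤ) (h : ℤ) := by
    rw [hrz]
    have h1 : a % h = a + h * (-(a / h)) := by
      have := Int.emod_add_mul_ediv a h
      linarith
    rw [h1]
    exact IsCoprime.add_mul_left_left hc _
  obtain ⟨κ, hκ, hx⟩ := hN h (mem_Icc.mpr ⟨hh, hhQ⟩) r (mem_range.mpr hrlt) hrc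
  set β : ℝ := θ - a / h
  have hex : ∀ n : ℕ, ex (θ * n) = ex ((r : ℤ) / h * n) * ex (β * n) := by
    intro n
    have h1 : θ * n = ((a / h : ℤ) * n : ℤ) + (((r : ℤ) : ℝ) / h * n + β * n) := by
      have h2 : (a : ℝ) = h * (a / h : ℤ) + (r : ℤ) := by
        rw [hrz]
        exact_mod_cast (Int.mul_ediv_add_emod a h).symm
      simp only [β]
      rw [h2]
      push_cast
      field_simp
      ring
    rw [h1, ex_add, ex_int, one_mul, ex_add]
  have hN0 : (0 : ℝ) < N := by exact_mod_cast hN1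
  have hsplit : ∑ n ∈ range N, ((lamW W n - 1 : ℝ) : ℂ) * ex (θ * n) =
      ∑ n ∈ range N, (((lamW W n - 1 : ℝ) : ℂ) * ex ((r : ℤ) / h * n) - κ) * ex (β * n) +
        κ * ∑ n ∈ range N, ex (β * n) := by
    rw [mul_sum, ← sum_add_distrib]
    refine sum_congr rfl fun n _ => ?_
    rw [hex]; ring
  rw [hsplit]
  refine (norm_add_le _ _).trans ?_
  have h1 := norm_sum_mul_ex_le hx β
  have h2 : ‖κ * ∑ n ∈ range N, ex (β * n)‖ ≤ 1 / w * N := by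
    rw [norm_mul]
    exact mul_le_mul hκ (norm_sum_ex_le _ _) (norm_nonneg _) (by positivity)
  have h3 : |β| * N ≤ Q := by rwa [← le_div_iff₀ hN0]
  have h4 : τ' * N * (1 + 2 * Real.pi * |β| * N) ≤ τ' * N * (1 + 2 * Real.pi * Q) := by
    have : 2 * Real.pi * |β| * N = 2 * Real.pi * (|β| * N) := by ring
    rw [this]
    gcongr
  have h5 : τ' * N * (1 + 2 * Real.pi * Q) = τ * N := by
    rw [hτ']; field_simp
  linarith
end SchurPrimes

namespace SchurPrimes
open Finset Filter Topology

theorem sum_lamW_ex_eq {W : ℕ} (hW : 1 ≤ W) (N : ℕ) (θ : ℝ) :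
    ∑ n ∈ range N, (lamW W n : ℂ) * ex (θ * n) =
      ((W.totient / W : ℝ) : ℂ) * ((1 / W : ℂ) * ∑ b ∈ range W, ex (-((θ + b) / W)) *
        ∑ m ∈ Ioc 0 (W * N), ((if m.Prime then Real.log m else 0 : ℝ) : ℂ) * ex ((θ + b) / W * m)) := by
  have hW0 : (W : ℂ) ≠ 0 := by
    have : W ≠ 0 := by omega
    exact_mod_cast this
  have hW0' : (W : ℝ) ≠ 0 := by
    have : W ≠ 0 := by omega
    exact_mod_cast this
  have h1 : (1 / W : ℂ) * ∑ b ∈ range W, ex (-((θ + b) / W)) *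
        ∑ m ∈ Ioc 0 (W * N), ((if m.Prime then Real.log m else 0 : ℝ) : ℂ) * ex ((θ + b) / W * m) =
      ∑ m ∈ Ioc 0 (W * N), if (W : ℤ) ∣ (m : ℤ) - 1 then
        ((if m.Prime then Real.log m else 0 : ℝ) : ℂ) * ex (θ / W * (m - 1)) else 0 := by
    simp_rw [mul_sum]
    rw [sum_comm]
    refine sum_congr rfl fun m _ => ?_
    have h2 : ∀ b : ℕ, (1 / W : ℂ) * (ex (-((θ + b) / W)) *
        (((if m.Prime then Real.log m else 0 : ℝ) : ℂ) * ex ((θ + b) / W * m))) =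
        (1 / W : ℂ) * (((if m.Prime then Real.log m else 0 : ℝ) : ℂ) * ex (θ / W * (m - 1))) *
          ex (b * ((m - 1 : ℤ) : ℝ) / W) := by
      intro b
      have h3 : ex (-((θ + b) / W)) * ex ((θ + b) / W * m) =
          ex (θ / W * (m - 1)) * ex (b * ((m - 1 : ℤ) : ℝ) / W) := by
        rw [← ex_add, ← ex_add]
        congr 1
        push_cast
        field_simp
        ring
      linear_combination (1 / W : ℂ) * ((if m.Prime then Real.log m else 0 : ℝ) : ℂ) * h3
    simp_rw [h2]
    rw [← mul_sum, sum_ex_div W hW]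
    split_ifs
    · field_simp
    · simp
    · simp
    · simp
  rw [h1, ← sum_filter, mul_sum]
  rw [← sum_filter_of_ne (s := range N) (p := fun n => (W * n + 1).Prime)]
  rotate_left
  · intro n _ hne
    by_contra hnp
    refine hne ?_
    simp [lamW, hnp]
  rw [← sum_filter_of_ne (s := (Ioc 0 (W * N)).filter _) (p := fun m => m.Prime)]
  rotate_left
  · intro n _ hne
    by_contra hnp
    refine hne ?_
    simp [hnp]
  refine sum_nbij (fun n => W * n + 1) ?_ ?_ ?_ ?_
  · intro n hn
    simp only [mem_filter, mem_range, mem_Ioc] at hn ⊢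
    refine ⟨⟨⟨by omega, ?_⟩, ?_⟩, hn.2⟩
    · calc W * n + 1 ≤ W * n + W := by omega
        _ = W * (n + 1) := by ring
        _ ≤ W * N := Nat.mul_le_mul_left _ hn.1
    · push_cast
      simp
  · intro x _ y _ hxy
    simp only [add_left_inj] at hxy
    exact Nat.eq_of_mul_eq_mul_left hW hxy
  · intro p hp
    simp only [coe_filter, mem_Ioc, Set.mem_ofPred_eq, Set.mem_image, mem_filter, mem_range] at hp ⊢
    obtain ⟨⟨⟨hp0, hpN⟩, hd⟩, hpp⟩ := hp
    have hd' : W ∣ p - 1 := by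
      rw [← Int.natCast_dvd_natCast, Nat.cast_sub hp0]
      exact_mod_cast hd
    obtain ⟨n, hn⟩ := hd'
    have hpn : p = W * n + 1 := by omega
    subst hpn
    refine ⟨n, ⟨?_, hpp⟩, rfl⟩
    have : W * n < W * N := by omega
    exact Nat.lt_of_mul_lt_mul_left this
  · intro n hn
    rw [mem_filter] at hn
    simp only [lamW, if_pos hn.2]
    have : θ / W * (((W * n + 1 : ℕ) : ℝ) - 1) = θ * n := by push_cast; field_simp; ring
    rw [this]
    push_cast
    ring

theorem norm_sum_log_prime_sub_vonMangoldt_le (φ : ℝ) {X : ℕ} (hX : 1 ≤ X) :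
    ‖∑ m ∈ Ioc 0 X, (ArithmeticFunction.vonMangoldt m : ℂ) * ex (φ * m) -
      ∑ m ∈ Ioc 0 X, ((if m.Prime then Real.log m else 0 : ℝ) : ℂ) * ex (φ * m)‖ ≤
      2 * √X * Real.log X := by
  have h4 := Chebyshev.psi_sub_theta_le (x := X) (by exact_mod_cast hX)
  rw [Chebyshev.psi_sub_theta_eq_sum_not_prime, Nat.floor_natCast, sum_filter] at h4
  refine le_trans ?_ h4
  rw [← sum_sub_distrib]
  refine (norm_sum_le _ _).trans (sum_le_sum fun m _ => ?_)
  rw [← sub_mul, norm_mul, norm_ex, mul_one, ← Complex.ofReal_sub, Complex.norm_real]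
  by_cases hm : m.Prime
  · simp [hm, ArithmeticFunction.vonMangoldt_apply_prime]
  · simp [hm, abs_of_nonneg ArithmeticFunction.vonMangoldt_nonneg]

theorem minor_arc_lamW {W : ℕ} (hW : 1 ≤ W) {ε : ℝ} (hε : 0 < ε) : ∃ Q : ℕ, ∀ᶠ N : ℕ in atTop,
    ∀ θ : ℝ, (∀ h : ℕ, 1 ≤ h → h ≤ Q → ∀ a : ℤ, (Q : ℝ) / N < |θ - a / h|) →
      ‖∑ n ∈ range N, ((lamW W n - 1 : ℝ) : ℂ) * ex (θ * n)‖ ≤ ε * N := by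
  have hW0 : (0 : ℝ) < W := by exact_mod_cast hW
  set η : ℝ := ε / (4 * W) with hη
  obtain ⟨Q₁, hQ₁, N₁, hmin⟩ := minor_arc (η := η) (by positivity)
  obtain ⟨Q₂, hQ₂⟩ := exists_nat_ge (1 / ε)
  refine ⟨max Q₁ Q₂, ?_⟩
  have hev := eventually_sqrt_mul_log_le 0 0 η (by positivity)
  have hev' := (tendsto_id.const_mul_atTop' (show 0 < W by omega)).eventually hev
  filter_upwards [hev', eventually_ge_atTop 1, eventually_ge_atTop N₁] with N hN hN1 hNN θ hθ
  simp only [id] at hN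
  have hN0 : (0 : ℝ) < N := by exact_mod_cast hN1
  have hQle₁ : (Q₁ : ℝ) ≤ (max Q₁ Q₂ : ℕ) := by exact_mod_cast le_max_left _ _
  have hQle₂ : (Q₂ : ℝ) ≤ (max Q₁ Q₂ : ℕ) := by exact_mod_cast le_max_right _ _
  set Q := max Q₁ Q₂
  have hQ1 : 1 ≤ Q := hQ₁.trans (le_max_left _ _)
  have hQ0 : (0 : ℝ) < Q := by exact_mod_cast hQ1
  have hgeom : ‖∑ n ∈ range N, ex (θ * n)‖ ≤ ε / 2 * N := by
    have h1 : (Q : ℝ) / N ≤ nn θ := by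
      have := hθ 1 le_rfl hQ1 (round θ)
      rw [Nat.cast_one, div_one] at this
      exact this.le
    refine (norm_geom_le (by positivity) h1 N).trans ?_
    have h2 : 1 ≤ ε * Q := by
      rw [div_le_iff₀ hε] at hQ₂
      nlinarith
    rw [div_le_iff₀ (by positivity)]
    have : ε / 2 * N * (2 * (Q / N)) = ε * Q := by field_simp
    rw [this]; exact h2
  have hmain : ‖∑ n ∈ range N, (lamW W n : ℂ) * ex (θ * n)‖ ≤ ε / 2 * N := by
    rw [sum_lamW_ex_eq hW, norm_mul, norm_mul]
    have h1 : ∀ b ∈ range W, ‖ex (-((θ + b) / W)) * ∑ m ∈ Ioc 0 (W * N),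
        ((if m.Prime then Real.log m else 0 : ℝ) : ℂ) * ex ((θ + b) / W * m)‖ ≤ 2 * η * (W * N) := by
      intro b _
      rw [norm_mul, norm_ex, one_mul]
      have h2 := hmin (W * N) (by nlinarith) ((θ + b) / W) (by
        intro h hh hhQ
        have hh0 : (0 : ℝ) < h := by exact_mod_cast hh
        have h3 := hθ h hh (hhQ.trans (le_max_left _ _)) (round (h * ((θ + b) / W)) * W - b * h)
        unfold nn
        set t := round (h * ((θ + b) / W))
        have h4 : h * ((θ + b) / W) - t = h / W * (θ - ((t * W - b * h : ℤ) : ℝ) / h) := by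
          push_cast; field_simp; ring
        rw [h4, abs_mul, abs_of_pos (by positivity)]
        calc (Q₁ : ℝ) / (W * N : ℕ) = 1 / W * (Q₁ / N) := by push_cast; field_simp
          _ ≤ h / W * (Q / N) := by
            gcongr
            exact_mod_cast hh
          _ < _ := by gcongr)
      have h5 := norm_sum_log_prime_sub_vonMangoldt_le ((θ + b) / W) (X := W * N) (by nlinarith)
      have h6 := norm_sub_norm_le (∑ m ∈ Ioc 0 (W * N),
        ((if m.Prime then Real.log m else 0 : ℝ) : ℂ) * ex ((θ + b) / W * m))
        (∑ m ∈ Ioc 0 (W * N), (ArithmeticFunction.vonMangoldt m : ℂ) * ex ((θ + b) / W * m))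
      rw [norm_sub_rev] at h6
      have h7 := hN.1
      have h8 := Real.sqrt_nonneg ((W * N : ℕ) : ℝ)
      push_cast at h2 h5 h6 h7 h8 ⊢
      linarith
    have h2 := (norm_sum_le _ _).trans (sum_le_sum h1)
    rw [sum_const, card_range, nsmul_eq_mul] at h2
    have h3 : ‖((W.totient / W : ℝ) : ℂ)‖ ≤ 1 := by
      rw [Complex.norm_real, Real.norm_of_nonneg (by positivity), div_le_one hW0]
      exact_mod_cast Nat.totient_le W
    have h4 : ‖(1 / W : ℂ)‖ = 1 / W := by simp
    rw [h4]
    calc _ ≤ 1 * (1 / W * (W * (2 * η * (W * N)))) := by gcongr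
      _ = ε / 2 * N := by rw [hη]; field_simp; ring
  have : ∑ n ∈ range N, ((lamW W n - 1 : ℝ) : ℂ) * ex (θ * n) =
      ∑ n ∈ range N, (lamW W n : ℂ) * ex (θ * n) - ∑ n ∈ range N, ex (θ * n) := by
    rw [← sum_sub_distrib]
    refine sum_congr rfl fun n _ => ?_
    push_cast; ring
  rw [this]
  refine (norm_sub_le _ _).trans ?_
  linarith

theorem fourier_lamW_sub_one_le {η : ℝ} (hη : 0 < η) : ∃ w : ℕ, ∀ W, 1 ≤ W →
    (∀ p, p.Prime → p ≤ w → p ∣ W) → ∀ᶠ N : ℕ in atTop, ∀ θ : ℝ,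
      ‖∑ n ∈ range N, ((lamW W n - 1 : ℝ) : ℂ) * ex (θ * n)‖ ≤ η * N := by
  obtain ⟨w, hw⟩ := exists_nat_ge (2 / η)
  have hw0 : (0 : ℝ) < w := lt_of_lt_of_le (by positivity) hw
  refine ⟨w, fun W hW hWw => ?_⟩
  obtain ⟨Q, hQ⟩ := minor_arc_lamW hW hη
  filter_upwards [hQ, major_arc (by exact_mod_cast hw0) hWw hW Q (half_pos hη)] with N h1 h2 θ
  by_cases h : ∃ h : ℕ, 1 ≤ h ∧ h ≤ Q ∧ ∃ a : ℤ, |θ - a / h| ≤ Q / N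
  · refine (h2 θ h).trans ?_
    have : 1 / (w : ℝ) ≤ η / 2 := by
      rw [div_le_iff₀ hη] at hw
      rw [div_le_div_iff₀ hw0 two_pos]
      linarith
    gcongr
    linarith
  · push Not at h
    exact h1 θ h
end SchurPrimes

namespace SchurPrimes
open Finset

noncomputable def FT {M : ℕ} [NeZero M] (f : ZMod M → ℝ) (r : ZMod M) : ℂ :=
  ∑ x, (f x : ℂ) * ZMod.stdAddChar (x * r)

theorem stdAddChar_natCast_mul {M : ℕ} [NeZero M] (n : ℕ) (r : ZMod M) :
    (ZMod.stdAddChar ((n : ZMod M) * r) : ℂ) = ex ((r.val : ℝ) / M * n) := by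
  have h : ((n : ZMod M) * r) = (((n * r.val : ℕ) : ℤ) : ZMod M) := by
    push_cast
    rw [ZMod.natCast_zmod_val]
  rw [h, ZMod.stdAddChar_coe, ex]
  congr 1
  push_cast
  ring

theorem sum_zmod_eq_sum_range {M : ℕ} [NeZero M] {β : Type*} [AddCommMonoid β] (h : ZMod M → β) :
    ∑ x, h x = ∑ n ∈ range M, h (n : ZMod M) := by
  refine Finset.sum_bij' (fun x _ => x.val) (fun n _ => (n : ZMod M)) ?_ ?_ ?_ ?_ ?_
  · intro x _; exact mem_range.2 x.val_lt
  · intro n _; exact mem_univ _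
  · intro x _; exact ZMod.natCast_zmod_val x
  · intro n hn; exact ZMod.val_natCast_of_lt (mem_range.1 hn)
  · intro x _; rw [ZMod.natCast_zmod_val]

theorem sum_stdAddChar_mul {M : ℕ} [NeZero M] (r : ZMod M) :
    ∑ x : ZMod M, (ZMod.stdAddChar (x * r) : ℂ) = if r = 0 then (M : ℂ) else 0 := by
  have := AddChar.sum_mulShift r (ZMod.isPrimitive_stdAddChar M)
  rw [this, ZMod.card]
  split_ifs <;> simp

theorem sum_normSq_trig {M : ℕ} [NeZero M] (c : ZMod M → ℂ) :
    ∑ x : ZMod M, ‖∑ r, c r * ZMod.stdAddChar (x * r)‖ ^ 2 = M * ∑ r, ‖c r‖ ^ 2 := by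
  have key : ∀ x : ZMod M, ((‖∑ r, c r * ZMod.stdAddChar (x * r)‖ ^ 2 : ℝ) : ℂ) =
      ∑ r, ∑ s, c r * (starRingEnd ℂ) (c s) * ZMod.stdAddChar (x * (r - s)) := by
    intro x
    rw [Complex.ofReal_pow, ← Complex.mul_conj', map_sum, Finset.sum_mul_sum]
    refine Finset.sum_congr rfl fun r _ => Finset.sum_congr rfl fun s _ => ?_
    rw [map_mul (starRingEnd ℂ), ← AddChar.map_neg_eq_conj, mul_sub, sub_eq_add_neg, AddChar.map_add_eq_mul]
    ring
  have : ((∑ x : ZMod M, ‖∑ r, c r * ZMod.stdAddChar (x * r)‖ ^ 2 : ℝ) : ℂ) =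
      ((M * ∑ r, ‖c r‖ ^ 2 : ℝ) : ℂ) := by
    rw [Complex.ofReal_sum, Finset.sum_congr rfl fun x _ => key x, Finset.sum_comm]
    rw [Complex.ofReal_mul, Complex.ofReal_sum, Finset.mul_sum]
    refine Finset.sum_congr rfl fun r _ => ?_
    rw [Finset.sum_comm]
    simp_rw [← Finset.mul_sum, sum_stdAddChar_mul, sub_eq_zero]
    rw [Finset.sum_eq_single r]
    · rw [if_pos rfl, Complex.mul_conj']
      push_cast; ring
    · intro s _ hs
      rw [if_neg (Ne.symm hs), mul_zero]
    · simp
  exact_mod_cast this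

theorem sum_normSq_FT {M : ℕ} [NeZero M] (f : ZMod M → ℝ) :
    ∑ r, ‖FT f r‖ ^ 2 = M * ∑ x, f x ^ 2 := by
  have := sum_normSq_trig (fun x => (f x : ℂ))
  simp only [Complex.norm_real, Real.norm_eq_abs, sq_abs] at this
  rw [← this]
  refine Finset.sum_congr rfl fun r _ => ?_
  rw [FT]
  simp_rw [mul_comm r]

theorem card_large_FT {M N : ℕ} [NeZero M] (hNM : N ≤ M) {f : ZMod M → ℝ} {ν a : ℕ → ℝ}
    {K A E S t : ℝ} (hK : 0 ≤ K) (hf0 : ∀ x, 0 ≤ f x) (hfν : ∀ x, f x ≤ K * ν x.val)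
    (hfN : ∀ x : ZMod M, N ≤ x.val → f x = 0) (ha0 : ∀ n, 0 ≤ a n)
    (haA : ∀ n, a n ≤ A)
    (hE : ∀ θ, ‖∑ n ∈ range N, ((ν n - a n : ℝ) : ℂ) * ex (θ * n)‖ ≤ E)
    (hS : ∑ n ∈ range N, ν n ≤ S) (ht : 0 ≤ t) {R : Finset (ZMod M)}
    (hR : ∀ r ∈ R, t ≤ ‖FT f r‖) :
    t ^ 2 * (#R : ℝ) ^ 2 ≤ K * S * (K * (E * (#R : ℝ) ^ 2 + A * M * #R)) := by
  classical
  have hc : ∀ r, ∃ z : ℂ, ‖z‖ = 1 ∧ z * FT f r = (‖FT f r‖ : ℂ) := by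
    intro r
    by_cases h : FT f r = 0
    · exact ⟨1, by simp, by simp [h]⟩
    · have h' : (‖FT f r‖ : ℂ) ≠ 0 := by simpa using h
      refine ⟨(‖FT f r‖ : ℂ) / FT f r, ?_, div_mul_cancel₀ _ h⟩
      rw [norm_div, Complex.norm_real, norm_norm, div_self (by simpa using h)]
  choose z hz1 hz2 using hc
  set c : ZMod M → ℂ := fun r => if r ∈ R then z r else 0 with hcdef
  set G : ZMod M → ℂ := fun x => ∑ r, c r * ZMod.stdAddChar (x * r) with hG
  have hGR : ∀ x, G x = ∑ r ∈ R, z r * ZMod.stdAddChar (x * r) := by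
    intro x
    simp [hG, hcdef, Finset.sum_ite_mem]
  have h1 : t * #R ≤ ∑ x, f x * ‖G x‖ := by
    have e1 : ((∑ r ∈ R, ‖FT f r‖ : ℝ) : ℂ) = ∑ x, (f x : ℂ) * G x := by
      rw [Complex.ofReal_sum]
      simp_rw [hGR, Finset.mul_sum]
      rw [Finset.sum_comm]
      refine Finset.sum_congr rfl fun r _ => ?_
      rw [← hz2, FT, Finset.mul_sum]
      exact Finset.sum_congr rfl fun x _ => by ring
    calc t * #R = ∑ r ∈ R, t := by rw [Finset.sum_const, nsmul_eq_mul]; ring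
      _ ≤ ∑ r ∈ R, ‖FT f r‖ := Finset.sum_le_sum hR
      _ = ‖((∑ r ∈ R, ‖FT f r‖ : ℝ) : ℂ)‖ := by
          rw [Complex.norm_real, Real.norm_eq_abs,
            abs_of_nonneg (Finset.sum_nonneg fun _ _ => norm_nonneg _)]
      _ ≤ ∑ x, f x * ‖G x‖ := by
          rw [e1]
          refine (norm_sum_le _ _).trans (Finset.sum_le_sum fun x _ => ?_)
          rw [norm_mul, Complex.norm_real, Real.norm_eq_abs, abs_of_nonneg (hf0 x)]
  have h2 : (∑ x, f x * ‖G x‖) ^ 2 ≤ (∑ x, f x) * ∑ x, f x * ‖G x‖ ^ 2 :=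
    Finset.sum_sq_le_sum_mul_sum_of_sq_le_mul _ (fun x _ => hf0 x)
      (fun x _ => mul_nonneg (hf0 x) (sq_nonneg _)) (fun x _ => by nlinarith)
  have hred : ∀ g : ZMod M → ℝ, (∀ x, 0 ≤ g x) →
      ∑ x, f x * g x ≤ K * ∑ n ∈ range N, ν n * g n := by
    intro g hg
    rw [sum_zmod_eq_sum_range, Finset.mul_sum]
    rw [← Finset.sum_subset (range_subset_range.2 hNM)]
    · refine Finset.sum_le_sum fun n hn => ?_
      have hn' : n < M := (mem_range.1 hn).trans_le hNM
      have := hfν n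
      rw [ZMod.val_natCast_of_lt hn'] at this
      calc f n * g n ≤ K * ν n * g n := mul_le_mul_of_nonneg_right this (hg _)
        _ = _ := by ring
    · intro n hn hn'
      rw [hfN n, zero_mul]
      rw [ZMod.val_natCast_of_lt (mem_range.1 hn)]
      simpa using hn'
  have h3 : ∑ x, f x ≤ K * S := by
    have := hred (fun _ => 1) (fun _ => zero_le_one)
    simp only [mul_one] at this
    exact this.trans (mul_le_mul_of_nonneg_left hS hK)
  have hGsum : ∑ x, ‖G x‖ ^ 2 = M * #R := by
    rw [hG, sum_normSq_trig]
    congr 1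
    rw [Finset.sum_congr rfl (g := fun r => if r ∈ R then (1:ℝ) else 0)]
    · simp
    · intro r _
      by_cases h : r ∈ R <;> simp [hcdef, h, hz1]
  have hA0 : 0 ≤ A := (ha0 0).trans (haA 0)
  have h4 : ∑ n ∈ range N, a n * ‖G n‖ ^ 2 ≤ A * M * #R := by
    calc ∑ n ∈ range N, a n * ‖G n‖ ^ 2 ≤ ∑ n ∈ range N, A * ‖G n‖ ^ 2 :=
          Finset.sum_le_sum fun n _ => mul_le_mul_of_nonneg_right (haA n) (sq_nonneg _)
      _ ≤ ∑ n ∈ range M, A * ‖G n‖ ^ 2 :=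
          Finset.sum_le_sum_of_subset_of_nonneg (range_subset_range.2 hNM)
            fun _ _ _ => mul_nonneg hA0 (sq_nonneg _)
      _ = A * ∑ x, ‖G x‖ ^ 2 := by rw [sum_zmod_eq_sum_range, Finset.mul_sum]
      _ = _ := by rw [hGsum]; ring
  have h5 : ∑ n ∈ range N, (ν n - a n) * ‖G n‖ ^ 2 ≤ E * (#R : ℝ) ^ 2 := by
    have e : ((∑ n ∈ range N, (ν n - a n) * ‖G n‖ ^ 2 : ℝ) : ℂ) =
        ∑ r ∈ R, ∑ s ∈ R, z r * (starRingEnd ℂ) (z s) *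
          ∑ n ∈ range N, ((ν n - a n : ℝ) : ℂ) * ex ((((r.val : ℝ) - s.val) / M) * n) := by
      rw [Complex.ofReal_sum]
      simp_rw [Finset.mul_sum]
      rw [Finset.sum_congr rfl fun r _ => Finset.sum_comm, Finset.sum_comm]
      refine Finset.sum_congr rfl fun n _ => ?_
      rw [Complex.ofReal_mul, Complex.ofReal_pow, ← Complex.mul_conj', hGR, map_sum,
        Finset.sum_mul_sum, Finset.mul_sum]
      refine Finset.sum_congr rfl fun r _ => ?_
      rw [Finset.mul_sum]
      refine Finset.sum_congr rfl fun s _ => ?_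
      rw [map_mul (starRingEnd ℂ), stdAddChar_natCast_mul, stdAddChar_natCast_mul,
        show (((r.val : ℝ) - s.val) / M) * n = (r.val : ℝ) / M * n - (s.val : ℝ) / M * n by ring,
        ex_sub]
      ring
    calc ∑ n ∈ range N, (ν n - a n) * ‖G n‖ ^ 2
        ≤ ‖((∑ n ∈ range N, (ν n - a n) * ‖G n‖ ^ 2 : ℝ) : ℂ)‖ := by
          rw [Complex.norm_real]; exact Real.le_norm_self _
      _ ≤ ∑ r ∈ R, ∑ s ∈ R, E := by
          rw [e]
          refine (norm_sum_le _ _).trans (Finset.sum_le_sum fun r _ => ?_)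
          refine (norm_sum_le _ _).trans (Finset.sum_le_sum fun s _ => ?_)
          rw [norm_mul, norm_mul, RCLike.norm_conj, hz1, hz1, one_mul, one_mul]
          exact hE _
      _ = _ := by simp only [Finset.sum_const, nsmul_eq_mul]; ring
  have h6 : ∑ x, f x * ‖G x‖ ^ 2 ≤ K * (E * (#R : ℝ) ^ 2 + A * M * #R) := by
    refine (hred _ fun x => sq_nonneg _).trans (mul_le_mul_of_nonneg_left ?_ hK)
    calc ∑ n ∈ range N, ν n * ‖G n‖ ^ 2
        = ∑ n ∈ range N, (ν n - a n) * ‖G n‖ ^ 2 + ∑ n ∈ range N, a n * ‖G n‖ ^ 2 := by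
          rw [← Finset.sum_add_distrib]
          exact Finset.sum_congr rfl fun _ _ => by ring
      _ ≤ _ := add_le_add h5 h4
  calc t ^ 2 * (#R : ℝ) ^ 2 = (t * #R) ^ 2 := by ring
    _ ≤ (∑ x, f x * ‖G x‖) ^ 2 := by gcongr
    _ ≤ _ := h2
    _ ≤ _ := mul_le_mul h3 h6
        (Finset.sum_nonneg fun x _ => mul_nonneg (hf0 x) (sq_nonneg _))
        ((Finset.sum_nonneg fun x _ => hf0 x).trans h3)

end SchurPrimes

namespace SchurPrimes
open Finset Filter

theorem rho_prime_eq_one (W : ℕ) {z p : ℕ} (hp : p.Prime) (h : z < p) : rho (prm W 0 z) p = 1 := by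
  unfold rho
  refine prod_eq_one fun q hq => ?_
  obtain ⟨⟨_, h2⟩, h1, _⟩ := mem_prm.mp hq
  have : ¬ q ∣ p := fun hd => by
    have := (Nat.prime_dvd_prime_iff_eq h1 hp).mp hd; omega
  simp [dv, this]

theorem lamW_le_mul_log {W N n : ℕ} (hW : 1 ≤ W) (hWN : W ≤ N) (hn : n < N) :
    lamW W n ≤ (W.totient / W : ℝ) * (2 * Real.log N) := by
  unfold lamW
  have hN : (1 : ℝ) ≤ N := by exact_mod_cast hW.trans hWN
  refine mul_le_mul_of_nonneg_left ?_ (by positivity)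
  split_ifs
  · have h : W * n + 1 ≤ N ^ 2 := by nlinarith
    calc Real.log ((W * n + 1 : ℕ) : ℝ) ≤ Real.log ((N ^ 2 : ℕ) : ℝ) :=
          Real.log_le_log (by positivity) (by exact_mod_cast h)
      _ = 2 * Real.log N := by push_cast; rw [Real.log_pow]; norm_num
  · have := Real.log_nonneg hN
    positivity

theorem exists_bound_pow_div_pow (k : ℕ) {r : ℝ} (hr : 1 < r) :
    ∃ B : ℝ, 1 ≤ B ∧ ∀ u : ℕ, (u : ℝ) ^ k ≤ B * r ^ u := by
  obtain ⟨B, hB⟩ := (tendsto_pow_const_div_const_pow_of_one_lt k hr).bddAbove_range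
  refine ⟨max B 1, le_max_right _ _, fun u => ?_⟩
  have h := hB ⟨u, rfl⟩
  have hp : 0 < r ^ u := by positivity
  rw [div_le_iff₀ hp] at h
  exact h.trans (mul_le_mul_of_nonneg_right (le_max_left _ _) hp.le)

theorem restriction : ∃ C : ℝ, 1 ≤ C ∧ ∃ s₁ : ℕ, ∀ (W N j : ℕ) [NeZero (2 * N)] (f : ZMod (2 * N) → ℝ),
    1 ≤ W → W ≤ N → 240 * (3 * (j + s₁)) ^ 2 ≤ Nat.log 2 N →
    (∀ x, 0 ≤ f x ∧ f x ≤ lamW W x.val) → (∀ x, f x ≠ 0 → x.val < N ∧ N ≤ x.val ^ 2) →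
    (#{r | (N : ℝ) / 2 ^ j ≤ ‖FT f r‖} : ℝ) ≤ C * 6 ^ j := by
  obtain ⟨C, hC, s₀, hs₀, H⟩ := sieve_exists
  obtain ⟨B, hB, hBu⟩ := exists_bound_pow_div_pow 8 (by norm_num : (1 : ℝ) < 3 / 2)
  obtain ⟨u₀, hu₀⟩ := eventually_atTop.1
    (eventually_pow_div_two_pow_le 16 (25600 * C ^ 2 * 3 ^ 16) (by norm_num : (0 : ℝ) < 1 / 2))
  set s₁ := max u₀ s₀
  refine ⟨102400 * C ^ 2 * 3 ^ 8 * B * (3 / 2) ^ s₁, ?_, s₁, ?_⟩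
  · have h1 : (1 : ℝ) ≤ (3 / 2) ^ s₁ := one_le_pow₀ (by norm_num)
    have h2 : (1 : ℝ) ≤ 102400 * C ^ 2 * 3 ^ 8 := by nlinarith
    exact one_le_mul_of_one_le_of_one_le (one_le_mul_of_one_le_of_one_le h2 hB) h1
  intro W N j _ f hW hWN hlog hf hsupp
  set u := j + s₁ with hu
  set s := 3 * u with hs
  have hs0s : s₀ ≤ s := by
    have : s₀ ≤ s₁ := le_max_right _ _
    omega
  have hu0 : u₀ ≤ u := by
    have : u₀ ≤ s₁ := le_max_left _ _
    omega
  have hs1 : 1 ≤ s := hs₀.trans hs0s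
  have hN0 : N ≠ 0 := by omega
  have hNpos : (0 : ℝ) < N := by exact_mod_cast Nat.pos_of_ne_zero hN0
  set J₀ := Nat.clog 2 (3 * s) with hJ₀
  have hJ1 : 3 * s ≤ 2 ^ J₀ := Nat.le_pow_clog (by norm_num) _
  have hJ2 : 2 ^ J₀ ≤ 6 * s := by
    have h := Nat.pow_pred_clog_lt_self (b := 2) (by norm_num) (x := 3 * s) (by omega)
    have h3 : 0 < J₀ := Nat.clog_pos (by norm_num) (by omega)
    have h4 : J₀ = (J₀ - 1) + 1 := by omega
    rw [h4, pow_succ]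
    have : 2 ^ (J₀ - 1) < 3 * s := h
    omega
  have htN : ((2 ^ s) ^ 40) ^ 2 ^ J₀ ≤ N := by
    rw [← pow_mul, ← pow_mul]
    refine (Nat.pow_le_pow_right (by norm_num) ?_).trans (Nat.pow_log_le_self 2 hN0)
    calc s * (40 * 2 ^ J₀) = s * 40 * 2 ^ J₀ := by ring
      _ ≤ s * 40 * (6 * s) := Nat.mul_le_mul_left _ hJ2
      _ = 240 * s ^ 2 := by ring
      _ ≤ _ := hlog
  have ht2 : 2 ≤ (2 ^ s) ^ 40 := by
    rw [← pow_mul]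
    calc 2 = 2 ^ 1 := by norm_num
      _ ≤ 2 ^ (s * 40) := Nat.pow_le_pow_right (by norm_num) (by omega)
  obtain ⟨J, hJ, hJN, hNJ⟩ := exists_sieve_level ht2 htN
  obtain ⟨ν, a, ha, -, hν, Hν⟩ := H W 1 s J hs0s (hJ1.trans (Nat.pow_le_pow_right (by norm_num) hJ))
  set z := 2 ^ (s * 2 ^ J) with hz
  have hz40 : ((2 ^ s) ^ 40) ^ 2 ^ J = z ^ 40 := by
    rw [hz, ← pow_mul, ← pow_mul, ← pow_mul]; congr 1; ring
  rw [hz40] at hJN hNJ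
  obtain ⟨hE, hS, -⟩ := Hν N (by simpa using hJN)
  have hz1 : 1 ≤ z := Nat.one_le_two_pow
  have hd := dens_pos W z
  have hνx : ∀ x, f x ≤ 160 * ν x.val := by
    intro x
    have hν0 : 0 ≤ ν x.val := (div_nonneg (rho_nonneg _ _) hd.le).trans (hν _)
    by_cases h0 : f x = 0
    · rw [h0]; positivity
    obtain ⟨hx1, hx2⟩ := hsupp x h0
    refine (hf x).2.trans ?_
    by_cases hp : (W * x.val + 1).Prime
    · have hzx : z < W * x.val + 1 := by
        have h1 : z ^ 2 ≤ x.val ^ 2 :=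
          ((Nat.pow_le_pow_right hz1 (by norm_num : 2 ≤ 40)).trans hJN).trans hx2
        have h2 : z ≤ x.val := by
          by_contra h
          push Not at h
          exact absurd (Nat.pow_lt_pow_left h (by norm_num : 2 ≠ 0)) (by omega)
        nlinarith
      have h1 := hν x.val
      rw [rho_prime_eq_one W hp hzx, div_le_iff₀ hd] at h1
      have h2 := dens_mul_log_le W z hW
      have h3 := lamW_le_mul_log hW hWN hx1
      have h4 : Real.log N ≤ 80 * Real.log z := by
        calc Real.log N ≤ Real.log (((z ^ 40) ^ 2 : ℕ) : ℝ) :=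
              Real.log_le_log hNpos (by exact_mod_cast hNJ.le)
          _ = 80 * Real.log z := by push_cast; rw [← pow_mul, Real.log_pow]; norm_num
      have h5 : lamW W x.val ≤ 160 * ((W.totient / W : ℝ) * Real.log z) := by
        refine h3.trans ?_
        have : (0 : ℝ) ≤ W.totient / W := by positivity
        nlinarith
      refine h5.trans (mul_le_mul_of_nonneg_left ?_ (by norm_num))
      have h6 : dens W z * ((W.totient / W : ℝ) * Real.log z) ≤ dens W z * ν x.val := by
        rw [← mul_assoc]; linarith
      exact le_of_mul_le_mul_left h6 hd
    · simp only [lamW, if_neg hp, mul_zero]; positivity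
  set R : Finset (ZMod (2 * N)) := {r | (N : ℝ) / 2 ^ j ≤ ‖FT f r‖} with hR
  have key := card_large_FT (by omega : N ≤ 2 * N) (by norm_num : (0 : ℝ) ≤ 160)
    (fun x => (hf x).1) hνx (fun x hx => by
      by_contra h
      exact absurd (hsupp x h).1 (by omega)) (fun n => (ha n).1) (fun n => (ha n).2) hE hS
    (by positivity : (0 : ℝ) ≤ N / 2 ^ j) (R := R) (fun r hr => (mem_filter.1 hr).2)
  rcases (Nat.cast_nonneg (α := ℝ) #R).eq_or_lt with h0 | hpos
  · rw [← h0]; positivity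
  have hε : 25600 * C ^ 2 * ((s : ℝ) ^ 16 / 2 ^ s) ≤ 1 / 2 / 4 ^ j := by
    have h1 := hu₀ u hu0
    have h2 : (s : ℝ) = 3 * u := by rw [hs]; push_cast; ring
    have h3 : (2 : ℝ) ^ s = 2 ^ u * 4 ^ u := by
      rw [hs, show (4 : ℝ) = 2 ^ 2 by norm_num, ← pow_mul, ← pow_add]; congr 1; omega
    have h4 : (4 : ℝ) ^ j ≤ 4 ^ u := pow_le_pow_right₀ (by norm_num) (by omega)
    calc 25600 * C ^ 2 * ((s : ℝ) ^ 16 / 2 ^ s)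
        = 25600 * C ^ 2 * 3 ^ 16 * ((u : ℝ) ^ 16 / 2 ^ u) / 4 ^ u := by
          rw [h2, h3]; field_simp
      _ ≤ 1 / 2 / 4 ^ u := by gcongr
      _ ≤ 1 / 2 / 4 ^ j := by gcongr
  have hs8 : (s : ℝ) ^ 8 ≤ 3 ^ 8 * B * (3 / 2) ^ s₁ * (3 / 2) ^ j := by
    have h2 : (s : ℝ) = 3 * u := by rw [hs]; push_cast; ring
    have h1 := hBu u
    rw [hu, pow_add] at h1
    rw [h2, mul_pow]
    calc (3 : ℝ) ^ 8 * (u : ℝ) ^ 8 ≤ 3 ^ 8 * (B * ((3 / 2) ^ j * (3 / 2) ^ s₁)) := by gcongr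
      _ = _ := by ring
  set r : ℝ := (#R : ℝ)
  set e : ℝ := (s : ℝ) ^ 16 / 2 ^ s
  have h4j : ((2 : ℝ) ^ j) ^ 2 = 4 ^ j := by rw [← pow_mul, mul_comm, pow_mul]; norm_num
  have key2 : N ^ 2 * (r * (r / 4 ^ j)) ≤
      N ^ 2 * (r * (25600 * C ^ 2 * e * r + 51200 * C ^ 2 * s ^ 8)) := by
    calc (N : ℝ) ^ 2 * (r * (r / 4 ^ j)) = ((N : ℝ) / 2 ^ j) ^ 2 * r ^ 2 := by
          rw [div_pow, h4j]; ring
      _ ≤ _ := key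
      _ = _ := by push_cast; ring
  have key3 := le_of_mul_le_mul_left (le_of_mul_le_mul_left key2 (by positivity)) hpos
  have h5 : 25600 * C ^ 2 * e * r ≤ 1 / 2 / 4 ^ j * r := mul_le_mul_of_nonneg_right hε hpos.le
  have h6 : r / 4 ^ j / 2 ≤ 51200 * C ^ 2 * s ^ 8 := by
    have : 1 / 2 / 4 ^ j * r = r / 4 ^ j / 2 := by ring
    linarith
  have h7 : r ≤ 102400 * C ^ 2 * s ^ 8 * 4 ^ j := by
    rw [div_div, div_le_iff₀ (by positivity)] at h6
    linarith
  calc r ≤ 102400 * C ^ 2 * s ^ 8 * 4 ^ j := h7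
    _ ≤ 102400 * C ^ 2 * (3 ^ 8 * B * (3 / 2) ^ s₁ * (3 / 2) ^ j) * 4 ^ j := by gcongr
    _ = 102400 * C ^ 2 * 3 ^ 8 * B * (3 / 2) ^ s₁ * ((3 / 2) ^ j * 4 ^ j) := by ring
    _ = _ := by rw [← mul_pow]; norm_num

end SchurPrimes

namespace SchurPrimes
open Finset

/-- The weighted count of solutions to `x + y = z`. -/
noncomputable def schurCount {M : ℕ} [NeZero M] (f : ZMod M → ℝ) : ℝ :=
  ∑ x, ∑ y, f x * f y * f (x + y)

theorem schurCount_eq {M : ℕ} [NeZero M] (f : ZMod M → ℝ) :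
    ((M * schurCount f : ℝ) : ℂ) = ∑ r, FT f r * (‖FT f r‖ ^ 2 : ℝ) := by
  have h : ∀ r, FT f r * (‖FT f r‖ ^ 2 : ℝ) = ∑ x, ∑ y, ∑ z, (f x * f y * f z : ℂ) *
      ZMod.stdAddChar (r * (x + y - z)) := by
    intro r
    rw [Complex.ofReal_pow, ← Complex.mul_conj', ← mul_assoc, FT, map_sum, Finset.sum_mul_sum,
      Finset.sum_mul]
    refine Finset.sum_congr rfl fun x _ => ?_
    rw [Finset.sum_mul]
    refine Finset.sum_congr rfl fun y _ => ?_
    rw [Finset.mul_sum]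
    refine Finset.sum_congr rfl fun z _ => ?_
    rw [map_mul (starRingEnd ℂ), ← AddChar.map_neg_eq_conj, Complex.conj_ofReal,
      show r * (x + y - z) = x * r + y * r + -(z * r) by ring, AddChar.map_add_eq_mul,
      AddChar.map_add_eq_mul]
    ring
  simp_rw [h]
  rw [Finset.sum_comm, schurCount, Complex.ofReal_mul, Complex.ofReal_sum, Finset.mul_sum]
  refine Finset.sum_congr rfl fun x _ => ?_
  rw [Finset.sum_comm, Complex.ofReal_sum, Finset.mul_sum]
  refine Finset.sum_congr rfl fun y _ => ?_
  rw [Finset.sum_comm]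
  simp_rw [← Finset.mul_sum, sum_stdAddChar_mul, sub_eq_zero]
  rw [Finset.sum_eq_single (x + y)]
  · rw [if_pos rfl]; push_cast; ring
  · intro z _ hz
    rw [if_neg (Ne.symm hz), mul_zero]
  · simp

theorem sum_FT_mul {M : ℕ} [NeZero M] (f : ZMod M → ℝ) (x : ZMod M) :
    ∑ r, FT f r * ZMod.stdAddChar (r * -x) = M * f x := by
  simp_rw [FT, Finset.sum_mul]
  rw [Finset.sum_comm]
  have : ∀ y, ∑ r, (f y : ℂ) * ZMod.stdAddChar (y * r) * ZMod.stdAddChar (r * -x) =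
      f y * if y - x = 0 then (M : ℂ) else 0 := by
    intro y
    rw [← sum_stdAddChar_mul, Finset.mul_sum]
    refine Finset.sum_congr rfl fun r _ => ?_
    rw [mul_assoc, ← AddChar.map_add_eq_mul]
    congr 2; ring
  simp_rw [this, sub_eq_zero]
  rw [Finset.sum_eq_single x]
  · rw [if_pos rfl, mul_comm]
  · intro z _ hz
    rw [if_neg hz, mul_zero]
  · simp

theorem mul_abs_le_sum_norm_FT {M : ℕ} [NeZero M] (f : ZMod M → ℝ) (x : ZMod M) :
    M * |f x| ≤ ∑ r, ‖FT f r‖ := by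
  have h : ‖(M * f x : ℂ)‖ = M * |f x| := by
    rw [norm_mul, Complex.norm_natCast, Complex.norm_real, Real.norm_eq_abs]
  rw [← h, ← sum_FT_mul]
  refine (norm_sum_le _ _).trans (Finset.sum_le_sum fun r _ => ?_)
  rw [norm_mul, AddChar.norm_apply, mul_one]

theorem norm_FT_le {M : ℕ} [NeZero M] {f : ZMod M → ℝ} (hf : ∀ x, 0 ≤ f x) (r : ZMod M) :
    ‖FT f r‖ ≤ ∑ x, f x := by
  refine (norm_sum_le _ _).trans (Finset.sum_le_sum fun x _ => ?_)
  rw [norm_mul, AddChar.norm_apply, mul_one, Complex.norm_real, Real.norm_eq_abs,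
    abs_of_nonneg (hf x)]

/-- The average of `f` over translates by the difference multiset of `A`. -/
noncomputable def smooth {M : ℕ} (A : Finset (ZMod M)) (f : ZMod M → ℝ) (x : ZMod M) : ℝ :=
  (∑ y ∈ A, ∑ z ∈ A, f (x - y + z)) / (#A : ℝ) ^ 2

/-- The Fourier multiplier of `smooth A`. -/
noncomputable def smoothMul {M : ℕ} [NeZero M] (A : Finset (ZMod M)) (r : ZMod M) : ℝ :=
  ‖∑ y ∈ A, (ZMod.stdAddChar (y * r) : ℂ)‖ ^ 2 / (#A : ℝ) ^ 2

theorem smooth_nonneg {M : ℕ} (A : Finset (ZMod M)) {f : ZMod M → ℝ} (hf : ∀ x, 0 ≤ f x)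
    (x : ZMod M) : 0 ≤ smooth A f x :=
  div_nonneg (Finset.sum_nonneg fun _ _ => Finset.sum_nonneg fun _ _ => hf _) (sq_nonneg _)

theorem smooth_sum {M : ℕ} (A : Finset (ZMod M)) {ι : Type*} (s : Finset ι) (f : ι → ZMod M → ℝ)
    (x : ZMod M) : smooth A (fun x => ∑ i ∈ s, f i x) x = ∑ i ∈ s, smooth A (f i) x := by
  simp only [smooth]
  rw [← Finset.sum_div]
  congr 1
  rw [Finset.sum_comm (s := s)]
  refine Finset.sum_congr rfl fun y _ => ?_
  rw [Finset.sum_comm]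

theorem smooth_sub {M : ℕ} (A : Finset (ZMod M)) (f g : ZMod M → ℝ)
    (x : ZMod M) : smooth A (fun x => f x - g x) x = smooth A f x - smooth A g x := by
  simp only [smooth, Finset.sum_sub_distrib, sub_div]

theorem FT_smooth {M : ℕ} [NeZero M] (A : Finset (ZMod M)) (f : ZMod M → ℝ) (r : ZMod M) :
    FT (smooth A f) r = smoothMul A r * FT f r := by
  have h : ∀ y z : ZMod M, ∑ x, (f (x - y + z) : ℂ) * ZMod.stdAddChar (x * r) =
      ZMod.stdAddChar (y * r) * (starRingEnd ℂ) (ZMod.stdAddChar (z * r)) * FT f r := by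
    intro y z
    rw [FT, Finset.mul_sum]
    refine Fintype.sum_equiv (Equiv.addRight (-y + z)) _ _ fun x => ?_
    rw [Equiv.coe_addRight, ← AddChar.map_neg_eq_conj, ← AddChar.map_add_eq_mul]
    beta_reduce
    rw [show x + (-y + z) = x - y + z by ring,
      show x * r = (y * r + -(z * r)) + (x - y + z) * r by ring, AddChar.map_add_eq_mul]
    ring
  rw [smoothMul, Complex.ofReal_div, Complex.ofReal_pow, ← Complex.mul_conj', map_sum,
    Finset.sum_mul_sum, FT]
  simp only [smooth]
  simp_rw [Complex.ofReal_div, Complex.ofReal_sum, div_mul_eq_mul_div, Finset.sum_mul]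
  rw [← Finset.sum_div]
  congr 1
  · rw [Finset.sum_comm]
    refine Finset.sum_congr rfl fun y _ => ?_
    rw [Finset.sum_comm]
    exact Finset.sum_congr rfl fun z _ => h y z

theorem smoothMul_nonneg {M : ℕ} [NeZero M] (A : Finset (ZMod M)) (r : ZMod M) :
    0 ≤ smoothMul A r := by
  unfold smoothMul; positivity

theorem smoothMul_le_one {M : ℕ} [NeZero M] (A : Finset (ZMod M)) (r : ZMod M) :
    smoothMul A r ≤ 1 := by
  unfold smoothMul
  refine div_le_one_of_le₀ (pow_le_pow_left₀ (norm_nonneg _) ?_ 2) (sq_nonneg _)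
  refine (norm_sum_le _ _).trans ?_
  simp [AddChar.norm_apply]

theorem sum_smoothMul {M : ℕ} [NeZero M] {A : Finset (ZMod M)} (hA : A.Nonempty) :
    ∑ r, smoothMul A r = M / #A := by
  classical
  have hA' : (#A : ℝ) ≠ 0 := by exact_mod_cast hA.card_pos.ne'
  have h := sum_normSq_trig (M := M) (fun y => if y ∈ A then 1 else 0)
  have h1 : ∀ x : ZMod M, ∑ r, (if r ∈ A then (1 : ℂ) else 0) * ZMod.stdAddChar (x * r) =
      ∑ y ∈ A, ZMod.stdAddChar (y * x) := by
    intro x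
    simp [Finset.sum_ite_mem, mul_comm]
  have h2 : ∑ r : ZMod M, ‖(if r ∈ A then (1 : ℂ) else 0)‖ ^ 2 = #A := by
    rw [Finset.sum_congr rfl (g := fun r => if r ∈ A then (1 : ℝ) else 0)]
    · simp
    · intro r _
      split_ifs <;> simp
  simp_rw [h1] at h
  rw [h2] at h
  simp only [smoothMul]
  rw [← Finset.sum_div, h]
  field_simp

theorem one_sub_smoothMul_le {M : ℕ} [NeZero M] {A : Finset (ZMod M)} (hA : A.Nonempty)
    {r : ZMod M} {ε : ℝ}
    (h : ∀ y ∈ A, ∀ z ∈ A, ‖(ZMod.stdAddChar (y * r) : ℂ) - ZMod.stdAddChar (z * r)‖ ≤ ε) :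
    1 - smoothMul A r ≤ ε := by
  have hA' : (0 : ℝ) < #A := by exact_mod_cast hA.card_pos
  have e : ((1 - smoothMul A r : ℝ) : ℂ) = (∑ y ∈ A, ∑ z ∈ A,
      (1 - ZMod.stdAddChar (y * r) * (starRingEnd ℂ) (ZMod.stdAddChar (z * r)))) /
        ((#A : ℝ) ^ 2 : ℝ) := by
    rw [smoothMul, Complex.ofReal_sub, Complex.ofReal_div, Complex.ofReal_pow,
      ← Complex.mul_conj', map_sum, Finset.sum_mul_sum]
    simp only [Finset.sum_sub_distrib]
    have : (#A : ℂ) ≠ 0 := by exact_mod_cast hA'.ne'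
    simp only [Finset.sum_const, nsmul_eq_mul, mul_one]
    push_cast
    field_simp
  calc 1 - smoothMul A r ≤ ‖((1 - smoothMul A r : ℝ) : ℂ)‖ := by
        rw [Complex.norm_real]; exact Real.le_norm_self _
    _ ≤ (∑ y ∈ A, ∑ z ∈ A, ε) / (#A : ℝ) ^ 2 := by
        rw [e, norm_div, Complex.norm_real, Real.norm_of_nonneg (sq_nonneg _)]
        refine div_le_div_of_nonneg_right ?_ (sq_nonneg _)
        refine (norm_sum_le _ _).trans (Finset.sum_le_sum fun y hy => ?_)
        refine (norm_sum_le _ _).trans (Finset.sum_le_sum fun z hz => ?_)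
        have h1 : (1 : ℂ) = ZMod.stdAddChar (z * r) * (starRingEnd ℂ) (ZMod.stdAddChar (z * r)) := by
          rw [Complex.mul_conj', AddChar.norm_apply]; norm_num
        rw [h1, ← sub_mul, norm_mul, RCLike.norm_conj, AddChar.norm_apply, mul_one]
        exact h z hz y hy
    _ = ε := by
        simp only [Finset.sum_const, nsmul_eq_mul]
        field_simp

theorem abs_smooth_le {M : ℕ} [NeZero M] {A : Finset (ZMod M)} (hA : A.Nonempty)
    {f : ZMod M → ℝ} {E : ℝ} (hE : ∀ r, ‖FT f r‖ ≤ E) (x : ZMod M) :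
    |smooth A f x| ≤ E / #A := by
  have hM : (0 : ℝ) < M := by exact_mod_cast Nat.pos_of_ne_zero (NeZero.ne M)
  have h := mul_abs_le_sum_norm_FT (smooth A f) x
  have h2 : ∑ r, ‖FT (smooth A f) r‖ ≤ M * (E / #A) := by
    calc ∑ r, ‖FT (smooth A f) r‖ ≤ ∑ r, smoothMul A r * E := by
          refine Finset.sum_le_sum fun r _ => ?_
          rw [FT_smooth, norm_mul, Complex.norm_real, Real.norm_of_nonneg (smoothMul_nonneg _ _)]
          exact mul_le_mul_of_nonneg_left (hE r) (smoothMul_nonneg _ _)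
      _ = _ := by rw [← Finset.sum_mul, sum_smoothMul hA]; ring
  exact le_of_mul_le_mul_left (h.trans h2) hM

theorem abs_schurCount_sub_smooth_le {M : ℕ} [NeZero M] (A : Finset (ZMod M)) (f : ZMod M → ℝ) :
    M * |schurCount f - schurCount (smooth A f)| ≤
      ∑ r, ‖FT f r‖ ^ 3 * (1 - smoothMul A r ^ 3) := by
  have h : ((M * (schurCount f - schurCount (smooth A f)) : ℝ) : ℂ) =
      ∑ r, FT f r * (‖FT f r‖ ^ 2 : ℝ) * ((1 - smoothMul A r ^ 3 : ℝ) : ℂ) := by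
    rw [mul_sub, Complex.ofReal_sub, schurCount_eq, schurCount_eq, ← Finset.sum_sub_distrib]
    refine Finset.sum_congr rfl fun r _ => ?_
    rw [FT_smooth, norm_mul, Complex.norm_real, Real.norm_of_nonneg (smoothMul_nonneg _ _)]
    push_cast
    ring
  have hM : (0 : ℝ) ≤ M := Nat.cast_nonneg _
  calc M * |schurCount f - schurCount (smooth A f)|
      = ‖((M * (schurCount f - schurCount (smooth A f)) : ℝ) : ℂ)‖ := by
        rw [Complex.norm_real, Real.norm_eq_abs, abs_mul, abs_of_nonneg hM]
    _ ≤ _ := by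
        rw [h]
        refine (norm_sum_le _ _).trans (Finset.sum_le_sum fun r _ => le_of_eq ?_)
        have h1 : 0 ≤ 1 - smoothMul A r ^ 3 :=
          sub_nonneg.2 (pow_le_one₀ (smoothMul_nonneg _ _) (smoothMul_le_one _ _))
        rw [norm_mul, norm_mul, Complex.norm_real, Complex.norm_real, Real.norm_of_nonneg h1,
          Real.norm_of_nonneg (sq_nonneg _)]
        ring

theorem exists_box {M : ℕ} [NeZero M] {m : ℕ} (hm : 1 ≤ m) (R : Finset (ZMod M)) :
    ∃ A : Finset (ZMod M), A.Nonempty ∧ (M : ℝ) ≤ m ^ #R * #A ∧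
      ∀ y ∈ A, ∀ z ∈ A, ∀ r ∈ R, m * |((y * r).val : ℝ) - (z * r).val| ≤ M := by
  classical
  have hM : 0 < M := Nat.pos_of_ne_zero (NeZero.ne M)
  have hM' : (0 : ℝ) < M := by exact_mod_cast hM
  have hm' : (0 : ℝ) < m := by exact_mod_cast hm
  have : NeZero m := ⟨by omega⟩
  have hlt : ∀ w : ZMod M, w.val * m / M < m := fun w => by
    rw [Nat.div_lt_iff_lt_mul hM, mul_comm]
    exact Nat.mul_lt_mul_of_pos_left w.val_lt hm
  set Φ : ZMod M → (R → Fin m) := fun x r => ⟨(x * r).val * m / M, hlt _⟩ with hΦ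
  obtain ⟨φ, -, hφ⟩ := Finset.exists_le_card_fiber_of_nsmul_le_card_of_maps_to
    (s := (univ : Finset (ZMod M))) (t := (univ : Finset (R → Fin m))) (f := Φ)
    (b := (M : ℝ) / m ^ #R) (fun _ _ => mem_univ _) univ_nonempty (by
      simp only [card_univ, Fintype.card_fun, Fintype.card_fin, Fintype.card_coe, ZMod.card,
        nsmul_eq_mul]
      push_cast
      rw [mul_div_cancel₀ _ (by positivity)])
  refine ⟨({x | Φ x = φ} : Finset (ZMod M)), ?_, ?_, ?_⟩
  · rw [← Finset.card_pos]
    have : (0 : ℝ) < M / m ^ #R := by positivity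
    exact_mod_cast this.trans_le hφ
  · rwa [div_le_iff₀' (by positivity)] at hφ
  · intro y hy z hz r hr
    have hy' := (mem_filter.1 hy).2
    have hz' := (mem_filter.1 hz).2
    have h := congrFun (hy'.trans hz'.symm) ⟨r, hr⟩
    simp only [hΦ, Fin.mk.injEq] at h
    set p := (y * r).val * m
    set q := (z * r).val * m
    have hp := Nat.div_add_mod p M
    have hq := Nat.div_add_mod q M
    have hp2 := Nat.mod_lt p hM
    have hq2 := Nat.mod_lt q hM
    rw [h] at hp
    have e : m * |((y * r).val : ℝ) - (z * r).val| = |(p : ℝ) - q| := by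
      rw [show (m : ℝ) * |((y * r).val : ℝ) - (z * r).val| =
        |(m : ℝ)| * |((y * r).val : ℝ) - (z * r).val| by rw [abs_of_pos hm'], ← abs_mul]
      congr 1
      simp only [p, q]
      push_cast; ring
    rw [e, abs_le]
    have h1 : p ≤ q + M := by omega
    have h2 : q ≤ p + M := by omega
    have h1' : (p : ℝ) ≤ q + M := by exact_mod_cast h1
    have h2' : (q : ℝ) ≤ p + M := by exact_mod_cast h2
    constructor <;> linarith

theorem norm_stdAddChar_sub_le {M : ℕ} [NeZero M] {m : ℕ} (hm : 1 ≤ m) {v w : ZMod M}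
    (h : m * |(v.val : ℝ) - w.val| ≤ M) :
    ‖(ZMod.stdAddChar v : ℂ) - ZMod.stdAddChar w‖ ≤ 2 * Real.pi / m := by
  have hM' : (0 : ℝ) < M := by exact_mod_cast Nat.pos_of_ne_zero (NeZero.ne M)
  have hm' : (0 : ℝ) < m := by exact_mod_cast hm
  have e : ∀ v : ZMod M, (ZMod.stdAddChar v : ℂ) = ex ((v.val : ℝ) / M) := by
    intro v
    have := stdAddChar_natCast_mul (M := M) 1 v
    rwa [Nat.cast_one, one_mul, Nat.cast_one, mul_one] at this
  rw [e, e]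
  refine (norm_ex_sub_ex_le _ _).trans ?_
  rw [← sub_div, abs_div, abs_of_pos hM']
  have : |(v.val : ℝ) - w.val| / M ≤ 1 / m := by
    rw [div_le_div_iff₀ hM' hm']; linarith
  calc 2 * Real.pi * (|(v.val : ℝ) - w.val| / M) ≤ 2 * Real.pi * (1 / m) := by
        have := Real.pi_pos
        gcongr
    _ = _ := by ring

end SchurPrimes

namespace SchurPrimes
open Finset

theorem exists_mono_triangle_aux (k : ℕ) : ∃ S : ℕ, ∀ (V : Finset ℕ) {κ : Type} [DecidableEq κ]
    (K : Finset κ) (e : ℕ → ℕ → κ), S ≤ #V → #K ≤ k →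
    (∀ i ∈ V, ∀ j ∈ V, i < j → e i j ∈ K) →
    ∃ i ∈ V, ∃ j ∈ V, ∃ l ∈ V, i < j ∧ j < l ∧ e i j = e i l ∧ e i j = e j l := by
  induction k with
  | zero =>
    refine ⟨2, fun V κ _ K e hV hK h => ?_⟩
    obtain ⟨a, ha, b, hb, hab⟩ := Finset.one_lt_card.1 hV
    have hK0 : K = ∅ := Finset.card_eq_zero.1 (Nat.le_zero.1 hK)
    subst hK0
    rcases lt_or_gt_of_ne hab with h1 | h1
    · exact absurd (h a ha b hb h1) (Finset.notMem_empty _)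
    · exact absurd (h b hb a ha h1) (Finset.notMem_empty _)
  | succ k ih =>
    obtain ⟨S, hS⟩ := ih
    refine ⟨(k + 1) * S + 2, fun V κ _ K e hV hK h => ?_⟩
    have hne : V.Nonempty := Finset.card_pos.1 (by omega)
    set v := V.min' hne with hv
    have hvV : v ∈ V := V.min'_mem hne
    have hlt : ∀ j ∈ V.erase v, v < j := fun j hj => V.min'_lt_of_mem_erase_min' hne hj
    have hcard : #K * S < #(V.erase v) := by
      rw [Finset.card_erase_of_mem hvV]
      have := Nat.mul_le_mul_right S hK
      omega
    obtain ⟨a, haK, ha⟩ := Finset.exists_lt_card_fiber_of_mul_lt_card_of_maps_to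
      (f := fun j => e v j) (fun j hj => h v hvV j (Finset.mem_of_mem_erase hj) (hlt j hj)) hcard
    set V' := (V.erase v).filter fun j => e v j = a with hV'
    have hV'V : ∀ j ∈ V', j ∈ V ∧ v < j ∧ e v j = a := fun j hj => by
      obtain ⟨h1, h2⟩ := Finset.mem_filter.1 hj
      exact ⟨Finset.mem_of_mem_erase h1, hlt j h1, h2⟩
    by_cases hex : ∃ i ∈ V', ∃ j ∈ V', i < j ∧ e i j = a
    · obtain ⟨i, hi, j, hj, hij, he⟩ := hex
      obtain ⟨hi1, hi2, hi3⟩ := hV'V i hi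
      obtain ⟨hj1, hj2, hj3⟩ := hV'V j hj
      exact ⟨v, hvV, i, hi1, j, hj1, hi2, hij, hi3.trans hj3.symm, hi3.trans he.symm⟩
    · push Not at hex
      obtain ⟨i, hi, j, hj, l, hl, H⟩ := hS V' (K.erase a) e ha.le
        (by rw [Finset.card_erase_of_mem haK]; omega) (fun i hi j hj hij =>
          Finset.mem_erase.2 ⟨hex i hi j hj hij, h i (hV'V i hi).1 j (hV'V j hj).1 hij⟩)
      exact ⟨i, (hV'V i hi).1, j, (hV'V j hj).1, l, (hV'V l hl).1, H⟩

theorem exists_mono_triangle (k : ℕ) : ∃ S : ℕ, 1 ≤ S ∧ ∀ e : ℕ → ℕ → Fin k,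
    ∃ i j l, i < j ∧ j < l ∧ l < S ∧ e i j = e i l ∧ e i j = e j l := by
  obtain ⟨S, hS⟩ := exists_mono_triangle_aux k
  refine ⟨S + 1, by omega, fun e => ?_⟩
  obtain ⟨i, hi, j, hj, l, hl, h1, h2, h3, h4⟩ := hS (range (S + 1)) (univ : Finset (Fin k)) e
    (by simp) (by simp) (fun _ _ _ _ _ => mem_univ _)
  exact ⟨i, j, l, h1, h2, mem_range.1 hl, h3, h4⟩

/-- A supersaturated form of Schur's theorem. -/
theorem exists_many_mono_schur (k : ℕ) : ∃ S : ℕ, 1 ≤ S ∧ ∀ (D : ℕ) (col : ℕ → Fin k),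
    D ^ 2 ≤ S ^ 3 * #{p ∈ range (4 * S ^ 2 * D + 1) ×ˢ range (4 * S ^ 2 * D + 1) |
      D ≤ p.1 ∧ D ≤ p.2 ∧ p.1 + p.2 ≤ 4 * S ^ 2 * D ∧
        col p.1 = col p.2 ∧ col p.1 = col (p.1 + p.2)} := by
  obtain ⟨S, hS1, hS⟩ := exists_mono_triangle k
  refine ⟨S, hS1, fun D col => ?_⟩
  set P : Finset (ℕ × ℕ) := {p ∈ range (4 * S ^ 2 * D + 1) ×ˢ range (4 * S ^ 2 * D + 1) |
      D ≤ p.1 ∧ D ≤ p.2 ∧ p.1 + p.2 ≤ 4 * S ^ 2 * D ∧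
        col p.1 = col p.2 ∧ col p.1 = col (p.1 + p.2)} with hP
  have key : ∀ d : ℕ × ℕ, ∃ i j l, i < j ∧ j < l ∧ l < S ∧
      col ((j - i) * (D + d.1 + (i + j) * d.2)) = col ((l - i) * (D + d.1 + (i + l) * d.2)) ∧
      col ((j - i) * (D + d.1 + (i + j) * d.2)) = col ((l - j) * (D + d.1 + (j + l) * d.2)) :=
    fun d => hS fun i j => col ((j - i) * (D + d.1 + (i + j) * d.2))
  choose i j l hij hjl hlS h1 h2 using key
  have hx : ∀ d : ℕ × ℕ, (j d - i d) * (D + d.1 + (i d + j d) * d.2) +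
      (l d - j d) * (D + d.1 + (j d + l d) * d.2) =
      (l d - i d) * (D + d.1 + (i d + l d) * d.2) := by
    intro d
    obtain ⟨u, hu⟩ := Nat.exists_eq_add_of_lt (hij d)
    obtain ⟨v, hv⟩ := Nat.exists_eq_add_of_lt (hjl d)
    rw [hv, hu]
    rw [show i d + u + 1 - i d = u + 1 by omega, show i d + u + 1 + v + 1 - (i d + u + 1) = v + 1 by
      omega, show i d + u + 1 + v + 1 - i d = u + v + 2 by omega]
    ring
  let Φ : ℕ × ℕ → (ℕ × ℕ × ℕ) × (ℕ × ℕ) := fun d => ((i d, j d, l d),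
    ((j d - i d) * (D + d.1 + (i d + j d) * d.2), (l d - j d) * (D + d.1 + (j d + l d) * d.2)))
  have hmaps : ∀ d ∈ range D ×ˢ range D, Φ d ∈ (range S ×ˢ range S ×ˢ range S) ×ˢ P := by
    intro d hd
    obtain ⟨hd1, hd2⟩ := mem_product.1 hd
    rw [mem_range] at hd1 hd2
    have a1 := hij d
    have a2 := hjl d
    have a3 := hlS d
    have hle : (l d - i d) * (D + d.1 + (i d + l d) * d.2) ≤ 4 * S ^ 2 * D := by
      have b1 : (i d + l d) * d.2 ≤ 2 * S * D := Nat.mul_le_mul (by omega) hd2.le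
      have b2 : D ≤ S * D := Nat.le_mul_of_pos_left _ hS1
      calc (l d - i d) * (D + d.1 + (i d + l d) * d.2) ≤ S * (4 * S * D) :=
            Nat.mul_le_mul (by omega) (by nlinarith)
        _ = _ := by ring
    have hge1 : D ≤ (j d - i d) * (D + d.1 + (i d + j d) * d.2) :=
      (by omega : D ≤ D + d.1 + (i d + j d) * d.2).trans (Nat.le_mul_of_pos_left _ (by omega))
    have hge2 : D ≤ (l d - j d) * (D + d.1 + (j d + l d) * d.2) :=
      (by omega : D ≤ D + d.1 + (j d + l d) * d.2).trans (Nat.le_mul_of_pos_left _ (by omega))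
    have := hx d
    simp only [Φ, mem_product, mem_range, hP, mem_filter]
    refine ⟨⟨by omega, by omega, by omega⟩, ⟨by omega, by omega⟩, hge1, hge2, by omega, h2 d, ?_⟩
    rw [this]; exact h1 d
  have hinj : Set.InjOn Φ (range D ×ˢ range D : Finset (ℕ × ℕ)) := by
    intro d _ d' _ h
    simp only [Φ, Prod.mk.injEq] at h
    obtain ⟨⟨e1, e2, e3⟩, e4, e5⟩ := h
    rw [← e1, ← e2] at e4
    rw [← e2, ← e3] at e5
    have a1 := hij d
    have a2 := hjl d
    have f4 := Nat.eq_of_mul_eq_mul_left (by omega) e4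
    have f5 := Nat.eq_of_mul_eq_mul_left (by omega) e5
    obtain ⟨u, hu⟩ := Nat.exists_eq_add_of_lt (a1.trans a2)
    rw [hu] at f5
    have e6 : (u + 1) * d.2 = (u + 1) * d'.2 := by nlinarith
    have e7 := Nat.eq_of_mul_eq_mul_left (by omega) e6
    rw [e7] at f4
    exact Prod.ext (by omega) e7
  have := Finset.card_le_card_of_injOn Φ hmaps hinj
  simp only [card_product, card_range] at this
  calc D ^ 2 = D * D := by ring
    _ ≤ _ := this
    _ = _ := by ring

end SchurPrimes

namespace SchurPrimes
open Finset Filter Topology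

theorem eventually_exists_level (j₀ s₁ : ℕ) {τ : ℝ} (hτ : 0 < τ) : ∀ᶠ N : ℕ in atTop, ∃ J, j₀ ≤ J ∧
    240 * (3 * (J + s₁)) ^ 2 ≤ Nat.log 2 N ∧ Real.log N ≤ τ * 2 ^ J := by
  obtain ⟨v₀, hv₀⟩ := eventually_atTop.1
    (eventually_pow_div_two_pow_le 2 (2160 * 9 * 2 ^ s₁) hτ)
  set v₁ := v₀ + j₀ + s₁ + 1
  filter_upwards [eventually_ge_atTop (2 ^ (2160 * v₁ ^ 2))] with N hN
  have hN0 : N ≠ 0 := by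
    have : 0 < 2 ^ (2160 * v₁ ^ 2) := by positivity
    omega
  set L := Nat.log 2 N with hL
  have hL1 : 2160 * v₁ ^ 2 ≤ L := by
    exact Nat.le_log_of_pow_le (by norm_num) hN
  set v := Nat.sqrt (L / 2160) with hv
  have hv1 : v₁ ≤ v := by
    rw [hv, Nat.le_sqrt']
    rw [Nat.le_div_iff_mul_le (by norm_num)]; linarith
  have hv2 : v ^ 2 ≤ L / 2160 := Nat.sqrt_le' _
  have hv3 : L / 2160 < (v + 1) ^ 2 := Nat.lt_succ_sqrt' _
  refine ⟨v - s₁, by omega, ?_, ?_⟩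
  · rw [show v - s₁ + s₁ = v by omega]
    have : v ^ 2 * 2160 ≤ L := (Nat.le_div_iff_mul_le (by norm_num)).1 hv2
    calc 240 * (3 * v) ^ 2 = v ^ 2 * 2160 := by ring
      _ ≤ L := this
  · have h1 : L + 1 ≤ 2160 * 9 * v ^ 2 := by
      have h2 := Nat.lt_mul_of_div_lt hv3 (by norm_num)
      have h3 : 1 ≤ v := by omega
      nlinarith
    have h2 : Real.log N ≤ L + 1 := by
      have hlt : N < 2 ^ (L + 1) := Nat.lt_pow_succ_log_self (by norm_num) N
      calc Real.log N ≤ Real.log ((2 ^ (L + 1) : ℕ) : ℝ) :=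
            Real.log_le_log (by exact_mod_cast Nat.pos_of_ne_zero hN0) (by exact_mod_cast hlt.le)
        _ = (L + 1) * Real.log 2 := by push_cast; rw [Real.log_pow]; push_cast; ring
        _ ≤ (L + 1) * 1 := by
            have := Real.log_two_lt_d9
            gcongr; linarith
        _ = _ := mul_one _
    have h3 := hv₀ v (by omega)
    have h4 : (2 : ℝ) ^ v = 2 ^ (v - s₁) * 2 ^ s₁ := by rw [← pow_add]; congr 1; omega
    have h5 : (L : ℝ) + 1 ≤ 2160 * 9 * v ^ 2 := by exact_mod_cast h1
    refine (h2.trans h5).trans ?_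
    have h6 : 2160 * 9 * (v : ℝ) ^ 2 = 2160 * 9 * 2 ^ s₁ * (v ^ 2 / 2 ^ v) * 2 ^ (v - s₁) := by
      rw [h4]; field_simp
    rw [h6]
    gcongr

theorem cube_le_dyadic {a X : ℝ} (ha : 0 ≤ a) {j₀ J : ℕ} (hJ : j₀ ≤ J)
    (h : a < X / 2 ^ j₀) : a ^ 3 ≤ X / 2 ^ J * a ^ 2 +
      ∑ j ∈ Ico j₀ J, if X / 2 ^ (j + 1) ≤ a then (X / 2 ^ j) ^ 3 else 0 := by
  have hX : 0 < X := by
    by_contra hX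
    exact absurd (ha.trans_lt h) (not_lt.2 (div_nonpos_of_nonpos_of_nonneg (not_lt.1 hX)
      (by positivity)))
  have key : a < X / 2 ^ J ∨ ∃ j ∈ Ico j₀ J, X / 2 ^ (j + 1) ≤ a ∧ a < X / 2 ^ j := by
    induction J, hJ using Nat.le_induction with
    | base => exact Or.inl h
    | succ J hJ ih =>
      rcases ih with h1 | ⟨j, hj, h1⟩
      · rcases lt_or_ge a (X / 2 ^ (J + 1)) with h2 | h2
        · exact Or.inl h2
        · exact Or.inr ⟨J, by simp [hJ], h2, h1⟩
      · refine Or.inr ⟨j, ?_, h1⟩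
        rw [mem_Ico] at hj ⊢
        omega
  have hpos : ∀ j ∈ Ico j₀ J, 0 ≤ if X / 2 ^ (j + 1) ≤ a then (X / 2 ^ j) ^ 3 else 0 := by
    intro j _; split_ifs <;> positivity
  rcases key with h1 | ⟨j, hj, h1, h2⟩
  · have : a ^ 3 ≤ X / 2 ^ J * a ^ 2 := by
      rw [pow_succ']
      exact mul_le_mul_of_nonneg_right h1.le (sq_nonneg _)
    linarith [Finset.sum_nonneg hpos]
  · have h3 := Finset.single_le_sum hpos hj
    rw [if_pos h1] at h3
    have h4 : a ^ 3 ≤ (X / 2 ^ j) ^ 3 := by gcongr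
    have : 0 ≤ X / 2 ^ J * a ^ 2 := by positivity
    linarith

theorem sum_cube_small_le {M : ℕ} [NeZero M] {f : ZMod M → ℝ} {X C Q : ℝ} (hX : 0 ≤ X) (hC : 0 ≤ C)
    {j₀ J : ℕ} (hJ : j₀ ≤ J)
    (hcard : ∀ j ≤ J, (#{r | X / 2 ^ j ≤ ‖FT f r‖} : ℝ) ≤ C * 6 ^ j)
    (hQ : ∑ x, f x ^ 2 ≤ Q) :
    ∑ r with ‖FT f r‖ < X / 2 ^ j₀, ‖FT f r‖ ^ 3 ≤
      X / 2 ^ J * (M * Q) + 24 * C * X ^ 3 * (3 / 4) ^ j₀ := by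
  have h1 : ∑ r with ‖FT f r‖ < X / 2 ^ j₀, ‖FT f r‖ ^ 3 ≤ ∑ r, (X / 2 ^ J * ‖FT f r‖ ^ 2 +
      ∑ j ∈ Ico j₀ J, if X / 2 ^ (j + 1) ≤ ‖FT f r‖ then (X / 2 ^ j) ^ 3 else 0) := by
    refine (Finset.sum_le_sum fun r hr =>
      cube_le_dyadic (norm_nonneg _) hJ (mem_filter.1 hr).2).trans
      (Finset.sum_le_sum_of_subset_of_nonneg (filter_subset _ _) fun r _ _ => ?_)
    refine add_nonneg (by positivity) (Finset.sum_nonneg fun j _ => ?_)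
    split_ifs <;> positivity
  refine h1.trans ?_
  rw [Finset.sum_add_distrib, ← Finset.mul_sum, sum_normSq_FT, Finset.sum_comm]
  refine add_le_add (by gcongr) ?_
  calc ∑ j ∈ Ico j₀ J, ∑ r, (if X / 2 ^ (j + 1) ≤ ‖FT f r‖ then (X / 2 ^ j) ^ 3 else 0)
      ≤ ∑ j ∈ Ico j₀ J, 6 * C * X ^ 3 * (3 / 4) ^ j := by
        refine Finset.sum_le_sum fun j hj => ?_
        rw [← Finset.sum_filter, Finset.sum_const, nsmul_eq_mul]
        have h2 := hcard (j + 1) (mem_Ico.1 hj).2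
        calc _ ≤ C * 6 ^ (j + 1) * (X / 2 ^ j) ^ 3 := by gcongr
          _ = 6 * C * X ^ 3 * (6 ^ j / (2 ^ j) ^ 3) := by rw [pow_succ]; ring
          _ = _ := by
              rw [← pow_mul, mul_comm j 3, pow_mul, ← div_pow]; norm_num
    _ = 6 * C * X ^ 3 * ∑ j ∈ Ico j₀ J, (3 / 4 : ℝ) ^ j := by rw [Finset.mul_sum]
    _ ≤ 6 * C * X ^ 3 * ((3 / 4) ^ j₀ * 4) := by
        gcongr
        have := geom_sum_Ico_le_of_lt_one (x := (3 / 4 : ℝ)) (m := j₀) (n := J) (by norm_num)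
          (by norm_num)
        refine this.trans (le_of_eq ?_)
        norm_num
        ring
    _ = _ := by ring

theorem one_sub_cube_le {b ε : ℝ} (h0 : 0 ≤ b) (h1 : b ≤ 1) (h : 1 - b ≤ ε) :
    1 - b ^ 3 ≤ 3 * ε := by
  nlinarith [mul_nonneg h0 h0, mul_nonneg h0 (sub_nonneg.2 h1),
    mul_nonneg (mul_nonneg h0 h0) (sub_nonneg.2 h1)]

theorem abs_schurCount_sub_smooth_le_of_restriction {M : ℕ} [NeZero M] {f : ZMod M → ℝ}
    {X C Q B : ℝ} (hX : 0 ≤ X) (hC : 0 ≤ C) {j₀ J m : ℕ} (hm : 1 ≤ m) (hJ : j₀ ≤ J)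
    (hcard : ∀ j ≤ J, (#{r | X / 2 ^ j ≤ ‖FT f r‖} : ℝ) ≤ C * 6 ^ j)
    (hQ : ∑ x, f x ^ 2 ≤ Q) (hB : ∀ r, ‖FT f r‖ ≤ B) {A : Finset (ZMod M)} (hA : A.Nonempty)
    (hAR : ∀ r, X / 2 ^ j₀ ≤ ‖FT f r‖ → ∀ y ∈ A, ∀ z ∈ A,
      m * |((y * r).val : ℝ) - (z * r).val| ≤ M) :
    M * |schurCount f - schurCount (smooth A f)| ≤
      C * 6 ^ j₀ * (B ^ 3 * (6 * Real.pi / m)) +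
        (X / 2 ^ J * (M * Q) + 24 * C * X ^ 3 * (3 / 4) ^ j₀) := by
  have hπ := Real.pi_pos
  have hm' : (0 : ℝ) < m := by exact_mod_cast hm
  have hB0 : 0 ≤ B := (norm_nonneg _).trans (hB 0)
  refine (abs_schurCount_sub_smooth_le A f).trans ?_
  rw [← Finset.sum_filter_add_sum_filter_not univ (fun r => X / 2 ^ j₀ ≤ ‖FT f r‖)]
  refine add_le_add ?_ ((Finset.sum_le_sum fun r _ => ?_).trans
    ((Finset.sum_congr (by simp only [not_le]) fun _ _ => rfl).le.trans
      (sum_cube_small_le hX hC hJ hcard hQ)))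
  · calc _ ≤ ∑ r with X / 2 ^ j₀ ≤ ‖FT f r‖, B ^ 3 * (6 * Real.pi / m) := by
          refine Finset.sum_le_sum fun r hr => ?_
          have h1 := one_sub_smoothMul_le hA fun y hy z hz =>
            norm_stdAddChar_sub_le hm (hAR r (mem_filter.1 hr).2 y hy z hz)
          have h2 := one_sub_cube_le (smoothMul_nonneg A r) (smoothMul_le_one A r) h1
          have h3 : 0 ≤ 1 - smoothMul A r ^ 3 :=
            sub_nonneg.2 (pow_le_one₀ (smoothMul_nonneg _ _) (smoothMul_le_one _ _))
          refine mul_le_mul (pow_le_pow_left₀ (norm_nonneg _) (hB r) 3) (h2.trans (le_of_eq ?_)) h3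
            (by positivity)
          ring
      _ ≤ _ := by
          rw [Finset.sum_const, nsmul_eq_mul]
          exact mul_le_mul_of_nonneg_right (hcard j₀ hJ) (by positivity)
  · have h3 := pow_nonneg (smoothMul_nonneg A r) 3
    have h4 := pow_nonneg (norm_nonneg (FT f r)) 3
    nlinarith

end SchurPrimes

namespace SchurPrimes
open Finset Filter Topology

theorem smooth_indicator_eq_one {N : ℕ} [NeZero (2 * N)] {A : Finset (ZMod (2 * N))}
    (hA : A.Nonempty) {D : ℕ} (hD : ∀ y ∈ A, ∀ z ∈ A, |(y.val : ℝ) - z.val| ≤ D)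
    {x : ZMod (2 * N)} (h1 : D ≤ x.val) (h2 : x.val + D < N) :
    smooth A (fun x => if x.val < N then 1 else 0) x = 1 := by
  have hA' : (#A : ℝ) ≠ 0 := by exact_mod_cast hA.card_pos.ne'
  have h : ∀ y ∈ A, ∀ z ∈ A, (if (x - y + z).val < N then (1 : ℝ) else 0) = 1 := by
    intro y hy z hz
    have h3 := hD y hy z hz
    rw [abs_le] at h3
    have h4 : y.val ≤ z.val + D := by
      have : (y.val : ℝ) ≤ z.val + D := by linarith
      exact_mod_cast this
    have h5 : z.val ≤ y.val + D := by
      have : (z.val : ℝ) ≤ y.val + D := by linarith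
      exact_mod_cast this
    have h6 : x - y + z = ((x.val + z.val - y.val : ℕ) : ZMod (2 * N)) := by
      rw [Nat.cast_sub (by omega)]
      push_cast
      rw [ZMod.natCast_zmod_val, ZMod.natCast_zmod_val, ZMod.natCast_zmod_val]
      ring
    rw [h6, ZMod.val_natCast_of_lt (by omega), if_pos (by omega)]
  rw [smooth, Finset.sum_congr rfl fun y hy => Finset.sum_congr rfl fun z hz => h y hy z hz]
  simp only [Finset.sum_const, nsmul_eq_mul, mul_one]
  field_simp

theorem le_sum_schurCount {k S D M : ℕ} [NeZero M] (hk : 0 < k)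
    (hS : ∀ (D : ℕ) (col : ℕ → Fin k),
      D ^ 2 ≤ S ^ 3 * #{p ∈ range (4 * S ^ 2 * D + 1) ×ˢ range (4 * S ^ 2 * D + 1) |
      D ≤ p.1 ∧ D ≤ p.2 ∧ p.1 + p.2 ≤ 4 * S ^ 2 * D ∧
        col p.1 = col p.2 ∧ col p.1 = col (p.1 + p.2)})
    (g : Fin k → ZMod M → ℝ) (hg : ∀ i x, 0 ≤ g i x) (hDM : 4 * S ^ 2 * D < M)
    (hlow : ∀ n : ℕ, D ≤ n → n ≤ 4 * S ^ 2 * D → 1 / 2 ≤ ∑ i, g i n) :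
    (D : ℝ) ^ 2 ≤ S ^ 3 * (2 * k) ^ 3 * ∑ i, schurCount (g i) := by
  classical
  have hk' : (0 : ℝ) < k := by exact_mod_cast hk
  have hex : ∀ n : ℕ, ∃ i, D ≤ n → n ≤ 4 * S ^ 2 * D → 1 / (2 * k : ℝ) ≤ g i n := by
    intro n
    by_cases h : D ≤ n ∧ n ≤ 4 * S ^ 2 * D
    · by_contra hcon
      push Not at hcon
      have h1 := hlow n h.1 h.2
      have : ∑ i, g i n < ∑ _i : Fin k, 1 / (2 * k : ℝ) :=
        Finset.sum_lt_sum_of_nonempty ⟨⟨0, hk⟩, mem_univ _⟩ fun i _ => (hcon i).2.2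
      rw [Finset.sum_const, card_univ, Fintype.card_fin, nsmul_eq_mul] at this
      have e : (k : ℝ) * (1 / (2 * k)) = 1 / 2 := by field_simp
      linarith
    · exact ⟨⟨0, hk⟩, fun h1 h2 => absurd ⟨h1, h2⟩ h⟩
  choose col hcol using hex
  have h := hS D col
  set P : Finset (ℕ × ℕ) := {p ∈ range (4 * S ^ 2 * D + 1) ×ˢ range (4 * S ^ 2 * D + 1) |
      D ≤ p.1 ∧ D ≤ p.2 ∧ p.1 + p.2 ≤ 4 * S ^ 2 * D ∧
        col p.1 = col p.2 ∧ col p.1 = col (p.1 + p.2)} with hP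
  have hPle : (#P : ℝ) * (1 / (2 * k)) ^ 3 ≤ ∑ i, schurCount (g i) := by
    have e : ∑ i, schurCount (g i) = ∑ p ∈ range M ×ˢ range M,
        ∑ i, g i (p.1 : ℕ) * g i (p.2 : ℕ) * g i ((p.1 + p.2 : ℕ)) := by
      rw [Finset.sum_comm]
      refine Finset.sum_congr rfl fun i _ => ?_
      rw [schurCount, sum_zmod_eq_sum_range, Finset.sum_product]
      refine Finset.sum_congr rfl fun n _ => ?_
      rw [sum_zmod_eq_sum_range]
      simp only [Nat.cast_add]
    have hnn : ∀ (i : Fin k) (p : ℕ × ℕ),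
        0 ≤ g i (p.1 : ℕ) * g i (p.2 : ℕ) * g i ((p.1 + p.2 : ℕ)) := fun i p =>
      mul_nonneg (mul_nonneg (hg _ _) (hg _ _)) (hg _ _)
    rw [e]
    calc (#P : ℝ) * (1 / (2 * k)) ^ 3 = ∑ p ∈ P, (1 / (2 * k : ℝ)) ^ 3 := by
          rw [Finset.sum_const, nsmul_eq_mul]
      _ ≤ ∑ p ∈ P, ∑ i, g i (p.1 : ℕ) * g i (p.2 : ℕ) * g i ((p.1 + p.2 : ℕ)) := by
          refine Finset.sum_le_sum fun p hp => ?_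
          obtain ⟨-, p1, p2, p3, p4, p5⟩ := mem_filter.1 hp
          refine le_trans ?_ (Finset.single_le_sum (fun i _ => hnn i p) (mem_univ (col p.1)))
          have q1 := hcol p.1 p1 (by omega)
          have q2 := hcol p.2 p2 (by omega)
          have q3 := hcol (p.1 + p.2) (by omega) p3
          rw [← p4] at q2
          rw [← p5] at q3
          have hc : (0 : ℝ) ≤ 1 / (2 * k) := by positivity
          rw [pow_succ, pow_two]
          exact mul_le_mul (mul_le_mul q1 q2 hc (hg _ _)) q3 hc (mul_nonneg (hg _ _) (hg _ _))
      _ ≤ _ := by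
          refine Finset.sum_le_sum_of_subset_of_nonneg (fun p hp => ?_)
            fun p _ _ => Finset.sum_nonneg fun i _ => hnn i p
          obtain ⟨hp0, -⟩ := mem_filter.1 hp
          simp only [mem_product, mem_range] at hp0 ⊢
          omega
  have h' : (D : ℝ) ^ 2 ≤ S ^ 3 * #P := by exact_mod_cast h
  calc (D : ℝ) ^ 2 ≤ S ^ 3 * #P := h'
    _ = S ^ 3 * (2 * k) ^ 3 * (#P * (1 / (2 * k)) ^ 3) := by field_simp
    _ ≤ _ := by gcongr

/-- The weight `lamW` restricted to `√N ≤ n < N`. -/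
noncomputable def truncLam (W N n : ℕ) : ℝ := if n < N ∧ N ≤ n ^ 2 then lamW W n else 0

theorem truncLam_nonneg (W N n : ℕ) : 0 ≤ truncLam W N n := by
  unfold truncLam
  split_ifs
  exacts [lamW_nonneg _ _, le_rfl]

theorem truncLam_le (W N n : ℕ) : truncLam W N n ≤ lamW W n := by
  unfold truncLam
  split_ifs
  exacts [le_rfl, lamW_nonneg _ _]

theorem lamW_le_two_mul_log {W N n : ℕ} (hW : 1 ≤ W) (hWN : W ≤ N) (hn : n < N) :
    lamW W n ≤ 2 * Real.log N := by
  have h1 := lamW_le_mul_log hW hWN hn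
  have hN : (1 : ℝ) ≤ N := by exact_mod_cast hW.trans hWN
  have h2 : (W.totient / W : ℝ) ≤ 1 :=
    div_le_one_of_le₀ (by exact_mod_cast Nat.totient_le W) (Nat.cast_nonneg _)
  have := Real.log_nonneg hN
  nlinarith

theorem truncLam_le_log {W N : ℕ} (hW : 1 ≤ W) (hWN : W ≤ N) (n : ℕ) :
    truncLam W N n ≤ 2 * Real.log N := by
  have hN : (1 : ℝ) ≤ N := by exact_mod_cast hW.trans hWN
  have h0 := Real.log_nonneg hN
  by_cases h : n < N
  · exact (truncLam_le W N n).trans (lamW_le_two_mul_log hW hWN h)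
  · rw [truncLam, if_neg fun h' => h h'.1]; positivity

theorem FT_val {N : ℕ} [NeZero (2 * N)] {g : ℕ → ℝ} (hg : ∀ n, N ≤ n → g n = 0)
    (r : ZMod (2 * N)) : FT (fun x => g x.val) r =
      ∑ n ∈ range N, (g n : ℂ) * ex ((r.val : ℝ) / (2 * N : ℕ) * n) := by
  rw [FT, sum_zmod_eq_sum_range, ← Finset.sum_subset (range_subset_range.2 (by omega : N ≤ 2 * N))]
  · refine Finset.sum_congr rfl fun n hn => ?_
    rw [mem_range] at hn
    rw [ZMod.val_natCast_of_lt (by omega), stdAddChar_natCast_mul]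
  · intro n hn hn'
    rw [mem_range] at hn hn'
    rw [ZMod.val_natCast_of_lt hn, hg n (by omega)]
    simp

theorem norm_FT_truncLam_sub_le {W N : ℕ} [NeZero (2 * N)] (hW : 1 ≤ W) (hWN : W ≤ N) {E : ℝ}
    (hE : ∀ θ, ‖∑ n ∈ range N, ((lamW W n - 1 : ℝ) : ℂ) * ex (θ * n)‖ ≤ E)
    (r : ZMod (2 * N)) :
    ‖FT (fun x => truncLam W N x.val - if x.val < N then 1 else 0) r‖ ≤
      E + (Nat.sqrt N + 1) * (2 * Real.log N) := by
  have hN : (1 : ℝ) ≤ N := by exact_mod_cast hW.trans hWN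
  have h0 := Real.log_nonneg hN
  rw [FT_val (g := fun n => truncLam W N n - if n < N then 1 else 0) (fun n hn => by
    have h' : ¬ n < N := by omega
    simp [truncLam, h'])]
  set θ : ℝ := (r.val : ℝ) / (2 * N : ℕ)
  have e : ∑ n ∈ range N, ((truncLam W N n - if n < N then 1 else 0 : ℝ) : ℂ) * ex (θ * n) =
      ∑ n ∈ range N, ((lamW W n - 1 : ℝ) : ℂ) * ex (θ * n) -
        ∑ n ∈ range N with n ^ 2 < N, (lamW W n : ℂ) * ex (θ * n) := by
    rw [Finset.sum_filter, ← Finset.sum_sub_distrib]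
    refine Finset.sum_congr rfl fun n hn => ?_
    rw [mem_range] at hn
    rw [truncLam]
    by_cases h : n ^ 2 < N
    · rw [if_neg (by omega), if_pos hn, if_pos h]; push_cast; ring
    · rw [if_pos ⟨hn, by omega⟩, if_pos hn, if_neg h]; push_cast; ring
  rw [e]
  refine (norm_sub_le _ _).trans (add_le_add (hE θ) ?_)
  calc _ ≤ ∑ n ∈ range N with n ^ 2 < N, 2 * Real.log N := by
        refine (norm_sum_le _ _).trans (Finset.sum_le_sum fun n hn => ?_)
        rw [norm_mul, norm_ex, mul_one, Complex.norm_real, Real.norm_of_nonneg (lamW_nonneg _ _)]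
        exact lamW_le_two_mul_log hW hWN (mem_range.1 (mem_filter.1 hn).1)
    _ = #{n ∈ range N | n ^ 2 < N} * (2 * Real.log N) := by rw [Finset.sum_const, nsmul_eq_mul]
    _ ≤ _ := by
        refine mul_le_mul_of_nonneg_right ?_ (by positivity)
        have : #{n ∈ range N | n ^ 2 < N} ≤ #(range (Nat.sqrt N + 1)) :=
          Finset.card_le_card fun n hn => by
            have := (mem_filter.1 hn).2
            rw [mem_range]
            have h2 : n ≤ Nat.sqrt N := Nat.le_sqrt'.2 this.le
            omega
        rw [card_range] at this
        exact_mod_cast this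

theorem eventually_sqrt_add_one_mul_log_le {η : ℝ} (hη : 0 < η) :
    ∀ᶠ N : ℕ in atTop, ((Nat.sqrt N : ℝ) + 1) * (2 * Real.log N) ≤ η * N := by
  have h := (isLittleO_log_rpow_atTop (by norm_num : (0 : ℝ) < 1 / 2)).bound
    (by positivity : 0 < η / 4)
  filter_upwards [tendsto_natCast_atTop_atTop.eventually h, eventually_ge_atTop 1] with N hN hN1
  have hN1' : (1 : ℝ) ≤ N := by exact_mod_cast hN1
  have h0 := Real.log_nonneg hN1'
  rw [← Real.sqrt_eq_rpow, Real.norm_of_nonneg h0, Real.norm_of_nonneg (Real.sqrt_nonneg _)] at hN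
  have h1 : (Nat.sqrt N : ℝ) ≤ Real.sqrt N := Real.nat_sqrt_le_real_sqrt
  have h2 : 1 ≤ Real.sqrt N := Real.one_le_sqrt.2 hN1'
  have h3 : Real.sqrt N * Real.sqrt N = N := Real.mul_self_sqrt (by linarith)
  calc ((Nat.sqrt N : ℝ) + 1) * (2 * Real.log N)
      ≤ (2 * Real.sqrt N) * (2 * (η / 4 * Real.sqrt N)) := by
        refine mul_le_mul (by linarith) (by linarith) (by positivity) (by positivity)
    _ = η * (Real.sqrt N * Real.sqrt N) := by ring
    _ = _ := by rw [h3]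

end SchurPrimes

namespace SchurPrimes
open Finset Filter Topology

theorem exists_prime_schur_of_schurCount_pos {W N : ℕ} [NeZero (2 * N)] {f : ZMod (2 * N) → ℝ}
    {k : ℕ} {c : ℕ → Fin k} {i : Fin k}
    (hf : ∀ x, f x = if c (W * x.val + 1) = i then truncLam W N x.val else 0)
    (hpos : 0 < schurCount f) :
    ∃ p₁ p₂ p₃ : ℕ, p₁.Prime ∧ p₂.Prime ∧ p₃.Prime ∧
      c p₁ = c p₂ ∧ c p₂ = c p₃ ∧ p₁ + p₂ = p₃ + 1 := by
  have hsupp : ∀ x, f x ≠ 0 → x.val < N ∧ (W * x.val + 1).Prime ∧ c (W * x.val + 1) = i := by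
    intro x hx
    rw [hf] at hx
    have h1 : c (W * x.val + 1) = i := by
      by_contra h
      exact hx (if_neg h)
    rw [if_pos h1, truncLam] at hx
    have h2 : x.val < N ∧ N ≤ x.val ^ 2 := by
      by_contra h
      exact hx (if_neg h)
    rw [if_pos h2, lamW] at hx
    refine ⟨h2.1, ?_, h1⟩
    by_contra h
    exact hx (by rw [if_neg h, mul_zero])
  have hex : ∃ x y, f x * f y * f (x + y) ≠ 0 := by
    by_contra! h
    have : schurCount f = 0 :=
      Finset.sum_eq_zero fun x _ => Finset.sum_eq_zero fun y _ => h x y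
    linarith
  obtain ⟨x, y, hxy⟩ := hex
  obtain ⟨hx1, hx2, hx3⟩ := hsupp x (left_ne_zero_of_mul (left_ne_zero_of_mul hxy))
  obtain ⟨hy1, hy2, hy3⟩ := hsupp y (right_ne_zero_of_mul (left_ne_zero_of_mul hxy))
  obtain ⟨-, hz2, hz3⟩ := hsupp (x + y) (right_ne_zero_of_mul hxy)
  rw [ZMod.val_add_of_lt (by omega)] at hz2 hz3
  exact ⟨_, _, _, hx2, hy2, hz2, hx3.trans hy3.symm, hy3.trans hz3.symm, by ring⟩

set_option maxHeartbeats 1000000 in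
theorem exists_prime_schur (k : ℕ) (c : ℕ → Fin k) :
    ∃ p₁ p₂ p₃ : ℕ, p₁.Prime ∧ p₂.Prime ∧ p₃.Prime ∧
      c p₁ = c p₂ ∧ c p₂ = c p₃ ∧ p₁ + p₂ = p₃ + 1 := by
  classical
  have hk : 0 < k := Fin.pos (c 0)
  have hk' : (0 : ℝ) < k := by exact_mod_cast hk
  have hπ := Real.pi_pos
  obtain ⟨S, hS1, hS⟩ := exists_many_mono_schur k
  have hS' : (1 : ℝ) ≤ S := by exact_mod_cast hS1
  obtain ⟨C, hC1, s₁, hrest⟩ := restriction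
  have hC0 : 0 < C := by linarith
  set c₁ : ℝ := 1 / (k * (S ^ 3 * (2 * k) ^ 3 * (16 * S ^ 2) ^ 2)) with hc₁
  have hc₁0 : 0 < c₁ := by positivity
  obtain ⟨j₀, hj₀⟩ := exists_pow_lt_of_lt_one (by positivity : 0 < c₁ / 4 / (24 * C))
    (by norm_num : (3 / 4 : ℝ) < 1)
  have hj₀' : 24 * C * (3 / 4) ^ j₀ ≤ c₁ / 4 := by
    rw [lt_div_iff₀ (by positivity)] at hj₀; linarith
  set m : ℕ := max (32 * S ^ 2) (⌈C * 6 ^ j₀ * (8 * (6 * Real.pi)) / (c₁ / 4)⌉₊) with hm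
  have hmS : 32 * S ^ 2 ≤ m := le_max_left _ _
  have hm1 : 1 ≤ m := by nlinarith
  have hm0 : (0 : ℝ) < m := by exact_mod_cast hm1
  have hmc : C * 6 ^ j₀ * (8 * (6 * Real.pi / m)) ≤ c₁ / 4 := by
    have h1 : C * 6 ^ j₀ * (8 * (6 * Real.pi)) / (c₁ / 4) ≤ m :=
      (Nat.le_ceil _).trans (Nat.cast_le.2 (le_max_right _ _))
    rw [div_le_iff₀ (by positivity)] at h1
    have : C * 6 ^ j₀ * (8 * (6 * Real.pi / m)) = C * 6 ^ j₀ * (8 * (6 * Real.pi)) / m := by ring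
    rw [this, div_le_iff₀ hm0]
    linarith
  clear_value m
  set ρ : ℕ := ⌈k * (C * 6 ^ j₀)⌉₊ + 1 with hρ
  set η : ℝ := 1 / (4 * m ^ ρ) with hη
  have hη0 : 0 < η := by positivity
  have hη1 : η ≤ 1 := by
    have : (1 : ℝ) ≤ m ^ ρ := one_le_pow₀ (by exact_mod_cast hm1)
    rw [hη, div_le_one (by positivity)]
    linarith
  obtain ⟨w, hw⟩ := fourier_lamW_sub_one_le hη0
  obtain ⟨W, hW1, hWdvd⟩ : ∃ W : ℕ, 1 ≤ W ∧ ∀ p, p.Prime → p ≤ w → p ∣ W :=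
    ⟨w.factorial, Nat.factorial_pos w, fun p hp hpw => Nat.dvd_factorial hp.pos hpw⟩
  obtain ⟨N, hE, ⟨J, hJ, hJlog, hJτ⟩, hsqrt, hWN, hNS⟩ :=
    ((hw W hW1 hWdvd).and
      ((eventually_exists_level j₀ s₁ (by positivity : 0 < c₁ / 32)).and
      ((eventually_sqrt_add_one_mul_log_le hη0).and
      ((eventually_ge_atTop W).and (eventually_ge_atTop (16 * S ^ 2)))))).exists
  have hN1 : 1 ≤ N := hW1.trans hWN
  have hN0 : (0 : ℝ) < N := by exact_mod_cast hN1
  have hN1' : (1 : ℝ) ≤ N := by exact_mod_cast hN1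
  have hlog0 := Real.log_nonneg hN1'
  have : NeZero (2 * N) := ⟨by omega⟩
  set D : ℕ := N / (8 * S ^ 2) with hD
  have hS2 : 0 < 8 * S ^ 2 := by positivity
  have hD1 : 4 * S ^ 2 * D * 2 ≤ N := by
    have := Nat.mul_div_le N (8 * S ^ 2)
    rw [← hD] at this
    linarith
  have hD2 : N ≤ 16 * S ^ 2 * D := by
    have h1 := Nat.lt_mul_div_succ N hS2
    rw [← hD] at h1
    nlinarith
  clear_value D
  have hD2' : (N : ℝ) ≤ 16 * S ^ 2 * D := by exact_mod_cast hD2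
  set f : Fin k → ZMod (2 * N) → ℝ := fun i x =>
    if c (W * x.val + 1) = i then truncLam W N x.val else 0 with hf
  have hf0 : ∀ i x, 0 ≤ f i x := by
    intro i x
    simp only [hf]
    split_ifs
    exacts [truncLam_nonneg _ _ _, le_rfl]
  have hfle : ∀ i x, f i x ≤ truncLam W N x.val := by
    intro i x
    simp only [hf]
    split_ifs
    exacts [le_rfl, truncLam_nonneg _ _ _]
  have hfsum : ∀ x, ∑ i, f i x = truncLam W N x.val := by
    intro x
    simp [hf]
  have hcard : ∀ i, ∀ j ≤ J, (#{r | (N : ℝ) / 2 ^ j ≤ ‖FT (f i) r‖} : ℝ) ≤ C * 6 ^ j := by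
    intro i j hj
    refine hrest W N j (f i) hW1 hWN (le_trans ?_ hJlog)
      (fun x => ⟨hf0 i x, (hfle i x).trans (truncLam_le _ _ _)⟩) fun x hx => ?_
    · have : j + s₁ ≤ J + s₁ := by omega
      gcongr
    · by_contra h
      have h1 : truncLam W N x.val = 0 := if_neg h
      have h2 := hfle i x
      rw [h1] at h2
      exact hx (le_antisymm h2 (hf0 i x))
  have htot : ∑ x : ZMod (2 * N), truncLam W N x.val ≤ 2 * N := by
    have h1 := hE 0
    have h2 : ∑ n ∈ range N, ((lamW W n - 1 : ℝ) : ℂ) * ex (0 * n) =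
        ((∑ n ∈ range N, (lamW W n - 1) : ℝ) : ℂ) := by
      rw [Complex.ofReal_sum]
      exact Finset.sum_congr rfl fun n _ => by rw [zero_mul, ex_zero, mul_one]
    rw [h2, Complex.norm_real, Finset.sum_sub_distrib] at h1
    simp only [Finset.sum_const, card_range, nsmul_eq_mul, mul_one] at h1
    have h3 := (Real.le_norm_self _).trans h1
    have h4 : ∑ x : ZMod (2 * N), truncLam W N x.val ≤ ∑ n ∈ range N, lamW W n := by
      rw [sum_zmod_eq_sum_range,
        ← Finset.sum_subset (range_subset_range.2 (by omega : N ≤ 2 * N))]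
      · refine Finset.sum_le_sum fun n hn => ?_
        rw [mem_range] at hn
        rw [ZMod.val_natCast_of_lt (by omega)]
        exact truncLam_le _ _ _
      · intro n hn hn'
        rw [mem_range] at hn hn'
        rw [ZMod.val_natCast_of_lt hn, truncLam, if_neg (by omega)]
    nlinarith
  have hB : ∀ i r, ‖FT (f i) r‖ ≤ 2 * N := fun i r =>
    (norm_FT_le (hf0 i) r).trans ((Finset.sum_le_sum fun x _ => hfle i x).trans htot)
  have hQ : ∀ i, ∑ x, f i x ^ 2 ≤ 4 * N * Real.log N := by
    intro i
    calc ∑ x, f i x ^ 2 ≤ ∑ x : ZMod (2 * N), 2 * Real.log N * truncLam W N x.val := by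
          refine Finset.sum_le_sum fun x _ => ?_
          rw [pow_two]
          exact mul_le_mul ((hfle i x).trans (truncLam_le_log hW1 hWN _)) (hfle i x) (hf0 i x)
            (by positivity)
      _ ≤ 2 * Real.log N * (2 * N) := by rw [← Finset.mul_sum]; gcongr
      _ = _ := by ring
  set R : Finset (ZMod (2 * N)) :=
    insert 1 (univ.biUnion fun i => ({r | (N : ℝ) / 2 ^ j₀ ≤ ‖FT (f i) r‖} : Finset _)) with hR
  have hRcard : #R ≤ ρ := by
    refine (Finset.card_insert_le _ _).trans (Nat.add_le_add_right ?_ 1)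
    refine Finset.card_biUnion_le.trans ?_
    have : ((∑ i, #({r | (N : ℝ) / 2 ^ j₀ ≤ ‖FT (f i) r‖} : Finset (ZMod (2 * N))) : ℕ) : ℝ) ≤
        k * (C * 6 ^ j₀) := by
      rw [Nat.cast_sum]
      refine (Finset.sum_le_sum fun i _ => hcard i j₀ hJ).trans ?_
      rw [Finset.sum_const, card_univ, Fintype.card_fin, nsmul_eq_mul]
    exact_mod_cast this.trans (Nat.le_ceil _)
  obtain ⟨A, hA, hAcard, hAbox⟩ := exists_box hm1 R
  have hA0 : (0 : ℝ) < #A := by exact_mod_cast hA.card_pos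
  have hclose : ∀ i, |schurCount (f i) - schurCount (smooth A (f i))| < c₁ * N ^ 2 := by
    intro i
    have h1 := abs_schurCount_sub_smooth_le_of_restriction (X := N) hN0.le hC0.le hm1 hJ (hcard i)
      (hQ i) (hB i) hA (fun r hr y hy z hz => hAbox y hy z hz r (by
        rw [hR, mem_insert, mem_biUnion]
        exact Or.inr ⟨i, mem_univ _, mem_filter.2 ⟨mem_univ _, hr⟩⟩))
    have h2 : C * 6 ^ j₀ * ((2 * N : ℝ) ^ 3 * (6 * Real.pi / m)) ≤ c₁ / 4 * N ^ 3 := by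
      calc _ = C * 6 ^ j₀ * (8 * (6 * Real.pi / m)) * (N : ℝ) ^ 3 := by ring
        _ ≤ _ := by gcongr
    have h3 : (N : ℝ) / 2 ^ J * ((2 * N : ℕ) * (4 * N * Real.log N)) ≤ c₁ / 4 * N ^ 3 := by
      calc (N : ℝ) / 2 ^ J * ((2 * N : ℕ) * (4 * N * Real.log N))
          = 8 * (N : ℝ) ^ 3 * (Real.log N / 2 ^ J) := by push_cast; ring
        _ ≤ 8 * (N : ℝ) ^ 3 * (c₁ / 32) :=
            mul_le_mul_of_nonneg_left ((div_le_iff₀ (by positivity)).2 hJτ) (by positivity)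
        _ = _ := by ring
    have h4 : 24 * C * (N : ℝ) ^ 3 * (3 / 4) ^ j₀ ≤ c₁ / 4 * N ^ 3 := by
      calc _ = 24 * C * (3 / 4) ^ j₀ * (N : ℝ) ^ 3 := by ring
        _ ≤ _ := by gcongr
    have h5 : (N : ℝ) * |schurCount (f i) - schurCount (smooth A (f i))| < N * (c₁ * N ^ 2) := by
      have h6 : 0 < c₁ * (N : ℝ) ^ 3 := by positivity
      push_cast at h1 h3
      nlinarith
    exact lt_of_mul_lt_mul_left h5 hN0.le
  have hAD : ∀ y ∈ A, ∀ z ∈ A, |(y.val : ℝ) - z.val| ≤ D := by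
    intro y hy z hz
    have h1 := hAbox y hy z hz 1 (mem_insert_self _ _)
    rw [mul_one, mul_one] at h1
    have h2 : ((2 * N : ℕ) : ℝ) ≤ m * D := by
      have h3 : (32 * S ^ 2 : ℝ) ≤ m := by exact_mod_cast hmS
      push_cast
      have : (0 : ℝ) ≤ D := Nat.cast_nonneg _
      nlinarith
    exact le_of_mul_le_mul_left (h1.trans h2) hm0
  have hlow : ∀ n : ℕ, D ≤ n → n ≤ 4 * S ^ 2 * D → 1 / 2 ≤ ∑ i, smooth A (f i) n := by
    intro n hn1 hn2
    have hDS : D ≤ 4 * S ^ 2 * D := Nat.le_mul_of_pos_left _ (by positivity)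
    have hDpos : 0 < D := by
      rw [Nat.pos_iff_ne_zero]
      intro h0
      rw [h0, mul_zero] at hD2
      omega
    have h4S : 4 * D ≤ 4 * S ^ 2 * D := Nat.mul_le_mul_right _ (by nlinarith)
    have hval : ((n : ZMod (2 * N))).val = n := ZMod.val_natCast_of_lt (by omega)
    have h1 := smooth_indicator_eq_one hA hAD (x := (n : ZMod (2 * N))) (by rwa [hval])
      (by rw [hval]; omega)
    have h2 := abs_smooth_le hA (norm_FT_truncLam_sub_le hW1 hWN hE) (n : ZMod (2 * N))
    rw [smooth_sub, h1] at h2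
    have h3 : (η * N + (Nat.sqrt N + 1) * (2 * Real.log N)) / #A ≤ 1 / 4 := by
      rw [div_le_iff₀ hA0]
      have h4 : (m : ℝ) ^ #R ≤ m ^ ρ := pow_le_pow_right₀ (by exact_mod_cast hm1) hRcard
      have h5 : (2 * N : ℝ) ≤ m ^ ρ * #A := by
        push_cast at hAcard
        exact hAcard.trans (mul_le_mul_of_nonneg_right h4 hA0.le)
      have h6 : η * (2 * N) ≤ η * (m ^ ρ * #A) := mul_le_mul_of_nonneg_left h5 hη0.le
      have h7 : η * ((m : ℝ) ^ ρ * #A) = 1 / 4 * #A := by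
        rw [hη]; field_simp
      linarith
    rw [← smooth_sum]
    simp_rw [hfsum]
    have h8 := (abs_le.1 (h2.trans h3)).1
    linarith
  have hcount := le_sum_schurCount hk hS (fun i => smooth A (f i))
    (fun i x => smooth_nonneg A (hf0 i) x) (by omega) hlow
  have hexi : ∃ i, c₁ * N ^ 2 ≤ schurCount (smooth A (f i)) := by
    by_contra! hcon
    have h1 : ∑ i, schurCount (smooth A (f i)) < ∑ _i : Fin k, c₁ * (N : ℝ) ^ 2 :=
      Finset.sum_lt_sum_of_nonempty ⟨⟨0, hk⟩, mem_univ _⟩ fun i _ => hcon i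
    rw [Finset.sum_const, card_univ, Fintype.card_fin, nsmul_eq_mul] at h1
    have h2 : (D : ℝ) ^ 2 < S ^ 3 * (2 * k) ^ 3 * (k * (c₁ * N ^ 2)) :=
      hcount.trans_lt (mul_lt_mul_of_pos_left h1 (by positivity))
    have h3 : (S : ℝ) ^ 3 * (2 * k) ^ 3 * (k * (c₁ * N ^ 2)) = N ^ 2 / (16 * S ^ 2) ^ 2 := by
      rw [hc₁]; field_simp
    rw [h3, lt_div_iff₀ (by positivity)] at h2
    have h4 : (N : ℝ) ^ 2 ≤ (16 * S ^ 2 * D) ^ 2 := by gcongr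
    linarith [mul_pow (16 * (S : ℝ) ^ 2) (D : ℝ) 2]
  obtain ⟨i, hi⟩ := hexi
  have hpos : 0 < schurCount (f i) := by
    have := (abs_lt.1 (hclose i)).1
    linarith
  exact exists_prime_schur_of_schurCount_pos (fun x => rfl) hpos

end SchurPrimes

/-- Schur-type theorem for primes: for any `k`-coloring of the primes there
exist monochromatic primes `p₁, p₂, p₃` with `p₁ + p₂ = p₃ + 1`. -/
theorem schur_for_primes (k : ℕ) (c : ℕ → Fin k) :
    ∃ p₁ p₂ p₃ : ℕ, p₁.Prime ∧ p₂.Prime ∧ p₃.Prime ∧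
      c p₁ = c p₂ ∧ c p₂ = c p₃ ∧ p₁ + p₂ = p₃ + 1 := by
  exact SchurPrimes.exists_prime_schur k c
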